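/- Let m ≥ 1 and let q be a prime power with 3 dividing q+1; let F be the field with q elements and E the field with q² elements. Let C = Eˣ ⋊ C₂ be the semidirect product of the multiplicative group Eˣ by the cyclic group of order 2, where the nontrivial element of C₂ acts on Eˣ by x ↦ x^q, and let H = C ≀ S_m be the wreath product, realized as the semidirect product of C^m by S_m acting by permuting coordinates. Then there exists a bijection between Irr_{3'}(H) and Irr_{3'}(GL_{2m}(F)). -/

import Mathlib

open scoped Classical
open Matrix

noncomputable section

/-- The set of irreducible complex characters of a group `G`. -/
def Irr (G : Type) [Group G] : Set (G → ℂ) :=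
  {χ | ∃ V : FDRep ℂ G, CategoryTheory.Simple V ∧ FDRep.character V = χ}

/-- The set of irreducible complex characters of `G` whose degree is coprime to `p`. -/
def IrrCoprime (p : ℕ) (G : Type) [Group G] : Set (G → ℂ) :=
  {χ | ∃ V : FDRep ℂ G, CategoryTheory.Simple V ∧ FDRep.character V = χ ∧
    Nat.Coprime (Module.finrank ℂ V) p}

/-- For a finite field `E` with `q^2` elements, the automorphism `x ↦ x^q` of the
multiplicative group `Eˣ`.  It has order 2 and generates a cyclic group `C₂` inside
`MulAut Eˣ`. -/
def qPowAut (E : Type) [Field E] [Fintype E] (q : ℕ) (hq : 0 < q)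
    (hE : Fintype.card E = q ^ 2) : MulAut Eˣ where
  toFun x := x ^ q
  invFun x := x ^ q
  left_inv x := by
    have hcard : Fintype.card Eˣ = q ^ 2 - 1 := by rw [Fintype.card_units, hE]
    have h1 : x ^ (q ^ 2 - 1) = 1 := by rw [← hcard]; exact pow_card_eq_one
    have hq2 : 1 ≤ q ^ 2 := Nat.one_le_pow _ _ hq
    calc (x ^ q) ^ q = x ^ (q * q) := by rw [← pow_mul]
      _ = x ^ (q ^ 2 - 1 + 1) := by
            congr 1
            have : q * q = q ^ 2 := (sq q).symm
            omega
      _ = x ^ (q ^ 2 - 1) * x := by rw [pow_succ]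
      _ = x := by rw [h1, one_mul]
  right_inv x := by
    have hcard : Fintype.card Eˣ = q ^ 2 - 1 := by rw [Fintype.card_units, hE]
    have h1 : x ^ (q ^ 2 - 1) = 1 := by rw [← hcard]; exact pow_card_eq_one
    have hq2 : 1 ≤ q ^ 2 := Nat.one_le_pow _ _ hq
    calc (x ^ q) ^ q = x ^ (q * q) := by rw [← pow_mul]
      _ = x ^ (q ^ 2 - 1 + 1) := by
            congr 1
            have : q * q = q ^ 2 := (sq q).symm
            omega
      _ = x ^ (q ^ 2 - 1) * x := by rw [pow_succ]
      _ = x := by rw [h1, one_mul]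
  map_mul' x y := mul_pow x y q

/-- The group `C = Eˣ ⋊ C₂`, where the cyclic group `C₂` generated by the automorphism
`x ↦ x^q` (an involution) acts naturally on `Eˣ`. -/
abbrev CyclicExt (E : Type) [Field E] [Fintype E] (q : ℕ) (hq : 0 < q)
    (hE : Fintype.card E = q ^ 2) : Type :=
  SemidirectProduct Eˣ ↥(Subgroup.zpowers (qPowAut E q hq hE))
    (Subgroup.zpowers (qPowAut E q hq hE)).subtype

/-- The permutation action of `S_m` on the direct power `K^m`, as a homomorphism into the
automorphism group; this is the action used to form the wreath product `K ≀ S_m`. -/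
def wreathAction (m : ℕ) (K : Type) [Group K] :
    Equiv.Perm (Fin m) →* MulAut (Fin m → K) where
  toFun σ :=
    { toFun := fun f => f ∘ σ.symm
      invFun := fun f => f ∘ σ
      left_inv := fun f => by funext i; simp
      right_inv := fun f => by funext i; simp
      map_mul' := fun f g => rfl }
  map_one' := by ext f i; rfl
  map_mul' σ τ := by ext f i; rfl

/-- The wreath product `K ≀ S_m`, realized as the semidirect product of `K^m` by `S_m`
permuting the coordinates. -/
abbrev WreathProductSymm (K : Type) [Group K] (m : ℕ) : Type :=
  SemidirectProduct (Fin m → K) (Equiv.Perm (Fin m)) (wreathAction m K)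

open Finset (sum_add_distrib mul_sum sum_mul sum_comm sum_eq_single mem_union sum_insert sum_nonneg sum_pos' exists_ne_zero_of_sum_ne_zero mem_insert mem_singleton sum_pair sum_subset mem_image sum_image univ prod_congr sum_singleton prod_eq_zero mem_univ sum_le_sum sum_const prod_mul_distrib range mem_range mem_coe sum_eq_zero prod_insert mem_insert_self mem_insert_of_mem prod_const_one sum_ite_eq' single_le_sum card_range prod_const mem_filter card_univ sum_bij' sum_fiberwise sum_ite_eq card_filter_add_card_filter_not mem_map sum_filter sum_mul_sum prod_univ_sum mem_image_of_mem card_map sum_product' mem_product sum_div card_bij sum_of_injOn prod_range_succ add_sum_erase ne_of_mem_erase sum_range_succ mem_erase sum_eq_single_of_mem sum_map prod_ne_zero_iff map_orderEmbOfFin_univ prod_map inter_subset_left sum_lt_sum sum_congr)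
open Nat (one_le_pow cast_one card_eq_fintype_card cast_ne_zero card_pi factorial_ne_zero cast_sub cast_pow card_congr)
open Fintype (card_units card_subtype card_fin sum_sigma piFinset equivFin sum_prod_type prod_bool card_ne_zero ofEquiv card_sigma card_fun one_lt_card card)
open LinearMap (compr₂_apply)
namespace Chr
variable {G : Type} [Group G] [Fintype G]
def ip (f h : G → ℂ) : ℂ := (Nat.card G : ℂ)⁻¹ * ∑ g, f g * h g⁻¹
def IsClass {G : Type} [Group G] (f : G → ℂ) : Prop := ∀ g x, f (x * g * x⁻¹) = f g
def IsChar {G : Type} [Group G] (f : G → ℂ) : Prop := ∃ V : FDRep ℂ G, V.character = f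
lemma ip_comm (f h : G → ℂ) : ip f h = ip h f := by
  unfold ip
  congr 1
  rw [← Equiv.sum_comp (Equiv.inv G)]
  exact sum_congr rfl fun g _ => by simp [mul_comm]
lemma ip_add_left (f f' h : G → ℂ) : ip (f + f') h = ip f h + ip f' h := by
  simp [ip, add_mul, sum_add_distrib, mul_add]
lemma ip_smul_left (a : ℂ) (f h : G → ℂ) : ip (a • f) h = a * ip f h := by
  simp only [ip, Pi.smul_apply, smul_eq_mul, mul_assoc, ← mul_sum]; ring
lemma ip_sum_left {ι : Type*} (s : Finset ι) (f : ι → G → ℂ) (h : G → ℂ) :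
    ip (fun g => ∑ i ∈ s, f i g) h = ∑ i ∈ s, ip (f i) h := by
  simp only [ip, sum_mul, ← mul_sum]
  rw [sum_comm]
lemma ip_mul_left (a : ℂ) (f h : G → ℂ) : ip (fun g => a * f g) h = a * ip f h :=
  ip_smul_left a f h
lemma IsChar.isClass {G : Type} [Group G] {f : G → ℂ} (hf : IsChar f) : IsClass f := by
  obtain ⟨V, rfl⟩ := hf
  intro g x; exact V.char_conj g x
lemma IsChar.comp {G H : Type} [Group G] [Group H] {f : G → ℂ} (hf : IsChar f) (φ : H →* G) :
    IsChar (fun h => f (φ h)) := by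
  obtain ⟨V, rfl⟩ := hf
  exact ⟨FDRep.of (V.ρ.comp φ), rfl⟩
lemma IsChar.mul {G : Type} [Group G] {f h : G → ℂ} (hf : IsChar f) (hh : IsChar h) :
    IsChar (fun g => f g * h g) := by
  obtain ⟨V, rfl⟩ := hf
  obtain ⟨W, rfl⟩ := hh
  open CategoryTheory.MonoidalCategory in
  exact ⟨V ⊗ W, FDRep.char_tensor V W⟩
lemma IsChar.ip_nat {f h : G → ℂ} (hf : IsChar f) (hh : IsChar h) : ∃ n : ℕ, ip f h = n := by
  obtain ⟨V, rfl⟩ := hf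
  obtain ⟨W, rfl⟩ := hh
  have := invertibleOfNonzero (NeZero.ne (Nat.card G : ℂ))
  exact ⟨_, FDRep.scalar_product_char_eq_finrank_equivariant W V⟩
lemma Irr.isChar {G : Type} [Group G] {f : G → ℂ} (hf : f ∈ Irr G) : IsChar f := by
  obtain ⟨V, _, h⟩ := hf
  exact ⟨V, h⟩
lemma mem_Irr_iff {f : G → ℂ} : f ∈ Irr G ↔ IsChar f ∧ ip f f = 1 := by
  have hG : (Nat.card G : ℂ) ≠ 0 := NeZero.ne _
  have key : ∀ V : FDRep ℂ G, CategoryTheory.Simple V ↔ ip V.character V.character = 1 := by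
    intro V
    rw [FDRep.simple_iff_char_is_norm_one, ip, inv_mul_eq_one₀ hG, eq_comm]
  constructor
  · rintro ⟨V, hV, rfl⟩
    exact ⟨⟨V, rfl⟩, (key V).1 hV⟩
  · rintro ⟨⟨V, rfl⟩, h⟩
    exact ⟨V, (key V).2 h, rfl⟩
lemma ip_Irr {f h : G → ℂ} (hf : f ∈ Irr G) (hh : h ∈ Irr G) :
    ip f h = if f = h then 1 else 0 := by
  split_ifs with e
  · subst e; exact (mem_Irr_iff.1 hf).2
  · obtain ⟨V, hV, rfl⟩ := hf
    obtain ⟨W, hW, rfl⟩ := hh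
    have := invertibleOfNonzero (NeZero.ne (Nat.card G : ℂ))
    have := FDRep.char_orthonormal V W
    rw [ip, this, if_neg]
    rintro ⟨i⟩
    exact e (FDRep.char_iso i)
lemma Irr_one_pos {f : G → ℂ} (hf : f ∈ Irr G) : ∃ n : ℕ, 0 < n ∧ f 1 = n := by
  obtain ⟨V, hV, rfl⟩ := hf
  refine ⟨_, ?_, V.char_one⟩
  rw [pos_iff_ne_zero]
  intro h0
  have h1 := (mem_Irr_iff.1 ⟨V, hV, rfl⟩).2
  have : Subsingleton V := Module.finrank_zero_iff.1 h0
  have h2 : V.character = 0 := by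
    funext g
    have : V.ρ g = 0 := Subsingleton.elim _ _
    simp [FDRep.character, this]
  rw [h2] at h1
  simp [ip] at h1
lemma Irr_linearIndependent : LinearIndependent ℂ (fun χ : Irr G => (χ : G → ℂ)) := by
  rw [linearIndependent_iff']
  intro s c hc χ hχ
  have h1 : ip (fun g => ∑ i ∈ s, c i * (i : G → ℂ) g) χ = 0 := by
    have : (fun g => ∑ i ∈ s, c i * (i : G → ℂ) g) = 0 := by
      rw [← hc]; funext g; simp
    rw [this]; simp [ip]
  rw [ip_sum_left] at h1
  simp only [ip_mul_left] at h1
  rw [sum_eq_single χ] at h1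
  · rwa [ip_Irr χ.2 χ.2, if_pos rfl, mul_one] at h1
  · intro b _ hb
    rw [ip_Irr b.2 χ.2, if_neg (fun h => hb (Subtype.ext h)), mul_zero]
  · exact fun h => absurd hχ h
instance : Fintype (Irr G) := by
  have : Finite (Irr G) := (Irr_linearIndependent (G := G)).finite
  exact Fintype.ofFinite _
def zel (f : G → ℂ) : MonoidAlgebra ℂ G := ∑ g, MonoidAlgebra.single g (f g⁻¹)
lemma zel_smul_simple {f : G → ℂ} (hf : IsClass f) (h0 : ∀ χ ∈ Irr G, ip f χ = 0)
    (M : Type) [AddCommGroup M] [Module (MonoidAlgebra ℂ G) M] [Module ℂ M]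
    [IsScalarTower ℂ (MonoidAlgebra ℂ G) M] [Module.Finite ℂ M]
    [hs : IsSimpleModule (MonoidAlgebra ℂ G) M] (x : M) : zel f • x = 0 := by
  have hG : (Nat.card G : ℂ) ≠ 0 := NeZero.ne _
  let ρ := Representation.ofModule' (k := ℂ) (G := G) M
  have hρ : ∀ (z : MonoidAlgebra ℂ G) (y : M), ρ.asAlgebraHom z y = z • y := by
    intro z y
    have : ρ.asAlgebraHom = Algebra.lsmul ℂ ℂ M := by
      simp [ρ, Representation.asAlgebraHom, Representation.ofModule']
    rw [this]; rfl
  let e : M ≃ₗ[MonoidAlgebra ℂ G] ρ.asModule :=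
    { ρ.asModuleEquiv.symm.toAddEquiv with
      map_smul' := fun z y => by
        have := hρ z y
        change ρ.asModuleEquiv.symm (z • y) = z • ρ.asModuleEquiv.symm y
        rw [← this]
        apply ρ.asModuleEquiv.injective
        simp [Representation.asModuleEquiv_map_smul] }
  have hirr' : ρ.IsIrreducible := by
    rw [Representation.irreducible_iff_isSimpleModule_asModule]
    exact IsSimpleModule.congr e.symm
  have hinv := invertibleOfNonzero hG
  have hI2 : ρ.character ∈ Irr G := by
    rw [mem_Irr_iff]
    refine ⟨⟨FDRep.of ρ, rfl⟩, ?_⟩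
    have := Representation.char_orthonormal ρ ρ
    rw [if_pos ⟨Representation.Equiv.refl ρ⟩] at this
    simpa [ip] using this
  -- the action of z
  have hT : ∀ x, ρ.asAlgebraHom (zel f) x = ∑ g, f g⁻¹ • ρ g x := by
    intro x
    simp [zel, LinearMap.sum_apply]
  let T : Representation.IntertwiningMap ρ ρ :=
    LinearMap.intertwiningMap_of_isIntertwiningMap (ρ := ρ) (σ := ρ) (ρ.asAlgebraHom (zel f)) (by
      intro g v
      rw [hT, hT, map_sum, ← Equiv.sum_comp (MulAut.conj g).toEquiv]
      refine sum_congr rfl fun x _ => ?_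
      rw [map_smul]
      have h1 : f ((MulAut.conj g).toEquiv x)⁻¹ = f x⁻¹ := by
        have := hf x⁻¹ g
        simpa [mul_assoc] using this
      rw [h1]
      congr 1
      have : ∀ a b : G, ∀ w, ρ a (ρ b w) = ρ (a * b) w := by intro a b w; simp
      rw [this, this]
      simp)
  obtain ⟨c, hc⟩ := (Representation.IsIrreducible.algebraMap_intertwiningMap_bijective_of_isAlgClosed
    (ρ := ρ)).2 T
  have hTc : ρ.asAlgebraHom (zel f) = c • LinearMap.id := by
    have := congrArg Representation.IntertwiningMap.toLinearMap hc
    rw [← show T.toLinearMap = ρ.asAlgebraHom (zel f) from rfl, ← this]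
    rw [Algebra.algebraMap_eq_smul_one]
    rfl
  have htr : LinearMap.trace ℂ _ (ρ.asAlgebraHom (zel f)) = 0 := by
    have h1 : ρ.asAlgebraHom (zel f) = ∑ g, f g⁻¹ • ρ g := by
      ext x; rw [hT]; simp
    have h2 := h0 _ hI2
    rw [h1, map_sum]
    rw [ip_comm, ip, mul_eq_zero, or_iff_right (inv_ne_zero hG)] at h2
    rw [← h2]
    refine sum_congr rfl fun g _ => ?_
    rw [map_smul, smul_eq_mul, mul_comm]; rfl
  have hc0 : c = 0 := by
    rw [hTc, map_smul] at htr
    rw [show (LinearMap.id : M →ₗ[ℂ] _) = 1 from rfl,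
      LinearMap.trace_one, smul_eq_mul, mul_eq_zero] at htr
    refine htr.resolve_right ?_
    have hn : Nontrivial M := IsSimpleModule.nontrivial (MonoidAlgebra ℂ G) M
    have := Module.finrank_pos (R := ℂ) (M := M)
    exact_mod_cast this.ne'
  rw [← hρ, hTc, hc0, zero_smul, LinearMap.zero_apply]
lemma class_eq_zero {f : G → ℂ} (hf : IsClass f) (h0 : ∀ χ ∈ Irr G, ip f χ = 0) : f = 0 := by
  have hmem : zel f ∈ Ring.jacobson (MonoidAlgebra ℂ G) := by
    rw [Ring.jacobson_eq_sInf_isMaximal, Submodule.mem_sInf]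
    intro I hI
    have hI' : Ideal.IsMaximal I := hI
    have hs : IsSimpleModule (MonoidAlgebra ℂ G) (MonoidAlgebra ℂ G ⧸ I) := by
      rw [isSimpleModule_iff_isCoatom]; exact hI'.out
    have h6 := zel_smul_simple hf h0 (MonoidAlgebra ℂ G ⧸ I) (Submodule.Quotient.mk 1)
    rw [← Submodule.Quotient.mk_smul, Submodule.Quotient.mk_eq_zero, smul_eq_mul, mul_one] at h6
    exact h6
  rw [IsSemisimpleRing.jacobson_eq_bot, Submodule.mem_bot] at hmem
  funext g
  have := congrArg (fun z : MonoidAlgebra ℂ G => z.coeff g⁻¹) hmem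
  simpa [zel, Finsupp.single_apply] using this
lemma class_expand {f : G → ℂ} (hf : IsClass f) (g : G) :
    f g = ∑ χ : Irr G, ip f χ * (χ : G → ℂ) g := by
  have : (fun g => f g + (-1) * ∑ χ : Irr G, ip f χ * (χ : G → ℂ) g) = 0 := by
    apply class_eq_zero
    · intro x y
      have : ∀ χ : Irr G, (χ : G → ℂ) (y * x * y⁻¹) = (χ : G → ℂ) x := fun χ => (Irr.isChar χ.2).isClass x y
      simp only [hf x y, this]
    · intro χ hχ
      have h1 := ip_add_left f (fun g => (-1) * ∑ χ : Irr G, ip f χ * (χ : G → ℂ) g) χ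
      refine h1.trans ?_
      rw [ip_mul_left, ip_sum_left]
      simp only [ip_mul_left]
      rw [sum_eq_single (⟨χ, hχ⟩ : Irr G)]
      · rw [ip_Irr hχ hχ, if_pos rfl]; ring
      · intro b _ hb
        rw [ip_Irr b.2 hχ, if_neg (fun h => hb (Subtype.ext h)), mul_zero]
      · simp
  have := congrFun this g
  simp only [Pi.zero_apply] at this
  linear_combination this
lemma ip_expand {f h : G → ℂ} (hf : IsClass f) :
    ip f h = ∑ χ : Irr G, ip f χ * ip χ h := by
  have : f = fun g => ∑ χ : Irr G, ip f χ * (χ : G → ℂ) g := funext (class_expand hf)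
  conv_lhs => rw [this]
  rw [ip_sum_left]
  simp only [ip_mul_left]
end Chr
/-- Structure constants of a positive self-adjoint Hopf algebra (Zelevinsky). -/
structure PSH (Ω : Type) where
  deg : Ω → ℕ
  one : Ω
  c : Ω → Ω → Ω →₀ ℕ
  cop : Ω → Finset (Ω × Ω)
  mem_cop : ∀ π p, p ∈ cop π ↔ c p.1 p.2 π ≠ 0
  deg_one : deg one = 0
  eq_one : ∀ ω, deg ω = 0 → ω = one
  c_deg : ∀ {σ τ π}, c σ τ π ≠ 0 → deg π = deg σ + deg τ
  c_one_left : ∀ τ, c one τ = Finsupp.single τ 1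
  c_one_right : ∀ τ, c τ one = Finsupp.single τ 1
  fin : ∀ n, {ω | deg ω = n}.Finite
  assoc : ∀ α β γ π, (c α β).sum (fun κ n => n * c κ γ π) = (c β γ).sum (fun κ n => n * c α κ π)
  hopf : ∀ α β γ δ, (c α β).sum (fun π n => n * c γ δ π) =
    ∑ p ∈ cop α, ∑ p' ∈ cop β, c p.1 p.2 α * c p'.1 p'.2 β * c p.1 p'.1 γ * c p.2 p'.2 δ
namespace PSH
variable {Ω : Type} (S : PSH Ω)
lemma sum_c_sym (α β γ δ : Ω) : (S.c α β).sum (fun π n => n * S.c γ δ π) =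
    (S.c γ δ).sum (fun π n => n * S.c α β π) := by
  rw [Finsupp.sum_of_support_subset (s := (S.c α β).support ∪ (S.c γ δ).support) _ Finset.subset_union_left _ (by simp),
   Finsupp.sum_of_support_subset (s := (S.c α β).support ∪ (S.c γ δ).support) _ Finset.subset_union_right _ (by simp)]
  exact sum_congr rfl fun x _ => mul_comm _ _
lemma sum_cop_swap_aux (α : Ω) (f : Ω → Ω → ℕ) (hs : ∀ σ τ, S.c σ τ α = S.c τ σ α) :
    ∑ p ∈ S.cop α, S.c p.1 p.2 α * f p.1 p.2 = ∑ p ∈ S.cop α, S.c p.1 p.2 α * f p.2 p.1 := by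
  refine Finset.sum_nbij' Prod.swap Prod.swap ?_ ?_ ?_ ?_ ?_
  · rintro ⟨a, b⟩ h; rw [mem_cop] at h ⊢; simpa [hs b a] using h
  · rintro ⟨a, b⟩ h; rw [mem_cop] at h ⊢; simpa [hs b a] using h
  · simp
  · simp
  · rintro ⟨a, b⟩ h; simp [hs b a]
lemma c_comm_aux (n : ℕ) : ∀ σ τ π, S.deg σ + S.deg τ ≤ n → S.c σ τ π = S.c τ σ π := by
  induction n with
  | zero =>
    intro σ τ π h
    rw [S.eq_one σ (by omega), S.eq_one τ (by omega)]
  | succ n ih =>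
    intro α β π h
    by_cases hα : S.deg α = 0
    · rw [S.eq_one α hα, c_one_left, c_one_right]
    by_cases hβ : S.deg β = 0
    · rw [S.eq_one β hβ, c_one_left, c_one_right]
    have sα : ∀ σ τ, S.c σ τ α = S.c τ σ α := by
      intro σ τ
      by_cases h1 : S.c σ τ α = 0
      · by_cases h2 : S.c τ σ α = 0
        · rw [h1, h2]
        · exact (ih _ _ _ (by have := S.c_deg h2; omega)).symm
      · exact (ih _ _ _ (by have := S.c_deg h1; omega))
    have sβ : ∀ σ τ, S.c σ τ β = S.c τ σ β := by
      intro σ τ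
      by_cases h1 : S.c σ τ β = 0
      · by_cases h2 : S.c τ σ β = 0
        · rw [h1, h2]
        · exact (ih _ _ _ (by have := S.c_deg h2; omega)).symm
      · exact (ih _ _ _ (by have := S.c_deg h1; omega))
    have key : ∀ γ δ, (S.c α β).sum (fun π n => n * S.c γ δ π) = (S.c α β).sum (fun π n => n * S.c δ γ π) := by
      intro γ δ
      rw [hopf, hopf]
      have e1 := S.sum_cop_swap_aux α (fun a b => ∑ p' ∈ S.cop β, S.c p'.1 p'.2 β * (S.c a p'.1 γ * S.c b p'.2 δ)) sα
      have e2 : ∀ a b, ∑ p' ∈ S.cop β, S.c p'.1 p'.2 β * (S.c a p'.1 γ * S.c b p'.2 δ) =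
          ∑ p' ∈ S.cop β, S.c p'.1 p'.2 β * (S.c a p'.2 γ * S.c b p'.1 δ) := fun a b =>
        S.sum_cop_swap_aux β (fun x y => S.c a x γ * S.c b y δ) sβ
      calc _ = _ := by
            simp only [mul_assoc, ← mul_sum]
            exact e1
        _ = _ := by
            simp only [e2, mul_assoc, ← mul_sum]
            refine sum_congr rfl fun p _ => ?_
            congr 1
            refine sum_congr rfl fun p _ => ?_
            ring
    have k1 := key α β
    have k2 := key β α
    have k3 : (S.c β α).sum (fun π n => n * S.c α β π) = (S.c β α).sum (fun π n => n * S.c β α π) := by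
      rw [S.sum_c_sym, ← k1, S.sum_c_sym β α]
      have sw : (S.c α β).sum (fun π n => n * S.c α β π) = (S.c β α).sum (fun π n => n * S.c β α π) := by
        rw [hopf, hopf, sum_comm]
        have e1 := S.sum_cop_swap_aux β (fun a b => ∑ p' ∈ S.cop α, S.c p'.1 p'.2 α * (S.c a p'.1 β * S.c b p'.2 α)) sβ
        have e2 : ∀ a b, ∑ p' ∈ S.cop α, S.c p'.1 p'.2 α * (S.c a p'.1 β * S.c b p'.2 α) =
          ∑ p' ∈ S.cop α, S.c p'.1 p'.2 α * (S.c a p'.2 β * S.c b p'.1 α) := fun a b =>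
          S.sum_cop_swap_aux α (fun x y => S.c a x β * S.c b y α) sα
        have e3 : ∀ p ∈ S.cop β, ∀ p' ∈ S.cop α, S.c p'.1 p'.2 α * S.c p.1 p.2 β * S.c p'.1 p.1 α * S.c p'.2 p.2 β
           = S.c p.1 p.2 β * (S.c p'.1 p'.2 α * (S.c p.2 p'.2 β * S.c p.1 p'.1 α)) := by
          intro p hp p' hp'
          have d1 := S.c_deg ((S.mem_cop _ _).1 hp)
          have d2 := S.c_deg ((S.mem_cop _ _).1 hp')
          by_cases hx : S.c p'.1 p.1 α = 0
          · by_cases hy : S.c p.1 p'.1 α = 0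
            · rw [hx, hy]; ring
            · rw [ sα p'.1 p.1, sβ p'.2 p.2]; ring
          · rw [sα p'.1 p.1, sβ p'.2 p.2]; ring
        rw [sum_congr rfl fun p hp => sum_congr rfl (e3 p hp)]
        simp only [mul_assoc, ← mul_sum]
        simp only [e2] at e1
        rw [← e1]
        simp only [← e2]
      exact sw
    -- norm of the difference vanishes
    set s := (S.c α β).support ∪ (S.c β α).support
    have f1 : ∀ γ δ, (S.c α β).sum (fun π n => n * S.c γ δ π) = ∑ x ∈ s, S.c α β x * S.c γ δ x := fun γ δ =>
      Finsupp.sum_of_support_subset _ Finset.subset_union_left _ (by simp)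
    have f2 : ∀ γ δ, (S.c β α).sum (fun π n => n * S.c γ δ π) = ∑ x ∈ s, S.c β α x * S.c γ δ x := fun γ δ =>
      Finsupp.sum_of_support_subset _ Finset.subset_union_right _ (by simp)
    rw [f1, f1] at k1
    rw [f2, f2] at k3
    have hz : ∑ x ∈ s, ((S.c α β x : ℤ) - S.c β α x) ^ 2 = 0 := by
      have k1' : (∑ x ∈ s, (S.c α β x : ℤ) * S.c α β x) = ∑ x ∈ s, (S.c α β x : ℤ) * S.c β α x := by exact_mod_cast k1
      have k3' : (∑ x ∈ s, (S.c β α x : ℤ) * S.c α β x) = ∑ x ∈ s, (S.c β α x : ℤ) * S.c β α x := by exact_mod_cast k3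
      have : ∀ x, ((S.c α β x : ℤ) - S.c β α x) ^ 2 = ((S.c α β x : ℤ) * S.c α β x - (S.c α β x : ℤ) * S.c β α x)
         - ((S.c β α x : ℤ) * S.c α β x - (S.c β α x : ℤ) * S.c β α x) := fun x => by ring
      simp only [this, Finset.sum_sub_distrib, k1', k3']
      ring
    rw [Finset.sum_eq_zero_iff_of_nonneg (fun x _ => sq_nonneg _)] at hz
    by_cases hs : π ∈ s
    · have := hz π hs
      have : (S.c α β π : ℤ) - S.c β α π = 0 := by simpa using this
      omega
    · simp only [s, mem_union, Finsupp.mem_support_iff, not_or, not_not] at hs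
      rw [hs.1, hs.2]
lemma c_comm (σ τ : Ω) : S.c σ τ = S.c τ σ := by
  ext π; exact S.c_comm_aux _ σ τ π le_rfl
def R (_ : PSH Ω) : Type := Ω →₀ ℤ
instance : AddCommGroup S.R := inferInstanceAs (AddCommGroup (Ω →₀ ℤ))
instance : FunLike S.R Ω ℤ := inferInstanceAs (FunLike (Ω →₀ ℤ) Ω ℤ)
def e (ω : Ω) : S.R := (Finsupp.single ω 1 : Ω →₀ ℤ)
lemma e_apply (ω τ : Ω) : S.e ω τ = if ω = τ then 1 else 0 := Finsupp.single_apply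
@[simp] lemma add_apply (a b : S.R) (ω : Ω) : (a + b) ω = a ω + b ω := rfl
@[simp] lemma sub_apply (a b : S.R) (ω : Ω) : (a - b) ω = a ω - b ω := rfl
@[simp] lemma zero_apply (ω : Ω) : (0 : S.R) ω = 0 := rfl
@[simp] lemma zsmul_apply (n : ℤ) (b : S.R) (ω : Ω) : (n • b) ω = n * b ω := rfl
@[ext] lemma R_ext {a b : S.R} (h : ∀ ω, a ω = b ω) : a = b := Finsupp.ext h
@[simp] lemma sum_apply {ι : Type*} (s : Finset ι) (f : ι → S.R) (ω : Ω) :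
    (∑ i ∈ s, f i) ω = ∑ i ∈ s, f i ω := by
  induction s using Finset.induction_on with
  | empty => simp
  | insert a s h ih => rw [sum_insert h, sum_insert h, add_apply, ih]
lemma R_induction {p : S.R → Prop} (h0 : p 0) (ha : ∀ a b, p a → p b → p (a + b))
    (hs : ∀ (n : ℤ) ω, p (n • S.e ω)) (a : S.R) : p a := by
  refine Finsupp.induction_linear (motive := p) a h0 (fun f g => ha f g) ?_
  intro ω n
  have := hs n ω
  have h2 : n • S.e ω = (Finsupp.single ω n : Ω →₀ ℤ) := by
    unfold e
    exact (Finsupp.smul_single n ω (1:ℤ)).trans (by simp)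
  rwa [h2] at this
def lift {M : Type*} [AddCommGroup M] (f : Ω → M) : S.R →ₗ[ℤ] M := Finsupp.linearCombination ℤ f
@[simp] lemma lift_e {M : Type*} [AddCommGroup M] (f : Ω → M) (ω : Ω) : S.lift f (S.e ω) = f ω := by
  unfold lift e
  exact (Finsupp.linearCombination_single ℤ (1:ℤ) ω).trans (one_smul _ _)
lemma lift_apply {M : Type*} [AddCommGroup M] (f : Ω → M) (a : S.R) :
    S.lift f a = Finsupp.sum (a : Ω →₀ ℤ) fun ω n => n • f ω := Finsupp.linearCombination_apply _ _
lemma hom_ext {M : Type*} [AddCommGroup M] {f g : S.R →ₗ[ℤ] M} (h : ∀ ω, f (S.e ω) = g (S.e ω)) :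
    f = g := by
  ext a
  induction a using S.R_induction with
  | h0 => simp
  | ha a b h1 h2 => rw [map_add, map_add, h1, h2]
  | hs n ω => rw [map_smul, map_smul, h]
def cE (σ τ : Ω) : S.R := (Finsupp.mapRange (Nat.cast : ℕ → ℤ) rfl (S.c σ τ) : Ω →₀ ℤ)
lemma cE_apply (σ τ π : Ω) : S.cE σ τ π = S.c σ τ π := rfl
def mulL : S.R →ₗ[ℤ] S.R →ₗ[ℤ] S.R := S.lift fun σ => S.lift fun τ => S.cE σ τ
def coordL (ω : Ω) : S.R →ₗ[ℤ] ℤ := Finsupp.lapply ω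
@[simp] lemma coordL_apply (ω : Ω) (a : S.R) : S.coordL ω a = a ω := rfl
lemma mulL_apply (a b : S.R) (ω : Ω) :
    S.mulL a b ω = ∑ p ∈ S.cop ω, (S.c p.1 p.2 ω : ℤ) * (a p.1 * b p.2) := by
  let rhs : S.R →ₗ[ℤ] S.R →ₗ[ℤ] ℤ := ∑ p ∈ S.cop ω, (S.c p.1 p.2 ω : ℤ) •
    (LinearMap.mul ℤ ℤ).compl₁₂ (S.coordL p.1) (S.coordL p.2)
  have : S.mulL.compr₂ (S.coordL ω) = rhs := by
    apply S.hom_ext; intro σ; apply S.hom_ext; intro τ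
    simp only [compr₂_apply, mulL, lift_e, coordL_apply, cE_apply, rhs, LinearMap.sum_apply,
      LinearMap.smul_apply, LinearMap.compl₁₂_apply, LinearMap.mul_apply', e_apply, smul_eq_mul]
    rw [sum_eq_single (σ, τ)]
    · simp
    · rintro ⟨a, b⟩ _ h
      have : ¬ (σ = a ∧ τ = b) := fun h' => h (by rw [h'.1, h'.2])
      by_cases h1 : σ = a
      · have h2 : ¬ τ = b := fun h2 => this ⟨h1, h2⟩
        simp [h2]
      · simp [h1]
    · intro h; rw [mem_cop, not_not] at h
      simp only at h
      simp [h]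
  have := LinearMap.congr_fun (LinearMap.congr_fun this a) b
  simpa [rhs, LinearMap.sum_apply] using this
lemma lift_cE {M : Type*} [AddCommGroup M] (f : Ω → M) (σ τ : Ω) :
    S.lift f (S.cE σ τ) = (S.c σ τ).sum (fun κ n => (n : ℤ) • f κ) := by
  rw [lift_apply]
  exact Finsupp.sum_mapRange_index (by simp)
lemma mulL_cE_left (α β γ : Ω) (π : Ω) :
    S.mulL (S.cE α β) (S.e γ) π = (S.c α β).sum (fun κ n => (n * S.c κ γ π : ℤ)) := by
  rw [mulL, lift_cE]
  simp only [Finsupp.sum, LinearMap.sum_apply, sum_apply, LinearMap.smul_apply, lift_e, zsmul_apply, cE_apply]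
lemma mulL_cE_right (α β γ : Ω) (π : Ω) :
    S.mulL (S.e α) (S.cE β γ) π = (S.c β γ).sum (fun κ n => (n * S.c α κ π : ℤ)) := by
  rw [mulL, lift_e, lift_cE]
  simp only [Finsupp.sum, sum_apply, zsmul_apply, cE_apply]
lemma mulL_comm (a b : S.R) : S.mulL a b = S.mulL b a := by
  have : S.mulL = S.mulL.flip := by
    apply S.hom_ext; intro σ; apply S.hom_ext; intro τ
    simp only [mulL, lift_e, LinearMap.flip_apply]
    ext π
    rw [cE_apply, cE_apply, S.c_comm σ τ]
  conv_lhs => rw [this]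
  rfl
lemma mulL_assoc (a b c : S.R) : S.mulL (S.mulL a b) c = S.mulL a (S.mulL b c) := by
  induction a using S.R_induction with
  | h0 => simp
  | ha a b h1 h2 => simp only [map_add, LinearMap.add_apply, h1, h2]
  | hs n α =>
    induction b using S.R_induction with
    | h0 => simp
    | ha a b h1 h2 => simp only [map_add, LinearMap.add_apply, h1, h2]
    | hs n' β =>
      induction c using S.R_induction with
      | h0 => simp
      | ha a b h1 h2 => simp only [map_add, LinearMap.add_apply, h1, h2]
      | hs n'' γ =>
        simp only [map_smul, LinearMap.smul_apply]
        congr 1; congr 1; congr 1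
        ext π
        rw [show S.mulL (S.e α) (S.e β) = S.cE α β by simp [mulL], show S.mulL (S.e β) (S.e γ) = S.cE β γ by simp [mulL],
          mulL_cE_left, mulL_cE_right]
        have := S.assoc α β γ π
        simp only [Finsupp.sum] at this ⊢
        exact_mod_cast this
lemma mulL_one (a : S.R) : S.mulL (S.e S.one) a = a := by
  have : S.mulL (S.e S.one) = LinearMap.id := by
    apply S.hom_ext; intro ω; ext τ
    simp [mulL, cE_apply, S.c_one_left, e_apply, Finsupp.single_apply]
  rw [this]; rfl
instance : CommRing S.R :=
  { (inferInstance : AddCommGroup S.R) with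
    mul := fun a b => S.mulL a b
    one := S.e S.one
    left_distrib := fun a b c => map_add (S.mulL a) b c
    right_distrib := fun a b c => by
      change S.mulL (a + b) c = S.mulL a c + S.mulL b c
      rw [map_add, LinearMap.add_apply]
    zero_mul := fun a => by change S.mulL 0 a = 0; simp
    mul_zero := fun a => by change S.mulL a 0 = 0; simp
    mul_assoc := S.mulL_assoc
    one_mul := S.mulL_one
    mul_one := fun a => by change S.mulL a (S.e S.one) = a; rw [mulL_comm, mulL_one]
    mul_comm := S.mulL_comm }
lemma one_def : (1 : S.R) = S.e S.one := rfl
lemma mul_apply (a b : S.R) (ω : Ω) :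
    (a * b) ω = ∑ p ∈ S.cop ω, (S.c p.1 p.2 ω : ℤ) * (a p.1 * b p.2) := S.mulL_apply a b ω
lemma e_mul_e (σ τ π : Ω) : (S.e σ * S.e τ) π = S.c σ τ π := by
  change S.mulL (S.e σ) (S.e τ) π = _
  simp [mulL, cE_apply]
def B : S.R →ₗ[ℤ] S.R →ₗ[ℤ] ℤ := S.lift fun ω => S.coordL ω
@[simp] lemma B_e_left (ω : Ω) (a : S.R) : S.B (S.e ω) a = a ω := by simp [B]
lemma B_comm (a b : S.R) : S.B a b = S.B b a := by
  have : S.B = S.B.flip := by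
    apply S.hom_ext; intro σ; apply S.hom_ext; intro τ
    simp [e_apply, eq_comm]
  conv_lhs => rw [this]
  rfl
@[simp] lemma B_e_right (ω : Ω) (a : S.R) : S.B a (S.e ω) = a ω := by rw [B_comm, B_e_left]
lemma B_apply (a b : S.R) : S.B a b = Finsupp.sum (a : Ω →₀ ℤ) fun ω n => n * b ω := by
  rw [B, lift_apply]
  simp only [Finsupp.sum, LinearMap.sum_apply, LinearMap.smul_apply, coordL_apply, smul_eq_mul]
def perp (π : Ω) : S.R →ₗ[ℤ] S.R :=
  S.lift fun ω => ∑ p ∈ S.cop ω, if p.1 = π then (S.c π p.2 ω : ℤ) • S.e p.2 else 0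
lemma perp_e_apply (π ω τ : Ω) : S.perp π (S.e ω) τ = S.c π τ ω := by
  rw [perp, lift_e, sum_apply, sum_eq_single (π, τ)]
  · rw [if_pos rfl, zsmul_apply, e_apply, if_pos rfl, mul_one]
  · rintro ⟨a, b⟩ _ h
    have : a = π → b ≠ τ := fun h1 h2 => h (by rw [h1, h2])
    by_cases h1 : a = π
    · rw [if_pos h1, zsmul_apply, e_apply, if_neg (this h1), mul_zero]
    · simp [h1]
  · intro h; rw [mem_cop, not_not] at h
    simp only at h
    simp [h]
lemma perp_adj (π : Ω) (a b : S.R) : S.B (S.perp π a) b = S.B a (S.e π * b) := by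
  have : S.B.comp (S.perp π) = S.B.compl₂ (S.mulL (S.e π)) := by
    apply S.hom_ext; intro σ; apply S.hom_ext; intro τ
    simp only [LinearMap.comp_apply, B_e_right, LinearMap.compl₂_apply, B_e_left, perp_e_apply]
    exact (S.e_mul_e π τ σ).symm
  exact LinearMap.congr_fun (LinearMap.congr_fun this a) b
lemma perp_apply (π : Ω) (a : S.R) (τ : Ω) : S.perp π a τ = S.B a (S.e π * S.e τ) := by
  rw [← perp_adj, B_e_right]
lemma perp_mul (π : Ω) (a b : S.R) :
    S.perp π (a * b) = ∑ p ∈ S.cop π, (S.c p.1 p.2 π : ℤ) • (S.perp p.1 a * S.perp p.2 b) := by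
  let rhs : S.R →ₗ[ℤ] S.R →ₗ[ℤ] S.R := ∑ p ∈ S.cop π, (S.c p.1 p.2 π : ℤ) •
    S.mulL.compl₁₂ (S.perp p.1) (S.perp p.2)
  have : S.mulL.compr₂ (S.perp π) = rhs := by
    apply S.hom_ext; intro α; apply S.hom_ext; intro β
    ext ω
    rw [compr₂_apply, perp_apply]
    change S.B (S.e α * S.e β) (S.e π * S.e ω) = _
    have h1 : S.B (S.e α * S.e β) (S.e π * S.e ω) = (((S.c α β).sum (fun π' n => n * S.c π ω π') : ℕ) : ℤ) := by
      have : S.e α * S.e β = S.cE α β := by ext; rw [e_mul_e, cE_apply]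
      rw [this, B, lift_cE]
      simp only [Finsupp.sum, LinearMap.sum_apply, LinearMap.smul_apply, coordL_apply, e_mul_e, smul_eq_mul]
      push_cast
      rfl
    rw [h1, S.sum_c_sym, S.hopf]
    simp only [rhs, LinearMap.sum_apply, LinearMap.smul_apply, LinearMap.compl₁₂_apply, sum_apply, zsmul_apply,
      mulL_apply, perp_e_apply]
    push_cast
    simp only [mul_sum]
    refine sum_congr rfl fun p _ => sum_congr rfl fun p' _ => ?_
    ring
  have := LinearMap.congr_fun (LinearMap.congr_fun this a) b
  simp only [rhs, LinearMap.sum_apply, LinearMap.smul_apply] at this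
  exact this
lemma perp_comm (π σ : Ω) (a : S.R) : S.perp π (S.perp σ a) = S.perp σ (S.perp π a) := by
  ext τ
  rw [← S.B_e_right τ, ← S.B_e_right τ (S.perp σ _), perp_adj, perp_adj, perp_adj, perp_adj]
  congr 1; ring
lemma perp_one' (a : S.R) : S.perp S.one a = a := by
  ext τ
  rw [perp_apply, ← one_def, one_mul, B_e_right]
variable {Ω : Type} (S : PSH Ω)
def Pos (a : S.R) : Prop := ∀ ω, 0 ≤ a ω
lemma pos_e (ω : Ω) : S.Pos (S.e ω) := fun τ => by rw [e_apply]; split_ifs <;> simp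
lemma pos_one : S.Pos 1 := S.pos_e _
variable {S}
lemma Pos.mul {a b : S.R} (ha : S.Pos a) (hb : S.Pos b) : S.Pos (a * b) := fun ω => by
  rw [mul_apply]
  exact sum_nonneg fun p _ => mul_nonneg (by positivity) (mul_nonneg (ha _) (hb _))
lemma Pos.pow {a : S.R} (ha : S.Pos a) (n : ℕ) : S.Pos (a ^ n) := by
  induction n with
  | zero => rw [pow_zero]; exact S.pos_one
  | succ n ih => rw [pow_succ]; exact ih.mul ha
lemma Pos.B_nonneg {a b : S.R} (ha : S.Pos a) (hb : S.Pos b) : 0 ≤ S.B a b := by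
  rw [B_apply]
  exact sum_nonneg fun p _ => mul_nonneg (ha _) (hb _)
lemma Pos.B_pos {a b : S.R} (ha : S.Pos a) (hb : S.Pos b) {ω : Ω} (h1 : a ω ≠ 0) (h2 : b ω ≠ 0) :
    0 < S.B a b := by
  rw [B_apply]
  refine sum_pos' (fun p _ => mul_nonneg (ha _) (hb _)) ⟨ω, ?_, ?_⟩
  · exact Finsupp.mem_support_iff.2 h1
  · exact mul_pos (lt_of_le_of_ne (ha _) h1.symm) (lt_of_le_of_ne (hb _) h2.symm)
lemma B_ne_zero {a b : S.R} (h : S.B a b ≠ 0) : ∃ ω, a ω ≠ 0 ∧ b ω ≠ 0 := by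
  rw [B_apply] at h
  obtain ⟨ω, _, h⟩ := exists_ne_zero_of_sum_ne_zero h
  exact ⟨ω, left_ne_zero_of_mul h, right_ne_zero_of_mul h⟩
lemma Pos.perp {a : S.R} (ha : S.Pos a) (π : Ω) : S.Pos (S.perp π a) := fun ω => by
  rw [perp_apply]
  exact ha.B_nonneg ((S.pos_e _).mul (S.pos_e _))
lemma Pos.perp_ne {a : S.R} (ha : S.Pos a) {π τ ω : Ω} (h1 : a ω ≠ 0) (h2 : S.c π τ ω ≠ 0) :
    S.perp π a τ ≠ 0 := by
  rw [perp_apply]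
  refine (ha.B_pos ((S.pos_e _).mul (S.pos_e _)) h1 ?_).ne'
  rw [e_mul_e]; exact_mod_cast h2
lemma Pos.perp_e_eq_zero {a : S.R} (ha : S.Pos a) {π τ : Ω} (h0 : S.perp π a = 0) (h1 : a τ ≠ 0) :
    S.perp π (S.e τ) = 0 := by
  ext ω
  rw [perp_e_apply, zero_apply]
  by_contra h
  have := ha.perp_ne (π := π) (τ := ω) h1 (by exact_mod_cast h)
  rw [h0] at this
  exact this rfl
lemma Pos.e_mul_ne {a : S.R} (ha : S.Pos a) {σ τ ω : Ω} (h1 : a τ ≠ 0) (h2 : S.c σ τ ω ≠ 0) :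
    (S.e σ * a) ω ≠ 0 := by
  rw [mul_apply]
  refine (sum_pos' (fun p _ => mul_nonneg (by positivity) (mul_nonneg (S.pos_e _ _) (ha _))) ⟨(σ, τ), ?_, ?_⟩).ne'
  · rw [mem_cop]; exact h2
  · simp only [e_apply, if_true, one_mul]
    exact mul_pos (by exact_mod_cast Nat.pos_of_ne_zero h2) (lt_of_le_of_ne (ha _) h1.symm)
lemma e_mul_ne_zero {a : S.R} {σ ω : Ω} (h : (S.e σ * a) ω ≠ 0) : ∃ τ, a τ ≠ 0 ∧ S.c σ τ ω ≠ 0 := by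
  rw [mul_apply] at h
  obtain ⟨⟨p, τ⟩, _, h⟩ := exists_ne_zero_of_sum_ne_zero h
  simp only [ne_eq, mul_eq_zero, not_or, e_apply] at h
  have : σ = p := by by_contra h3; simp [h3] at h
  subst this
  exact ⟨τ, h.2.2, by exact_mod_cast h.1⟩
lemma B_self_nonneg (a : S.R) : 0 ≤ S.B a a := by
  rw [B_apply]; exact sum_nonneg fun p _ => mul_self_nonneg _
lemma B_self_eq_zero {a : S.R} (h : S.B a a = 0) : a = 0 := by
  rw [B_apply] at h
  unfold Finsupp.sum at h
  replace h := (Finset.sum_eq_zero_iff_of_nonneg (fun p _ => mul_self_nonneg _)).1 h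
  ext ω
  by_contra h2
  exact h2 (mul_self_eq_zero.1 (h ω (Finsupp.mem_support_iff.2 h2)))
lemma B_sub_e (a : S.R) (ω : Ω) : S.B (a - a ω • S.e ω) (a - a ω • S.e ω) = S.B a a - (a ω) ^ 2 := by
  simp only [map_sub, map_smul, LinearMap.sub_apply, LinearMap.smul_apply, B_e_right, B_e_left, smul_eq_mul, e_apply, sub_apply, zsmul_apply]
  simp
  ring
lemma norm_one {a : S.R} (h : S.B a a = 1) : ∃ ω, a = S.e ω ∨ a = - S.e ω := by
  have hne : ∃ ω, a ω ≠ 0 := by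
    by_contra h2; push Not at h2
    have : a = 0 := by ext ω; exact h2 ω
    simp [this] at h
  obtain ⟨ω, hω⟩ := hne
  have h1 := B_sub_e a ω
  have h2 := B_self_nonneg (a - a ω • S.e ω)
  have h3 : (a ω) ^ 2 = 1 := by
    have : 0 < (a ω) ^ 2 := by positivity
    omega
  have h4 : a = a ω • S.e ω := by
    rw [← sub_eq_zero]; apply B_self_eq_zero; rw [h1, h, h3]; rfl
  rcases sq_eq_one_iff.1 h3 with h5 | h5
  · exact ⟨ω, Or.inl (by rw [h5, one_smul] at h4; exact h4)⟩
  · exact ⟨ω, Or.inr (by rw [h5, neg_one_smul] at h4; exact h4)⟩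
lemma norm_two {a : S.R} (ha : S.Pos a) (h : S.B a a = 2) : ∃ x y, x ≠ y ∧ a = S.e x + S.e y := by
  have hne : ∃ ω, a ω ≠ 0 := by
    by_contra h2; push Not at h2
    have : a = 0 := by ext ω; exact h2 ω
    simp [this] at h
  obtain ⟨ω, hω⟩ := hne
  have h1 := B_sub_e a ω
  have h2 := B_self_nonneg (a - a ω • S.e ω)
  have h3 : a ω = 1 := by
    have := lt_of_le_of_ne (ha ω) (Ne.symm hω)
    nlinarith
  rw [h3, h, one_smul] at h1
  obtain ⟨y, hy⟩ := norm_one (S := S) (a := a - S.e ω) (by rw [h1]; rfl)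
  have h4 : (a - S.e ω) ω = 0 := by rw [sub_apply, e_apply, h3]; simp
  have hxy : ω ≠ y := by
    rintro rfl
    rcases hy with hy | hy
    · rw [hy, e_apply] at h4; simp at h4
    · rw [hy, show (-S.e ω) = 0 - S.e ω by simp, sub_apply, e_apply] at h4; simp at h4
  refine ⟨ω, y, hxy, ?_⟩
  rcases hy with hy | hy
  · rw [← hy]; abel
  · exfalso
    have h5 : (a - S.e ω) y = -1 := by
      rw [hy, show (-S.e y) = 0 - S.e y by simp, sub_apply, e_apply]; simp
    rw [sub_apply, e_apply, if_neg hxy] at h5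
    have := ha y
    omega
variable (S) in
def Prim (ρ : Ω) : Prop := 0 < S.deg ρ ∧ ∀ σ τ, S.c σ τ ρ ≠ 0 → σ = S.one ∨ τ = S.one
lemma perp_e_of_deg {π ω : Ω} (h : S.deg ω < S.deg π) : S.perp π (S.e ω) = 0 := by
  ext τ
  rw [perp_e_apply, zero_apply]
  by_contra h1
  have := S.c_deg (by exact_mod_cast h1)
  omega
lemma perp_one_eq_zero {π : Ω} (h : 0 < S.deg π) : S.perp π 1 = 0 := by
  rw [one_def]; exact perp_e_of_deg (by rwa [S.deg_one])
lemma perp_self_e (π : Ω) : S.perp π (S.e π) = 1 := by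
  ext τ
  rw [perp_e_apply, one_def, e_apply]
  by_cases h : S.c π τ π = 0
  · rw [h, if_neg]; · rfl
    rintro rfl
    rw [S.c_one_right] at h; simp at h
  · have := S.c_deg h
    have h2 := S.eq_one τ (by omega)
    subst h2
    rw [S.c_one_right]; simp
lemma Prim.ne_one {ρ : Ω} (h : S.Prim ρ) : ρ ≠ S.one := by
  rintro rfl
  have := h.1
  rw [S.deg_one] at this; omega
lemma Prim.perp_e {ρ : Ω} (h : S.Prim ρ) {σ : Ω} (h1 : σ ≠ S.one) (h2 : σ ≠ ρ) : S.perp σ (S.e ρ) = 0 := by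
  ext τ
  rw [perp_e_apply, zero_apply]
  by_contra h3
  have h3' : S.c σ τ ρ ≠ 0 := by exact_mod_cast h3
  rcases h.2 σ τ h3' with h4 | h4
  · exact h1 h4
  · subst h4
    rw [S.c_one_right, Finsupp.single_apply] at h3'
    simp [h2] at h3'
lemma Prim.perp_mul {ρ : Ω} (h : S.Prim ρ) (a b : S.R) :
    S.perp ρ (a * b) = S.perp ρ a * b + a * S.perp ρ b := by
  rw [PSH.perp_mul]
  have hc : S.cop ρ = {(ρ, S.one), (S.one, ρ)} := by
    ext ⟨σ, τ⟩
    rw [mem_cop]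
    simp only [mem_insert, mem_singleton, Prod.mk.injEq]
    constructor
    · intro h1
      rcases h.2 _ _ h1 with h2 | h2
      · subst h2
        rw [S.c_one_left, Finsupp.single_apply] at h1
        right; refine ⟨rfl, ?_⟩
        by_contra h3; simp [h3] at h1
      · subst h2
        rw [S.c_one_right, Finsupp.single_apply] at h1
        left; refine ⟨?_, rfl⟩
        by_contra h3; simp [h3] at h1
    · rintro (⟨rfl, rfl⟩ | ⟨rfl, rfl⟩)
      · rw [S.c_one_right]; simp
      · rw [S.c_one_left]; simp
  rw [hc, sum_pair]
  · simp only [S.c_one_left, S.c_one_right, perp_one', Finsupp.single_eq_same, cast_one, one_smul]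
  · intro h1
    exact h.ne_one (congrArg Prod.fst h1)
section thm1
variable {ρ : Ω} (hρ : S.Prim ρ)
include hρ
lemma Prim.perp_pow (n : ℕ) : S.perp ρ (S.e ρ ^ (n + 1)) = ((n : S.R) + 1) * S.e ρ ^ n := by
  induction n with
  | zero => simp [perp_self_e]
  | succ n ih =>
    rw [pow_succ, hρ.perp_mul, ih, perp_self_e]
    push_cast; ring
lemma Prim.sq : ∃ u v, u ≠ v ∧ S.e ρ * S.e ρ = S.e u + S.e v := by
  apply norm_two ((S.pos_e _).mul (S.pos_e _))
  rw [← perp_adj, hρ.perp_mul, perp_self_e]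
  simp [e_apply, map_add]
variable {u y : Ω} (huy : u ≠ y) (hsq : S.e ρ * S.e ρ = S.e u + S.e y)
include huy hsq
lemma Prim.perp_y : S.perp ρ (S.e y) = S.e ρ := by
  have h1 : S.perp ρ (S.e u) + S.perp ρ (S.e y) = S.e ρ + S.e ρ := by
    rw [← map_add, ← hsq, hρ.perp_mul, perp_self_e]; ring
  ext τ
  have h2 := congrArg (fun a : S.R => a τ) h1
  have p1 := (S.pos_e u).perp ρ τ
  have p2 := (S.pos_e y).perp ρ τ
  simp only [add_apply] at h2
  by_cases h : ρ = τ
  · subst h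
    rw [perp_e_apply, ← e_mul_e, hsq, add_apply, e_apply, e_apply, if_neg huy, e_apply]; simp
  · rw [e_apply, if_neg h] at h2 ⊢
    omega
lemma Prim.deg_y : S.deg y = S.deg ρ + S.deg ρ := by
  apply S.c_deg (σ := ρ) (τ := ρ)
  have := hρ.perp_y huy hsq
  have h2 := S.perp_e_apply ρ y ρ
  rw [this, e_apply, if_pos rfl] at h2
  omega
lemma Prim.perp_y_mul (a : S.R) : S.perp y (S.e ρ * a) = S.e ρ * S.perp y a + S.perp ρ a := by
  rw [PSH.perp_mul]
  have hy1 : y ≠ S.one := by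
    rintro rfl
    have := hρ.deg_y huy hsq; rw [S.deg_one] at this; have := hρ.1; omega
  have hcy : ∀ τ, (S.c ρ τ y : ℤ) = S.e ρ τ := fun τ => by rw [← perp_e_apply, hρ.perp_y huy hsq]
  have hne : (S.one, y) ≠ (ρ, ρ) := fun h => hρ.ne_one (congrArg Prod.fst h).symm
  have hsub : ({(S.one, y), (ρ, ρ)} : Finset (Ω × Ω)) ⊆ S.cop y := by
    intro p hp
    simp only [mem_insert, mem_singleton] at hp
    rw [mem_cop]
    rcases hp with rfl | rfl
    · rw [S.c_one_left]; simp
    · have := hcy ρ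
      rw [e_apply, if_pos rfl] at this
      simp only; omega
  rw [← sum_subset hsub, sum_pair hne]
  · simp only [hcy, S.c_one_left, perp_one', perp_self_e, e_apply]
    simp
  · rintro ⟨σ, τ⟩ h1 h2
    rw [mem_cop] at h1
    simp only [mem_insert, mem_singleton, Prod.mk.injEq, not_or, not_and] at h2
    simp only at h1
    by_cases c1 : σ = S.one
    · exfalso
      subst c1
      rw [S.c_one_left, Finsupp.single_apply] at h1
      refine h2.1 rfl ?_
      by_contra h3; simp [h3] at h1
    by_cases c2 : σ = ρ
    · exfalso
      subst c2
      have := hcy τ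
      rw [e_apply, if_neg (fun h => h2.2 rfl h.symm)] at this
      omega
    · rw [hρ.perp_e c1 c2]; simp
lemma Prim.step (n : ℕ) : ∃ x x', (∀ ω, ((S.e ρ ^ n) ω ≠ 0 ∧ S.perp y (S.e ω) = 0) ↔ ω = x) ∧
    (∀ ω, ((S.e ρ ^ (n + 1)) ω ≠ 0 ∧ S.perp y (S.e ω) = 0) ↔ ω = x') ∧ S.perp ρ (S.e x') = S.e x := by
  have hd := hρ.deg_y huy hsq
  have hd0 := hρ.1
  induction n with
  | zero =>
    refine ⟨S.one, ρ, ?_, ?_, perp_self_e ρ⟩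
    · intro ω
      rw [pow_zero, one_def, e_apply]
      constructor
      · rintro ⟨h, _⟩
        by_contra h2; simp [Ne.symm h2] at h
      · rintro rfl
        exact ⟨by simp, perp_one_eq_zero (by omega)⟩
    · intro ω
      rw [zero_add, pow_one, e_apply]
      constructor
      · rintro ⟨h, _⟩
        by_contra h2; simp [Ne.symm h2] at h
      · rintro rfl
        exact ⟨by simp, perp_e_of_deg (by omega)⟩
  | succ n ih =>
    obtain ⟨x, x', hx, hx', hxx⟩ := ih
    refine ⟨x', ?_⟩
    obtain ⟨hx'1, hx'2⟩ := (hx' x').2 rfl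
    have hcx : S.c ρ x x' = 1 := by
      have := S.perp_e_apply ρ x' x
      rw [hxx, e_apply, if_pos rfl] at this; omega
    have hn2 : S.B (S.e ρ * S.e x') (S.e ρ * S.e x') = 2 := by
      rw [← perp_adj, hρ.perp_mul, perp_self_e, hxx]
      simp only [B_e_right, one_mul, add_apply, e_mul_e, hcx, e_apply]; simp
    have main : ∃ a b, a ≠ b ∧ S.e ρ * S.e x' = S.e a + S.e b ∧ S.perp y (S.e a) = 0 ∧ S.perp y (S.e b) = S.e x := by
      obtain ⟨a, b, hab, he⟩ := norm_two ((S.pos_e _).mul (S.pos_e _)) hn2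
      have hs : S.perp y (S.e a) + S.perp y (S.e b) = S.e x := by
        rw [← map_add, ← he, hρ.perp_y_mul huy hsq, hx'2, hxx]; simp
      by_cases h0 : S.perp y (S.e a) = 0
      · exact ⟨a, b, hab, he, h0, by rw [← hs, h0, zero_add]⟩
      · refine ⟨b, a, hab.symm, by rw [he, add_comm], ?_⟩
        have : S.perp y (S.e b) = 0 := by
          obtain ⟨τ, hτ⟩ : ∃ τ, S.perp y (S.e a) τ ≠ 0 := by
            by_contra h; push Not at h
            exact h0 (S.R_ext h)
          ext κ
          have q1 := (S.pos_e a).perp y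
          have q2 := (S.pos_e b).perp y
          have r1 := congrArg (fun z : S.R => z τ) hs
          have r2 := congrArg (fun z : S.R => z κ) hs
          simp only [add_apply, e_apply] at r1 r2
          have := q1 τ; have := q2 τ; have := q1 κ; have := q2 κ
          rw [zero_apply]
          split_ifs at r1 with h1
          · subst h1
            by_cases h2 : x = κ
            · subst h2; omega
            · rw [if_neg h2] at r2; omega
          · omega
        exact ⟨this, by rw [← hs, this, add_zero]⟩
    obtain ⟨a, b, hab, he, ha0, hb0⟩ := main
    have hca : S.c ρ x' a = 1 := by
      have := S.e_mul_e ρ x' a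
      rw [he, add_apply, e_apply, e_apply, if_neg hab.symm, if_pos rfl] at this; omega
    have hpa : (S.e ρ ^ (n + 1 + 1)) a ≠ 0 := by
      rw [pow_succ']
      exact ((S.pos_e ρ).pow _).e_mul_ne hx'1 (by omega)
    refine ⟨a, hx', ?_, ?_⟩
    · intro ω
      constructor
      · rintro ⟨h1, h2⟩
        rw [pow_succ'] at h1
        obtain ⟨τ, hτ1, hτ2⟩ := e_mul_ne_zero h1
        have hτ3 : S.perp y (S.e τ) = 0 := by
          have h3 : S.perp y (S.perp ρ (S.e ω)) = 0 := by rw [perp_comm, h2, map_zero]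
          refine ((S.pos_e ω).perp ρ).perp_e_eq_zero h3 ?_
          rw [perp_e_apply]; exact_mod_cast hτ2
        have := (hx' τ).1 ⟨hτ1, hτ3⟩
        subst this
        have h4 := S.e_mul_e ρ τ ω
        rw [he, add_apply, e_apply, e_apply] at h4
        by_contra hne
        rw [if_neg (Ne.symm hne)] at h4
        by_cases hb : b = ω
        · subst hb
          rw [h2] at hb0
          have := congrArg (fun z : S.R => z x) hb0
          simp [e_apply] at this
        · rw [if_neg hb] at h4; omega
      · rintro rfl
        exact ⟨hpa, ha0⟩
    · ext τ
      rw [perp_e_apply, e_apply]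
      by_cases h : x' = τ
      · subst h; rw [hca, if_pos rfl]; rfl
      · rw [if_neg h]
        by_contra h1
        have h1' : S.c ρ τ a ≠ 0 := by exact_mod_cast h1
        apply h
        symm
        apply (hx' τ).1
        constructor
        · have h5 := ((S.pos_e ρ).pow (n + 1 + 1)).perp_ne hpa h1'
          rw [hρ.perp_pow] at h5
          intro h6
          apply h5
          have : ((↑(n+1) : S.R) + 1) * S.e ρ ^ (n + 1) = ((n : ℤ) + 2) • S.e ρ ^ (n + 1) := by
            rw [zsmul_eq_mul]; push_cast; ring
          rw [this, zsmul_apply, h6, mul_zero]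
        · have h3 : S.perp y (S.perp ρ (S.e a)) = 0 := by rw [perp_comm, ha0, map_zero]
          refine ((S.pos_e a).perp ρ).perp_e_eq_zero h3 ?_
          rw [perp_e_apply]; exact_mod_cast h1'
omit huy hsq in
lemma Prim.split (n : ℕ) : ∀ σ τ, S.B (S.e σ * S.e τ) (S.e ρ ^ n) ≠ 0 →
    ∃ i j, i + j = n ∧ (S.e ρ ^ i) σ ≠ 0 ∧ (S.e ρ ^ j) τ ≠ 0 := by
  induction n with
  | zero =>
    intro σ τ h
    rw [pow_zero, one_def, B_e_right, e_mul_e] at h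
    have := S.c_deg (by exact_mod_cast h)
    rw [S.deg_one] at this
    refine ⟨0, 0, rfl, ?_⟩
    rw [S.eq_one σ (by omega), S.eq_one τ (by omega), pow_zero, one_def, e_apply]
    simp
  | succ n ih =>
    have key : ∀ σ τ, S.B (S.perp ρ (S.e σ) * S.e τ) (S.e ρ ^ n) ≠ 0 →
        ∃ i j, i + j = n + 1 ∧ (S.e ρ ^ i) σ ≠ 0 ∧ (S.e ρ ^ j) τ ≠ 0 := by
      intro σ τ h
      obtain ⟨ω, h1, h2⟩ := B_ne_zero h
      rw [mul_comm] at h1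
      obtain ⟨κ, h3, h4⟩ := e_mul_ne_zero h1
      rw [perp_e_apply] at h3
      obtain ⟨i, j, hij, h5, h6⟩ := ih κ τ (((S.pos_e _).mul (S.pos_e _)).B_pos ((S.pos_e ρ).pow n)
        (ω := ω) (by rw [mul_comm, e_mul_e]; exact_mod_cast h4) h2).ne'
      refine ⟨i + 1, j, by omega, ?_, h6⟩
      rw [pow_succ']
      exact ((S.pos_e ρ).pow i).e_mul_ne h5 (by exact_mod_cast h3)
    intro σ τ h
    rw [pow_succ', ← perp_adj, hρ.perp_mul, map_add, LinearMap.add_apply] at h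
    by_cases h1 : S.B (S.perp ρ (S.e σ) * S.e τ) (S.e ρ ^ n) = 0
    · rw [h1, zero_add, mul_comm] at h
      obtain ⟨i, j, hij, a, b⟩ := key τ σ h
      exact ⟨j, i, by omega, b, a⟩
    · exact key σ τ h1
/-- Zelevinsky: the sequence of "trivial-type" elements attached to a primitive element. -/
theorem Prim.exists_h : ∃ x : ℕ → Ω, x 0 = S.one ∧ x 1 = ρ ∧
    (∀ n, S.c ρ (x n) (x (n + 1)) = 1) ∧ (∀ n, (S.e ρ ^ n) (x n) = 1) ∧ x 2 = u ∧
    ∀ σ τ n, S.c σ τ (x n) = if ∃ i ≤ n, σ = x i ∧ τ = x (n - i) then 1 else 0 := by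
  choose x x' hx hx' hxx using hρ.step huy hsq
  have e1 : ∀ n, x' n = x (n + 1) := fun n => (hx (n + 1) (x' n)).1 ((hx' n _).2 rfl)
  have hP : ∀ n, S.perp ρ (S.e (x (n + 1))) = S.e (x n) := fun n => by rw [← e1, hxx]
  have hc1 : ∀ n, S.c ρ (x n) (x (n + 1)) = 1 := fun n => by
    have := S.perp_e_apply ρ (x (n+1)) (x n)
    rw [hP, e_apply, if_pos rfl] at this; omega
  have hx0 : x 0 = S.one := by
    symm; rw [← hx]
    refine ⟨by rw [pow_zero, one_def, e_apply]; simp, perp_one_eq_zero ?_⟩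
    have := hρ.deg_y huy hsq; have := hρ.1; omega
  have hx1 : x 1 = ρ := by
    symm; rw [← hx]
    refine ⟨by rw [pow_one, e_apply]; simp, perp_e_of_deg ?_⟩
    have := hρ.deg_y huy hsq; have := hρ.1; omega
  have hBp : ∀ i j, S.B (S.e ρ ^ i * S.e (x j)) (S.e (x (i + j))) = 1 := by
    intro i
    induction i with
    | zero => intro j; simp [e_apply]
    | succ i ih =>
      intro j
      rw [pow_succ', mul_assoc, B_comm, ← perp_adj, show i + 1 + j = (i + j) + 1 by ring, hP, B_comm, ih]
  have hp1 : ∀ n, (S.e ρ ^ n) (x n) = 1 := by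
    intro n
    have := hBp n 0
    rwa [hx0, ← one_def, mul_one, add_zero, B_e_right] at this
  have hdeg : ∀ n, S.deg (x n) = n * S.deg ρ := by
    intro n
    induction n with
    | zero => rw [hx0, S.deg_one]; simp
    | succ n ih =>
      rw [S.c_deg (σ := ρ) (τ := x n) (by rw [hc1]; simp), ih]; ring
  have hmain : ∀ σ τ n, S.c σ τ (x n) ≠ 0 → ∃ i ≤ n, σ = x i ∧ τ = x (n - i) := by
    intro σ τ n h
    obtain ⟨i, j, hij, h1, h2⟩ := hρ.split n σ τ (((S.pos_e _).mul (S.pos_e _)).B_pos ((S.pos_e ρ).pow n)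
        (ω := x n) (by rw [e_mul_e]; exact_mod_cast h) (by rw [hp1]; simp)).ne'
    have hy := ((hx n _).2 rfl).2
    refine ⟨i, by omega, ?_, ?_⟩
    · rw [← hx]
      refine ⟨h1, ?_⟩
      refine ((S.pos_e (x n)).perp τ).perp_e_eq_zero (by rw [perp_comm, hy, map_zero]) ?_
      rw [perp_e_apply, S.c_comm]; exact_mod_cast h
    · rw [← hx, ← hij, Nat.add_sub_cancel_left]
      refine ⟨h2, ?_⟩
      refine ((S.pos_e (x n)).perp σ).perp_e_eq_zero (by rw [perp_comm, hy, map_zero]) ?_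
      rw [perp_e_apply]; exact_mod_cast h
  have hxinj : ∀ i j, x i = x j → i = j := by
    intro i j h
    have := congrArg S.deg h
    rw [hdeg, hdeg] at this
    exact Nat.eq_of_mul_eq_mul_right hρ.1 this
  refine ⟨x, hx0, hx1, hc1, hp1, ?_, ?_⟩
  · symm
    rw [← hx]
    have hu1 : (S.e ρ ^ 2) u ≠ 0 := by
      rw [pow_two, hsq, add_apply, e_apply, e_apply, if_neg huy.symm]; simp
    refine ⟨hu1, ?_⟩
    ext τ
    rw [perp_e_apply, zero_apply]
    by_contra h
    have h' : S.c y τ u ≠ 0 := by exact_mod_cast h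
    have d1 := S.c_deg h'
    have d2 := hρ.deg_y huy hsq
    have d3 := hρ.deg_y huy.symm (by rw [hsq, add_comm])
    have := S.eq_one τ (by omega)
    subst this
    rw [S.c_one_right, Finsupp.single_apply] at h'
    simp [huy.symm] at h'
  · intro σ τ n
    split_ifs with h
    · obtain ⟨i, hi, rfl, rfl⟩ := h
      obtain ⟨j, rfl⟩ := Nat.exists_eq_add_of_le hi
      rw [Nat.add_sub_cancel_left]
      have h1 := hBp i j
      rw [B_e_right, mul_apply, sum_eq_single (x i, x j)] at h1
      · rw [hp1, e_apply, if_pos rfl] at h1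
        simp at h1; exact_mod_cast h1
      · rintro ⟨a, b⟩ hm hne
        rw [mem_cop] at hm
        by_cases hb : x j = b
        · exfalso
          obtain ⟨i', hi', h3, h4⟩ := hmain _ _ _ hm
          simp only at h3 h4
          rw [← hb] at h4
          have := hxinj _ _ h4
          apply hne
          rw [← hb, h3, show i' = i by omega]
        · simp [e_apply, hb]
      · intro h; rw [mem_cop, not_not] at h
        simp only at h
        simp [h]
    · by_contra h1
      exact h (hmain _ _ _ h1)
end thm1
end PSH
/-- A finite family of primitive elements with their associated sequences. -/
structure PSH.Sys {Ω : Type} (S : PSH Ω) (P : Type) where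
  X : P → ℕ → Ω
  r : P → ℕ
  K : P → ℕ
  r_pos : ∀ ρ, 0 < r ρ
  X0 : ∀ ρ, X ρ 0 = S.one
  deg_X : ∀ ρ n, S.deg (X ρ n) = n * r ρ
  prim : ∀ ρ, S.Prim (X ρ 1)
  inj : ∀ ρ ρ', X ρ 1 = X ρ' 1 → ρ = ρ'
  c_X : ∀ ρ σ τ n, S.c σ τ (X ρ n) = if ∃ i ≤ n, σ = X ρ i ∧ τ = X ρ (n - i) then 1 else 0
namespace PSH
namespace Sys
variable {Ω : Type} {S : PSH Ω} {P : Type} [Fintype P] (Y : S.Sys P)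
omit [Fintype P] in
lemma X_inj_same {ρ : P} {i j : ℕ} (h : Y.X ρ i = Y.X ρ j) : i = j := by
  have := congrArg S.deg h
  rw [Y.deg_X, Y.deg_X] at this
  exact Nat.eq_of_mul_eq_mul_right (Y.r_pos ρ) this
omit [Fintype P] in
lemma X_one {ρ : P} {i : ℕ} (h : Y.X ρ i = S.one) : i = 0 := by
  rw [← Y.X0 ρ] at h; exact Y.X_inj_same h
omit [Fintype P] in
lemma X_inj {ρ ρ' : P} {i j : ℕ} (h : Y.X ρ i = Y.X ρ' j) (hi : 0 < i) : ρ = ρ' := by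
  have h1 : S.c (Y.X ρ 1) (Y.X ρ (i - 1)) (Y.X ρ i) = 1 := by
    rw [Y.c_X, if_pos ⟨1, hi, rfl, rfl⟩]
  rw [h, Y.c_X] at h1
  have h2 : ∃ k ≤ j, Y.X ρ 1 = Y.X ρ' k ∧ Y.X ρ (i-1) = Y.X ρ' (j - k) := by
    by_contra h3; rw [if_neg h3] at h1; omega
  obtain ⟨k, _, hk, _⟩ := h2
  have hk0 : k ≠ 0 := by
    rintro rfl
    rw [Y.X0] at hk
    have := Y.X_one hk
    omega
  have h4 : S.c (Y.X ρ' 1) (Y.X ρ' (k - 1)) (Y.X ρ' k) = 1 := by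
    rw [Y.c_X, if_pos ⟨1, by omega, rfl, rfl⟩]
  have h5 := (Y.prim ρ).2 (Y.X ρ' 1) (Y.X ρ' (k-1)) (by rw [hk, h4]; omega)
  have h6 : k = 1 := by
    rcases h5 with h5 | h5
    · have := Y.X_one h5; omega
    · have := Y.X_one h5; omega
  subst h6
  exact Y.inj _ _ hk
omit [Fintype P] in
lemma cop_X (ρ : P) (n : ℕ) : S.cop (Y.X ρ n) =
    (Finset.HasAntidiagonal.antidiagonal n).image (fun p => (Y.X ρ p.1, Y.X ρ p.2)) := by
  ext ⟨σ, τ⟩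
  rw [S.mem_cop, Y.c_X]
  simp only [ne_eq, ite_eq_right_iff, one_ne_zero, imp_false, not_not, mem_image,
    Finset.HasAntidiagonal.mem_antidiagonal, Prod.mk.injEq, Prod.exists]
  constructor
  · rintro ⟨i, hi, rfl, rfl⟩; exact ⟨i, n - i, by omega, rfl, rfl⟩
  · rintro ⟨a, b, h, rfl, rfl⟩
    exact ⟨a, by omega, rfl, by congr 1; omega⟩
omit [Fintype P] in
lemma perp_X_mul (ρ : P) (n : ℕ) (a b : S.R) : S.perp (Y.X ρ n) (a * b) =
    ∑ p ∈ Finset.HasAntidiagonal.antidiagonal n, S.perp (Y.X ρ p.1) a * S.perp (Y.X ρ p.2) b := by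
  rw [perp_mul, cop_X, sum_image]
  refine sum_congr rfl ?_
  · rintro ⟨i, j⟩ hp
    rw [Finset.HasAntidiagonal.mem_antidiagonal] at hp
    simp only at hp
    rw [Y.c_X, if_pos ⟨i, by omega, rfl, by simp only; congr 1; omega⟩]
    simp
  · rintro ⟨a, b⟩ _ ⟨a', b'⟩ _ h
    simp only [Prod.mk.injEq] at h ⊢
    exact ⟨Y.X_inj_same h.1, Y.X_inj_same h.2⟩
omit [Fintype P] in
lemma perp_X_one (ρ : P) (n : ℕ) : S.perp (Y.X ρ n) 1 = if n = 0 then 1 else 0 := by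
  split_ifs with h
  · subst h; rw [Y.X0, perp_one']
  · apply perp_one_eq_zero; rw [Y.deg_X]; exact Nat.mul_pos (by omega) (Y.r_pos ρ)
def TS (ρ : P) : S.R →+* PowerSeries S.R where
  toFun a := PowerSeries.mk fun n => S.perp (Y.X ρ n) a
  map_one' := by
    ext n; rw [PowerSeries.coeff_mk, perp_X_one, PowerSeries.coeff_one]
  map_mul' a b := by
    ext n; rw [PowerSeries.coeff_mk, perp_X_mul, PowerSeries.coeff_mul]
    simp only [PowerSeries.coeff_mk]
  map_zero' := by ext n; simp
  map_add' a b := by ext n; simp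
omit [Fintype P] in
lemma coeff_TS (ρ : P) (a : S.R) (n : ℕ) :
    PowerSeries.coeff n (Y.TS ρ a) = S.perp (Y.X ρ n) a := by simp [TS]
def hs (ρ : P) (m ν : ℕ) : S.R := if ν ≤ m then S.e (Y.X ρ (m - ν)) else 0
omit [Fintype P] in
lemma perp_hs_same (ρ : P) (m ν n : ℕ) : S.perp (Y.X ρ n) (Y.hs ρ m ν) = Y.hs ρ m (ν + n) := by
  unfold hs
  by_cases h : ν ≤ m
  · rw [if_pos h]
    ext τ
    rw [perp_e_apply, Y.c_X]
    by_cases h2 : ν + n ≤ m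
    · rw [if_pos h2, e_apply]
      have : (∃ i ≤ m - ν, Y.X ρ n = Y.X ρ i ∧ τ = Y.X ρ (m - ν - i)) ↔ Y.X ρ (m - (ν + n)) = τ := by
        constructor
        · rintro ⟨i, hi, h3, rfl⟩
          have := Y.X_inj_same h3
          subst this
          congr 1; omega
        · rintro rfl
          exact ⟨n, by omega, rfl, by congr 1; omega⟩
      simp only [this]
      split_ifs <;> simp
    · rw [if_neg h2, if_neg]
      · simp
      · rintro ⟨i, hi, h3, _⟩
        have := Y.X_inj_same h3
        omega
  · rw [if_neg h, if_neg (by omega), map_zero]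
omit [Fintype P] in
lemma perp_hs_ne {ρ ρ' : P} (hne : ρ ≠ ρ') (m ν n : ℕ) :
    S.perp (Y.X ρ n) (Y.hs ρ' m ν) = if n = 0 then Y.hs ρ' m ν else 0 := by
  split_ifs with h
  · subst h; rw [Y.X0, perp_one']
  unfold hs
  split_ifs with h1
  · ext τ
    rw [perp_e_apply, Y.c_X, if_neg]
    · simp
    · rintro ⟨i, _, h3, _⟩
      exact hne (Y.X_inj h3 (by omega))
  · rw [map_zero]
abbrev J : Type := Σ ρ : P, Fin (Y.K ρ)
def Hs (x : Y.J → ℕ) (ν : Y.J →₀ ℕ) : S.R := ∏ j, Y.hs j.1 (x j) (ν j)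
def L (x : Y.J → ℕ) : MvPolynomial Y.J ℤ →ₗ[ℤ] S.R :=
  (MvPolynomial.basisMonomials Y.J ℤ).constr ℤ (Y.Hs x)
lemma L_monomial (x : Y.J → ℕ) (ν : Y.J →₀ ℕ) (a : ℤ) :
    Y.L x (MvPolynomial.monomial ν a) = a • Y.Hs x ν := by
  have : MvPolynomial.monomial ν a = a • MvPolynomial.basisMonomials Y.J ℤ ν := by
    simp [MvPolynomial.smul_monomial]
  rw [this, map_smul, L, Module.Basis.constr_basis]
def Jc (ρ : P) : Finset Y.J := univ.filter fun j => j.1 = ρ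
def QS (ρ : P) : PowerSeries (MvPolynomial Y.J ℤ) :=
  ∏ j ∈ Y.Jc ρ, PowerSeries.mk fun k => (MvPolynomial.X j) ^ k
def q (ρ : P) (n : ℕ) : MvPolynomial Y.J ℤ := PowerSeries.coeff n (Y.QS ρ)
lemma q_eq (ρ : P) (n : ℕ) :
    Y.q ρ n = ∑ μ ∈ (Y.Jc ρ).finsuppAntidiag n, MvPolynomial.monomial μ 1 := by
  rw [q, QS, PowerSeries.coeff_prod]
  refine sum_congr rfl fun μ hμ => ?_
  simp only [PowerSeries.coeff_mk]
  rw [Finset.mem_finsuppAntidiag] at hμ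
  rw [MvPolynomial.monomial_eq, Finsupp.prod_of_support_subset _ hμ.2 _ (by simp)]
  simp
lemma perp_Hs (x : Y.J → ℕ) (ν : Y.J →₀ ℕ) (ρ : P) (n : ℕ) :
    S.perp (Y.X ρ n) (Y.Hs x ν) = ∑ μ ∈ (Y.Jc ρ).finsuppAntidiag n, Y.Hs x (ν + μ) := by
  have h1 : Y.TS ρ (Y.Hs x ν) = (∏ j ∈ Y.Jc ρ, PowerSeries.mk fun k => Y.hs j.1 (x j) (ν j + k)) *
      PowerSeries.C (∏ j ∈ (Y.Jc ρ)ᶜ, Y.hs j.1 (x j) (ν j)) := by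
    rw [Hs, ← Finset.prod_mul_prod_compl (Y.Jc ρ), map_mul, map_prod, map_prod, map_prod]
    congr 1
    · refine prod_congr rfl fun j hj => ?_
      ext k
      rw [coeff_TS, PowerSeries.coeff_mk]
      have : j.1 = ρ := by simpa [Jc] using hj
      rw [← this, perp_hs_same]
    · refine prod_congr rfl fun j hj => ?_
      ext k
      have : j.1 ≠ ρ := by simpa [Jc] using hj
      rw [coeff_TS, perp_hs_ne _ this.symm, PowerSeries.coeff_C]
  rw [← coeff_TS, h1, PowerSeries.coeff_mul_C, PowerSeries.coeff_prod, sum_mul]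
  refine sum_congr rfl fun μ hμ => ?_
  rw [Hs, ← Finset.prod_mul_prod_compl (Y.Jc ρ)]
  simp only [PowerSeries.coeff_mk, Finsupp.add_apply]
  congr 1
  refine prod_congr rfl fun j hj => ?_
  rw [Finset.mem_finsuppAntidiag] at hμ
  have : μ j = 0 := by
    by_contra h
    exact Finset.mem_compl.1 hj (hμ.2 (Finsupp.mem_support_iff.2 h))
  rw [this, add_zero]
lemma perp_L (x : Y.J → ℕ) (ρ : P) (n : ℕ) (p : MvPolynomial Y.J ℤ) :
    S.perp (Y.X ρ n) (Y.L x p) = Y.L x (Y.q ρ n * p) := by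
  induction p using MvPolynomial.induction_on' with
  | monomial ν a =>
    rw [L_monomial, map_smul, perp_Hs, q_eq, sum_mul, map_sum, Finset.smul_sum]
    refine sum_congr rfl fun μ _ => ?_
    rw [MvPolynomial.monomial_mul, L_monomial, one_mul, add_comm]
  | add p q h1 h2 => rw [map_add, map_add, h1, h2, mul_add, map_add]
omit [Fintype P] in
lemma one_coord_mul (a b : S.R) : (a * b) S.one = a S.one * b S.one := by
  rw [mul_apply]
  have : S.cop S.one = {(S.one, S.one)} := by
    ext ⟨σ, τ⟩
    rw [S.mem_cop, mem_singleton]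
    constructor
    · intro h
      have := S.c_deg h
      rw [S.deg_one] at this
      simp only at this
      rw [S.eq_one σ (by omega), S.eq_one τ (by omega)]
    · rintro h
      rw [Prod.mk.injEq] at h
      simp only [h.1, h.2, S.c_one_left]; simp
  rw [this, sum_singleton]
  simp [S.c_one_left]
omit [Fintype P] in
lemma hs_one (ρ : P) (m ν : ℕ) : (Y.hs ρ m ν) S.one = if ν = m then 1 else 0 := by
  unfold hs
  by_cases h1 : ν = m
  · subst h1; simp [Y.X0, e_apply]
  · rw [if_neg h1]
    split_ifs with h2
    · rw [e_apply, if_neg]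
      intro h3
      have := Y.X_one h3
      omega
    · rfl
def ε (S : PSH Ω) : S.R →+* ℤ where
  toFun a := a S.one
  map_one' := by rw [one_def, e_apply, if_pos rfl]
  map_mul' := one_coord_mul
  map_zero' := rfl
  map_add' _ _ := rfl
lemma L_one (x : Y.J → ℕ) (p : MvPolynomial Y.J ℤ) :
    (Y.L x p) S.one = p.coeff (Finsupp.equivFunOnFinite.symm x) := by
  induction p using MvPolynomial.induction_on' with
  | monomial ν a =>
    rw [L_monomial, zsmul_apply, MvPolynomial.coeff_monomial]
    have : (Y.Hs x ν) S.one = ∏ j, if ν j = x j then 1 else 0 := by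
      change ε S (Y.Hs x ν) = _
      rw [Hs, map_prod]
      exact prod_congr rfl fun j _ => Y.hs_one _ _ _
    rw [this, Finset.prod_boole]
    have h2 : (∀ i ∈ univ, ν i = x i) ↔ ν = Finsupp.equivFunOnFinite.symm x := by
      rw [Finsupp.ext_iff]; simp
    simp only [h2]
    split_ifs <;> simp
  | add p q h1 h2 => rw [map_add, add_apply, h1, h2, MvPolynomial.coeff_add]
def Rel (x : Y.J → ℕ) : Subring (S.R × MvPolynomial Y.J ℤ) where
  carrier := {g | ∀ b p, S.B (g.1 * b) (Y.L x p) = S.B b (Y.L x (g.2 * p))}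
  mul_mem' := by
    intro g g' h h' b p
    simp only [Prod.fst_mul, Prod.snd_mul, mul_assoc]
    rw [h, h']
    congr 2; ring
  one_mem' := by intro b p; simp
  add_mem' := by
    intro g g' h h' b p
    simp only [Prod.fst_add, Prod.snd_add, add_mul, map_add, LinearMap.add_apply]
    rw [h, h']
  zero_mem' := by intro b p; simp
  neg_mem' := by
    intro g h b p
    simp only [Prod.fst_neg, Prod.snd_neg, neg_mul, map_neg, LinearMap.neg_apply]
    rw [h]
def qs (ρ : P) (m ν : ℕ) : MvPolynomial Y.J ℤ := if ν ≤ m then Y.q ρ (m - ν) else 0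
lemma hs_rel (x : Y.J → ℕ) (ρ : P) (m ν : ℕ) : (Y.hs ρ m ν, Y.qs ρ m ν) ∈ Y.Rel x := by
  unfold hs qs
  split_ifs with h
  · intro b p
    simp only
    rw [B_comm, ← perp_adj, perp_L, B_comm]
  · exact (Y.Rel x).zero_mem
def sM (x : Y.J → ℕ) : Matrix Y.J Y.J S.R := of fun i j => if i.1 = j.1 then Y.hs i.1 (x i) j.2 else 0
def qM (x : Y.J → ℕ) : Matrix Y.J Y.J (MvPolynomial Y.J ℤ) :=
  of fun i j => if i.1 = j.1 then Y.qs i.1 (x i) j.2 else 0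
def s (x : Y.J → ℕ) : S.R := (Y.sM x).det
def aM (y : Y.J → ℕ) : Matrix Y.J Y.J (MvPolynomial Y.J ℤ) :=
  of fun i k => if i.1 = k.1 then (MvPolynomial.X i : MvPolynomial Y.J ℤ) ^ (y k) else 0
def A (y : Y.J → ℕ) : MvPolynomial Y.J ℤ := (Y.aM y).det
def δ : Y.J → ℕ := fun j => j.2
lemma det_rel (x y : Y.J → ℕ) : (Y.s y, (Y.qM y).det) ∈ Y.Rel x := by
  let N : Matrix Y.J Y.J (S.R × MvPolynomial Y.J ℤ) := of fun i j => (Y.sM y i j, Y.qM y i j)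
  have h1 : (Y.s y, (Y.qM y).det) = N.det := by
    apply Prod.ext
    · exact ((RingHom.fst S.R (MvPolynomial Y.J ℤ)).map_det N).symm
    · exact ((RingHom.snd S.R (MvPolynomial Y.J ℤ)).map_det N).symm
  rw [h1, det_apply]
  refine Subring.sum_mem _ fun w _ => ?_
  rw [Units.smul_def]
  refine Subring.zsmul_mem _ (Subring.prod_mem _ fun i _ => ?_) _
  simp only [N, sM, qM, of_apply]
  split_ifs
  · exact Y.hs_rel x _ _ _
  · exact Subring.zero_mem _
lemma L_prod (x : Y.J → ℕ) (ν : Y.J → ℕ) : Y.L x (∏ j, (MvPolynomial.X j) ^ (ν j)) =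
    ∏ j, Y.hs j.1 (x j) (ν j) := by
  have : (∏ j, (MvPolynomial.X j : MvPolynomial Y.J ℤ) ^ (ν j)) =
      MvPolynomial.monomial (Finsupp.equivFunOnFinite.symm ν) 1 := by
    rw [MvPolynomial.monomial_eq, Finsupp.prod_fintype _ _ (by simp)]; simp
  rw [this, L_monomial, one_smul]; rfl
lemma s_eq (x : Y.J → ℕ) : Y.s x = Y.L x (Y.A Y.δ) := by
  rw [s, A, ← det_transpose, ← det_transpose (Y.aM Y.δ), det_apply, det_apply, map_sum]
  refine sum_congr rfl fun w _ => ?_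
  rw [Units.smul_def, Units.smul_def, map_smul]
  congr 1
  simp only [transpose_apply, sM, aM, of_apply]
  by_cases hw : ∀ i, i.1 = (w i).1
  · rw [prod_congr rfl fun i _ => if_pos (hw i), prod_congr rfl fun i _ => if_pos (hw i)]
    exact (Y.L_prod x _).symm
  · push Not at hw
    obtain ⟨i, hi⟩ := hw
    rw [prod_eq_zero (mem_univ i) (if_neg hi), prod_eq_zero (mem_univ i) (if_neg hi), map_zero]
def mP (i : Y.J) : Polynomial (MvPolynomial Y.J ℤ) :=
  ∏ i' ∈ (Y.Jc i.1).erase i, (1 - Polynomial.C (MvPolynomial.X i') * Polynomial.X)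
lemma card_Jc (ρ : P) : (Y.Jc ρ).card = Y.K ρ := by
  rw [Jc, ← card_subtype, ← card_fin (Y.K ρ)]
  exact Fintype.card_congr (Equiv.sigmaSubtype (a := ρ))
lemma mP_coeff (i : Y.J) {l : ℕ} (hl : Y.K i.1 ≤ l) : (Y.mP i).coeff l = 0 := by
  apply Polynomial.coeff_eq_zero_of_natDegree_lt
  refine lt_of_lt_of_le ?_ hl
  have h1 : (Y.mP i).natDegree ≤ ∑ i' ∈ (Y.Jc i.1).erase i, 1 := by
    refine (Polynomial.natDegree_prod_le _ _).trans (sum_le_sum fun j _ => ?_)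
    compute_degree
  have h2 : i ∈ Y.Jc i.1 := by simp [Jc]
  rw [sum_const, smul_eq_mul, mul_one, Finset.card_erase_of_mem h2, card_Jc] at h1
  have := i.2.2
  omega
lemma geom_mul (a : MvPolynomial Y.J ℤ) :
    ((1 - Polynomial.C a * Polynomial.X : Polynomial (MvPolynomial Y.J ℤ)) :
      PowerSeries (MvPolynomial Y.J ℤ)) * (PowerSeries.mk fun k => a ^ k) = 1 := by
  ext n : 1
  rw [Polynomial.coe_sub, Polynomial.coe_mul, Polynomial.coe_C, Polynomial.coe_X, Polynomial.coe_one,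
    sub_mul, one_mul, map_sub, mul_assoc, PowerSeries.coeff_C_mul, PowerSeries.coeff_mk, PowerSeries.coeff_one]
  cases n with
  | zero => simp
  | succ n => rw [PowerSeries.coeff_succ_X_mul, PowerSeries.coeff_mk, pow_succ']; simp
lemma mP_QS (i : Y.J) : (Y.mP i : PowerSeries (MvPolynomial Y.J ℤ)) * Y.QS i.1 =
    PowerSeries.mk fun k => (MvPolynomial.X i) ^ k := by
  have h2 : i ∈ Y.Jc i.1 := by simp [Jc]
  rw [QS, ← Finset.mul_prod_erase _ _ h2, mul_left_comm, mP]
  have : ((∏ i' ∈ (Y.Jc i.1).erase i, (1 - Polynomial.C (MvPolynomial.X i') * Polynomial.X) :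
     Polynomial (MvPolynomial Y.J ℤ)) : PowerSeries (MvPolynomial Y.J ℤ)) =
     ∏ i' ∈ (Y.Jc i.1).erase i, ((1 - Polynomial.C (MvPolynomial.X i') * Polynomial.X :
     Polynomial (MvPolynomial Y.J ℤ)) : PowerSeries (MvPolynomial Y.J ℤ)) :=
    map_prod (Polynomial.coeToPowerSeries.ringHom) _ _
  rw [this, ← prod_mul_distrib, prod_congr rfl fun j _ => Y.geom_mul _]
  simp
lemma key (i : Y.J) (n : ℕ) : ∑ l : Fin (Y.K i.1), (Y.mP i).coeff l * Y.qs i.1 n l = (MvPolynomial.X i) ^ n := by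
  have h := congrArg (PowerSeries.coeff n) (Y.mP_QS i)
  rw [PowerSeries.coeff_mk, PowerSeries.coeff_mul] at h
  rw [← h, Fin.sum_univ_eq_sum_range (fun l => (Y.mP i).coeff l * Y.qs i.1 n l),
    Finset.Nat.sum_antidiagonal_eq_sum_range_succ (fun a b => PowerSeries.coeff a (Y.mP i : PowerSeries (MvPolynomial Y.J ℤ)) * PowerSeries.coeff b (Y.QS i.1))]
  simp only [Polynomial.coeff_coe]
  have e1 : ∑ l ∈ range (Y.K i.1), (Y.mP i).coeff l * Y.qs i.1 n l =
      ∑ l ∈ range (max (Y.K i.1) n.succ), (Y.mP i).coeff l * Y.qs i.1 n l := by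
    apply sum_subset
    · intro x hx; rw [mem_range] at hx ⊢; exact lt_of_lt_of_le hx (le_max_left _ _)
    · intro x _ hx; rw [mem_range] at hx; rw [Y.mP_coeff i (by omega), zero_mul]
  have e2 : ∑ l ∈ range n.succ, (Y.mP i).coeff l * Y.qs i.1 n l =
      ∑ l ∈ range (max (Y.K i.1) n.succ), (Y.mP i).coeff l * Y.qs i.1 n l := by
    apply sum_subset
    · intro x hx; rw [mem_range] at hx ⊢; exact lt_of_lt_of_le hx (le_max_right _ _)
    · intro x _ hx; rw [mem_range] at hx; rw [qs, if_neg (by omega), mul_zero]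
  rw [e1, ← e2]
  refine sum_congr rfl fun l hl => ?_
  rw [mem_range] at hl
  rw [qs, if_pos (by omega), q]
def M : Matrix Y.J Y.J (MvPolynomial Y.J ℤ) := of fun i k => if i.1 = k.1 then (Y.mP i).coeff k.2 else 0
lemma aM_eq (y : Y.J → ℕ) : Y.aM y = Y.M * (Y.qM y)ᵀ := by
  ext1 i k
  rw [Matrix.mul_apply]
  simp only [aM, M, qM, of_apply, transpose_apply]
  rw [sum_sigma, sum_eq_single i.1]
  · simp only [if_true]
    by_cases h : i.1 = k.1
    · rw [if_pos h, ← h]; simp only [if_true]; exact (Y.key i (y k)).symm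
    · rw [if_neg h]; simp [Ne.symm h]
  · intro ρ _ h
    simp [Ne.symm h]
  · simp
lemma q_zero (ρ : P) : Y.q ρ 0 = 1 := by
  rw [q_eq]; simp
lemma qM_δ : (Y.qM Y.δ).det = 1 := by
  rw [← det_transpose]
  have hb : (Y.qM Y.δ)ᵀ.BlockTriangular (fun j : Y.J => (j.2 : ℕ)) := by
    intro i j hij
    simp only [qM, of_apply, transpose_apply]
    have : Y.qs j.1 (Y.δ j) i.2 = 0 := if_neg (not_le.2 hij)
    rw [this, ite_self]
  rw [hb.det]
  refine Finset.prod_eq_one fun a _ => ?_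
  have : (Y.qM Y.δ)ᵀ.toSquareBlock (fun j : Y.J => (j.2 : ℕ)) a = 1 := by
    ext1 ⟨⟨ρ, i⟩, hi⟩ ⟨⟨ρ', j⟩, hj⟩
    simp only at hi hj
    simp only [Matrix.toSquareBlock_def, qM, of_apply, transpose_apply, qs, δ, hi, hj, Matrix.one_apply,
      le_refl, if_true, Nat.sub_self, q_zero]
    by_cases h : ρ = ρ'
    · subst h
      have : i = j := Fin.ext (by omega)
      subst this
      simp
    · rw [if_neg (Ne.symm h), if_neg]
      intro h2
      rw [Subtype.mk.injEq, Sigma.mk.injEq] at h2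
      exact h h2.1
  rw [this, Matrix.det_one]
lemma A_eq (y : Y.J → ℕ) : Y.A y = (Y.qM y).det * Y.A Y.δ := by
  rw [A, A, aM_eq, aM_eq, Matrix.det_mul, Matrix.det_mul, det_transpose, det_transpose, qM_δ]
  ring
lemma B_s_s (x y : Y.J → ℕ) : S.B (Y.s y) (Y.s x) = (Y.A y).coeff (Finsupp.equivFunOnFinite.symm x) := by
  have := Y.det_rel x y 1 (Y.A Y.δ)
  simp only [mul_one] at this
  rw [← s_eq, ← A_eq] at this
  rw [this, one_def, B_e_left, L_one]
lemma A_coeff (x y : Y.J → ℕ) : (Y.A y).coeff (Finsupp.equivFunOnFinite.symm x) =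
    ∑ w : Equiv.Perm Y.J, (Equiv.Perm.sign w : ℤ) * if ∀ i, i.1 = (w i).1 ∧ y (w i) = x i then 1 else 0 := by
  rw [A, ← det_transpose, det_apply, MvPolynomial.coeff_sum]
  refine sum_congr rfl fun w _ => ?_
  rw [Units.smul_def, MvPolynomial.coeff_smul, smul_eq_mul]
  congr 1
  simp only [transpose_apply, aM, of_apply]
  by_cases hw : ∀ i, i.1 = (w i).1
  · rw [prod_congr rfl fun i _ => if_pos (hw i)]
    have : (∏ j, (MvPolynomial.X j : MvPolynomial Y.J ℤ) ^ (y (w j))) =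
        MvPolynomial.monomial (Finsupp.equivFunOnFinite.symm (fun j => y (w j))) 1 := by
      rw [MvPolynomial.monomial_eq, Finsupp.prod_fintype _ _ (by simp)]; simp
    rw [this, MvPolynomial.coeff_monomial]
    refine if_congr ?_ rfl rfl
    rw [Equiv.apply_eq_iff_eq, funext_iff]
    exact ⟨fun h i => ⟨hw i, h i⟩, fun h i => (h i).2⟩
  · rw [if_neg (fun h => hw fun i => (h i).1)]
    push Not at hw
    obtain ⟨i, hi⟩ := hw
    rw [prod_eq_zero (mem_univ i) (if_neg hi), MvPolynomial.coeff_zero]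
def srt (Z : ∀ ρ, {s : Finset ℕ // s.card = Y.K ρ}) : Y.J → ℕ := fun j => (Z j.1).1.orderEmbOfFin (Z j.1).2 j.2
lemma srt_mem (Z : ∀ ρ, {s : Finset ℕ // s.card = Y.K ρ}) (j : Y.J) : Y.srt Z j ∈ (Z j.1).1 :=
  Finset.orderEmbOfFin_mem _ _ _
lemma B_srt (Z Z' : ∀ ρ, {s : Finset ℕ // s.card = Y.K ρ}) :
    S.B (Y.s (Y.srt Z)) (Y.s (Y.srt Z')) = if Z = Z' then 1 else 0 := by
  rw [B_s_s, A_coeff]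
  have sub : ∀ w : Equiv.Perm Y.J, (∀ i, i.1 = (w i).1 ∧ Y.srt Z (w i) = Y.srt Z' i) → Z = Z' := by
    intro w hw
    funext ρ
    apply Subtype.ext
    symm
    apply Finset.eq_of_subset_of_card_le
    · intro a ha
      rw [← mem_coe, ← Finset.range_orderEmbOfFin _ (Z' ρ).2] at ha
      obtain ⟨i, rfl⟩ := ha
      have h1 := hw ⟨ρ, i⟩
      have h2 : Y.srt Z' ⟨ρ, i⟩ = (Z' ρ).1.orderEmbOfFin (Z' ρ).2 i := rfl
      rw [← h2, ← h1.2]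
      replace h1 := h1.1
      revert h1
      generalize w ⟨ρ, i⟩ = k
      rintro rfl
      exact Y.srt_mem Z k
    · rw [(Z ρ).2, (Z' ρ).2]
  split_ifs with h
  · subst h
    rw [sum_eq_single 1]
    · simp
    · intro w _ hw
      rw [if_neg, mul_zero]
      intro h
      apply hw
      ext1 i
      have h1 := h i
      revert h1
      generalize w i = k
      rintro ⟨h1, h2⟩
      obtain ⟨ρ, i⟩ := i
      obtain ⟨ρ', k⟩ := k
      simp only at h1
      subst h1
      simp only [srt, EmbeddingLike.apply_eq_iff_eq] at h2
      rw [h2]; rfl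
    · simp
  · refine sum_eq_zero fun w _ => ?_
    rw [if_neg, mul_zero]
    exact fun h2 => h (sub w h2)
end Sys
end PSH
set_option linter.unusedSectionVars false
set_option linter.unusedSimpArgs false
namespace PSH
variable {Ω : Type} {S : PSH Ω}
lemma mul_ne_zero_iff {a b : S.R} {ω : Ω} (h : (a * b) ω ≠ 0) :
    ∃ σ τ, a σ ≠ 0 ∧ b τ ≠ 0 ∧ S.c σ τ ω ≠ 0 := by
  rw [mul_apply] at h
  obtain ⟨⟨σ, τ⟩, _, h⟩ := exists_ne_zero_of_sum_ne_zero h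
  simp only [ne_eq, mul_eq_zero, not_or] at h
  exact ⟨σ, τ, h.2.1, h.2.2, by exact_mod_cast h.1⟩
lemma Pos.mul_ne {a b : S.R} (ha : S.Pos a) (hb : S.Pos b) {σ τ ω : Ω} (h1 : a σ ≠ 0) (h2 : b τ ≠ 0)
    (h3 : S.c σ τ ω ≠ 0) : (a * b) ω ≠ 0 := by
  rw [mul_apply]
  refine (sum_pos' (fun p _ => mul_nonneg (by positivity) (mul_nonneg (ha _) (hb _))) ⟨(σ, τ), ?_, ?_⟩).ne'
  · rw [mem_cop]; exact h3
  · exact mul_pos (by exact_mod_cast Nat.pos_of_ne_zero h3)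
      (mul_pos (lt_of_le_of_ne (ha _) h1.symm) (lt_of_le_of_ne (hb _) h2.symm))
def Hom (d : ℕ) (a : S.R) : Prop := ∀ ω, a ω ≠ 0 → S.deg ω = d
lemma Hom.mul {d d' : ℕ} {a b : S.R} (ha : Hom d a) (hb : Hom d' b) : Hom (d + d') (a * b) := by
  intro ω h
  obtain ⟨σ, τ, h1, h2, h3⟩ := mul_ne_zero_iff h
  rw [S.c_deg h3, ha _ h1, hb _ h2]
lemma hom_one : Hom 0 (1 : S.R) := by
  intro ω h
  rw [one_def, e_apply] at h
  have : S.one = ω := by by_contra h2; simp [h2] at h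
  rw [← this, S.deg_one]
lemma hom_e (ω : Ω) : Hom (S.deg ω) (S.e ω) := by
  intro τ h
  rw [e_apply] at h
  have : ω = τ := by by_contra h2; simp [h2] at h
  rw [this]
lemma hom_prod {ι : Type*} (s : Finset ι) (d : ι → ℕ) (a : ι → S.R) (h : ∀ i ∈ s, Hom (d i) (a i)) :
    Hom (∑ i ∈ s, d i) (∏ i ∈ s, a i) := by
  induction s using Finset.induction_on with
  | empty => simpa using hom_one
  | insert i s hi ih =>
    rw [sum_insert hi, prod_insert hi]
    exact (h i (mem_insert_self _ _)).mul (ih fun j hj => h j (mem_insert_of_mem hj))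
lemma pos_prod {ι : Type*} (s : Finset ι) (a : ι → S.R) (h : ∀ i ∈ s, S.Pos (a i)) :
    S.Pos (∏ i ∈ s, a i) := by
  induction s using Finset.induction_on with
  | empty => simpa using S.pos_one
  | insert i s hi ih =>
    rw [prod_insert hi]
    exact (h i (mem_insert_self _ _)).mul (ih fun j hj => h j (mem_insert_of_mem hj))
namespace Sys
variable {P : Type} [Fintype P] (Y : S.Sys P)
lemma s_deg {x : Y.J → ℕ} {ω : Ω} (h : Y.s x ω ≠ 0) :
    S.deg ω + ∑ j : Y.J, Y.r j.1 * (j.2 : ℕ) = ∑ j : Y.J, Y.r j.1 * x j := by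
  rw [s, ← det_transpose, det_apply, sum_apply] at h
  obtain ⟨w, _, h⟩ := exists_ne_zero_of_sum_ne_zero h
  rw [Units.smul_def, zsmul_apply] at h
  replace h := right_ne_zero_of_mul h
  simp only [transpose_apply] at h
  have h0 : ∀ i, Y.sM x i (w i) ≠ 0 := by
    intro i hi
    rw [prod_eq_zero (mem_univ i) hi] at h
    exact h rfl
  have h1 : ∀ i, i.1 = (w i).1 ∧ ((w i).2 : ℕ) ≤ x i := by
    intro i
    have := h0 i
    simp only [sM, of_apply, hs] at this
    constructor
    · by_contra h3; simp [h3] at this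
    · by_contra h3; simp [h3] at this
  have h2 : ∀ i, Y.sM x i (w i) = S.e (Y.X i.1 (x i - (w i).2)) := by
    intro i
    simp only [sM, of_apply, hs]
    rw [if_pos (h1 i).1, if_pos (h1 i).2]
  rw [prod_congr rfl fun i _ => h2 i] at h
  have h3 := hom_prod univ _ _ (fun i _ => hom_e (S := S) (Y.X i.1 (x i - (w i).2))) ω h
  rw [h3]
  have h4 : ∑ j : Y.J, Y.r j.1 * (j.2 : ℕ) = ∑ j : Y.J, Y.r j.1 * ((w j).2 : ℕ) := by
    rw [← Equiv.sum_comp w]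
    exact sum_congr rfl fun j _ => by
      have := congrArg Y.r (h1 j).1
      simp only [this]
  rw [h4, ← sum_add_distrib]
  refine sum_congr rfl fun j _ => ?_
  rw [Y.deg_X, mul_comm, ← mul_add, Nat.sub_add_cancel (h1 j).2]
lemma exists_prims {n : ℕ} (hP : ∀ σ, S.Prim σ → S.deg σ ≤ n → ∃ ρ, Y.X ρ 1 = σ) :
    ∀ d ω, S.deg ω = d → d ≤ n → ∃ μ : P → ℕ, (∏ ρ, S.e (Y.X ρ 1) ^ (μ ρ)) ω ≠ 0 := by
  intro d
  induction d using Nat.strong_induction_on with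
  | _ d ih =>
    intro ω hω hd
    by_cases h0 : d = 0
    · refine ⟨0, ?_⟩
      rw [S.eq_one ω (by omega)]
      simp only [Pi.zero_apply, pow_zero, prod_const_one]
      rw [one_def, e_apply]; simp
    by_cases hp : S.Prim ω
    · obtain ⟨ρ, rfl⟩ := hP ω hp (by omega)
      refine ⟨Pi.single ρ 1, ?_⟩
      rw [Finset.prod_eq_single ρ]
      · simp [e_apply]
      · intro ρ' _ h; simp [h]
      · simp
    · have : ∃ σ τ, S.c σ τ ω ≠ 0 ∧ σ ≠ S.one ∧ τ ≠ S.one := by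
        by_contra h
        push Not at h
        refine hp ⟨by omega, fun σ τ h1 => ?_⟩
        by_contra h2
        push Not at h2
        exact h2.2 (h σ τ h1 h2.1)
      obtain ⟨σ, τ, h1, h2, h3⟩ := this
      have e1 := S.c_deg h1
      have e2 : S.deg σ ≠ 0 := fun h => h2 (S.eq_one _ h)
      have e3 : S.deg τ ≠ 0 := fun h => h3 (S.eq_one _ h)
      obtain ⟨μ, hμ⟩ := ih (S.deg σ) (by omega) σ rfl (by omega)
      obtain ⟨μ', hμ'⟩ := ih (S.deg τ) (by omega) τ rfl (by omega)
      refine ⟨μ + μ', ?_⟩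
      simp only [Pi.add_apply, pow_add, prod_mul_distrib]
      exact (pos_prod _ _ fun i _ => (S.pos_e _).pow _).mul_ne (pos_prod _ _ fun i _ => (S.pos_e _).pow _) hμ hμ' h1
def Hp (ν : Y.J → ℕ) : S.R := ∏ j, S.e (Y.X j.1 (ν j))
lemma Hp_deg {ν : Y.J → ℕ} {ω : Ω} (h : Y.Hp ν ω ≠ 0) : S.deg ω = ∑ j, ν j * Y.r j.1 := by
  have h3 := hom_prod univ _ _ (fun j _ => hom_e (S := S) (Y.X j.1 (ν j))) ω h
  rw [h3]
  exact sum_congr rfl fun j _ => Y.deg_X _ _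
def Φ (ω : Ω) : MvPolynomial Y.J ℤ :=
  ∑ ν ∈ piFinset (fun _ : Y.J => range (S.deg ω + 1)),
    MvPolynomial.monomial (Finsupp.equivFunOnFinite.symm ν) (Y.Hp ν ω)
lemma Φ_coeff (ω : Ω) (ν : Y.J →₀ ℕ) : (Y.Φ ω).coeff ν = Y.Hp ν ω := by
  rw [Φ, MvPolynomial.coeff_sum]
  simp only [MvPolynomial.coeff_monomial]
  have : ∀ x : Y.J → ℕ, (Finsupp.equivFunOnFinite.symm x = ν) ↔ x = ν := by
    intro x; rw [Equiv.symm_apply_eq]; rfl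
  simp only [this]
  rw [sum_ite_eq']
  split_ifs with h
  · rfl
  · by_contra h2
    apply h
    rw [Fintype.mem_piFinset]
    intro j
    rw [mem_range]
    have h3 := Y.Hp_deg (ne_comm.1 h2)
    have h4 : ν j * Y.r j.1 ≤ ∑ j, ν j * Y.r j.1 := single_le_sum (f := fun j => ν j * Y.r j.1) (fun _ _ => Nat.zero_le _) (mem_univ j)
    have h5 := Nat.le_mul_of_pos_right (ν j) (Y.r_pos j.1)
    omega
lemma L_coord (x : Y.J → ℕ) (p : MvPolynomial Y.J ℤ) (ω : Ω) :
    (Y.L x p) ω = (Y.Φ ω * p).coeff (Finsupp.equivFunOnFinite.symm x) := by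
  induction p using MvPolynomial.induction_on' with
  | monomial ν a =>
    rw [L_monomial, zsmul_apply, MvPolynomial.coeff_mul_monomial', Φ_coeff]
    have h1 : ν ≤ Finsupp.equivFunOnFinite.symm x ↔ ∀ j, ν j ≤ x j := Iff.rfl
    rw [mul_comm]
    by_cases h : ∀ j, ν j ≤ x j
    · rw [if_pos (h1.2 h)]
      congr 1
      rw [Hs, Hp]
      congr 1
      refine prod_congr rfl fun j _ => ?_
      rw [hs, if_pos (h j)]; rfl
    · rw [if_neg (fun h2 => h (h1.1 h2))]
      push Not at h
      obtain ⟨j, hj⟩ := h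
      rw [Hs, prod_eq_zero (mem_univ j), zero_apply, zero_mul]
      rw [hs, if_neg (by omega)]
  | add p q h1 h2 => rw [map_add, add_apply, h1, h2, mul_add, MvPolynomial.coeff_add]
lemma A_δ_ne : Y.A Y.δ ≠ 0 := by
  intro h
  let Z : ∀ ρ, {s : Finset ℕ // s.card = Y.K ρ} := fun ρ => ⟨range (Y.K ρ), card_range _⟩
  have h1 := Y.B_srt Z Z
  rw [B_s_s, A_eq, h] at h1
  simp at h1
lemma s_sort (x : Y.J → ℕ) : Y.s x = 0 ∨ ∃ Z, Y.s x = Y.s (Y.srt Z) ∨ Y.s x = - Y.s (Y.srt Z) := by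
  by_cases hinj : ∀ ρ, Function.Injective fun i => x ⟨ρ, i⟩
  · right
    let Z : ∀ ρ, {s : Finset ℕ // s.card = Y.K ρ} := fun ρ =>
      ⟨univ.image fun i => x ⟨ρ, i⟩, by rw [Finset.card_image_of_injective _ (hinj ρ), Finset.card_fin]⟩
    let σ : ∀ ρ, Equiv.Perm (Fin (Y.K ρ)) := fun ρ => Tuple.sort fun i => x ⟨ρ, i⟩
    let e : Equiv.Perm Y.J := Equiv.sigmaCongrRight σ
    have h1 : Y.srt Z = fun j => x (e j) := by
      funext ⟨ρ, i⟩
      have hm : StrictMono fun i => x ⟨ρ, σ ρ i⟩ :=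
        (Tuple.monotone_sort fun i => x ⟨ρ, i⟩).strictMono_of_injective ((hinj ρ).comp (σ ρ).injective)
      have := Finset.orderEmbOfFin_unique (Z ρ).2 (f := fun i => x ⟨ρ, σ ρ i⟩) (by intro i; simp [Z]) hm
      exact (congrFun this i).symm
    have h2 : Y.s (Y.srt Z) = Equiv.Perm.sign e * Y.s x := by
      rw [s, s, ← Matrix.det_permute]
      congr 1
      ext1 i j
      simp only [h1, sM, of_apply, submatrix_apply, id]
      rfl
    refine ⟨Z, ?_⟩
    rcases Int.units_eq_one_or (Equiv.Perm.sign e) with h | h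
    · left; rw [h2, h]; simp
    · right; rw [h2, h]; simp
  · left
    push Not at hinj
    obtain ⟨ρ, h⟩ := hinj
    rw [Function.not_injective_iff] at h
    obtain ⟨i, i', h1, h2⟩ := h
    refine Matrix.det_zero_of_row_eq (i := ⟨ρ, i⟩) (j := ⟨ρ, i'⟩) ?_ ?_
    · intro h; apply h2; simpa using h
    · funext j
      simp only [sM, of_apply] at h1 ⊢
      rw [h1]
lemma exists_srt {n : ℕ} (hP : ∀ σ, S.Prim σ → S.deg σ ≤ n → ∃ ρ, Y.X ρ 1 = σ)
    (hK : ∀ ρ, n ≤ Y.K ρ * Y.r ρ) (ω : Ω) (hω : S.deg ω = n) : ∃ Z, Y.s (Y.srt Z) ω ≠ 0 := by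
  by_contra hn
  push Not at hn
  have h1 : ∀ x, Y.s x ω = 0 := by
    intro x
    rcases Y.s_sort x with h | ⟨Z, h | h⟩
    · rw [h]; rfl
    · rw [h, hn]
    · rw [h]; exact neg_eq_zero.2 (hn Z)
  have h2 : Y.Φ ω * Y.A Y.δ = 0 := by
    ext ν
    have := h1 ν
    rw [s_eq, L_coord] at this
    rw [MvPolynomial.coeff_zero, ← this]
    congr 1
    ext j; rfl
  have h3 : Y.Φ ω = 0 := by
    rcases mul_eq_zero.1 h2 with h | h
    · exact h
    · exact absurd h Y.A_δ_ne
  obtain ⟨μ, hμ⟩ := Y.exists_prims hP n ω hω le_rfl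
  have hd : S.deg ω = ∑ ρ, μ ρ * Y.r ρ := by
    refine hom_prod univ (fun ρ => μ ρ * Y.r ρ) _ (fun ρ _ => ?_) ω hμ
    have : S.e (Y.X ρ 1) ^ μ ρ = ∏ i ∈ range (μ ρ), S.e (Y.X ρ 1) := by simp
    rw [this]
    have := hom_prod (range (μ ρ)) (fun _ => Y.r ρ) (fun _ => S.e (Y.X ρ 1)) (fun _ _ => by
      have := hom_e (S := S) (Y.X ρ 1); rwa [Y.deg_X, one_mul] at this)
    rwa [sum_const, card_range, smul_eq_mul] at this
  have hle : ∀ ρ, μ ρ ≤ Y.K ρ := by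
    intro ρ
    have h4 : μ ρ * Y.r ρ ≤ ∑ ρ, μ ρ * Y.r ρ := single_le_sum (f := fun ρ => μ ρ * Y.r ρ) (fun _ _ => Nat.zero_le _) (mem_univ ρ)
    exact Nat.le_of_mul_le_mul_right (by have := hK ρ; omega) (Y.r_pos ρ)
  let ν : Y.J → ℕ := fun j => if (j.2 : ℕ) < μ j.1 then 1 else 0
  have h5 : Y.Hp ν = ∏ ρ, S.e (Y.X ρ 1) ^ (μ ρ) := by
    rw [Hp, Fintype.prod_sigma]
    refine prod_congr rfl fun ρ _ => ?_
    have : ∀ i : Fin (Y.K ρ), S.e (Y.X ρ (ν ⟨ρ, i⟩)) = if (i : ℕ) < μ ρ then S.e (Y.X ρ 1) else 1 := by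
      intro i
      simp only [ν]
      split_ifs
      · rfl
      · rw [Y.X0]; rfl
    simp only [this]
    rw [Fin.prod_univ_eq_prod_range (fun i => if i < μ ρ then S.e (Y.X ρ 1) else 1), Finset.prod_ite, prod_const_one, mul_one,
      prod_const]
    congr 1
    have : (range (Y.K ρ)).filter (fun x => x < μ ρ) = range (μ ρ) := by
      ext a; simp only [mem_filter, mem_range]; have := hle ρ; omega
    rw [this, card_range]
  have h6 := Y.Φ_coeff ω (Finsupp.equivFunOnFinite.symm ν)
  rw [h3, MvPolynomial.coeff_zero] at h6
  apply hμ
  rw [← h5]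
  exact h6.symm
def Lab (n : ℕ) : Type := {Z : ∀ ρ, {s : Finset ℕ // s.card = Y.K ρ} //
  ∑ ρ, Y.r ρ * ∑ a ∈ (Z ρ).1, a = n + ∑ ρ, Y.r ρ * ∑ a ∈ range (Y.K ρ), a}
lemma sum_srt (Z : ∀ ρ, {s : Finset ℕ // s.card = Y.K ρ}) :
    ∑ j : Y.J, Y.r j.1 * Y.srt Z j = ∑ ρ, Y.r ρ * ∑ a ∈ (Z ρ).1, a := by
  rw [sum_sigma]
  refine sum_congr rfl fun ρ _ => ?_
  change ∑ y, Y.r ρ * Y.srt Z ⟨ρ, y⟩ = _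
  rw [← mul_sum]
  congr 1
  have : (Z ρ).1 = univ.image ((Z ρ).1.orderEmbOfFin (Z ρ).2) := by
    ext a
    rw [← mem_coe, ← Finset.range_orderEmbOfFin _ (Z ρ).2]; simp
  conv_rhs => rw [this]
  rw [sum_image (fun a _ b _ h => ((Z ρ).1.orderEmbOfFin (Z ρ).2).injective h)]
  rfl
theorem classify {n : ℕ} (hP : ∀ σ, S.Prim σ → S.deg σ ≤ n → ∃ ρ, Y.X ρ 1 = σ)
    (hK : ∀ ρ, n ≤ Y.K ρ * Y.r ρ) : ∃ f : Y.Lab n ≃ {ω // S.deg ω = n},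
      ∀ Z, S.e (f Z).1 = Y.s (Y.srt Z.1) ∨ S.e (f Z).1 = - Y.s (Y.srt Z.1) := by
  have h0 : ∀ Z, ∃ ω, Y.s (Y.srt Z) = S.e ω ∨ Y.s (Y.srt Z) = - S.e ω := fun Z =>
    norm_one (by rw [B_srt, if_pos rfl])
  choose g hg using h0
  have hg1 : ∀ Z, Y.s (Y.srt Z) (g Z) ≠ 0 := by
    intro Z
    rcases hg Z with h | h
    · rw [h, e_apply]; simp
    · rw [h]; change - (S.e (g Z) (g Z)) ≠ 0; rw [e_apply]; simp
  have hg2 : ∀ Z ω, Y.s (Y.srt Z) ω ≠ 0 → ω = g Z := by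
    intro Z ω hω
    by_contra hne
    apply hω
    rcases hg Z with h | h
    · rw [h, e_apply, if_neg (Ne.symm hne)]
    · rw [h]; change - (S.e (g Z) ω) = 0; rw [e_apply, if_neg (Ne.symm hne), neg_zero]
  have hd : ∀ Z, S.deg (g Z) + ∑ ρ, Y.r ρ * ∑ a ∈ range (Y.K ρ), a = ∑ ρ, Y.r ρ * ∑ a ∈ (Z ρ).1, a := by
    intro Z
    have := Y.s_deg (hg1 Z)
    rw [sum_srt, sum_sigma] at this
    rw [← this]
    congr 1
    refine sum_congr rfl fun ρ _ => ?_
    change _ = ∑ y : Fin (Y.K ρ), Y.r ρ * (y : ℕ)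
    rw [← mul_sum, Fin.sum_univ_eq_sum_range (fun i => i)]
  have hginj : Function.Injective g := by
    intro Z Z' h
    by_contra hne
    have h1 := Y.B_srt Z Z'
    rw [if_neg hne] at h1
    rcases hg Z with h2 | h2 <;> rcases hg Z' with h3 | h3 <;> rw [h2, h3, h] at h1 <;>
      simp only [map_neg, LinearMap.neg_apply, B_e_left, e_apply, if_true] at h1 <;> omega
  have hbij : Function.Bijective (fun Z : Y.Lab n => (⟨g Z.1, by have := hd Z.1; have := Z.2; omega⟩ : {ω // S.deg ω = n})) := by
    constructor
    · intro Z Z' h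
      exact Subtype.ext (hginj (congrArg Subtype.val h))
    · rintro ⟨ω, hω⟩
      obtain ⟨Z, hZ⟩ := Y.exists_srt hP hK ω hω
      have := hg2 Z ω hZ
      subst this
      exact ⟨⟨Z, by have := hd Z; omega⟩, rfl⟩
  refine ⟨Equiv.ofBijective _ hbij, fun Z => ?_⟩
  rw [Equiv.ofBijective_apply]
  rcases hg Z.1 with h | h
  · left; exact h.symm
  · right; rw [h, neg_neg]
def sB (ρ : P) (z : Fin (Y.K ρ) → ℕ) : S.R := (of fun i j : Fin (Y.K ρ) => Y.hs ρ (z i) j).det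
lemma s_blocks (x : Y.J → ℕ) : Y.s x = ∏ ρ, Y.sB ρ (fun i => x ⟨ρ, i⟩) := by
  have : Y.sM x = Matrix.blockDiagonal' (fun ρ => of fun i j : Fin (Y.K ρ) => Y.hs ρ (x ⟨ρ, i⟩) j) := by
    ext1 ⟨ρ, i⟩ ⟨ρ', j⟩
    rw [Matrix.blockDiagonal'_apply]
    simp only [sM, of_apply]
    by_cases h : ρ = ρ'
    · subst h; simp
    · rw [if_neg h, dif_neg h]
  rw [s, this]
  have hb : (Matrix.blockDiagonal' (fun ρ => of fun i j : Fin (Y.K ρ) => Y.hs ρ (x ⟨ρ, i⟩) j)).BlockTriangular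
      (fun j : Y.J => equivFin P j.1) := by
    intro i j hij
    rw [Matrix.blockDiagonal'_apply, dif_neg]
    intro h
    simp only [h] at hij
    exact lt_irrefl _ hij
  rw [hb.det_fintype, ← Equiv.prod_comp (equivFin P)]
  refine prod_congr rfl fun ρ _ => ?_
  let e : Fin (Y.K ρ) ≃ {j : Y.J // equivFin P j.1 = equivFin P ρ} :=
    { toFun := fun i => ⟨⟨ρ, i⟩, rfl⟩
      invFun := fun j => ((equivFin P).injective j.2) ▸ j.1.2
      left_inv := fun i => rfl
      right_inv := by
        rintro ⟨⟨ρ', i⟩, h⟩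
        obtain rfl := (equivFin P).injective h
        rfl }
  rw [sB, ← Matrix.det_submatrix_equiv_self e]
  congr 1
  ext1 i j
  simp [Matrix.toSquareBlock_def, e]
def Sp (ρ : P) : Subring S.R where
  carrier := {a | ∀ ω, a ω ≠ 0 → ∃ k, (S.e (Y.X ρ 1) ^ k) ω ≠ 0}
  mul_mem' := by
    intro a b ha hb ω h
    obtain ⟨σ, τ, h1, h2, h3⟩ := mul_ne_zero_iff h
    obtain ⟨k, hk⟩ := ha σ h1
    obtain ⟨l, hl⟩ := hb τ h2
    refine ⟨k + l, ?_⟩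
    rw [pow_add]
    exact ((S.pos_e _).pow _).mul_ne ((S.pos_e _).pow _) hk hl h3
  one_mem' := fun ω h => ⟨0, by rwa [pow_zero]⟩
  add_mem' := by
    intro a b ha hb ω h
    rw [add_apply] at h
    by_cases h1 : a ω = 0
    · exact hb ω (by rw [h1, zero_add] at h; exact h)
    · exact ha ω h1
  zero_mem' := fun ω h => absurd rfl h
  neg_mem' := by
    intro a ha ω h
    exact ha ω (fun h1 => h (by change -(a ω) = 0; rw [h1, neg_zero]))
lemma X_Sp (ρ : P) (n : ℕ) : S.e (Y.X ρ n) ∈ Y.Sp ρ := by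
  intro ω h
  rw [e_apply] at h
  have : Y.X ρ n = ω := by by_contra h2; simp [h2] at h
  subst this
  refine ⟨n, ?_⟩
  clear h
  induction n with
  | zero => rw [Y.X0, pow_zero, one_def, e_apply]; simp
  | succ n ih =>
    rw [pow_succ']
    refine (S.pos_e _).mul_ne ((S.pos_e _).pow _) (σ := Y.X ρ 1) (τ := Y.X ρ n) (by simp [e_apply]) ih ?_
    rw [Y.c_X, if_pos ⟨1, by omega, rfl, by congr 1⟩]; omega
lemma sB_Sp (ρ : P) (z : Fin (Y.K ρ) → ℕ) : Y.sB ρ z ∈ Y.Sp ρ := by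
  rw [sB, det_apply]
  refine Subring.sum_mem _ fun w _ => ?_
  rw [Units.smul_def]
  refine Subring.zsmul_mem _ (Subring.prod_mem _ fun i _ => ?_) _
  simp only [of_apply, hs]
  split_ifs
  · exact Y.X_Sp _ _
  · exact Subring.zero_mem _
lemma sB_deg (ρ : P) {z : Fin (Y.K ρ) → ℕ} {ω : Ω} (h : Y.sB ρ z ω ≠ 0) :
    S.deg ω + Y.r ρ * ∑ a ∈ range (Y.K ρ), a = Y.r ρ * ∑ i, z i := by
  rw [sB, ← det_transpose, det_apply, sum_apply] at h
  obtain ⟨w, _, h⟩ := exists_ne_zero_of_sum_ne_zero h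
  rw [Units.smul_def, zsmul_apply] at h
  replace h := right_ne_zero_of_mul h
  simp only [transpose_apply, of_apply] at h
  have h1 : ∀ i, ((w i : Fin _) : ℕ) ≤ z i := by
    intro i
    by_contra h3
    apply h
    rw [prod_eq_zero (mem_univ i)]; · rfl
    rw [hs, if_neg h3]
  have h2 : ∀ i, Y.hs ρ (z i) (w i) = S.e (Y.X ρ (z i - w i)) := fun i => if_pos (h1 i)
  rw [prod_congr rfl fun i _ => h2 i] at h
  have h3 := hom_prod univ _ _ (fun i _ => hom_e (S := S) (Y.X ρ (z i - w i))) ω h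
  rw [h3, ← Fin.sum_univ_eq_sum_range (fun i => i), ← Equiv.sum_comp w (fun i : Fin _ => (i : ℕ)), mul_sum, mul_sum,
    ← sum_add_distrib]
  refine sum_congr rfl fun j _ => ?_
  rw [Y.deg_X, mul_comm, ← mul_add, Nat.sub_add_cancel (h1 j)]
end Sys
end PSH
set_option linter.unusedSectionVars false
namespace Chr
section
variable {A B G : Type} [Group A] [Fintype A] [Group B] [Fintype B] [Group G] [Fintype G]
lemma card_fib (φ : A →* B) (hφ : Function.Surjective φ) (g : B) :
    (univ.filter (fun u => φ u = g)).card = Nat.card φ.ker := by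
  obtain ⟨x, hx⟩ := hφ g
  rw [card_eq_fintype_card, ← card_subtype]
  refine Fintype.card_congr ⟨fun u => ⟨x⁻¹ * u.1, by simp [MonoidHom.mem_ker, hx, u.2]⟩,
    fun u => ⟨x * u.1, by rw [map_mul, hx, MonoidHom.mem_ker.1 u.2, mul_one]⟩, fun u => by simp, fun u => by simp⟩
lemma card_ker (φ : A →* B) (hφ : Function.Surjective φ) :
    Nat.card A = Nat.card B * Nat.card φ.ker := by
  have : card A = ∑ g : B, (univ.filter (fun u => φ u = g)).card := by
    rw [← card_univ]
    exact Finset.card_eq_sum_card_fiberwise (fun _ _ => mem_coe.2 (mem_univ _))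
  rw [card_eq_fintype_card, this, sum_congr rfl (fun g _ => card_fib φ hφ g)]
  simp [card_eq_fintype_card]
def fav (φ : A →* B) (h : A → ℂ) (g : B) : ℂ :=
  (Nat.card φ.ker : ℂ)⁻¹ * ∑ u with φ u = g, h u
lemma ker_ne (φ : A →* B) : (Nat.card φ.ker : ℂ) ≠ 0 := by
  rw [cast_ne_zero]; exact Nat.card_pos.ne'
lemma grp_ne (G : Type) [Group G] [Fintype G] : (Nat.card G : ℂ) ≠ 0 := by
  rw [cast_ne_zero]; exact Nat.card_pos.ne'
lemma fav_class (φ : A →* B) (hφ : Function.Surjective φ) {h : A → ℂ} (hh : IsClass h) : IsClass (fav φ h) := by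
  intro g x
  obtain ⟨y, rfl⟩ := hφ x
  unfold fav
  congr 1
  refine sum_bij' (fun u _ => y⁻¹ * u * y) (fun u _ => y * u * y⁻¹) ?_ ?_ ?_ ?_ ?_
  · intro u hu
    simp only [mem_filter, mem_univ, true_and] at hu ⊢
    rw [map_mul, map_mul, hu, map_inv]; group
  · intro u hu
    simp only [mem_filter, mem_univ, true_and] at hu ⊢
    rw [map_mul, map_mul, hu, map_inv]
  · intro u _; group
  · intro u _; group
  · intro u _; exact (hh u y⁻¹ ▸ by simp)
lemma sum_fav (φ : A →* B) (F : B → ℂ) (h : A → ℂ) :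
    ∑ g, F g * fav φ h g = (Nat.card φ.ker : ℂ)⁻¹ * ∑ u, F (φ u) * h u := by
  rw [← sum_fiberwise (s := univ) (g := φ), mul_sum]
  refine sum_congr rfl fun g _ => ?_
  rw [fav, mul_left_comm, mul_sum]
  congr 1
  refine sum_congr rfl fun u hu => ?_
  rw [(mem_filter.1 hu).2]
lemma ip_fav (φ : A →* B) (hφ : Function.Surjective φ) (F : B → ℂ) (h : A → ℂ) :
    ip (fun u => F (φ u)) h = ip F (fav φ h) := by
  rw [ip_comm, ip_comm F]
  unfold ip
  have := sum_fav φ (fun g => F g⁻¹) h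
  simp only [mul_comm (fav φ h _)]
  rw [this, ← mul_assoc, card_ker φ hφ]
  push_cast
  rw [mul_inv]
  congr 1
  exact sum_congr rfl fun u _ => by rw [map_inv, mul_comm]
def ind (H : Subgroup G) (θ : H → ℂ) (g : G) : ℂ :=
  (Nat.card H : ℂ)⁻¹ * ∑ T : G, ∑ u : H, if T * u * T⁻¹ = g then θ u else 0
lemma ind_class (H : Subgroup G) (θ : H → ℂ) : IsClass (ind H θ) := by
  intro g x
  unfold ind
  congr 1
  rw [← Equiv.sum_comp (Equiv.mulLeft x)]
  refine sum_congr rfl fun T _ => sum_congr rfl fun u _ => ?_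
  have : x * T * (u : G) * (x * T)⁻¹ = x * g * x⁻¹ ↔ T * u * T⁻¹ = g := by
    constructor
    · intro h
      have := congrArg (fun z => x⁻¹ * z * x) h
      simpa [mul_assoc] using this
    · rintro rfl; group
  simp only [Equiv.coe_mulLeft, this]
lemma ip_ind (H : Subgroup G) (θ : H → ℂ) {π : G → ℂ} (hπ : IsClass π) :
    ip (ind H θ) π = ip θ (fun u => π u) := by
  have h1 : ∑ g, ind H θ g * π g⁻¹ = (Nat.card H : ℂ)⁻¹ * ∑ T : G, ∑ u : H, θ u * π (u : G)⁻¹ := by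
    unfold ind
    simp only [mul_assoc, ← mul_sum]
    congr 1
    simp only [sum_mul]
    rw [sum_comm]
    refine sum_congr rfl fun T _ => ?_
    rw [sum_comm]
    refine sum_congr rfl fun u _ => ?_
    simp only [ite_mul, zero_mul]
    rw [sum_ite_eq, if_pos (mem_univ _)]
    congr 1
    rw [← hπ (u : G)⁻¹ T]
    congr 1; group
  unfold ip
  rw [h1, sum_const, card_univ, nsmul_eq_mul, card_eq_fintype_card (α := G)]
  have := grp_ne G
  rw [card_eq_fintype_card] at this
  simp only [InvMemClass.coe_inv]
  field_simp
lemma ind_one (H : Subgroup G) (θ : H → ℂ) :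
    ind H θ 1 = (Nat.card G : ℂ) / Nat.card H * θ 1 := by
  unfold ind
  have : ∀ (T : G) (u : H), (T * u * T⁻¹ = 1) ↔ u = 1 := by
    intro T u
    constructor
    · intro h
      have := congrArg (fun z => T⁻¹ * z * T) h
      exact Subtype.ext (by simpa [mul_assoc] using this)
    · rintro rfl; simp
  simp only [this, sum_ite_eq', mem_univ, if_true, sum_const, card_univ, nsmul_eq_mul]
  rw [card_eq_fintype_card (α := G)]
  ring
lemma sum_dc {K : Type} [Fintype K] (A B : Subgroup G) (rep : K → G)
    (hrep : ∀ T, ∃! k, ∃ u ∈ A, ∃ v ∈ B, T = u * rep k * v) (F : G → ℂ)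
    (hF : ∀ u ∈ A, ∀ v ∈ B, ∀ T, F (u * T * v) = F T) :
    (Nat.card A : ℂ)⁻¹ * (Nat.card B : ℂ)⁻¹ * ∑ T, F T =
      ∑ k, (Nat.card {p : A × B // (p.1 : G) * rep k * p.2 = rep k} : ℂ)⁻¹ * F (rep k) := by
  choose κ hκ hκu using hrep
  rw [← sum_fiberwise (s := univ) (g := κ), mul_sum]
  refine sum_congr rfl fun k _ => ?_
  have h1 : ∀ T ∈ univ.filter (fun T => κ T = k), F T = F (rep k) := by
    intro T hT
    obtain ⟨u, hu, v, hv, h⟩ := hκ T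
    rw [(mem_filter.1 hT).2] at h
    rw [h, hF u hu v hv]
  rw [sum_congr rfl h1, sum_const, nsmul_eq_mul, ← mul_assoc]
  congr 1
  have h2 : card (A × B) = ∑ T ∈ univ.filter (fun T => κ T = k),
      (univ.filter (fun p : A × B => (p.1 : G) * rep k * p.2 = T)).card := by
    rw [← card_univ]
    apply Finset.card_eq_sum_card_fiberwise
    intro p _
    refine mem_coe.2 (mem_filter.2 ⟨mem_univ _, ?_⟩)
    exact (hκu _ k ⟨p.1, p.1.2, p.2, p.2.2, rfl⟩).symm
  have h3 : ∀ T ∈ univ.filter (fun T => κ T = k),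
      (univ.filter (fun p : A × B => (p.1 : G) * rep k * p.2 = T)).card =
      Nat.card {p : A × B // (p.1 : G) * rep k * p.2 = rep k} := by
    intro T hT
    obtain ⟨u, hu, v, hv, h⟩ := hκ T
    rw [(mem_filter.1 hT).2] at h
    rw [card_eq_fintype_card, ← card_subtype]
    refine Fintype.card_congr ⟨fun p => ⟨(⟨u, hu⟩⁻¹ * p.1.1, p.1.2 * ⟨v, hv⟩⁻¹), ?_⟩,
      fun p => ⟨(⟨u, hu⟩ * p.1.1, p.1.2 * ⟨v, hv⟩), ?_⟩, fun p => by simp, fun p => by simp⟩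
    · have := congrArg (fun z => u⁻¹ * z * v⁻¹) (p.2.trans h)
      simpa [mul_assoc] using this
    · have := congrArg (fun z => u * z * v) p.2
      rw [h]
      simpa [mul_assoc] using this
  rw [sum_congr rfl h3, sum_const, smul_eq_mul, Fintype.card_prod] at h2
  have h4 : ((Nat.card A : ℂ) * Nat.card B) = (univ.filter (fun T => κ T = k)).card *
      Nat.card {p : A × B // (p.1 : G) * rep k * p.2 = rep k} := by
    rw [card_eq_fintype_card (α := A), card_eq_fintype_card (α := B)]; exact_mod_cast h2
  have h5 := grp_ne A
  have h6 := grp_ne B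
  have h7 : (Nat.card {p : A × B // (p.1 : G) * rep k * p.2 = rep k} : ℂ) ≠ 0 := by
    intro h; rw [h, mul_zero] at h4; exact mul_ne_zero h5 h6 h4
  rw [← mul_inv, h4, mul_inv, mul_comm, ← mul_assoc, mul_inv_cancel₀, one_mul]
  intro h; rw [h, zero_mul] at h4; exact mul_ne_zero h5 h6 h4
lemma expand2 (F : A → B → ℂ) (h1 : ∀ y, IsClass (fun x => F x y)) (h2 : ∀ x, IsClass (F x)) (x : A) (y : B) :
    F x y = ∑ χ : Irr A, ∑ η : Irr B,
      ((Nat.card A : ℂ)⁻¹ * ((Nat.card B : ℂ)⁻¹ * ∑ g, ∑ h, F g h * (χ.1 g⁻¹ * η.1 h⁻¹))) * (χ.1 x * η.1 y) := by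
  have e1 : ∀ χ : Irr A, ip (fun x => F x y) χ.1 = ∑ η : Irr B,
      ((Nat.card A : ℂ)⁻¹ * ((Nat.card B : ℂ)⁻¹ * ∑ g, ∑ h, F g h * (χ.1 g⁻¹ * η.1 h⁻¹))) * η.1 y := by
    intro χ
    have : ∀ g, F g y = ∑ η : Irr B, ip (F g) η.1 * η.1 y := fun g => class_expand (h2 g) y
    rw [ip]
    simp only [this, ip, sum_mul, mul_sum]
    rw [sum_comm]
    refine sum_congr rfl fun η _ => sum_congr rfl fun g _ => sum_congr rfl fun h _ => ?_
    ring
  rw [class_expand (h1 y) x]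
  refine sum_congr rfl fun χ _ => ?_
  rw [e1, sum_mul]
  exact sum_congr rfl fun η _ => by ring
end
end Chr
open Chr
def Cov {n a : ℕ} (c : Fin n → Bool) (b : Bool) (e : Fin a ↪ Fin n) : Prop :=
  ∀ i, c i = b ↔ i ∈ Set.range e
structure Tower where
  G : ℕ → Type
  [grp : ∀ n, Group (G n)]
  [fin : ∀ n, Fintype (G n)]
  P : ∀ {n : ℕ}, (Fin n → Bool) → Subgroup (G n)
  res : ∀ {a n : ℕ}, (Fin a ↪ Fin n) → G n → G a
  w : ∀ {n : ℕ}, Equiv.Perm (Fin n) → G n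
  G0 : Subsingleton (G 0)
  P_const : ∀ {n : ℕ} {c : Fin n → Bool} {b : Bool}, (∀ i, c i = b) → ∀ x, x ∈ P c
  res_id : ∀ {n : ℕ} (x : G n), res (Function.Embedding.refl _) x = x
  res_mul : ∀ {a n : ℕ} {c : Fin n → Bool} {b : Bool} {e : Fin a ↪ Fin n}, Cov c b e →
    ∀ x ∈ P c, ∀ y ∈ P c, res e (x * y) = res e x * res e y
  res_mem : ∀ {a n : ℕ} {c d : Fin n → Bool} {b : Bool} {e : Fin a ↪ Fin n}, Cov c b e →
    ∀ x ∈ P c, x ∈ P d → res e x ∈ P (d ∘ e)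
  res_res : ∀ {a a' k n : ℕ} {c d : Fin n → Bool} {b b' : Bool} {e : Fin a ↪ Fin n} {e' : Fin a' ↪ Fin n}
    {f : Fin k ↪ Fin a} {f' : Fin k ↪ Fin a'}, Cov c b e → Cov (d ∘ e) b' f → Cov d b' e' → Cov (c ∘ e') b f' →
    (∀ i, e (f i) = e' (f' i)) → ∀ x ∈ P c, x ∈ P d → res f (res e x) = res f' (res e' x)
  surj2 : ∀ {n : ℕ} {a : Bool → ℕ} {c : Fin n → Bool} {e : ∀ b, Fin (a b) ↪ Fin n}, (∀ b, Cov c b (e b)) →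
    ∀ g : ∀ b, G (a b), ∃ x ∈ P c, ∀ b, res (e b) x = g b
  surj4 : ∀ {n : ℕ} {a a' : Bool → ℕ} {c d : Fin n → Bool} {e : ∀ b, Fin (a b) ↪ Fin n}
    {f : ∀ b, Fin (a' b) ↪ Fin n} {k : Bool → Bool → ℕ} {g : ∀ b b', Fin (k b b') ↪ Fin (a b)}
    {h : ∀ b' b, Fin (k b b') ↪ Fin (a' b')},
    (∀ b, Cov c b (e b)) → (∀ b, Cov d b (f b)) → (∀ b b', Cov (d ∘ e b) b' (g b b')) →
    (∀ b' b, Cov (c ∘ f b') b (h b' b)) → (∀ b b' i, e b (g b b' i) = f b' (h b' b i)) →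
    ∀ (u : ∀ b, G (a b)) (v : ∀ b', G (a' b')), (∀ b, u b ∈ P (d ∘ e b)) → (∀ b', v b' ∈ P (c ∘ f b')) →
    (∀ b b', res (g b b') (u b) = res (h b' b) (v b')) →
    ∃ x ∈ P c, x ∈ P d ∧ (∀ b, res (e b) x = u b) ∧ ∀ b', res (f b') x = v b'
  mem3 : ∀ {a n : ℕ} {c d : Fin n → Bool} {e : Fin a ↪ Fin n}, (∀ i, c i = true → d i = true) →
    Cov c false e → ∀ x ∈ P c, res e x ∈ P (d ∘ e) → x ∈ P d
  mem3' : ∀ {a n : ℕ} {c d : Fin n → Bool} {e : Fin a ↪ Fin n}, (∀ i, c i = true → d i = true) →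
    Cov d true e → ∀ x ∈ P d, res e x ∈ P (c ∘ e) → x ∈ P c
  w_mem : ∀ {n : ℕ} (c : Fin n → Bool) (p : Equiv.Perm (Fin n)) (x : G n),
    w p * x * (w p)⁻¹ ∈ P c ↔ x ∈ P (c ∘ p)
  res_w : ∀ {a n : ℕ} (e : Fin a ↪ Fin n) (p : Equiv.Perm (Fin n)) (x : G n),
    res (e.trans p.toEmbedding) (w p * x * (w p)⁻¹) = res e x
  w_mul : ∀ {n : ℕ} (p p' : Equiv.Perm (Fin n)), w (p * p') = w p * w p'
  w_color : ∀ {n : ℕ} {c : Fin n → Bool} {p : Equiv.Perm (Fin n)}, (∀ i, c (p i) = c i) → w p ∈ P c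
  dc : ∀ {n : ℕ} (c d : Fin n → Bool) (T : G n), ∃ p, ∃ u ∈ P c, ∃ v ∈ P d, T = u * w p * v
  dc' : ∀ {n : ℕ} (c d : Fin n → Bool) (p p' : Equiv.Perm (Fin n)) (u v : G n), u ∈ P c → v ∈ P d →
    u * w p * v = w p' → ∀ b b', (univ.filter (fun i => c (p i) = b ∧ d i = b')).card =
      (univ.filter (fun i => c (p' i) = b ∧ d i = b')).card
namespace Chr
def tens {X : Bool → Type} (σ : ∀ b, X b → ℂ) (g : ∀ b, X b) : ℂ := ∏ b, σ b (g b)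
def boolPi (X : Bool → Type) : (∀ b, X b) ≃ X false × X true where
  toFun g := (g false, g true)
  invFun p := fun b => match b with | false => p.1 | true => p.2
  left_inv g := by funext b; cases b <;> rfl
  right_inv p := rfl
lemma expand_pi {X : Bool → Type} [∀ b, Group (X b)] [∀ b, Fintype (X b)] {Φ : (∀ b, X b) → ℂ}
    (hΦ : IsClass Φ) (g : ∀ b, X b) :
    Φ g = ∑ χ : ∀ b, Irr (X b), ip Φ (tens fun b => (χ b).1) * tens (fun b => (χ b).1) g := by
  have h := expand2 (fun x y => Φ ((boolPi X).symm (x, y)))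
    (fun y g x => by
      have := hΦ ((boolPi X).symm (g, y)) ((boolPi X).symm (x, 1))
      beta_reduce
      rw [← this]; congr 1
      funext b; cases b <;> simp [boolPi])
    (fun y g x => by
      have := hΦ ((boolPi X).symm (y, g)) ((boolPi X).symm (1, x))
      beta_reduce
      rw [← this]; congr 1
      funext b; cases b <;> simp [boolPi]) (g false) (g true)
  have e1 : (boolPi X).symm (g false, g true) = g := (boolPi X).symm_apply_apply g
  rw [e1] at h
  rw [h, ← Equiv.sum_comp (boolPi (fun b => Irr (X b))).symm, sum_prod_type]
  refine sum_congr rfl fun χ _ => sum_congr rfl fun η _ => ?_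
  congr 1
  · rw [ip, ← Equiv.sum_comp (boolPi X).symm, sum_prod_type, card_congr (boolPi X), Nat.card_prod]
    push_cast
    rw [mul_inv, mul_assoc]
    simp only [tens, prod_bool, boolPi, Equiv.coe_fn_symm_mk, Pi.inv_apply]
    congr 2
    refine sum_congr rfl fun x _ => sum_congr rfl fun y _ => ?_
    ring
  · simp only [tens, prod_bool, boolPi, Equiv.coe_fn_symm_mk]
    ring
end Chr
namespace Tower
variable (𝒯 : Tower)
instance (n : ℕ) : Group (𝒯.G n) := 𝒯.grp n
instance (n : ℕ) : Fintype (𝒯.G n) := 𝒯.fin n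
structure Dat (n : ℕ) (a : Bool → ℕ) where
  c : Fin n → Bool
  e : ∀ b, Fin (a b) ↪ Fin n
  cov : ∀ b, Cov c b (e b)
namespace Dat
variable {𝒯} {n : ℕ} {a : Bool → ℕ}
lemma card (D : Dat n a) : n = a false + a true := by
  have h : ∀ b, (univ.filter (fun i => D.c i = b)).card = a b := by
    intro b
    have : univ.filter (fun i => D.c i = b) = univ.map (D.e b) := by
      ext i; simp [D.cov b i]
    rw [this]; simp
  have := card_filter_add_card_filter_not (s := (univ : Finset (Fin n))) (fun i => D.c i = false)
  simp only [Bool.not_eq_false, card_univ, card_fin] at this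
  rw [h, h] at this
  exact this.symm
lemma of_color (c : Fin n → Bool) (ha : ∀ b, (univ.filter (fun i => c i = b)).card = a b) :
    ∃ D : Dat n a, D.c = c := by
  have : ∀ b, ∃ e : Fin (a b) ↪ Fin n, Cov c b e := by
    intro b
    refine ⟨((univ.filter (fun i => c i = b)).orderEmbOfFin (ha b)).toEmbedding, fun i => ?_⟩
    have := Finset.range_orderEmbOfFin (univ.filter (fun i => c i = b)) (ha b)
    change _ ↔ i ∈ Set.range ((univ.filter (fun i => c i = b)).orderEmbOfFin (ha b))
    rw [this]; simp
  choose e he using this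
  exact ⟨⟨c, e, he⟩, rfl⟩
lemma exists_dat (h : n = a false + a true) : Nonempty (Dat n a) := by
  subst h
  refine (of_color (fun i => decide (a false ≤ i.1)) ?_).elim fun D _ => ⟨D⟩
  intro b
  have h1 : (univ.filter (fun i : Fin (a false + a true) => decide (a false ≤ i.1) = false)).card = a false := by
    have : univ.filter (fun i : Fin (a false + a true) => decide (a false ≤ i.1) = false) =
      univ.map (Fin.castAddEmb (a true)) := by
      ext i
      simp only [mem_filter, mem_univ, true_and, decide_eq_false_iff_not, not_le, mem_map]
      constructor
      · intro h; exact ⟨⟨i, h⟩, rfl⟩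
      · rintro ⟨j, rfl⟩; simp
    rw [this]; simp
  cases b
  · exact h1
  · have := card_filter_add_card_filter_not (s := (univ : Finset (Fin (a false + a true)))) (fun i => decide (a false ≤ i.1) = false)
    simp only [Bool.not_eq_false, card_univ, card_fin] at this
    rw [h1] at this
    omega
lemma exists_perm (D D' : Dat n a) : ∃ p : Equiv.Perm (Fin n), (∀ b i, p (D.e b i) = D'.e b i) ∧
    ∀ i, D'.c (p i) = D.c i := by
  have hx : ∀ i, ∃ j, D.e (D.c i) j = i := fun i => (D.cov _ i).1 rfl
  choose x hx using hx
  have h0 : ∀ b i, D.c (D.e b i) = b := fun b i => (D.cov b _).2 ⟨i, rfl⟩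
  have h0' : ∀ b i, D'.c (D'.e b i) = b := fun b i => (D'.cov b _).2 ⟨i, rfl⟩
  have key : ∀ b i, D'.e (D.c (D.e b i)) (x (D.e b i)) = D'.e b i := by
    intro b i
    have : ∀ b' (h : D.c (D.e b i) = b'), (D.e b' (h ▸ x (D.e b i)) = D.e b i) ∧
        D'.e (D.c (D.e b i)) (x (D.e b i)) = D'.e b' (h ▸ x (D.e b i)) := by
      rintro _ rfl
      exact ⟨hx _, rfl⟩
    obtain ⟨h1, h2⟩ := this b (h0 b i)
    rw [h2, (D.e b).injective h1]
  have inj : Function.Injective (fun i => D'.e (D.c i) (x i)) := by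
    intro i j hij
    have hb : ∀ i, ∃ b j, D.e b j = i := fun i => ⟨_, _, hx i⟩
    obtain ⟨b, i', rfl⟩ := hb i
    obtain ⟨b', j', rfl⟩ := hb j
    simp only [key] at hij
    have h1 := congrArg D'.c hij
    rw [h0', h0'] at h1
    subst h1
    rw [(D'.e _).injective hij]
  refine ⟨Equiv.ofBijective _ (Finite.injective_iff_bijective.1 inj), ?_, ?_⟩
  · intro b i
    exact key b i
  · intro i
    exact h0' _ _
def resH (D : Dat n a) : 𝒯.P D.c →* ∀ b, 𝒯.G (a b) where
  toFun u b := 𝒯.res (D.e b) u.1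
  map_one' := by
    funext b
    have := 𝒯.res_mul (D.cov b) 1 (one_mem _) 1 (one_mem _)
    rw [mul_one] at this
    exact left_eq_mul.1 this
  map_mul' u v := by
    funext b
    exact 𝒯.res_mul (D.cov b) u.1 u.2 v.1 v.2
lemma resH_surj (D : Dat n a) : Function.Surjective (D.resH (𝒯 := 𝒯)) := by
  intro g
  obtain ⟨x, hx, h⟩ := 𝒯.surj2 D.cov g
  exact ⟨⟨x, hx⟩, funext h⟩
def r (D : Dat n a) (π : 𝒯.G n → ℂ) : (∀ b, 𝒯.G (a b)) → ℂ := fav D.resH (fun u => π u.1)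
def m (D : Dat n a) (F : (∀ b, 𝒯.G (a b)) → ℂ) : 𝒯.G n → ℂ := ind (𝒯.P D.c) (fun u => F (D.resH u))
def cf (D : Dat n a) (F : (∀ b, 𝒯.G (a b)) → ℂ) (π : 𝒯.G n → ℂ) : ℂ :=
  ip (G := 𝒯.P D.c) (fun u => F (D.resH u)) (fun u => π u.1)
lemma cf_eq_r (D : Dat n a) (F : (∀ b, 𝒯.G (a b)) → ℂ) (π : 𝒯.G n → ℂ) : D.cf F π = ip F (D.r π) :=
  ip_fav _ D.resH_surj F _
lemma cf_eq_m (D : Dat n a) (F : (∀ b, 𝒯.G (a b)) → ℂ) {π : 𝒯.G n → ℂ} (hπ : IsClass π) : D.cf F π = ip (D.m F) π :=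
  (ip_ind _ _ hπ).symm
lemma r_class (D : Dat n a) {π : 𝒯.G n → ℂ} (hπ : IsClass π) : IsClass (D.r π) :=
  fav_class _ D.resH_surj (fun g x => hπ g.1 x.1)
lemma m_class (D : Dat n a) (F : (∀ b, 𝒯.G (a b)) → ℂ) : IsClass (D.m F) := ind_class _ _
lemma cf_nat (D : Dat n a) {σ : ∀ b, 𝒯.G (a b) → ℂ} (hσ : ∀ b, IsChar (σ b)) {π : 𝒯.G n → ℂ} (hπ : IsChar π) :
    ∃ k : ℕ, D.cf (tens σ) π = k := by
  refine IsChar.ip_nat (G := 𝒯.P D.c) ?_ (hπ.comp (𝒯.P D.c).subtype)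
  have h : ∀ b, IsChar (fun u : 𝒯.P D.c => σ b (D.resH u b)) := fun b =>
    (hσ b).comp ((Pi.evalMonoidHom _ b).comp D.resH)
  have := (h true).mul (h false)
  convert this using 2
  simp [tens]
lemma cf_indep (D D' : Dat n a) (F : (∀ b, 𝒯.G (a b)) → ℂ) {π : 𝒯.G n → ℂ} (hπ : IsClass π) :
    D.cf F π = D'.cf F π := by
  obtain ⟨p, hp, hc⟩ := exists_perm D D'
  have hcc : D'.c ∘ p = D.c := funext hc
  have hee : ∀ b, (D.e b).trans p.toEmbedding = D'.e b := fun b => by ext1 i; exact hp b i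
  let E : 𝒯.P D.c ≃ 𝒯.P D'.c :=
    { toFun := fun u => ⟨𝒯.w p * u.1 * (𝒯.w p)⁻¹, (𝒯.w_mem _ _ _).2 (by rw [hcc]; exact u.2)⟩
      invFun := fun u => ⟨(𝒯.w p)⁻¹ * u.1 * 𝒯.w p, by
        rw [← hcc, ← 𝒯.w_mem]; convert u.2 using 1; group⟩
      left_inv := fun u => by ext; simp [mul_assoc]
      right_inv := fun u => by ext; simp [mul_assoc] }
  unfold cf ip
  rw [card_congr E, ← Equiv.sum_comp E]
  congr 1
  refine sum_congr rfl fun u _ => ?_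
  beta_reduce
  congr 1
  · congr 1
    funext b
    change 𝒯.res (D.e b) u.1 = 𝒯.res (D'.e b) (𝒯.w p * u.1 * (𝒯.w p)⁻¹)
    rw [← hee, 𝒯.res_w]
  · rw [← hπ _ (𝒯.w p)]
    congr 1
    simp [E, mul_assoc]
lemma m_expand (D : Dat n a) (F : (∀ b, 𝒯.G (a b)) → ℂ) :
    D.m F = fun g => ∑ χ : Irr (𝒯.G n), D.cf F χ.1 * χ.1 g := by
  funext g
  rw [class_expand (D.m_class F) g]
  refine sum_congr rfl fun χ _ => ?_
  rw [cf_eq_m _ _ (Irr.isChar χ.2).isClass]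
lemma m_one (D : Dat n a) (F : (∀ b, 𝒯.G (a b)) → ℂ) :
    D.m F 1 = Nat.card (𝒯.G n) / Nat.card (𝒯.P D.c) * F 1 := by
  unfold m
  rw [ind_one, map_one]
end Dat
end Tower
namespace Chr
section
variable {A X G : Type} [Group A] [Fintype A] [Group X] [Fintype X] [Group G] [Fintype G]
lemma sum_hom (φ : A →* X) (hφ : Function.Surjective φ) (F : X → ℂ) :
    ∑ u, F (φ u) = (Nat.card φ.ker : ℂ) * ∑ g, F g := by
  rw [← sum_fiberwise (s := univ) (g := φ), mul_sum]
  refine sum_congr rfl fun g _ => ?_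
  rw [← card_fib φ hφ g, ← nsmul_eq_mul, ← sum_const]
  exact sum_congr rfl fun u hu => by rw [(mem_filter.1 hu).2]
lemma ind_eq (H : Subgroup G) (θ : H → ℂ) (g : G) : ind H θ g =
    (Nat.card H : ℂ)⁻¹ * ∑ T : G, if h : T⁻¹ * g * T ∈ H then θ ⟨_, h⟩ else 0 := by
  unfold ind
  congr 1
  refine sum_congr rfl fun T _ => ?_
  split_ifs with h
  · rw [sum_eq_single ⟨_, h⟩]
    · simp [mul_assoc]
    · intro u _ hu
      rw [if_neg]
      rintro rfl
      exact hu (Subtype.ext (by simp [mul_assoc]))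
    · simp
  · refine sum_eq_zero fun u _ => ?_
    rw [if_neg]
    rintro rfl
    exact h (by simp [mul_assoc])
lemma ind_infl (φ : A →* X) (hφ : Function.Surjective φ) (H : Subgroup X) (θ : H → ℂ) (a : A) :
    ind H θ (φ a) = ind (H.comap φ) (fun u => θ ⟨φ u.1, u.2⟩) a := by
  rw [ind_eq, ind_eq]
  have h1 := sum_hom φ hφ (fun T => if h : T⁻¹ * φ a * T ∈ H then θ ⟨_, h⟩ else 0)
  have h2 : ∀ S : A, (if h : (φ S)⁻¹ * φ a * φ S ∈ H then θ ⟨_, h⟩ else 0) =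
      if h : S⁻¹ * a * S ∈ H.comap φ then θ ⟨φ (S⁻¹ * a * S), h⟩ else 0 := by
    intro S
    have h3 : φ (S⁻¹ * a * S) = (φ S)⁻¹ * φ a * φ S := by simp
    have h4 : S⁻¹ * a * S ∈ H.comap φ ↔ (φ S)⁻¹ * φ a * φ S ∈ H := by rw [Subgroup.mem_comap, h3]
    by_cases h : (φ S)⁻¹ * φ a * φ S ∈ H
    · rw [dif_pos h, dif_pos (h4.2 h)]
      congr 1
      exact Subtype.ext h3.symm
    · rw [dif_neg h, dif_neg (fun h' => h (h4.1 h'))]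
  simp only [h2] at h1
  rw [h1, ← mul_assoc]
  congr 1
  have h5 : Nat.card (H.comap φ) = Nat.card H * Nat.card φ.ker := by
    let ψ : H.comap φ →* H := (φ.comp (H.comap φ).subtype).codRestrict H (fun u => u.2)
    have hψ : Function.Surjective ψ := by
      rintro ⟨x, hx⟩
      obtain ⟨y, rfl⟩ := hφ x
      exact ⟨⟨y, hx⟩, rfl⟩
    rw [card_ker ψ hψ]
    congr 1
    refine card_congr ⟨fun u => ⟨u.1.1, ?_⟩, fun u => ⟨⟨u.1, ?_⟩, ?_⟩, fun u => rfl, fun u => rfl⟩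
    · have := MonoidHom.mem_ker.1 u.2
      exact MonoidHom.mem_ker.2 (congrArg Subtype.val this)
    · rw [Subgroup.mem_comap, MonoidHom.mem_ker.1 u.2]; exact one_mem _
    · rw [MonoidHom.mem_ker]; exact Subtype.ext (MonoidHom.mem_ker.1 u.2)
  have := ker_ne φ
  have := grp_ne H
  rw [h5]
  push_cast
  field_simp
lemma ip_ind_infl (φ : A →* X) (hφ : Function.Surjective φ) (H : Subgroup X) (θ : H → ℂ)
    {γ π : A → ℂ} (hγ : IsClass γ) (hπ : IsClass π) :
    ip (fun u => ind H θ (φ u) * γ u) π = ip (G := H.comap φ) (fun u => θ ⟨φ u.1, u.2⟩ * γ u.1) (fun u => π u.1) := by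
  have h := ip_ind (H.comap φ) (fun u => θ ⟨φ u.1, u.2⟩) (π := fun u => γ u⁻¹ * π u) (by
    intro g x
    have : (x * g * x⁻¹)⁻¹ = x * g⁻¹ * x⁻¹ := by group
    simp only [this, hπ g x]
    rw [hγ])
  unfold ip at h ⊢
  simp only [ind_infl φ hφ H θ]
  simpa [mul_assoc] using h
lemma IsClass.comp {f : X → ℂ} (hf : IsClass f) (φ : A →* X) : IsClass (fun u => f (φ u)) := by
  intro g x; simp only [map_mul, map_inv]; exact hf _ _
end
end Chr
def bb {X : Type} (x y : X) : Bool → X := fun b => bif b then y else x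
namespace Tower
variable (𝒯 : Tower)
namespace Dat
variable {𝒯} {n : ℕ} {a : Bool → ℕ}
def resb (D : Dat n a) (b : Bool) : 𝒯.P D.c →* 𝒯.G (a b) := (Pi.evalMonoidHom _ b).comp D.resH
lemma resb_surj (D : Dat n a) (b : Bool) : Function.Surjective (D.resb (𝒯 := 𝒯) b) := by
  intro g
  obtain ⟨u, hu⟩ := D.resH_surj (𝒯 := 𝒯) (Function.update 1 b g)
  exact ⟨u, by change D.resH u b = g; rw [hu]; simp⟩
lemma resb_val (D : Dat n a) (b : Bool) (u : 𝒯.P D.c) : D.resb b u = 𝒯.res (D.e b) u.1 := rfl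
lemma assoc3 {p q A B C : ℕ} (Dc : Dat n (bb p C)) (D0 : Dat p (bb A B)) (Dd : Dat n (bb A q)) (D1 : Dat q (bb B C))
    (hcd : ∀ i, Dc.c i = true → Dd.c i = true) (h0 : D0.c = Dd.c ∘ Dc.e false) (h1 : D1.c = Dc.c ∘ Dd.e true)
    (hA : ∀ i, Dc.e false (D0.e false i) = Dd.e false i)
    (hB : ∀ i, Dc.e false (D0.e true i) = Dd.e true (D1.e false i))
    (hC : ∀ i, Dc.e true i = Dd.e true (D1.e true i))
    {α : 𝒯.G A → ℂ} {β : 𝒯.G B → ℂ} {γ : 𝒯.G C → ℂ} {π : 𝒯.G n → ℂ} (hα : IsClass α) (hγ : IsClass γ)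
    (hπ : IsClass π) :
    Dc.cf (fun g => D0.m (fun h => α (h false) * β (h true)) (g false) * γ (g true)) π =
    Dd.cf (fun g => D1.m (fun h => β (h false) * γ (h true)) (g true) * α (g false)) π := by
  have hd1 : ∀ i, Dd.c i = false → Dc.c i = false := by
    intro i hi; by_contra h; rw [Bool.not_eq_false] at h; rw [hcd i h] at hi; cases hi
  have l := ip_ind_infl (Dc.resb (𝒯 := 𝒯) false) (Dc.resb_surj false) (𝒯.P D0.c)
    (fun u => (fun h : ∀ b, 𝒯.G (bb A B b) => α (h false) * β (h true)) (D0.resH u))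
    (γ := fun u => γ (Dc.resb true u)) (π := fun u => π u.1) (hγ.comp (Dc.resb true)) (fun g x => hπ g.1 x.1)
  have r := ip_ind_infl (Dd.resb (𝒯 := 𝒯) true) (Dd.resb_surj true) (𝒯.P D1.c)
    (fun u => (fun h : ∀ b, 𝒯.G (bb B C b) => β (h false) * γ (h true)) (D1.resH u))
    (γ := fun u => α (Dd.resb false u)) (π := fun u => π u.1) (hα.comp (Dd.resb false)) (fun g x => hπ g.1 x.1)
  refine l.trans (Eq.trans ?_ r.symm)
  let E : (𝒯.P D0.c).comap (Dc.resb (𝒯 := 𝒯) false) ≃ (𝒯.P D1.c).comap (Dd.resb (𝒯 := 𝒯) true) :=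
    { toFun := fun u => ⟨⟨u.1.1, 𝒯.mem3 hcd (Dc.cov false) _ u.1.2 (by rw [← h0]; exact u.2)⟩, by
        have h2 := 𝒯.mem3 hcd (Dc.cov false) _ u.1.2 (by rw [← h0]; exact u.2)
        have h3 := 𝒯.res_mem (Dd.cov true) u.1.1 h2 u.1.2
        rw [← h1] at h3
        exact h3⟩
      invFun := fun u => ⟨⟨u.1.1, 𝒯.mem3' hcd (Dd.cov true) _ u.1.2 (by rw [← h1]; exact u.2)⟩, by
        have h2 := 𝒯.mem3' hcd (Dd.cov true) _ u.1.2 (by rw [← h1]; exact u.2)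
        have h3 := 𝒯.res_mem (Dc.cov false) u.1.1 h2 u.1.2
        rw [← h0] at h3
        exact h3⟩
      left_inv := fun u => rfl
      right_inv := fun u => rfl }
  refine congrArg₂ (· * ·) (congrArg (fun k : ℕ => (k:ℂ)⁻¹) (card_congr E)) (Fintype.sum_equiv E _ _ fun u => ?_)
  have hu1 := u.1.2
  have hu2 : u.1.1 ∈ 𝒯.P Dd.c := (E u).1.2
  have eA : 𝒯.res (D0.e false) (𝒯.res (Dc.e false) u.1.1) = 𝒯.res (Dd.e false) u.1.1 := by
    refine (𝒯.res_res (Dc.cov false) (f := D0.e false) (fun i => (Iff.of_eq (congrArg (· = false) (congrFun h0 i).symm)).trans (D0.cov false i)) (Dd.cov false)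
      (f' := Function.Embedding.refl _) (fun i => by
        refine ⟨fun _ => ⟨i, rfl⟩, fun _ => hd1 _ ((Dd.cov false _).2 ⟨i, rfl⟩)⟩) (fun i => hA i) _ hu1 hu2).trans (𝒯.res_id _)
  have eB : 𝒯.res (D0.e true) (𝒯.res (Dc.e false) u.1.1) = 𝒯.res (D1.e false) (𝒯.res (Dd.e true) u.1.1) :=
    𝒯.res_res (Dc.cov false) (f := D0.e true) (fun i => (Iff.of_eq (congrArg (· = true) (congrFun h0 i).symm)).trans (D0.cov true i)) (Dd.cov true)
      (f' := D1.e false) (fun i => (Iff.of_eq (congrArg (· = false) (congrFun h1 i).symm)).trans (D1.cov false i)) hB _ hu1 hu2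
  have eC : 𝒯.res (D1.e true) (𝒯.res (Dd.e true) u.1.1) = 𝒯.res (Dc.e true) u.1.1 := by
    refine (𝒯.res_res (Dd.cov true) (f := D1.e true) (fun i => (Iff.of_eq (congrArg (· = true) (congrFun h1 i).symm)).trans (D1.cov true i)) (Dc.cov true)
      (f' := Function.Embedding.refl _) (fun i => by
        refine ⟨fun _ => ⟨i, rfl⟩, fun _ => hcd _ ((Dc.cov true _).2 ⟨i, rfl⟩)⟩) (fun i => (hC i).symm) _ hu2 hu1).trans (𝒯.res_id _)
  change α (𝒯.res (D0.e false) (𝒯.res (Dc.e false) u.1.1)) * β (𝒯.res (D0.e true) (𝒯.res (Dc.e false) u.1.1)) *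
     γ (𝒯.res (Dc.e true) u.1.1) * π (u.1.1)⁻¹ =
     β (𝒯.res (D1.e false) (𝒯.res (Dd.e true) u.1.1)) * γ (𝒯.res (D1.e true) (𝒯.res (Dd.e true) u.1.1)) *
     α (𝒯.res (Dd.e false) u.1.1) * π (u.1.1)⁻¹
  refine (congrArg₂ (fun x y => α x * β y * γ (𝒯.res (Dc.e true) u.1.1) * π (u.1.1)⁻¹) eA eB).trans
    (Eq.trans ?_ (congrArg (fun z => β (𝒯.res (D1.e false) (𝒯.res (Dd.e true) u.1.1)) * γ z *
     α (𝒯.res (Dd.e false) u.1.1) * π (u.1.1)⁻¹) eC).symm)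
  have comm : ∀ x y z w : ℂ, x * y * z * w = y * z * x * w := fun x y z w => by ring
  exact comm _ _ _ _
lemma assoc_data {A B C : ℕ} (hn : n = A + B + C) : ∃ (Dc : Dat n (bb (A + B) C)) (D0 : Dat (A + B) (bb A B))
    (Dd : Dat n (bb A (B + C))) (D1 : Dat (B + C) (bb B C)),
    (∀ i, Dc.c i = true → Dd.c i = true) ∧ (D0.c = Dd.c ∘ Dc.e false) ∧ (D1.c = Dc.c ∘ Dd.e true) ∧
    (∀ i, Dc.e false (D0.e false i) = Dd.e false i) ∧
    (∀ i, Dc.e false (D0.e true i) = Dd.e true (D1.e false i)) ∧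
    (∀ i, Dc.e true i = Dd.e true (D1.e true i)) := by
  subst hn
  have std : ∀ x y N (hN : N = x + y), ∃ D : Dat N (bb x y), (∀ i, D.c i = decide (x ≤ i.1)) ∧
      (∀ i, (D.e false i).1 = i.1) ∧ (∀ i, (D.e true i).1 = x + i.1) := by
    rintro x y _ rfl
    refine ⟨⟨fun i => decide (x ≤ i.1), fun b => match b with
      | false => Fin.castAddEmb y
      | true => Fin.natAddEmb x, ?_⟩, fun i => rfl, fun i => rfl, fun i => rfl⟩
    intro b i
    cases b
    · simp only [decide_eq_false_iff_not, not_le]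
      constructor
      · intro h; exact ⟨⟨i, h⟩, rfl⟩
      · rintro ⟨j, rfl⟩; exact j.2
    · simp only [decide_eq_true_eq]
      constructor
      · intro h
        refine ⟨⟨i - x, ?_⟩, ?_⟩
        · have := i.2; change _ < y; omega
        · apply Fin.ext; change x + (i.1 - x) = i.1; omega
      · rintro ⟨j, rfl⟩; exact Nat.le_add_right x j.1
  obtain ⟨Dc, c1, c2, c3⟩ := std (A + B) C (A + B + C) rfl
  obtain ⟨D0, c4, c5, c6⟩ := std A B (A + B) rfl
  obtain ⟨Dd, c7, c8, c9⟩ := std A (B + C) (A + B + C) (by omega)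
  obtain ⟨D1, d1, d2, d3⟩ := std B C (B + C) rfl
  refine ⟨Dc, D0, Dd, D1, ?_, ?_, ?_, ?_, ?_, ?_⟩
  · intro i; rw [c1, c7]; simp only [decide_eq_true_eq]; omega
  · funext i
    refine (c4 i).trans (Eq.trans ?_ (c7 _).symm)
    exact congrArg (fun z => decide (A ≤ z)) (c2 _).symm
  · funext i
    refine (d1 i).trans (Eq.trans ?_ (c1 _).symm)
    have e : (Dd.e true i).1 = A + i.1 := c9 i
    have : (A + B ≤ (Dd.e true i).1) ↔ B ≤ i.1 := by rw [e]; omega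
    simp only [this]
  · intro i; exact Fin.ext ((c2 _).trans ((c5 i).trans (c8 i).symm))
  · intro i; exact Fin.ext ((c2 _).trans ((c6 i).trans (((c9 _).trans (congrArg (A + ·) (d2 i))).symm)))
  · intro i
    refine Fin.ext ((c3 _).trans (Eq.trans ?_ ((c9 _).trans (congrArg (A + ·) (d3 i))).symm))
    exact add_assoc A B i.1
end Dat
end Tower
namespace Chr
section
variable {Q A B L : Type} [Group A] [Fintype A] [Group B] [Fintype B] [Group Q] [Fintype Q] [Group L] [Fintype L]
lemma avg_fiber (i : Q →* A) (j : Q →* B) (s : A →* L) (t : B →* L) (hs : Function.Surjective s)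
    (ht : Function.Surjective t) (hst : ∀ u, s (i u) = t (j u))
    (hQ : ∀ x y, s x = t y → ∃ u, i u = x ∧ j u = y) (f : A → ℂ) (h : B → ℂ) :
    (Nat.card Q : ℂ)⁻¹ * ∑ u, f (i u) * h (j u) = (Nat.card L : ℂ)⁻¹ * ∑ g, fav s f g * fav t h g := by
  let M : Subgroup (A × B) := (s.comp (MonoidHom.fst A B)).eqLocus (t.comp (MonoidHom.snd A B))
  let φ : Q →* M := (i.prod j).codRestrict M (fun u => hst u)
  have hφ : Function.Surjective φ := by
    rintro ⟨⟨x, y⟩, hxy⟩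
    obtain ⟨u, rfl, rfl⟩ := hQ x y hxy
    exact ⟨u, rfl⟩
  have h1 := sum_hom φ hφ (fun m => f m.1.1 * h m.1.2)
  have h2 := card_ker φ hφ
  have h3 : ∀ (f : A → ℂ) (h : B → ℂ), ∑ m : M, f m.1.1 * h m.1.2 =
      ∑ g, (∑ x with s x = g, f x) * (∑ y with t y = g, h y) := by
    intro f h
    have e1 : ∑ m : M, f m.1.1 * h m.1.2 = ∑ p : A × B, if s p.1 = t p.2 then f p.1 * h p.2 else 0 := by
      rw [← sum_filter]
      exact (Finset.sum_subtype (univ.filter fun p : A × B => s p.1 = t p.2) (p := fun p => p ∈ M)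
        (fun p => by simp only [mem_filter, mem_univ, true_and]; exact Iff.rfl) (fun p => f p.1 * h p.2)).symm
    rw [e1, sum_prod_type]
    simp only [sum_filter, sum_mul_sum]
    rw [sum_comm (s := (univ : Finset L))]
    refine sum_congr rfl fun x _ => ?_
    rw [sum_comm]
    refine sum_congr rfl fun y _ => ?_
    simp only [ite_mul, zero_mul, sum_ite_eq, mem_univ, if_true]
    by_cases hxy : s x = t y <;> simp [hxy, eq_comm]
  have h4 := h3 1 1
  simp only [Pi.one_apply, mul_one, sum_const, nsmul_eq_mul, card_fib s hs, card_fib t ht, card_univ] at h4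
  rw [← card_eq_fintype_card, ← card_eq_fintype_card] at h4
  have h5 : ∑ u, f (i u) * h (j u) = _ := h1
  rw [h5, h2, h3]
  push_cast
  rw [h4]
  simp only [fav]
  have n1 := ker_ne s
  have n2 := ker_ne t
  have n3 := ker_ne φ
  have n4 := grp_ne L
  have : ∀ g, (Nat.card s.ker : ℂ)⁻¹ * (∑ u with s u = g, f u) * ((Nat.card t.ker : ℂ)⁻¹ * ∑ u with t u = g, h u) =
    ((Nat.card s.ker : ℂ)⁻¹ * (Nat.card t.ker : ℂ)⁻¹) * ((∑ u with s u = g, f u) * ∑ u with t u = g, h u) := by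
    intro g; ring
  rw [sum_congr rfl fun g _ => this g, ← mul_sum]
  field_simp
end
lemma fav_pi {X Y : Bool → Type} {L : Type} [∀ b, Group (X b)] [∀ b, Group (Y b)] [∀ b, Fintype (X b)] [∀ b, Fintype (Y b)]
    [Group L] [Fintype L] (s : (∀ b, X b) →* L) (φ : ∀ b, X b →* Y b) (κ : L → ∀ b, Y b) (hs : Function.Surjective s)
    (hφ : ∀ b, Function.Surjective (φ b))
    (h : ∀ x g, s x = g ↔ ∀ b, φ b (x b) = κ g b) (f : ∀ b, X b → ℂ) (g : L) :
    fav s (fun x => ∏ b, f b (x b)) g = ∏ b, fav (φ b) (f b) (κ g b) := by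
  have h0 : univ.filter (fun u => s u = g) =
      piFinset (fun b => univ.filter (fun x => φ b x = κ g b)) := by
    ext u; simp [h]
  have h1 : Nat.card s.ker = ∏ b, Nat.card (φ b).ker := by
    rw [← card_fib s hs g, h0, Fintype.card_piFinset]
    exact prod_congr rfl fun b _ => card_fib _ (hφ b) _
  unfold fav
  rw [h0, h1, prod_mul_distrib, prod_univ_sum]
  push_cast
  rw [Finset.prod_inv_distrib]
lemma fav_inv {A B : Type} [Group A] [Fintype A] [Group B] [Fintype B] (φ : A →* B) (f : A → ℂ) (g : B) :
    fav φ (fun x => f x⁻¹) g = fav φ f g⁻¹ := by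
  unfold fav
  congr 1
  refine Finset.sum_equiv (Equiv.inv A) ?_ ?_
  · intro x; simp [inv_eq_iff_eq_inv]
  · intro x _; rfl
end Chr
namespace Tower
variable (𝒯 : Tower)
namespace Dat
variable {𝒯} {n : ℕ} {a a' : Bool → ℕ}
def move (D : Dat n a) (p : Equiv.Perm (Fin n)) : Dat n a where
  c := D.c ∘ p.symm
  e b := (D.e b).trans p.toEmbedding
  cov b i := by
    rw [Function.comp_apply, D.cov b]
    constructor
    · rintro ⟨j, hj⟩; exact ⟨j, by simp [hj]⟩
    · rintro ⟨j, rfl⟩; exact ⟨j, by simp⟩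
def tab (c d : Fin n → Bool) (b b' : Bool) : ℕ := (univ.filter (fun i => c i = b ∧ d i = b')).card
lemma tab_comp (c d : Fin n → Bool) (p : Equiv.Perm (Fin n)) : tab (c ∘ p) d = tab c (d ∘ p.symm) := by
  funext b b'
  refine Finset.card_equiv p ?_
  intro i; simp
lemma exists_recolor (f f' : Fin n → Bool × Bool)
    (h : ∀ x, (univ.filter (fun i => f i = x)).card = (univ.filter (fun i => f' i = x)).card) :
    ∃ y : Equiv.Perm (Fin n), ∀ i, f' (y i) = f i := by
  have h2 : ∀ x, Nonempty ({i // f i = x} ≃ {i // f' i = x}) := by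
    intro x
    apply Fintype.card_eq.1
    rw [card_subtype, card_subtype]
    convert h x
  let E := fun x => (h2 x).some
  refine ⟨(Equiv.sigmaFiberEquiv f).symm.trans ((Equiv.sigmaCongrRight E).trans (Equiv.sigmaFiberEquiv f')), ?_⟩
  intro i
  exact (E (f i) ⟨i, rfl⟩).2
lemma exists_perm_tab (c d : Fin n → Bool) (p p' : Equiv.Perm (Fin n)) (h : tab (c ∘ p) d = tab (c ∘ p') d) :
    ∃ x y : Equiv.Perm (Fin n), (∀ i, c (x i) = c i) ∧ (∀ i, d (y i) = d i) ∧ p = x * p' * y := by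
  obtain ⟨y, hy⟩ := exists_recolor (fun i => (c (p i), d i)) (fun i => (c (p' i), d i)) (by
    rintro ⟨b, b'⟩
    have := congrFun (congrFun h b) b'
    simpa [tab] using this)
  refine ⟨p * y⁻¹ * p'⁻¹, y, ?_, ?_, by group⟩
  · intro j
    have := hy (y⁻¹ (p'⁻¹ j))
    simp only [Prod.mk.injEq] at this
    simp only [Equiv.Perm.coe_mul, Function.comp_apply]
    rw [← this.1]
    simp
  · intro i
    exact (Prod.mk.inj (hy i)).2
def mid (D : Dat n a) (D' : Dat n a') (F : (∀ b, 𝒯.G (a b)) → ℂ) (F' : (∀ b, 𝒯.G (a' b)) → ℂ) : ℂ :=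
  (Nat.card (𝒯.P D.c ⊓ 𝒯.P D'.c : Subgroup (𝒯.G n)) : ℂ)⁻¹ *
    ∑ u : (𝒯.P D.c ⊓ 𝒯.P D'.c : Subgroup (𝒯.G n)), F (fun b => 𝒯.res (D.e b) u.1) * F' (fun b => 𝒯.res (D'.e b) u.1⁻¹)
lemma mackey (D : Dat n a) (D' : Dat n a') {F : (∀ b, 𝒯.G (a b)) → ℂ} {F' : (∀ b, 𝒯.G (a' b)) → ℂ}
    (hF : IsClass F) (hF' : IsClass F') (W : (Bool → Bool → ℕ) → ℂ)
    (hW : ∀ p, mid D (D'.move p) F F' = W (tab (D.c ∘ p) D'.c)) :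
    ip (D.m F) (D'.m F') = ∑ k ∈ univ.image (fun p : Equiv.Perm (Fin n) => tab (D.c ∘ p) D'.c), W k := by
  let A := 𝒯.P D.c
  let B := 𝒯.P D'.c
  let Φ : 𝒯.G n → ℂ := fun T => ∑ u : A, F (D.resH u) *
    if h : T⁻¹ * u.1⁻¹ * T ∈ B then F' (D'.resH ⟨_, h⟩) else 0
  have e1 : ip (D.m F) (D'.m F') = (Nat.card A : ℂ)⁻¹ * (Nat.card B : ℂ)⁻¹ * ∑ T, Φ T := by
    rw [← cf_eq_m _ _ (D'.m_class F')]
    unfold cf ip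
    rw [mul_assoc]
    congr 1
    have : ∀ u : 𝒯.P D.c, D'.m F' (u⁻¹).1 = _ := fun u => ind_eq _ _ _
    simp only [this, Φ]
    rw [sum_comm, mul_sum]
    refine sum_congr rfl fun u _ => ?_
    rw [← mul_sum, ← mul_assoc, mul_comm (F _), mul_assoc]
    rfl
  have hΦ : ∀ u ∈ A, ∀ v ∈ B, ∀ T, Φ (u * T * v) = Φ T := by
    intro u hu v hv T
    simp only [Φ]
    refine Fintype.sum_equiv (MulAut.conj (⟨u, hu⟩⁻¹ : A)).toEquiv _ _ ?_
    intro x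
    have h1 : F (D.resH ((MulAut.conj (⟨u, hu⟩⁻¹ : A)).toEquiv x)) = F (D.resH x) := by
      have := hF (D.resH x) (D.resH (⟨u, hu⟩⁻¹ : A))
      rw [← this]
      simp [MulAut.conj_apply]
    rw [h1]
    congr 1
    have h2 : (u * T * v)⁻¹ * (x.1)⁻¹ * (u * T * v) =
        v⁻¹ * (T⁻¹ * ((MulAut.conj (⟨u, hu⟩⁻¹ : A)).toEquiv x).1⁻¹ * T) * v := by
      simp [MulAut.conj_apply, mul_assoc]
    have h3 : (u * T * v)⁻¹ * (x.1)⁻¹ * (u * T * v) ∈ B ↔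
        T⁻¹ * ((MulAut.conj (⟨u, hu⟩⁻¹ : A)).toEquiv x).1⁻¹ * T ∈ B := by
      rw [h2, Subgroup.mul_mem_cancel_right _ hv, Subgroup.mul_mem_cancel_left _ (inv_mem hv)]
    by_cases h : T⁻¹ * ((MulAut.conj (⟨u, hu⟩⁻¹ : A)).toEquiv x).1⁻¹ * T ∈ B
    · rw [dif_pos h, dif_pos (h3.2 h)]
      have := hF' (D'.resH ⟨_, h⟩) (D'.resH (⟨v, hv⟩⁻¹ : B))
      rw [← this, ← map_inv, ← map_mul, ← map_mul]
      congr 2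
      apply Subtype.ext
      refine h2.trans ?_
      simp [mul_assoc]
    · rw [dif_neg h, dif_neg (fun h' => h (h3.1 h'))]
  let K := {k // k ∈ univ.image (fun p : Equiv.Perm (Fin n) => tab (D.c ∘ p) D'.c)}
  have hK : ∀ k : K, ∃ p : Equiv.Perm (Fin n), tab (D.c ∘ p) D'.c = k.1 := by
    intro k
    have := k.2
    rw [mem_image] at this
    obtain ⟨p, _, h⟩ := this
    exact ⟨p, h⟩
  choose P hP using hK
  have hrep : ∀ T, ∃! k : K, ∃ u ∈ A, ∃ v ∈ B, T = u * 𝒯.w (P k) * v := by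
    intro T
    obtain ⟨p, u, hu, v, hv, h⟩ := 𝒯.dc D.c D'.c T
    let k : K := ⟨tab (D.c ∘ p) D'.c, mem_image_of_mem _ (mem_univ p)⟩
    refine ⟨k, ?_, ?_⟩
    · obtain ⟨x, y, hx, hy, hxy⟩ := exists_perm_tab D.c D'.c p (P k) (hP k).symm
      refine ⟨u * 𝒯.w x, mul_mem hu (𝒯.w_color hx), 𝒯.w y * v, mul_mem (𝒯.w_color hy) hv, ?_⟩
      rw [h, hxy, 𝒯.w_mul, 𝒯.w_mul]
      simp only [mul_assoc]
    · rintro k' ⟨u', hu', v', hv', h'⟩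
      apply Subtype.ext
      rw [← hP k']
      funext b b'
      refine (𝒯.dc' D.c D'.c p (P k') (u'⁻¹ * u) (v * v'⁻¹) (mul_mem (inv_mem hu') hu) (mul_mem hv (inv_mem hv')) ?_ b b').symm
      have : u'⁻¹ * u * 𝒯.w p * (v * v'⁻¹) = u'⁻¹ * (u * 𝒯.w p * v) * v'⁻¹ := by group
      rw [this, ← h, h']
      group
  have : Fintype K := Finset.Subtype.fintype _
  rw [e1, sum_dc A B (fun k => 𝒯.w (P k)) hrep Φ hΦ,
    ← Finset.sum_attach (univ.image (fun p : Equiv.Perm (Fin n) => tab (D.c ∘ p) D'.c))]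
  refine sum_congr (Finset.ext fun k => ⟨fun _ => Finset.mem_attach _ k, fun _ => mem_univ _⟩) fun k _ => ?_
  rw [← hP k, ← hW]
  set p := P k
  have hQ : ∀ x, x ∈ 𝒯.P (D'.move p).c ↔ (𝒯.w p)⁻¹ * x * 𝒯.w p ∈ B := by
    intro x
    have h1 := 𝒯.w_mem (D'.move p).c p ((𝒯.w p)⁻¹ * x * 𝒯.w p)
    have h2 : (D'.move p).c ∘ p = D'.c := by funext i; simp [move]
    rw [h2] at h1
    rw [← h1]
    have : 𝒯.w p * ((𝒯.w p)⁻¹ * x * 𝒯.w p) * (𝒯.w p)⁻¹ = x := by group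
    rw [this]
  unfold mid
  congr 1
  · congr 1
    rw [Nat.cast_inj]
    refine card_congr ⟨fun q => ⟨q.1.1.1, q.1.1.2, (hQ _).2 ?_⟩, fun u => ⟨⟨⟨u.1, u.2.1⟩, ⟨(𝒯.w p)⁻¹ * u.1⁻¹ * 𝒯.w p, ?_⟩⟩, ?_⟩, ?_, ?_⟩
    · have : (𝒯.w p)⁻¹ * q.1.1.1 * 𝒯.w p = (q.1.2.1)⁻¹ := by
        rw [eq_inv_iff_mul_eq_one, mul_assoc, mul_assoc, ← mul_assoc q.1.1.1, q.2]; group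
      rw [this]; exact inv_mem q.1.2.2
    · have := (hQ _).1 (inv_mem u.2.2); exact this
    · simp [mul_assoc]
    · intro q
      apply Subtype.ext
      refine Prod.ext rfl (Subtype.ext ?_)
      have gen : ∀ x y z : 𝒯.G n, x * y * z = y → y⁻¹ * x⁻¹ * y = z := by
        intro x y z h
        rw [mul_assoc, inv_mul_eq_iff_eq_mul, inv_mul_eq_iff_eq_mul, ← mul_assoc, h]
      exact gen _ _ _ q.2
    · intro u; rfl
  · let Qs : Subgroup (𝒯.G n) := 𝒯.P D.c ⊓ 𝒯.P (D'.move p).c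
    simp only [Φ]
    have h1 : ∀ u : A, (F (D.resH u) * if h : (𝒯.w p)⁻¹ * u.1⁻¹ * 𝒯.w p ∈ B then F' (D'.resH ⟨_, h⟩) else 0) =
      if u.1 ∈ 𝒯.P (D'.move p).c then F (D.resH u) * F' (fun b => 𝒯.res ((D'.move p).e b) u.1⁻¹) else 0 := by
      intro u
      have hiff : u.1 ∈ 𝒯.P (D'.move p).c ↔ (𝒯.w p)⁻¹ * u.1⁻¹ * 𝒯.w p ∈ B := by
        rw [← hQ, inv_mem_iff]
      by_cases h : u.1 ∈ 𝒯.P (D'.move p).c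
      · rw [if_pos h, dif_pos (hiff.1 h)]
        congr 2
        funext b
        have := 𝒯.res_w (D'.e b) p ((𝒯.w p)⁻¹ * u.1⁻¹ * 𝒯.w p)
        have h2 : 𝒯.w p * ((𝒯.w p)⁻¹ * u.1⁻¹ * 𝒯.w p) * (𝒯.w p)⁻¹ = u.1⁻¹ := by group
        rw [h2] at this
        exact this.symm
      · rw [if_neg h, dif_neg (fun h' => h (hiff.2 h')), mul_zero]
    rw [sum_congr rfl fun u _ => h1 u, ← sum_filter]
    refine sum_bij' (fun u hu => ⟨u.1, u.2, (mem_filter.1 hu).2⟩) (fun u _ => ⟨u.1, u.2.1⟩) ?_ ?_ ?_ ?_ ?_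
    · intros; simp
    · intro u _; rw [mem_filter]; exact ⟨mem_univ _, u.2.2⟩
    · intros; rfl
    · intros; rfl
    · intros; rfl
end Dat
variable (𝒯 : Tower)
namespace Dat
variable {𝒯} {n : ℕ} {a a' : Bool → ℕ}
lemma sub_data (D : Dat n a) (D' : Dat n a') (k : Bool → Bool → ℕ) (hk : tab D.c D'.c = k) :
    ∃ (Dα : ∀ b, Dat (a b) (k b)) (Dγ : ∀ b', Dat (a' b') (fun b => k b b')),
      (∀ b, (Dα b).c = D'.c ∘ D.e b) ∧ (∀ b', (Dγ b').c = D.c ∘ D'.e b') ∧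
      ∀ b b' i, D.e b ((Dα b).e b' i) = D'.e b' ((Dγ b').e b i) := by
  subst hk
  have h1 : ∀ b, ∃ E : Dat (a b) (tab D.c D'.c b), E.c = D'.c ∘ D.e b := by
    intro b
    apply of_color
    intro b'
    unfold tab
    rw [← card_map (D.e b)]
    congr 1
    ext j
    simp only [mem_map, mem_filter, mem_univ, true_and, Function.comp_apply]
    constructor
    · rintro ⟨i, hi, rfl⟩; exact ⟨(D.cov b _).2 ⟨i, rfl⟩, hi⟩
    · rintro ⟨h, h'⟩
      obtain ⟨i, rfl⟩ := (D.cov b j).1 h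
      exact ⟨i, h', rfl⟩
  choose Dα hα using h1
  have h2 : ∀ b b' i, ∃ j, D'.e b' j = D.e b ((Dα b).e b' i) := by
    intro b b' i
    refine (D'.cov b' _).1 ?_
    have := ((Dα b).cov b' _).2 ⟨i, rfl⟩
    rw [hα] at this
    exact this
  choose h hh using h2
  have hinj : ∀ b b', Function.Injective (h b b') := by
    intro b b' i j hij
    have := hh b b' i
    rw [hij, hh] at this
    exact ((Dα b).e b').injective ((D.e b).injective this.symm)
  refine ⟨Dα, fun b' => ⟨D.c ∘ D'.e b', fun b => ⟨h b b', hinj b b'⟩, ?_⟩, hα, fun b' => rfl, fun b b' i => (hh b b' i).symm⟩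
  intro b j
  simp only [Function.comp_apply]
  constructor
  · intro hj
    obtain ⟨i, hi⟩ := (D.cov b _).1 hj
    have : (Dα b).c i = b' := by
      rw [hα, Function.comp_apply, hi]; exact (D'.cov b' _).2 ⟨j, rfl⟩
    obtain ⟨l, rfl⟩ := ((Dα b).cov b' i).1 this
    exact ⟨l, (D'.e b').injective ((hh b b' l).trans hi)⟩
  · rintro ⟨l, rfl⟩
    change D.c (D'.e b' (h b b' l)) = b
    rw [hh]; exact (D.cov b _).2 ⟨_, rfl⟩
lemma tab_realize (D : Dat n a) (D' : Dat n a') (k : Bool → Bool → ℕ) (h1 : ∀ b, a b = k b false + k b true)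
    (h2 : ∀ b', a' b' = k false b' + k true b') : ∃ p : Equiv.Perm (Fin n), tab (D.c ∘ p) D'.c = k := by
  have E : ∀ b, Dat (a b) (k b) := fun b => (exists_dat (h1 b)).some
  have hx : ∀ i, ∃ j, D.e (D.c i) j = i := fun i => (D.cov _ i).1 rfl
  choose x hx using hx
  let col : Fin n → Bool := fun i => (E (D.c i)).c (x i)
  have h0 : ∀ b i, D.c (D.e b i) = b := fun b i => (D.cov b _).2 ⟨i, rfl⟩
  have hcol : ∀ b i, col (D.e b i) = (E b).c i := by
    intro b i
    have : ∀ b' (h : D.c (D.e b i) = b'), (D.e b' (h ▸ x (D.e b i)) = D.e b i) ∧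
        col (D.e b i) = (E b').c (h ▸ x (D.e b i)) := by
      rintro _ rfl
      exact ⟨hx _, rfl⟩
    obtain ⟨h1, h2⟩ := this b (h0 b i)
    rw [h2, (D.e b).injective h1]
  have htab : tab D.c col = k := by
    funext b b'
    have : univ.filter (fun i => D.c i = b ∧ col i = b') = univ.map (((E b).e b').trans (D.e b)) := by
      ext j
      simp only [mem_map, mem_filter, mem_univ, true_and, Function.Embedding.trans_apply]
      constructor
      · rintro ⟨h, h'⟩
        obtain ⟨i, rfl⟩ := (D.cov b j).1 h
        rw [hcol] at h'
        obtain ⟨l, rfl⟩ := ((E b).cov b' i).1 h'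
        exact ⟨l, rfl⟩
      · rintro ⟨l, rfl⟩
        rw [hcol]
        exact ⟨h0 _ _, ((E b).cov b' _).2 ⟨l, rfl⟩⟩
    unfold tab
    rw [this]; simp
  obtain ⟨D1, hD1⟩ := of_color (a := a') col (by
    intro b'
    rw [h2 b', ← htab]
    unfold tab
    rw [← Finset.card_union_of_disjoint]
    · congr 1
      ext i
      simp only [mem_union, mem_filter, mem_univ, true_and]
      cases D.c i <;> simp
    · rw [Finset.disjoint_left]
      intro i hi hi'
      simp only [mem_filter, mem_univ, true_and] at hi hi'
      rw [hi.1] at hi'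
      exact absurd hi'.1 (by simp))
  obtain ⟨p, -, hp⟩ := exists_perm D' D1
  refine ⟨p, ?_⟩
  rw [tab_comp, ← htab, ← hD1]
  congr 1
  funext i
  have := hp (p.symm i)
  simp at this
  exact this.symm
lemma core (D : Dat n a) (D' : Dat n a') (k : Bool → Bool → ℕ) (Dα : ∀ b, Dat (a b) (k b))
    (Dγ : ∀ b', Dat (a' b') (fun b => k b b'))
    (hα : ∀ b, (Dα b).c = D'.c ∘ D.e b) (hγ : ∀ b', (Dγ b').c = D.c ∘ D'.e b')
    (heq : ∀ b b' i, D.e b ((Dα b).e b' i) = D'.e b' ((Dγ b').e b i))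
    (α : ∀ b, 𝒯.G (a b) → ℂ) (γ : ∀ b, 𝒯.G (a' b) → ℂ) :
    mid D D' (tens α) (tens γ) = (Nat.card (∀ b b', 𝒯.G (k b b')) : ℂ)⁻¹ *
      ∑ g : ∀ b b', 𝒯.G (k b b'), (∏ b, (Dα b).r (α b) (g b)) * ∏ b', (Dγ b').r (γ b') (fun b => (g b b')⁻¹) := by
  let Q : Subgroup (𝒯.G n) := 𝒯.P D.c ⊓ 𝒯.P D'.c
  let i : Q →* ∀ b, 𝒯.P (Dα b).c :=
    { toFun := fun u b => ⟨𝒯.res (D.e b) u.1, by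
        rw [hα]; exact 𝒯.res_mem (D.cov b) u.1 u.2.1 u.2.2⟩
      map_one' := by
        funext b
        apply Subtype.ext
        exact congrFun (map_one (D.resH (𝒯 := 𝒯))) b
      map_mul' := fun u v => by
        funext b
        apply Subtype.ext
        exact 𝒯.res_mul (D.cov b) u.1 u.2.1 v.1 v.2.1 }
  let j : Q →* ∀ b, 𝒯.P (Dγ b).c :=
    { toFun := fun u b => ⟨𝒯.res (D'.e b) u.1, by
        rw [hγ]; exact 𝒯.res_mem (D'.cov b) u.1 u.2.2 u.2.1⟩
      map_one' := by
        funext b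
        apply Subtype.ext
        exact congrFun (map_one (D'.resH (𝒯 := 𝒯))) b
      map_mul' := fun u v => by
        funext b
        apply Subtype.ext
        exact 𝒯.res_mul (D'.cov b) u.1 u.2.2 v.1 v.2.2 }
  let s : (∀ b, 𝒯.P (Dα b).c) →* ∀ b b', 𝒯.G (k b b') :=
    { toFun := fun x b => (Dα b).resH (x b)
      map_one' := by funext b; exact map_one _
      map_mul' := fun x y => by funext b; exact map_mul _ _ _ }
  let t : (∀ b, 𝒯.P (Dγ b).c) →* ∀ b b', 𝒯.G (k b b') :=
    { toFun := fun x b b' => (Dγ b').resH (x b') b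
      map_one' := by funext b b'; rw [Pi.one_apply, map_one]; rfl
      map_mul' := fun x y => by funext b b'; rw [Pi.mul_apply, map_mul]; rfl }
  have hs : Function.Surjective s := by
    intro g
    choose x hx using fun b => (Dα b).resH_surj (𝒯 := 𝒯) (g b)
    exact ⟨x, funext hx⟩
  have ht : Function.Surjective t := by
    intro g
    choose x hx using fun b' => (Dγ b').resH_surj (𝒯 := 𝒯) (fun b => g b b')
    exact ⟨x, funext fun b => funext fun b' => congrFun (hx b') b⟩
  have cα : ∀ b b', Cov (D'.c ∘ D.e b) b' ((Dα b).e b') := fun b b' => by rw [← hα]; exact (Dα b).cov b'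
  have cγ : ∀ b' b, Cov (D.c ∘ D'.e b') b ((Dγ b').e b) := fun b' b => by rw [← hγ]; exact (Dγ b').cov b
  have hst : ∀ u, s (i u) = t (j u) := by
    intro u
    funext b b'
    exact 𝒯.res_res (D.cov b) (cα b b') (D'.cov b') (cγ b' b) (heq b b') u.1 u.2.1 u.2.2
  have hQ : ∀ x y, s x = t y → ∃ u, i u = x ∧ j u = y := by
    intro x y hxy
    obtain ⟨u, hu, hu', h1, h2⟩ := 𝒯.surj4 D.cov D'.cov cα cγ heq (fun b => (x b).1) (fun b => (y b).1)
      (fun b => by rw [← hα]; exact (x b).2) (fun b => by rw [← hγ]; exact (y b).2)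
      (fun b b' => congrFun (congrFun hxy b) b')
    exact ⟨⟨u, hu, hu'⟩, funext fun b => Subtype.ext (h1 b), funext fun b => Subtype.ext (h2 b)⟩
  have key := avg_fiber i j s t hs ht hst hQ (fun x => ∏ b, α b (x b).1) (fun y => ∏ b, γ b ((y b)⁻¹ : 𝒯.P (Dγ b).c).1)
  refine Eq.trans ?_ (key.trans ?_)
  · unfold mid
    congr 1
    refine sum_congr rfl fun u _ => ?_
    congr 1
    unfold tens
    refine prod_congr rfl fun b _ => ?_
    congr 1
    have h1 := congrFun (map_inv (D'.resH (𝒯 := 𝒯)) ⟨u.1, u.2.2⟩) b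
    exact h1
  · congr 1
    refine sum_congr rfl fun g _ => ?_
    congr 1
    · exact fav_pi s (fun b => (Dα b).resH) (fun g => g) hs (fun b => (Dα b).resH_surj)
        (fun x g => funext_iff) (fun b u => α b u.1) g
    · refine (fav_pi t (fun b => (Dγ b).resH) (fun g b' b => g b b') ht (fun b => (Dγ b).resH_surj)
        (fun x g => ?_) (fun b u => γ b (u⁻¹).1) g).trans ?_
      · constructor
        · rintro rfl b; rfl
        · intro h; funext b b'; exact congrFun (h b') b
      · refine prod_congr rfl fun b _ => ?_
        exact fav_inv ((Dγ b).resH (𝒯 := 𝒯)) (fun u => γ b u.1) _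
end Dat
variable (𝒯 : Tower)
namespace Dat
variable {𝒯} {n : ℕ} {a a' : Bool → ℕ}
lemma core2 (D : Dat n a) (D' : Dat n a') (k : Bool → Bool → ℕ) (Dα : ∀ b, Dat (a b) (k b))
    (Dγ : ∀ b', Dat (a' b') (fun b => k b b'))
    (hα : ∀ b, (Dα b).c = D'.c ∘ D.e b) (hγ : ∀ b', (Dγ b').c = D.c ∘ D'.e b')
    (heq : ∀ b b' i, D.e b ((Dα b).e b' i) = D'.e b' ((Dγ b').e b i))
    {α : ∀ b, 𝒯.G (a b) → ℂ} {γ : ∀ b, 𝒯.G (a' b) → ℂ} (cα : ∀ b, IsClass (α b)) :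
    mid D D' (tens α) (tens γ) = ∑ χ : ∀ b b', Irr (𝒯.G (k b b')),
      (∏ b, (Dα b).cf (tens fun b' => (χ b b').1) (α b)) * ∏ b', (Dγ b').cf (tens fun b => (χ b b').1) (γ b') := by
  rw [core D D' k Dα Dγ hα hγ heq]
  have h1 : ∀ b (x : ∀ b', 𝒯.G (k b b')), (Dα b).r (α b) x = ∑ χ : ∀ b', Irr (𝒯.G (k b b')),
      (Dα b).cf (tens fun b' => (χ b').1) (α b) * tens (fun b' => (χ b').1) x := by
    intro b x
    rw [expand_pi ((Dα b).r_class (cα b)) x]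
    refine sum_congr rfl fun χ _ => ?_
    rw [ip_comm, ← cf_eq_r]
  have h2 : ∀ g : ∀ b b', 𝒯.G (k b b'), ∏ b, (Dα b).r (α b) (g b) = ∑ χ : ∀ b b', Irr (𝒯.G (k b b')),
      (∏ b, (Dα b).cf (tens fun b' => (χ b b').1) (α b)) * ∏ b, tens (fun b' => (χ b b').1) (g b) := by
    intro g
    rw [prod_congr rfl fun b _ => h1 b (g b), prod_univ_sum, Fintype.piFinset_univ]
    refine sum_congr rfl fun χ _ => ?_
    rw [prod_mul_distrib]
  have h3 : ∀ χ : ∀ b b', Irr (𝒯.G (k b b')), ∏ b', (Dγ b').cf (tens fun b => (χ b b').1) (γ b') =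
      (Nat.card (∀ b b', 𝒯.G (k b b')) : ℂ)⁻¹ * ∑ g : ∀ b b', 𝒯.G (k b b'), (∏ b, tens (fun b' => (χ b b').1) (g b)) *
        ∏ b', (Dγ b').r (γ b') (fun b => (g b b')⁻¹) := by
    intro χ
    rw [prod_congr rfl fun b' _ => (Dγ b').cf_eq_r _ _]
    unfold ip
    rw [prod_mul_distrib, prod_univ_sum, Fintype.piFinset_univ]
    have E : (∀ b b', 𝒯.G (k b b')) ≃ (∀ b' b, 𝒯.G (k b b')) := Equiv.piComm _
    congr 1
    · rw [card_congr E, card_pi, Finset.prod_inv_distrib]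
      push_cast; rfl
    · refine (Fintype.sum_equiv (Equiv.piComm fun b b' => 𝒯.G (k b b')) _ _ fun g => ?_).symm
      rw [prod_mul_distrib]
      congr 1
      unfold tens
      rw [Finset.prod_comm]
      rfl
  simp only [h2, h3, sum_mul, mul_sum]
  rw [sum_comm]
  refine sum_congr rfl fun χ _ => sum_congr rfl fun g _ => ?_
  ring
def toBb (D : Dat n a) : Dat n (bb (a false) (a true)) where
  c := D.c
  e b := match b with | false => D.e false | true => D.e true
  cov b := match b with | false => D.cov false | true => D.cov true
lemma toBb_cf (D : Dat n a) (s : ∀ b, 𝒯.G (a b) → ℂ) (π : 𝒯.G n → ℂ) :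
    D.toBb.cf (fun g => s false (g false) * s true (g true)) π = D.cf (tens s) π := by
  unfold cf ip
  refine congrArg₂ (· * ·) rfl (sum_congr rfl fun u _ => ?_)
  have key : s false (𝒯.res (D.e false) u.1) * s true (𝒯.res (D.e true) u.1) = tens s (fun b => 𝒯.res (D.e b) u.1) := by
    unfold tens
    rw [prod_bool, mul_comm]
  exact congrArg (· * π ((u⁻¹).1)) key
end Dat
abbrev Om : Type := Σ n, Irr (𝒯.G n)
variable {𝒯}
def FF (σ τ : 𝒯.Om) : (∀ b, 𝒯.G (bb σ.1 τ.1 b)) → ℂ := fun g => σ.2.1 (g false) * τ.2.1 (g true)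
lemma cfF_nat {n : ℕ} (σ τ : 𝒯.Om) (D : Dat n (bb σ.1 τ.1)) {π : 𝒯.G n → ℂ} (hπ : IsChar π) :
    ∃ k : ℕ, D.cf (FF σ τ) π = k := by
  let s : ∀ b, 𝒯.G (bb σ.1 τ.1 b) → ℂ := fun b => match b with | false => σ.2.1 | true => τ.2.1
  have := D.cf_nat (σ := s) (fun b => by cases b; exact Irr.isChar σ.2.2; exact Irr.isChar τ.2.2) hπ
  obtain ⟨k, hk⟩ := this
  refine ⟨k, Eq.trans ?_ hk⟩
  have key : FF σ τ = tens s := by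
    funext g
    exact ((prod_bool _).trans (mul_comm _ _)).symm
  exact congrArg (fun F => D.cf F π) key
def co (σ τ π : 𝒯.Om) : ℕ :=
  if h : π.1 = σ.1 + τ.1 then (cfF_nat σ τ (Dat.exists_dat (a := bb σ.1 τ.1) h).some (Irr.isChar π.2.2)).choose else 0
lemma co_deg {σ τ π : 𝒯.Om} (h : co σ τ π ≠ 0) : π.1 = σ.1 + τ.1 := by
  by_contra h'
  exact h (dif_neg h')
lemma co_eq (σ τ π : 𝒯.Om) (D : Dat π.1 (bb σ.1 τ.1)) : (co σ τ π : ℂ) = D.cf (FF σ τ) π.2.1 := by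
  have h : π.1 = σ.1 + τ.1 := D.card
  unfold co
  rw [dif_pos h, ← (cfF_nat σ τ (Dat.exists_dat (a := bb σ.1 τ.1) h).some (Irr.isChar π.2.2)).choose_spec]
  exact Dat.cf_indep _ _ _ (Irr.isChar π.2.2).isClass
lemma co_eq' {n : ℕ} {a : Bool → ℕ} (D : Dat n a) (s : ∀ b, Irr (𝒯.G (a b))) (π : Irr (𝒯.G n)) :
    (co ⟨a false, s false⟩ ⟨a true, s true⟩ ⟨n, π⟩ : ℂ) = D.cf (tens fun b => (s b).1) π.1 :=
  by
  have h1 := co_eq (𝒯 := 𝒯) ⟨a false, s false⟩ ⟨a true, s true⟩ ⟨n, π⟩ D.toBb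
  have h2 := D.toBb_cf (fun b => (s b).1) π.1
  exact h1.trans h2
lemma fin_deg (n : ℕ) : {ω : 𝒯.Om | ω.1 = n}.Finite := by
  refine (Set.finite_range (fun χ => ⟨n, χ⟩ : Irr (𝒯.G n) → 𝒯.Om)).subset ?_
  rintro ⟨m, χ⟩ rfl
  exact ⟨χ, rfl⟩
lemma fin_le (n : ℕ) : {ω : 𝒯.Om | ω.1 ≤ n}.Finite := by
  have : {ω : 𝒯.Om | ω.1 ≤ n} = ⋃ i ∈ range (n + 1), {ω : 𝒯.Om | ω.1 = i} := by
    ext ω; simp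
  rw [this]
  exact Set.Finite.biUnion (Finset.finite_toSet _) fun i _ => fin_deg i
def cc (σ τ : 𝒯.Om) : 𝒯.Om →₀ ℕ :=
  Finsupp.ofSupportFinite (co σ τ) ((fin_deg (σ.1 + τ.1)).subset fun _ h => co_deg h)
lemma cc_apply (σ τ π : 𝒯.Om) : cc σ τ π = co σ τ π := rfl
lemma sum_cc (σ τ : 𝒯.Om) {N : ℕ} (hN : N = σ.1 + τ.1) (f : 𝒯.Om → ℕ) :
    (cc σ τ).sum (fun κ n => n * f κ) = ∑ χ : Irr (𝒯.G N), co σ τ ⟨N, χ⟩ * f ⟨N, χ⟩ := by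
  have hinj : Function.Injective (fun χ => ⟨N, χ⟩ : Irr (𝒯.G N) → 𝒯.Om) := fun _ _ h => eq_of_heq (Sigma.mk.inj h).2
  rw [← sum_image (s := univ) (g := (fun χ => ⟨N, χ⟩ : Irr (𝒯.G N) → 𝒯.Om)) (f := fun κ => co σ τ κ * f κ)
    (fun x _ y _ h => hinj h)]
  refine Finsupp.sum_of_support_subset _ ?_ _ (by simp)
  rintro ⟨M, χ⟩ hχ
  rw [Finsupp.mem_support_iff, cc_apply] at hχ
  have := co_deg hχ
  change M = _ at this
  rw [← hN] at this
  subst this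
  exact mem_image_of_mem _ (mem_univ χ)
lemma ccop_fin (π : 𝒯.Om) : {p : 𝒯.Om × 𝒯.Om | cc p.1 p.2 π ≠ 0}.Finite := by
  refine ((fin_le π.1).prod (fin_le π.1)).subset fun p h => ?_
  have h' : co p.1 p.2 π ≠ 0 := h
  have := co_deg h'
  exact ⟨show p.1.1 ≤ π.1 by omega, show p.2.1 ≤ π.1 by omega⟩
def ccop (π : 𝒯.Om) : Finset (𝒯.Om × 𝒯.Om) := (ccop_fin π).toFinset
lemma mem_ccop (π : 𝒯.Om) (p : 𝒯.Om × 𝒯.Om) : p ∈ ccop π ↔ cc p.1 p.2 π ≠ 0 := by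
  unfold ccop; rw [Set.Finite.mem_toFinset]; rfl
variable {𝒯 : Tower}
def Wk {a a' : Bool → ℕ} (α : ∀ b, Irr (𝒯.G (a b))) (γ : ∀ b, Irr (𝒯.G (a' b))) (ω : Bool → Bool → 𝒯.Om) : ℕ :=
  co (ω false false) (ω false true) ⟨a false, α false⟩ * co (ω true false) (ω true true) ⟨a true, α true⟩ *
  co (ω false false) (ω true false) ⟨a' false, γ false⟩ * co (ω false true) (ω true true) ⟨a' true, γ true⟩
def mkO {k : Bool → Bool → ℕ} (χ : ∀ b b', Irr (𝒯.G (k b b'))) : Bool → Bool → 𝒯.Om := fun b b' => ⟨k b b', χ b b'⟩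
lemma tens_class {a : Bool → ℕ} (α : ∀ b, Irr (𝒯.G (a b))) : IsClass (tens fun b => (α b).1) := by
  intro g x
  unfold tens
  exact prod_congr rfl fun b _ => (Irr.isChar (α b).2).isClass _ _
lemma hopf_aux {n : ℕ} {a a' : Bool → ℕ} (D : Dat n a) (D' : Dat n a') (α : ∀ b, Irr (𝒯.G (a b))) (γ : ∀ b, Irr (𝒯.G (a' b))) :
    ∑ χ : Irr (𝒯.G n), D.cf (tens fun b => (α b).1) χ.1 * D'.cf (tens fun b => (γ b).1) χ.1 =
    ∑ k ∈ univ.image (fun p : Equiv.Perm (Fin n) => Dat.tab (D.c ∘ p) D'.c),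
      ∑ χ : ∀ b b', Irr (𝒯.G (k b b')), (Wk α γ (mkO χ) : ℂ) := by
  rw [← D.mackey D' (tens_class α) (tens_class γ) (fun k => ∑ χ : ∀ b b', Irr (𝒯.G (k b b')), (Wk α γ (mkO χ) : ℂ)),
    ip_expand (D.m_class _)]
  · refine sum_congr rfl fun χ _ => ?_
    rw [D.cf_eq_m _ (Irr.isChar χ.2).isClass, D'.cf_eq_m _ (Irr.isChar χ.2).isClass, ip_comm (χ.1)]
  · intro p
    obtain ⟨Dα, Dγ, h1, h2, h3⟩ := Dat.sub_data D (D'.move p) (Dat.tab (D.c ∘ p) D'.c) (Dat.tab_comp _ _ _).symm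
    rw [Dat.core2 D (D'.move p) _ Dα Dγ h1 h2 h3 (fun b => (Irr.isChar (α b).2).isClass)]
    refine sum_congr rfl fun χ _ => ?_
    rw [prod_bool, prod_bool, ← co_eq' (Dα true) (χ true), ← co_eq' (Dα false) (χ false),
      ← co_eq' (Dγ true) (fun b => χ b true), ← co_eq' (Dγ false) (fun b => χ b false)]
    unfold Wk mkO
    push_cast
    ring
def bbI (α β : 𝒯.Om) : ∀ b, Irr (𝒯.G (bb α.1 β.1 b)) := fun b => match b with | false => α.2 | true => β.2
lemma cf_bbI {n : ℕ} (α β : 𝒯.Om) (D : Dat n (bb α.1 β.1)) (χ : Irr (𝒯.G n)) :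
    (co α β ⟨n, χ⟩ : ℂ) = D.cf (tens fun b => (bbI α β b).1) χ.1 := co_eq' D (bbI α β) χ
lemma co_hopf (α β γ δ : 𝒯.Om) : (cc α β).sum (fun π n => n * cc γ δ π) =
    ∑ p ∈ ccop α, ∑ p' ∈ ccop β, cc p.1 p.2 α * cc p'.1 p'.2 β * cc p.1 p'.1 γ * cc p.2 p'.2 δ := by
  simp only [cc_apply]
  rw [sum_cc α β rfl]
  by_cases hn : α.1 + β.1 = γ.1 + δ.1
  · obtain ⟨D⟩ := Dat.exists_dat (n := α.1 + β.1) (a := bb α.1 β.1) rfl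
    obtain ⟨D'⟩ := Dat.exists_dat (n := α.1 + β.1) (a := bb γ.1 δ.1) hn
    have H := hopf_aux D D' (bbI α β) (bbI γ δ)
    simp only [← cf_bbI] at H
    have H' : ∑ χ : Irr (𝒯.G (α.1 + β.1)), co α β ⟨_, χ⟩ * co γ δ ⟨_, χ⟩ = 
      ∑ k ∈ univ.image (fun p : Equiv.Perm (Fin (α.1 + β.1)) => Dat.tab (D.c ∘ p) D'.c),
      ∑ χ : ∀ b b', Irr (𝒯.G (k b b')), Wk (bbI α β) (bbI γ δ) (mkO χ) := by
      exact_mod_cast H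
    rw [H', Finset.sum_sigma', ← sum_product']
    symm
    let sel : (𝒯.Om × 𝒯.Om) × (𝒯.Om × 𝒯.Om) → Bool → Bool → 𝒯.Om := fun p => bb (bb p.1.1 p.1.2) (bb p.2.1 p.2.2)
    let J : (Bool → Bool → 𝒯.Om) → (k : Bool → Bool → ℕ) × ∀ b b', Irr (𝒯.G (k b b')) :=
      fun ω => ⟨fun b b' => (ω b b').1, fun b b' => (ω b b').2⟩
    have hJ : ∀ ω, mkO (J ω).2 = ω := fun ω => rfl
    refine Finset.sum_bij_ne_zero (fun p _ _ => J (sel p)) ?_ ?_ ?_ ?_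
    · intro p _ h
      rw [Finset.mem_sigma]
      refine ⟨?_, mem_univ _⟩
      have h4 := right_ne_zero_of_mul h
      have h3 := right_ne_zero_of_mul (left_ne_zero_of_mul h)
      have h2 := right_ne_zero_of_mul (left_ne_zero_of_mul (left_ne_zero_of_mul h))
      have h1 := left_ne_zero_of_mul (left_ne_zero_of_mul (left_ne_zero_of_mul h))
      obtain ⟨q, hq⟩ := Dat.tab_realize D D' (fun b b' => (sel p b b').1)
        (fun b => match b with | false => co_deg h1 | true => co_deg h2)
        (fun b => match b with | false => co_deg h3 | true => co_deg h4)
      rw [mem_image]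
      exact ⟨q, mem_univ _, hq⟩
    · intro p _ _ p' _ _ h
      have := congrArg (fun s => mkO (𝒯 := 𝒯) s.2) h
      simp only [hJ] at this
      have e1 : ∀ b b', sel p b b' = sel p' b b' := fun b b' => by rw [this]
      exact Prod.ext (Prod.ext (e1 false false) (e1 false true)) (Prod.ext (e1 true false) (e1 true true))
    · rintro ⟨k, χ⟩ _ h
      have h' : Wk (bbI α β) (bbI γ δ) (mkO χ) ≠ 0 := h
      unfold Wk at h'
      have h2 := right_ne_zero_of_mul (left_ne_zero_of_mul (left_ne_zero_of_mul h'))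
      have h1 := left_ne_zero_of_mul (left_ne_zero_of_mul (left_ne_zero_of_mul h'))
      refine ⟨((mkO χ false false, mkO χ false true), (mkO χ true false, mkO χ true true)), ?_, h', ?_⟩
      · rw [mem_product, mem_ccop, mem_ccop]
        exact ⟨h1, h2⟩
      · have : sel ((mkO χ false false, mkO χ false true), (mkO χ true false, mkO χ true true)) = mkO χ := by
          funext b b'; cases b <;> cases b' <;> rfl
        change J (sel _) = _
        rw [this]
        rfl
    · intro p _ _
      rfl
  · have z1 : ∑ χ : Irr (𝒯.G (α.1 + β.1)), co α β ⟨_, χ⟩ * co γ δ ⟨_, χ⟩ = 0 := by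
      refine sum_eq_zero fun χ _ => ?_
      have : co γ δ ⟨_, χ⟩ = 0 := by
        by_contra h; exact hn (co_deg h)
      rw [this, mul_zero]
    rw [z1]
    symm
    refine sum_eq_zero fun p hp => sum_eq_zero fun p' hp' => ?_
    by_contra h
    have h4 := co_deg (right_ne_zero_of_mul h)
    have h3 := co_deg (right_ne_zero_of_mul (left_ne_zero_of_mul h))
    have h2 := co_deg (right_ne_zero_of_mul (left_ne_zero_of_mul (left_ne_zero_of_mul h)))
    have h1 := co_deg (left_ne_zero_of_mul (left_ne_zero_of_mul (left_ne_zero_of_mul h)))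
    omega
variable {𝒯 : Tower}
lemma Dat.cf_sum {n : ℕ} {a : Bool → ℕ} (D : Dat n a) {ι : Type} [Fintype ι] (x : ι → ℂ) (F : ι → (∀ b, 𝒯.G (a b)) → ℂ) (π : 𝒯.G n → ℂ) :
    D.cf (fun g => ∑ i, x i * F i g) π = ∑ i, x i * D.cf (F i) π := by
  unfold Dat.cf ip
  simp only [sum_mul, mul_sum]
  rw [sum_comm]
  refine sum_congr rfl fun i _ => sum_congr rfl fun u _ => ?_
  ring
lemma co_assoc (α β γ π : 𝒯.Om) : (cc α β).sum (fun κ n => n * cc κ γ π) =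
    (cc β γ).sum (fun κ n => n * cc α κ π) := by
  simp only [cc_apply]
  rw [sum_cc α β rfl (fun κ => co κ γ π), sum_cc β γ rfl (fun κ => co α κ π)]
  by_cases hn : π.1 = α.1 + β.1 + γ.1
  · obtain ⟨Dc, D0, Dd, D1, h1, h2, h3, h4, h5, h6⟩ := Dat.assoc_data hn
    have H := Dat.assoc3 (𝒯 := 𝒯) Dc D0 Dd D1 h1 h2 h3 h4 h5 h6 (α := α.2.1) (β := β.2.1) (γ := γ.2.1) (π := π.2.1)
      (Irr.isChar α.2.2).isClass (Irr.isChar γ.2.2).isClass (Irr.isChar π.2.2).isClass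
    have L : Dc.cf (fun g => D0.m (fun h => α.2.1 (h false) * β.2.1 (h true)) (g false) * γ.2.1 (g true)) π.2.1 =
        ∑ χ : Irr (𝒯.G (α.1 + β.1)), (co α β ⟨_, χ⟩ * co ⟨_, χ⟩ γ π : ℂ) := by
      have e : ∀ χ : Irr (𝒯.G (α.1 + β.1)), (co α β ⟨_, χ⟩ * co ⟨_, χ⟩ γ π : ℂ) =
        D0.cf (FF α β) χ.1 * Dc.cf (FF ⟨_, χ⟩ γ) π.2.1 := fun χ =>
          congrArg₂ (· * ·) (co_eq α β ⟨_, χ⟩ D0) (co_eq ⟨α.1 + β.1, χ⟩ γ π Dc)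
      rw [sum_congr rfl fun χ _ => e χ]
      refine Eq.trans ?_ (Dc.cf_sum (fun χ : Irr (𝒯.G (α.1 + β.1)) => D0.cf (FF α β) χ.1) (fun χ => FF ⟨_, χ⟩ γ) π.2.1)
      refine congrArg (fun F => Dc.cf F π.2.1) (funext fun g => ?_)
      refine (congrArg (· * γ.2.1 (g true)) (congrFun (D0.m_expand (FF α β)) (g false))).trans ?_
      refine (sum_mul _ _ _).trans (sum_congr rfl fun χ _ => ?_)
      exact mul_assoc _ _ _
    have R : Dd.cf (fun g => D1.m (fun h => β.2.1 (h false) * γ.2.1 (h true)) (g true) * α.2.1 (g false)) π.2.1 =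
        ∑ χ : Irr (𝒯.G (β.1 + γ.1)), (co β γ ⟨_, χ⟩ * co α ⟨_, χ⟩ π : ℂ) := by
      have e : ∀ χ : Irr (𝒯.G (β.1 + γ.1)), (co β γ ⟨_, χ⟩ * co α ⟨_, χ⟩ π : ℂ) =
        D1.cf (FF β γ) χ.1 * Dd.cf (FF α ⟨_, χ⟩) π.2.1 := fun χ =>
          congrArg₂ (· * ·) (co_eq β γ ⟨_, χ⟩ D1) (co_eq α ⟨β.1 + γ.1, χ⟩ π Dd)
      rw [sum_congr rfl fun χ _ => e χ]
      refine Eq.trans ?_ (Dd.cf_sum (fun χ : Irr (𝒯.G (β.1 + γ.1)) => D1.cf (FF β γ) χ.1) (fun χ => FF α ⟨_, χ⟩) π.2.1)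
      refine congrArg (fun F => Dd.cf F π.2.1) (funext fun g => ?_)
      refine (congrArg (· * α.2.1 (g false)) (congrFun (D1.m_expand (FF β γ)) (g true))).trans ?_
      refine (sum_mul _ _ _).trans (sum_congr rfl fun χ _ => ?_)
      have cm : ∀ x y z : ℂ, x * y * z = x * (z * y) := fun x y z => by ring
      exact cm _ _ _
    rw [L, R] at H
    exact_mod_cast H
  · rw [sum_eq_zero, sum_eq_zero]
    · intro χ _
      have : co α ⟨_, χ⟩ π = 0 := by
        by_contra h
        have h' := co_deg h
        change _ = _ + (β.1 + γ.1) at h'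
        omega
      rw [this, mul_zero]
    · intro χ _
      have : co ⟨_, χ⟩ γ π = 0 := by
        by_contra h
        exact hn (co_deg h)
      rw [this, mul_zero]
lemma ip_inv_emb (n : ℕ) (σ π : Irr (𝒯.G n)) : ip σ.1 π.1 = if π = σ then 1 else 0 := by
  rw [ip_Irr σ.2 π.2]
  by_cases h : σ = π
  · subst h; simp
  · rw [if_neg, if_neg (fun h' => h h'.symm)]
    intro h'; exact h (Subtype.ext h')
end Tower
namespace Chr
lemma isChar_lin {G : Type} [Group G] (χ : G →* ℂ) : IsChar (fun g => χ g) := by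
  let ρ : Representation ℂ G ℂ := (Algebra.lmul ℂ ℂ).toMonoidHom.comp χ
  refine ⟨FDRep.of ρ, ?_⟩
  funext g
  change LinearMap.trace ℂ ℂ (Algebra.lmul ℂ ℂ (χ g)) = χ g
  have : (Algebra.lmul ℂ ℂ (χ g) : ℂ →ₗ[ℂ] ℂ) = χ g • LinearMap.id := by
    ext; simp
  rw [this, map_smul, LinearMap.trace_id]
  simp
lemma lin_mem_Irr {G : Type} [Group G] [Fintype G] (χ : G →* ℂ) : (fun g => χ g) ∈ Irr G := by
  rw [mem_Irr_iff]
  refine ⟨isChar_lin χ, ?_⟩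
  unfold ip
  have : ∀ g : G, χ g * χ g⁻¹ = 1 := fun g => by rw [← map_mul]; simp
  simp only [this, sum_const, card_univ, nsmul_eq_mul, mul_one, card_eq_fintype_card]
  exact inv_mul_cancel₀ (cast_ne_zero.2 card_ne_zero)
end Chr
namespace Tower
variable {𝒯 : Tower}
def one1 : 𝒯.Om := ⟨0, ⟨fun _ => 1, lin_mem_Irr (1 : 𝒯.G 0 →* ℂ)⟩⟩
lemma one1_val (h : 𝒯.G 0) : (one1 (𝒯 := 𝒯)).2.1 h = 1 := rfl
lemma co_one_left (τ : 𝒯.Om) : cc one1 τ = Finsupp.single τ 1 := by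
  ext π
  rw [cc_apply, Finsupp.single_apply]
  by_cases hd : π.1 = τ.1
  · obtain ⟨n, π⟩ := π
    obtain ⟨n', τ⟩ := τ
    change n = n' at hd
    subst hd
    let D : Dat n (bb 0 n) := ⟨fun _ => true, fun b => match b with
      | false => ⟨fun i => i.elim0, fun i => i.elim0⟩
      | true => Function.Embedding.refl _, fun b i => match b with
      | false => ⟨fun h => (Bool.false_ne_true h.symm).elim, fun ⟨j, _⟩ => j.elim0⟩
      | true => ⟨fun _ => ⟨i, rfl⟩, fun _ => rfl⟩⟩
    have h := co_eq one1 ⟨n, τ⟩ ⟨n, π⟩ D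
    have e : D.cf (FF one1 ⟨n, τ⟩) π.1 = ip τ.1 π.1 := by
      unfold Dat.cf ip
      let E : 𝒯.P D.c ≃ 𝒯.G n := ⟨fun u => u.1, fun x => ⟨x, 𝒯.P_const (fun _ => rfl) x⟩, fun _ => rfl, fun _ => rfl⟩
      refine congrArg₂ (· * ·) (congrArg (fun k : ℕ => (k:ℂ)⁻¹) (card_congr E)) (Fintype.sum_equiv E _ _ fun u => ?_)
      refine congrArg (· * π.1 (u.1)⁻¹) ((one_mul (τ.1 (𝒯.res (Function.Embedding.refl _) u.1))).trans ?_)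
      rw [𝒯.res_id]
      rfl
    change (co one1 ⟨n, τ⟩ ⟨n, π⟩ : ℂ) = D.cf (FF one1 ⟨n, τ⟩) π.1 at h
    rw [e, ip_inv_emb] at h
    have : ((⟨n, τ⟩ : 𝒯.Om) = ⟨n, π⟩) ↔ π = τ := ⟨fun h => (eq_of_heq (Sigma.mk.inj h).2).symm, fun h => by rw [h]⟩
    simp only [this]
    split_ifs at h ⊢ <;> exact_mod_cast h
  · rw [if_neg (fun h => hd (by rw [h]))]
    by_contra h
    exact hd ((co_deg h).trans (zero_add _))
lemma co_one_right (τ : 𝒯.Om) : cc τ one1 = Finsupp.single τ 1 := by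
  ext π
  rw [cc_apply, Finsupp.single_apply]
  by_cases hd : π.1 = τ.1
  · obtain ⟨n, π⟩ := π
    obtain ⟨n', τ⟩ := τ
    change n = n' at hd
    subst hd
    let D : Dat n (bb n 0) := ⟨fun _ => false, fun b => match b with
      | true => ⟨fun i => i.elim0, fun i => i.elim0⟩
      | false => Function.Embedding.refl _, fun b i => match b with
      | true => ⟨fun h => (Bool.false_ne_true h).elim, fun ⟨j, _⟩ => j.elim0⟩
      | false => ⟨fun _ => ⟨i, rfl⟩, fun _ => rfl⟩⟩
    have h := co_eq ⟨n, τ⟩ one1 ⟨n, π⟩ D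
    have e : D.cf (FF ⟨n, τ⟩ one1) π.1 = ip τ.1 π.1 := by
      unfold Dat.cf ip
      let E : 𝒯.P D.c ≃ 𝒯.G n := ⟨fun u => u.1, fun x => ⟨x, 𝒯.P_const (fun _ => rfl) x⟩, fun _ => rfl, fun _ => rfl⟩
      refine congrArg₂ (· * ·) (congrArg (fun k : ℕ => (k:ℂ)⁻¹) (card_congr E)) (Fintype.sum_equiv E _ _ fun u => ?_)
      refine congrArg (· * π.1 (u.1)⁻¹) ((mul_one (τ.1 (𝒯.res (Function.Embedding.refl _) u.1))).trans ?_)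
      rw [𝒯.res_id]
      rfl
    change (co ⟨n, τ⟩ one1 ⟨n, π⟩ : ℂ) = D.cf (FF ⟨n, τ⟩ one1) π.1 at h
    rw [e, ip_inv_emb] at h
    have : ((⟨n, τ⟩ : 𝒯.Om) = ⟨n, π⟩) ↔ π = τ := ⟨fun h => (eq_of_heq (Sigma.mk.inj h).2).symm, fun h => by rw [h]⟩
    simp only [this]
    split_ifs at h ⊢ <;> exact_mod_cast h
  · rw [if_neg (fun h => hd (by rw [h]))]
    by_contra h
    exact hd (co_deg h)
lemma eq_one1 (ω : 𝒯.Om) (h : ω.1 = 0) : ω = one1 := by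
  obtain ⟨n, χ⟩ := ω
  change n = 0 at h
  subst h
  have := 𝒯.G0
  have hχ := (mem_Irr_iff.1 χ.2).2
  obtain ⟨k, hk, hk1⟩ := Irr_one_pos χ.2
  have : ∀ g : 𝒯.G 0, g = 1 := fun g => Subsingleton.elim _ _
  have hc : ∀ g, χ.1 g = k := fun g => by rw [this g, hk1]
  unfold ip at hχ
  simp only [hc, sum_const, card_univ, nsmul_eq_mul, card_eq_fintype_card] at hχ
  rw [inv_mul_cancel_left₀ (cast_ne_zero.2 card_ne_zero)] at hχ
  have hk2 : k * k = 1 := by exact_mod_cast hχ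
  have hk3 : k = 1 := Nat.eq_one_of_mul_eq_one_left hk2
  unfold one1
  congr 1
  refine Subtype.ext (funext fun g => ?_)
  rw [hc, hk3, cast_one]
def psh (𝒯 : Tower) : PSH 𝒯.Om where
  deg := Sigma.fst
  one := one1
  c := cc
  cop := ccop
  mem_cop := mem_ccop
  deg_one := rfl
  eq_one := eq_one1
  c_deg h := co_deg h
  c_one_left := co_one_left
  c_one_right := co_one_right
  fin := fin_deg
  assoc := co_assoc
  hopf := co_hopf
/-- normalised degree data: `N n` such that `|G n| / |P c| = N n / (N a * N b)` -/
lemma co_dim (N : ℕ → ℚ) (hN : ∀ n, N n ≠ 0) (hP : ∀ {n : ℕ} {a : Bool → ℕ} (D : Dat n a), (Nat.card (𝒯.G n) : ℚ) / Nat.card (𝒯.P D.c) =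
    N n / (N (a false) * N (a true))) (dm : 𝒯.Om → ℕ) (hdm : ∀ ω : 𝒯.Om, ω.2.1 1 = dm ω) (σ τ : 𝒯.Om) :
    (cc σ τ).sum (fun π k => (k : ℚ) * (dm π / N π.1)) = (dm σ / N σ.1) * (dm τ / N τ.1) := by
  obtain ⟨D⟩ := Dat.exists_dat (n := σ.1 + τ.1) (a := bb σ.1 τ.1) rfl
  have h1 := D.m_one (FF (𝒯 := 𝒯) σ τ)
  rw [D.m_expand] at h1
  have h2 : ∑ χ : Irr (𝒯.G (σ.1 + τ.1)), (co σ τ ⟨_, χ⟩ * dm ⟨_, χ⟩ : ℂ) = 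
      (Nat.card (𝒯.G (σ.1 + τ.1)) / Nat.card (𝒯.P D.c)) * (dm σ * dm τ) := by
    have e1 : FF (𝒯 := 𝒯) σ τ 1 = dm σ * dm τ := congrArg₂ (· * ·) (hdm σ) (hdm τ)
    rw [e1] at h1
    rw [← h1]
    refine sum_congr rfl fun χ _ => ?_
    exact congrArg₂ (· * ·) (co_eq σ τ ⟨_, χ⟩ D) (hdm ⟨_, χ⟩).symm
  have h3 : ∑ χ : Irr (𝒯.G (σ.1 + τ.1)), (co σ τ ⟨_, χ⟩ * dm ⟨_, χ⟩ : ℚ) = 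
      (Nat.card (𝒯.G (σ.1 + τ.1)) / Nat.card (𝒯.P D.c)) * (dm σ * dm τ) := by
    apply Rat.cast_injective (α := ℂ)
    push_cast
    exact h2
  have h4 : (Nat.card (𝒯.G (σ.1 + τ.1)) : ℚ) / Nat.card (𝒯.P D.c) = N (σ.1 + τ.1) / (N σ.1 * N τ.1) := hP D
  rw [h4] at h3
  have hinj : Function.Injective (fun χ => ⟨σ.1 + τ.1, χ⟩ : Irr (𝒯.G (σ.1 + τ.1)) → 𝒯.Om) := fun _ _ h => eq_of_heq (Sigma.mk.inj h).2
  have h5 : (cc σ τ).sum (fun π k => (k : ℚ) * (dm π / N π.1)) = ∑ χ : Irr (𝒯.G (σ.1 + τ.1)), (co σ τ ⟨_, χ⟩ : ℚ) * (dm ⟨_, χ⟩ / N (σ.1 + τ.1)) := by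
    rw [← sum_image (s := univ) (g := (fun χ => ⟨σ.1 + τ.1, χ⟩ : Irr (𝒯.G (σ.1 + τ.1)) → 𝒯.Om))
      (f := fun κ => (co σ τ κ : ℚ) * (dm κ / N κ.1)) (fun x _ y _ h => hinj h)]
    refine Finsupp.sum_of_support_subset _ ?_ _ (by simp)
    rintro ⟨M, χ⟩ hχ
    rw [Finsupp.mem_support_iff, cc_apply] at hχ
    have := co_deg hχ
    change M = _ at this
    subst this
    exact mem_image_of_mem _ (mem_univ χ)
  rw [h5]
  have h6 : ∑ χ : Irr (𝒯.G (σ.1 + τ.1)), (co σ τ ⟨_, χ⟩ : ℚ) * (dm ⟨_, χ⟩ / N (σ.1 + τ.1)) =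
    (∑ χ : Irr (𝒯.G (σ.1 + τ.1)), (co σ τ ⟨_, χ⟩ * dm ⟨_, χ⟩ : ℚ)) / N (σ.1 + τ.1) := by
    rw [sum_div]
    exact sum_congr rfl fun χ _ => by ring
  rw [h6, h3]
  have := hN (σ.1 + τ.1)
  have := hN σ.1
  have := hN τ.1
  field_simp
end Tower
namespace Wr
lemma ai {X : Type} (σ : Equiv.Perm X) (i : X) : σ (σ⁻¹ i) = i := σ.apply_symm_apply i
lemma ia {X : Type} (σ : Equiv.Perm X) (i : X) : σ⁻¹ (σ i) = i := σ.symm_apply_apply i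
def rp {a n : ℕ} (e : Fin a ↪ Fin n) (σ : Equiv.Perm (Fin n)) : Equiv.Perm (Fin a) :=
  if h : ∃ τ : Equiv.Perm (Fin a), ∀ j, e (τ j) = σ (e j) then h.choose else 1
lemma rp_eq {a n : ℕ} {e : Fin a ↪ Fin n} {σ : Equiv.Perm (Fin n)} {τ : Equiv.Perm (Fin a)}
    (h : ∀ j, e (τ j) = σ (e j)) : rp e σ = τ := by
  have h' : ∃ τ : Equiv.Perm (Fin a), ∀ j, e (τ j) = σ (e j) := ⟨τ, h⟩
  unfold rp
  rw [dif_pos h']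
  ext j : 1
  exact e.injective ((h'.choose_spec j).trans (h j).symm)
lemma rp_spec {a n : ℕ} {c : Fin n → Bool} {b : Bool} {e : Fin a ↪ Fin n} (he : Cov c b e) {σ : Equiv.Perm (Fin n)}
    (hσ : ∀ i, c (σ i) = c i) (j : Fin a) : e (rp e σ j) = σ (e j) := by
  have h : ∀ j, ∃ j', e j' = σ (e j) := fun j => (he _).1 ((hσ _).trans ((he _).2 ⟨j, rfl⟩))
  choose τ hτ using h
  have inj : Function.Injective τ := fun x y h => by
    apply e.injective; apply σ.injective; rw [← hτ, ← hτ, h]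
  have := rp_eq (e := e) (σ := σ) (τ := Equiv.ofBijective τ (Finite.injective_iff_bijective.1 inj)) hτ
  rw [this]
  exact hτ j
variable {K : Type} [Group K]
def res {a n : ℕ} (e : Fin a ↪ Fin n) (x : WreathProductSymm K n) : WreathProductSymm K a := ⟨x.left ∘ e, rp e x.right⟩
def P {n : ℕ} (c : Fin n → Bool) : Subgroup (WreathProductSymm K n) where
  carrier := {x | ∀ i, c (x.right i) = c i}
  one_mem' := fun i => rfl
  mul_mem' := fun {x y} hx hy i => (hx _).trans (hy i)
  inv_mem' := fun {x} hx i => by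
    have := hx (x.right⁻¹ i)
    rw [Wr.ai] at this
    exact this.symm
lemma mem_P {n : ℕ} {c : Fin n → Bool} {x : WreathProductSymm K n} : x ∈ P c ↔ ∀ i, c (x.right i) = c i := Iff.rfl
lemma mul_left {n : ℕ} (x y : WreathProductSymm K n) (i : Fin n) : (x * y).left i = x.left i * y.left (x.right⁻¹ i) := rfl
def w {n : ℕ} (p : Equiv.Perm (Fin n)) : WreathProductSymm K n := ⟨1, p⟩
lemma glue {n : ℕ} {a : Bool → ℕ} {c : Fin n → Bool} {e : ∀ b, Fin (a b) ↪ Fin n} (he : ∀ b, Cov c b (e b))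
    (u : ∀ b, WreathProductSymm K (a b)) : ∃ x ∈ P c, (∀ b j, x.left (e b j) = (u b).left j) ∧
      ∀ b j, x.right (e b j) = e b ((u b).right j) := by
  have hx : ∀ i, ∃ s : Σ b, Fin (a b), e s.1 s.2 = i := fun i => 
    let ⟨j, hj⟩ := (he (c i) i).1 rfl
    ⟨⟨_, j⟩, hj⟩
  choose s hs using hx
  have hc : ∀ b j, c (e b j) = b := fun b j => (he b _).2 ⟨j, rfl⟩
  have hse : ∀ b j, s (e b j) = ⟨b, j⟩ := by
    intro b j
    have h := hs (e b j)
    generalize s (e b j) = t at h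
    obtain ⟨b', j'⟩ := t
    have h1 := congrArg c h
    rw [hc, hc] at h1
    change b' = b at h1
    subst h1
    have h2 : j' = j := (e b').injective h
    rw [h2]
  let f : Fin n → Fin n := fun i => e (s i).1 ((u (s i).1).right (s i).2)
  have fe : ∀ b j, f (e b j) = e b ((u b).right j) := by
    intro b j
    change e (s (e b j)).1 ((u (s (e b j)).1).right (s (e b j)).2) = _
    rw [hse]
  have inj : Function.Injective f := by
    intro i i' h
    have : ∀ i, ∃ b j, i = e b j := fun i => ⟨_, _, (hs i).symm⟩
    obtain ⟨b, j, rfl⟩ := this i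
    obtain ⟨b', j', rfl⟩ := this i'
    rw [fe, fe] at h
    have h1 := congrArg c h
    rw [hc, hc] at h1
    subst h1
    rw [(u b).right.injective ((e b).injective h)]
  refine ⟨⟨fun i => (u (s i).1).left (s i).2, Equiv.ofBijective f (Finite.injective_iff_bijective.1 inj)⟩, ?_, ?_, fe⟩
  · intro i
    obtain ⟨j, hj⟩ := (he (c i) i).1 rfl
    change c (f i) = _
    rw [← hj, fe, hc, hc]
  · intro b j
    change (u (s (e b j)).1).left (s (e b j)).2 = _
    rw [hse]
end Wr
def wrTower (K : Type) [Group K] [Fintype K] : Tower where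
  G n := WreathProductSymm K n
  fin n := ofEquiv _ SemidirectProduct.equivProd.symm
  P c := Wr.P c
  res e := Wr.res e
  w p := Wr.w p
  G0 := ⟨fun x y => SemidirectProduct.ext (Subsingleton.elim _ _) (Subsingleton.elim _ _)⟩
  P_const h x i := by rw [h, h]
  res_id x := SemidirectProduct.ext rfl (Wr.rp_eq fun _ => rfl)
  res_mul := by
    intro a n c b e he x hx y hy
    refine SemidirectProduct.ext ?_ ?_
    · funext i
      change x.left (e i) * y.left (x.right⁻¹ (e i)) = x.left (e i) * y.left (e ((Wr.rp e x.right)⁻¹ i))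
      refine congrArg (fun z => x.left (e i) * y.left z) ?_
      apply x.right.injective
      rw [Wr.ai, ← Wr.rp_spec he hx, Wr.ai]
    · refine Wr.rp_eq fun j => ?_
      change e (Wr.rp e x.right (Wr.rp e y.right j)) = x.right (y.right (e j))
      rw [Wr.rp_spec he hx, Wr.rp_spec he hy]
  res_mem := by
    intro a n c d b e he x hx hd i
    change d (e (Wr.rp e x.right i)) = d (e i)
    rw [Wr.rp_spec he hx, hd]
  res_res := by
    intro a a' k n c d b b' e e' f f' he hf he' hf' hh x hc hd
    refine SemidirectProduct.ext ?_ ?_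
    · funext i
      change x.left (e (f i)) = x.left (e' (f' i))
      rw [hh]
    · refine Wr.rp_eq fun j => ?_
      change f (Wr.rp f' (Wr.rp e' x.right) j) = Wr.rp e x.right (f j)
      apply e.injective
      rw [hh, Wr.rp_spec hf' (fun i => ?_), Wr.rp_spec he' hd, Wr.rp_spec he hc, hh]
      change c (e' (Wr.rp e' x.right i)) = c (e' i)
      rw [Wr.rp_spec he' hd, hc]
  surj2 := by
    intro n a c e he g
    obtain ⟨x, hx, h1, h2⟩ := Wr.glue he g
    exact ⟨x, hx, fun b => SemidirectProduct.ext (funext fun j => h1 b j) (Wr.rp_eq fun j => (h2 b j).symm)⟩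
  surj4 := by
    intro n a a' c d e f k g h he hf hg hh hgh u v hu hv huv
    obtain ⟨x, hx, h1, h2⟩ := Wr.glue he u
    have key : ∀ b' j', ∃ b l, h b' b l = j' := fun b' j' => ⟨_, (hh b' (c (f b' j')) j').1 rfl⟩
    refine ⟨x, hx, ?_, fun b => SemidirectProduct.ext (funext fun j => h1 b j) (Wr.rp_eq fun j => (h2 b j).symm), fun b' => SemidirectProduct.ext (funext fun j => ?_) (Wr.rp_eq fun j => ?_)⟩
    · intro i
      obtain ⟨j, hj⟩ := (he (c i) i).1 rfl
      rw [← hj, h2]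
      exact hu _ j
    · obtain ⟨b, l, rfl⟩ := key b' j
      change x.left (f b' _) = _
      rw [← hgh, h1]
      exact congrFun (congrArg SemidirectProduct.left (huv b b')) l
    · obtain ⟨b, l, rfl⟩ := key b' j
      rw [← hgh, h2]
      have e1 : Wr.rp (g b b') (u b).right l = Wr.rp (h b' b) (v b').right l := congrArg (· l) (congrArg SemidirectProduct.right (huv b b'))
      rw [← Wr.rp_spec (hh b' b) (hv b'), ← e1, ← hgh, Wr.rp_spec (hg b b') (hu b)]
  mem3 := by
    intro a n c d e hcd he x hx hr i
    cases hi : c i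
    · obtain ⟨j, rfl⟩ := (he i).1 hi
      rw [← Wr.rp_spec he hx]
      exact hr j
    · rw [hcd i hi, hcd _ ((hx i).trans hi)]
  mem3' := by
    intro a n c d e hcd he x hx hr i
    have hd1 : ∀ i, d i = false → c i = false := by
      intro i hi; by_contra h; rw [Bool.not_eq_false] at h; rw [hcd i h] at hi; cases hi
    cases hi : d i
    · rw [hd1 i hi, hd1 _ ((hx i).trans hi)]
    · obtain ⟨j, rfl⟩ := (he i).1 hi
      rw [← Wr.rp_spec he hx]
      exact hr j
  w_mem := by
    intro n c p x
    rw [Wr.mem_P, Wr.mem_P]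
    change (∀ i, c (p (x.right (p⁻¹ i))) = c i) ↔ ∀ i, c (p (x.right i)) = c (p i)
    constructor
    · intro h i
      have := h (p i)
      rwa [Wr.ia] at this
    · intro h i
      have := h (p⁻¹ i)
      rwa [Wr.ai] at this
  res_w := by
    intro a n e p x
    refine SemidirectProduct.ext ?_ ?_
    · funext i
      have : (Wr.w p * x * (Wr.w p)⁻¹ : WreathProductSymm K n).left (p (e i)) = x.left (e i) := by
        rw [Wr.mul_left, Wr.mul_left]
        change 1 * x.left (p⁻¹ (p (e i))) * 1⁻¹ = _
        rw [Wr.ia]; simp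
      exact this
    · change Wr.rp (e.trans p.toEmbedding) (p * x.right * p⁻¹) = Wr.rp e x.right
      by_cases h : ∃ τ : Equiv.Perm (Fin a), ∀ j, e (τ j) = x.right (e j)
      · obtain ⟨τ, hτ⟩ := h
        rw [Wr.rp_eq hτ]
        refine Wr.rp_eq fun j => ?_
        change p (e (τ j)) = p (x.right (p⁻¹ (p (e j))))
        rw [Wr.ia, hτ]
      · unfold Wr.rp
        rw [dif_neg h, dif_neg]
        rintro ⟨τ, hτ⟩
        refine h ⟨τ, fun j => ?_⟩
        have h1 : p (e (τ j)) = p (x.right (p⁻¹ (p (e j)))) := hτ j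
        rw [Wr.ia] at h1
        exact p.injective h1
  w_mul p p' := SemidirectProduct.ext (funext fun i => by rw [Wr.mul_left]; change (1 : K) = 1 * 1; simp) rfl
  w_color h := h
  dc := by
    intro n c d T
    refine ⟨T.right, ⟨T.left, 1⟩, fun _ => rfl, 1, one_mem _, ?_⟩
    rw [mul_one]
    refine SemidirectProduct.ext (funext fun i => ?_) ?_
    · rw [Wr.mul_left]; change T.left i = T.left i * 1; simp
    · change T.right = 1 * T.right; simp
  dc' := by
    intro n c d p p' u v hu hv h b b'
    have hr : u.right * p * v.right = p' := congrArg SemidirectProduct.right h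
    symm
    refine card_bij (fun i _ => v.right i) ?_ (fun _ _ _ _ h => v.right.injective h) ?_
    · intro i hi
      rw [mem_filter] at hi ⊢
      refine ⟨mem_univ _, ?_, (hv i).trans hi.2.2⟩
      rw [← hi.2.1, ← hr]
      exact (hu _).symm
    · intro i hi
      rw [mem_filter] at hi
      refine ⟨v.right⁻¹ i, ?_, by simp⟩
      rw [mem_filter]
      refine ⟨mem_univ _, ?_, ?_⟩
      · rw [← hi.2.1, ← hr]
        change c (u.right (p (v.right (v.right⁻¹ i)))) = _
        rw [hu]; simp
      · rw [← hi.2.2]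
        have := hv (v.right⁻¹ i)
        rw [← this]; simp
lemma wr_card (K : Type) [Group K] [Fintype K] (n : ℕ) : Nat.card ((wrTower K).G n) = Nat.card K ^ n * n.factorial := by
  change Nat.card (WreathProductSymm K n) = _
  rw [card_congr SemidirectProduct.equivProd, Nat.card_prod, Nat.card_perm, Nat.card_fun]
  simp
lemma wr_bij (K : Type) [Group K] [Fintype K] {n : ℕ} {a : Bool → ℕ} (D : Tower.Dat n a) : Function.Bijective (D.resH (𝒯 := wrTower K)) := by
  refine ⟨fun x y h => ?_, D.resH_surj⟩
  have hb : ∀ i, ∃ b j, D.e b j = i := fun i => ⟨_, (D.cov (D.c i) i).1 rfl⟩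
  have hh : ∀ b, Wr.res (D.e b) x.1 = Wr.res (D.e b) y.1 := fun b => congrFun h b
  refine Subtype.ext (SemidirectProduct.ext (funext fun i => ?_) (Equiv.ext fun i => ?_))
  · obtain ⟨b, j, rfl⟩ := hb i
    exact congrFun (congrArg SemidirectProduct.left (hh b)) j
  · obtain ⟨b, j, rfl⟩ := hb i
    have h1 : Wr.rp (D.e b) x.1.right j = Wr.rp (D.e b) y.1.right j := congrArg (· j) (congrArg SemidirectProduct.right (hh b))
    rw [← Wr.rp_spec (D.cov b) x.2, ← Wr.rp_spec (D.cov b) y.2, h1]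
lemma wr_index (K : Type) [Group K] [Fintype K] {n : ℕ} {a : Bool → ℕ} (D : Tower.Dat n a) :
    (Nat.card ((wrTower K).G n) : ℚ) / Nat.card ((wrTower K).P D.c) = 
      (n.factorial : ℚ) / ((a false).factorial * (a true).factorial) := by
  have h1 : Nat.card ((wrTower K).P D.c) = Nat.card (∀ b, (wrTower K).G (a b)) := card_congr (Equiv.ofBijective _ (wr_bij K D))
  rw [h1, card_pi, prod_bool, wr_card, wr_card, wr_card]
  have h0 : (Nat.card K : ℚ) ≠ 0 := cast_ne_zero.2 Nat.card_pos.ne'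
  push_cast
  have f1 := cast_ne_zero (R := ℚ).2 (factorial_ne_zero (a false))
  have f2 := cast_ne_zero (R := ℚ).2 (factorial_ne_zero (a true))
  rw [show (Nat.card K : ℚ) ^ n = Nat.card K ^ a true * Nat.card K ^ a false by rw [← pow_add, D.card, add_comm]]
  field_simp
set_option linter.unusedSectionVars false
namespace Gl
variable {F : Type} [Field F]
def Blk {n : ℕ} (c : Fin n → Bool) (M : Matrix (Fin n) (Fin n) F) : Prop := ∀ i j, c i = true → c j = false → M i j = 0
lemma Blk.mul {n : ℕ} {c : Fin n → Bool} {M N : Matrix (Fin n) (Fin n) F} (hM : Blk c M) (hN : Blk c N) : Blk c (M * N) := by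
  intro i j hi hj
  rw [Matrix.mul_apply]
  refine sum_eq_zero fun k _ => ?_
  cases hk : c k
  · rw [hM i k hi hk, zero_mul]
  · rw [hN k j hk hj, mul_zero]
lemma Blk.one {n : ℕ} (c : Fin n → Bool) : Blk c (1 : Matrix (Fin n) (Fin n) F) := by
  intro i j hi hj
  rw [Matrix.one_apply_ne]
  rintro rfl
  rw [hi] at hj; cases hj
lemma sub_mul {a n : ℕ} {c : Fin n → Bool} {b : Bool} {e : Fin a ↪ Fin n} (he : Cov c b e)
    {M N : Matrix (Fin n) (Fin n) F} (hM : Blk c M) (hN : Blk c N) :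
    (M * N).submatrix e e = M.submatrix e e * N.submatrix e e := by
  ext i j
  rw [submatrix_apply, Matrix.mul_apply, Matrix.mul_apply]
  symm
  refine sum_of_injOn e e.injective.injOn (fun _ _ => mem_coe.2 (mem_univ _)) ?_ (fun _ _ => rfl)
  intro k _ hk
  have hk' : c k ≠ b := fun h => hk (by obtain ⟨l, hl⟩ := (he k).1 h; exact ⟨l, by simp, hl⟩)
  have hi : c (e i) = b := (he _).2 ⟨i, rfl⟩
  have hj : c (e j) = b := (he _).2 ⟨j, rfl⟩
  cases b
  · rw [hN k _ (by simpa using hk') hj, mul_zero]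
  · rw [hM _ k hi (by simpa using hk'), zero_mul]
variable [Fintype F]
def P {n : ℕ} (c : Fin n → Bool) : Subgroup (GL (Fin n) F) where
  carrier := {x | Blk c x.1}
  one_mem' := Blk.one c
  mul_mem' := fun hx hy => Blk.mul hx hy
  inv_mem' := fun {x} hx => by
    have h : ∀ k : ℕ, Blk c (x ^ k).1 := by
      intro k
      induction k with
      | zero => exact Blk.one c
      | succ k ih => rw [pow_succ]; exact Blk.mul ih hx
    have : x⁻¹ = x ^ (orderOf x - 1) := by
      rw [inv_eq_iff_mul_eq_one, ← pow_succ', Nat.sub_add_cancel (orderOf_pos x), pow_orderOf_eq_one]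
    change Blk c (x⁻¹).1
    rw [this]; exact h _
lemma mem_P {n : ℕ} {c : Fin n → Bool} {x : GL (Fin n) F} : x ∈ P c ↔ Blk c x.1 := Iff.rfl
def res {a n : ℕ} (e : Fin a ↪ Fin n) (x : GL (Fin n) F) : GL (Fin a) F :=
  if h : IsUnit (x.1.submatrix e e) then h.unit else 1
lemma res_val {a n : ℕ} {c : Fin n → Bool} {b : Bool} {e : Fin a ↪ Fin n} (he : Cov c b e) {x : GL (Fin n) F} (hx : x ∈ P c) :
    (res e x).1 = x.1.submatrix e e := by
  have h : IsUnit (x.1.submatrix e e) := by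
    have h1 := sub_mul he (mem_P.1 hx) (mem_P.1 (inv_mem hx))
    have h2 := sub_mul he (mem_P.1 (inv_mem hx)) (mem_P.1 hx)
    rw [Units.mul_inv] at h1
    rw [Units.inv_mul] at h2
    refine ⟨⟨_, (x⁻¹).1.submatrix e e, ?_, ?_⟩, rfl⟩
    · exact h1.symm.trans (Matrix.submatrix_one e e.injective)
    · exact h2.symm.trans (Matrix.submatrix_one e e.injective)
  unfold res
  rw [dif_pos h]; rfl
def w {n : ℕ} (p : Equiv.Perm (Fin n)) : Matrix (Fin n) (Fin n) F := of fun i j => if i = p j then 1 else 0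
lemma mul_w {n : ℕ} (M : Matrix (Fin n) (Fin n) F) (p : Equiv.Perm (Fin n)) (i j : Fin n) : (M * (w p : Matrix (Fin n) (Fin n) F)) i j = M i (p j) := by
  rw [Matrix.mul_apply]; simp [w]
lemma w_mul' {n : ℕ} (M : Matrix (Fin n) (Fin n) F) (p : Equiv.Perm (Fin n)) (i j : Fin n) : ((w p : Matrix (Fin n) (Fin n) F) * M) (p i) j = M i j := by
  rw [Matrix.mul_apply]; simp [w]
lemma w_mulVec {n : ℕ} (p : Equiv.Perm (Fin n)) (x : Fin n → F) (i : Fin n) : (w p *ᵥ x) (p i) = x i := by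
  simp [Matrix.mulVec, dotProduct, w]
lemma w_one {n : ℕ} : (w 1 : Matrix (Fin n) (Fin n) F) = 1 := by
  ext i j
  by_cases h : i = j
  · subst h; simp [w]
  · rw [Matrix.one_apply_ne h]; simp [w, h]
lemma w_mul {n : ℕ} (p p' : Equiv.Perm (Fin n)) : (w (p * p') : Matrix (Fin n) (Fin n) F) = w p * w p' := by
  ext i j; rw [mul_w]; rfl
def wU {n : ℕ} (p : Equiv.Perm (Fin n)) : GL (Fin n) F where
  val := w p
  inv := w p⁻¹
  val_inv := by rw [← w_mul, mul_inv_cancel, w_one]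
  inv_val := by rw [← w_mul, inv_mul_cancel, w_one]
lemma conj_w {n : ℕ} (p : Equiv.Perm (Fin n)) (x : GL (Fin n) F) (i j : Fin n) : (wU p * x * (wU p)⁻¹).1 (p i) (p j) = x.1 i j := by
  change ((w p : Matrix (Fin n) (Fin n) F) * x.1 * (w p⁻¹ : Matrix (Fin n) (Fin n) F)) (p i) (p j) = _
  rw [mul_w, Wr.ia, w_mul']
def ext {a n : ℕ} (e : Fin a ↪ Fin n) (A : Matrix (Fin a) (Fin a) F) (i j : Fin n) : F :=
  if h : ∃ p : Fin a × Fin a, e p.1 = i ∧ e p.2 = j then A h.choose.1 h.choose.2 else 0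
lemma ext_apply {a n : ℕ} (e : Fin a ↪ Fin n) (A : Matrix (Fin a) (Fin a) F) (i j : Fin a) : ext e A (e i) (e j) = A i j := by
  have h : ∃ p : Fin a × Fin a, e p.1 = e i ∧ e p.2 = e j := ⟨(i, j), rfl, rfl⟩
  unfold ext
  rw [dif_pos h, e.injective h.choose_spec.1, e.injective h.choose_spec.2]
def cEq {a n : ℕ} {c : Fin n → Bool} {b : Bool} {e : Fin a ↪ Fin n} (he : Cov c b e) : Fin a ≃ {i // c i = b} :=
  Equiv.ofBijective (fun j => ⟨e j, (he _).2 ⟨j, rfl⟩⟩) ⟨fun x y h => e.injective (congrArg Subtype.val h), fun i => by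
    obtain ⟨j, hj⟩ := (he i.1).1 i.2
    exact ⟨j, Subtype.ext hj⟩⟩
lemma unit_of_blocks {n : ℕ} {a : Bool → ℕ} {c : Fin n → Bool} {e : ∀ b, Fin (a b) ↪ Fin n} (he : ∀ b, Cov c b (e b))
    {M : Matrix (Fin n) (Fin n) F} (hM : Blk c M) (hu : ∀ b, IsUnit (M.submatrix (e b) (e b))) : IsUnit M := by
  rw [isUnit_iff_isUnit_det]
  rw [Matrix.twoBlockTriangular_det M (fun i => c i = false) (fun i hi j hj => hM i j (by simpa using hi) hj)]
  refine IsUnit.mul ?_ ?_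
  · have := (isUnit_iff_isUnit_det _).1 (hu false)
    have e1 : M.submatrix (e false) (e false) = (M.toSquareBlockProp fun i => c i = false).submatrix (cEq (he false)) (cEq (he false)) := rfl
    rwa [e1, Matrix.det_submatrix_equiv_self] at this
  · have := (isUnit_iff_isUnit_det _).1 (hu true)
    let E : {i // c i = true} ≃ {i // ¬ c i = false} := Equiv.subtypeEquivRight (fun i => by simp)
    have e1 : M.submatrix (e true) (e true) = (M.toSquareBlockProp fun i => ¬ c i = false).submatrix ((cEq (he true)).trans E) ((cEq (he true)).trans E) := rfl
    rwa [e1, Matrix.det_submatrix_equiv_self] at this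
lemma glue {n : ℕ} {a : Bool → ℕ} {c : Fin n → Bool} {e : ∀ b, Fin (a b) ↪ Fin n} (he : ∀ b, Cov c b (e b))
    (u : ∀ b, GL (Fin (a b)) F) (Z : Matrix (Fin n) (Fin n) F) (hZ : Blk c Z) : ∃ x ∈ P c, (∀ b, res (e b) x = u b) ∧
    (∀ b i j, x.1 (e b i) (e b j) = (u b).1 i j) ∧ ∀ i j, c i ≠ c j → x.1 i j = Z i j := by
  let M : Matrix (Fin n) (Fin n) F := of fun i j => if c i = c j then ext (e (c i)) (u (c i)).1 i j else Z i j
  have hc : ∀ b j, c (e b j) = b := fun b j => (he b _).2 ⟨j, rfl⟩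
  have h1 : ∀ b i j, M (e b i) (e b j) = (u b).1 i j := by
    intro b i j
    change (if c (e b i) = c (e b j) then ext (e (c (e b i))) (u (c (e b i))).1 (e b i) (e b j) else _) = _
    rw [if_pos (by rw [hc, hc]), hc, ext_apply]
  have h2 : ∀ i j, c i ≠ c j → M i j = Z i j := fun i j h => if_neg h
  have hM : Blk c M := by
    intro i j hi hj
    rw [h2 i j (by rw [hi, hj]; decide)]
    exact hZ i j hi hj
  have hs : ∀ b, M.submatrix (e b) (e b) = (u b).1 := fun b => by ext i j; exact h1 b i j
  have hu := unit_of_blocks he hM (fun b => by rw [hs]; exact (u b).isUnit)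
  have hx : hu.unit ∈ P c := hM
  refine ⟨hu.unit, hx, fun b => ?_, h1, h2⟩
  apply Units.ext
  rw [res_val (he b) hx]
  exact hs b
def Ax {n : ℕ} (F : Type) [Field F] (I : Fin n → Prop) : Submodule F (Fin n → F) where
  carrier := {x | ∀ i, ¬ I i → x i = 0}
  zero_mem' := fun i _ => rfl
  add_mem' := fun {x y} hx hy i hi => by
    change x i + y i = 0
    rw [hx i hi, hy i hi, add_zero]
  smul_mem' := fun a x hx i hi => by
    change a * x i = 0
    rw [hx i hi, mul_zero]
lemma Ax_finrank {n : ℕ} (I : Fin n → Prop) : Module.finrank F (Ax F I) = (univ.filter I).card := by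
  let E : Ax F I ≃ₗ[F] ({i // I i} → F) :=
    { toFun := fun x i => x.1 i.1
      map_add' := fun x y => rfl
      map_smul' := fun a x => rfl
      invFun := fun y => ⟨fun i => if h : I i then y ⟨i, h⟩ else 0, fun i hi => dif_neg hi⟩
      left_inv := fun x => by
        ext i
        by_cases h : I i
        · exact dif_pos h
        · exact (dif_neg h).trans (x.2 i h).symm
      right_inv := fun y => by
        funext i
        exact dif_pos i.2 }
  rw [E.finrank_eq, Module.finrank_fintype_fun_eq_card, card_subtype]
lemma Blk.mulVec {n : ℕ} {c : Fin n → Bool} {M : Matrix (Fin n) (Fin n) F} (hM : Blk c M) {x : Fin n → F}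
    (hx : x ∈ Ax F (fun i => c i = false)) : M *ᵥ x ∈ Ax F (fun i => c i = false) := by
  intro i hi
  change ∑ j, M i j * x j = 0
  refine sum_eq_zero fun j _ => ?_
  by_cases hj : c j = false
  · rw [hM i j (by simpa using hi) hj, zero_mul]
  · rw [hx j hj, mul_zero]
lemma Blk.of_col {n : ℕ} {c : Fin n → Bool} {M : Matrix (Fin n) (Fin n) F}
    (h : ∀ j, c j = false → M.col j ∈ Ax F (fun i => c i = false)) : Blk c M := by
  intro i j hi hj
  exact h j hj i (fun h' : c i = false => by rw [hi] at h'; cases h')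
variable {F : Type} [Field F] [Fintype F]
lemma exists_colorEquiv {X Y : Type} [Fintype X] [Fintype Y] (f : X → Bool) (g : Y → Bool) (hXY : card X = card Y)
    (h : (univ.filter (fun i => f i = false)).card = (univ.filter (fun i => g i = false)).card) :
    ∃ E : X ≃ Y, ∀ i, g (E i) = f i := by
  have h2 : ∀ b, Nonempty ({i // f i = b} ≃ {i // g i = b}) := by
    intro b
    apply Fintype.card_eq.1
    rw [card_subtype, card_subtype]
    cases b
    · exact h
    · have h1 := card_filter_add_card_filter_not (s := (univ : Finset X)) (fun i => f i = false)
      have h2 := card_filter_add_card_filter_not (s := (univ : Finset Y)) (fun i => g i = false)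
      simp only [Bool.not_eq_false, card_univ] at h1 h2
      omega
  let E : X ≃ Y := (Equiv.sigmaFiberEquiv f).symm.trans ((Equiv.sigmaCongrRight fun b => (h2 b).some).trans (Equiv.sigmaFiberEquiv g))
  exact ⟨E, fun i => ((h2 (f i)).some ⟨i, rfl⟩).2⟩
lemma adapted {n : ℕ} (A B : Submodule F (Fin n → F)) (c d : Fin n → Bool)
    (hA : Module.finrank F A = (univ.filter (fun i => c i = false)).card)
    (hB : Module.finrank F B = (univ.filter (fun i => d i = false)).card) :
    ∃ (y : Module.Basis (Fin n) F (Fin n → F)) (p : Equiv.Perm (Fin n)), (∀ i, c i = false → y i ∈ A) ∧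
      ∀ i, d i = false → y (p i) ∈ B := by
  obtain ⟨A', hA'⟩ := Submodule.exists_isCompl ((A ⊓ B).comap A.subtype)
  obtain ⟨B', hB'⟩ := Submodule.exists_isCompl ((A ⊓ B).comap B.subtype)
  obtain ⟨C, hC⟩ := Submodule.exists_isCompl (A ⊔ B)
  let X : Bool × Bool → Submodule F (Fin n → F) := fun s =>
    match s with
    | (false, false) => A ⊓ B
    | (false, true) => A'.map A.subtype
    | (true, false) => B'.map B.subtype
    | (true, true) => C
  let k : Bool × Bool → ℕ := fun s => Module.finrank F (X s)
  have supA : X (false, false) ⊔ X (false, true) = A := by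
    have h1 := congrArg (Submodule.map A.subtype) hA'.sup_eq_top
    rw [Submodule.map_sup, Submodule.map_comap_subtype, Submodule.map_subtype_top] at h1
    rwa [inf_eq_right.2 (inf_le_left : A ⊓ B ≤ A)] at h1
  have supB : X (false, false) ⊔ X (true, false) = B := by
    have h1 := congrArg (Submodule.map B.subtype) hB'.sup_eq_top
    rw [Submodule.map_sup, Submodule.map_comap_subtype, Submodule.map_subtype_top] at h1
    rwa [inf_eq_right.2 (inf_le_right : A ⊓ B ≤ B)] at h1
  have dA : k (false, false) + k (false, true) = Module.finrank F A := by
    have h1 := Submodule.finrank_add_eq_of_isCompl hA'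
    rw [(Submodule.comapSubtypeEquivOfLe (inf_le_left : A ⊓ B ≤ A)).finrank_eq] at h1
    have h2 : Module.finrank F (A'.map A.subtype) = Module.finrank F A' := Submodule.finrank_map_subtype_eq _ _
    change Module.finrank F (A ⊓ B : Submodule F _) + Module.finrank F (A'.map A.subtype) = _
    rw [h2]; exact h1
  have dB : k (false, false) + k (true, false) = Module.finrank F B := by
    have h1 := Submodule.finrank_add_eq_of_isCompl hB'
    rw [(Submodule.comapSubtypeEquivOfLe (inf_le_right : A ⊓ B ≤ B)).finrank_eq] at h1
    have h2 : Module.finrank F (B'.map B.subtype) = Module.finrank F B' := Submodule.finrank_map_subtype_eq _ _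
    change Module.finrank F (A ⊓ B : Submodule F _) + Module.finrank F (B'.map B.subtype) = _
    rw [h2]; exact h1
  have dC : k (false, false) + k (false, true) + k (true, false) + k (true, true) = n := by
    have h1 := Submodule.finrank_add_eq_of_isCompl hC
    have h2 := Submodule.finrank_sup_add_finrank_inf_eq A B
    rw [Module.finrank_fintype_fun_eq_card, card_fin] at h1
    change _ + k (true, true) = n at h1
    change _ + k (false, false) = _ at h2
    omega
  let T := Σ s, Fin (k s)
  let z : T → Fin n → F := fun t => (Module.finBasis F (X t.1) t.2 : Fin n → F)
  have cT : card T = n := by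
    rw [card_sigma]
    simp only [card_fin, sum_prod_type, Fintype.sum_bool]
    omega
  have hz : ∀ s, X s ≤ Submodule.span F (Set.range z) := by
    intro s
    have h1 : X s = Submodule.map (X s).subtype (Submodule.span F (Set.range (Module.finBasis F (X s)))) := by
      rw [Module.Basis.span_eq, Submodule.map_subtype_top]
    rw [h1, Submodule.map_span]
    apply Submodule.span_mono
    rintro _ ⟨_, ⟨j, rfl⟩, rfl⟩
    exact ⟨⟨s, j⟩, rfl⟩
  have hspan : ⊤ ≤ Submodule.span F (Set.range z) := by
    rw [← hC.sup_eq_top, ← supA, ← supB]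
    exact sup_le (sup_le (sup_le (hz (false, false)) (hz (false, true))) (sup_le (hz (false, false)) (hz (true, false)))) (hz (true, true))
  let Z := basisOfTopLeSpanOfCardEqFinrank z hspan (by rw [cT, Module.finrank_fintype_fun_eq_card, card_fin])
  have hZ : ∀ t, Z t = z t := fun t => by simp [Z]
  have cF : ∀ (P : Bool × Bool → Prop), (univ.filter (fun t : T => P t.1)).card = ∑ s, if P s then k s else 0 := by
    intro P
    rw [Finset.card_filter, sum_sigma]
    refine sum_congr rfl fun s _ => ?_
    split_ifs <;> simp
  obtain ⟨E1, hE1⟩ := exists_colorEquiv c (fun t : T => t.1.1) (by rw [cT, card_fin]) (by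
    rw [← hA, ← dA]
    refine Eq.trans ?_ (Eq.trans (cF (fun s => s.1 = false)).symm (by congr!))
    simp [sum_prod_type]; try omega)
  obtain ⟨E2, hE2⟩ := exists_colorEquiv d (fun t : T => t.1.2) (by rw [cT, card_fin]) (by
    rw [← hB, ← dB]
    refine Eq.trans ?_ (Eq.trans (cF (fun s => s.2 = false)).symm (by congr!))
    simp [sum_prod_type]; try omega)
  have hzX : ∀ t, z t ∈ X t.1 := fun t => (Module.finBasis F (X t.1) t.2).2
  refine ⟨Z.reindex E1.symm, E2.trans E1.symm, fun i hi => ?_, fun i hi => ?_⟩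
  · rw [Module.Basis.reindex_apply, hZ, Equiv.symm_symm]
    have h1 := hzX (E1 i)
    have h2 := hE1 i
    rw [hi] at h2
    generalize E1 i = t at h1 h2
    rw [← supA]
    obtain ⟨⟨b, b'⟩, j⟩ := t
    change b = false at h2
    subst h2
    cases b'
    · exact Submodule.mem_sup_left h1
    · exact Submodule.mem_sup_right h1
  · rw [Module.Basis.reindex_apply, hZ, Equiv.symm_symm]
    simp only [Equiv.trans_apply, Equiv.apply_symm_apply]
    have h1 := hzX (E2 i)
    have h2 := hE2 i
    rw [hi] at h2
    generalize E2 i = t at h1 h2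
    rw [← supB]
    obtain ⟨⟨b, b'⟩, j⟩ := t
    change b' = false at h2
    subst h2
    cases b
    · exact Submodule.mem_sup_left h1
    · exact Submodule.mem_sup_right h1
variable {F : Type} [Field F] [Fintype F]
lemma res_mem {a n : ℕ} {c d : Fin n → Bool} {b : Bool} {e : Fin a ↪ Fin n} (he : Cov c b e)
    (x : GL (Fin n) F) (hx : x ∈ P c) (hd : x ∈ P d) : res e x ∈ P (d ∘ e) := by
  rw [mem_P, res_val he hx]
  exact fun i j hi hj => hd _ _ hi hj
lemma res_res {a a' k n : ℕ} {c d : Fin n → Bool} {b b' : Bool} {e : Fin a ↪ Fin n} {e' : Fin a' ↪ Fin n}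
    {f : Fin k ↪ Fin a} {f' : Fin k ↪ Fin a'} (h1 : Cov c b e) (h2 : Cov (d ∘ e) b' f) (h3 : Cov d b' e') (h4 : Cov (c ∘ e') b f')
    (h5 : ∀ i, e (f i) = e' (f' i)) (x : GL (Fin n) F) (hx : x ∈ P c) (hd : x ∈ P d) : res f (res e x) = res f' (res e' x) := by
  apply Units.ext
  rw [res_val h2 (res_mem h1 x hx hd), res_val h1 hx, res_val h4 (res_mem h3 x hd hx), res_val h3 hd]
  ext i j
  change x.1 (e (f i)) (e (f j)) = x.1 (e' (f' i)) (e' (f' j))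
  rw [h5, h5]
lemma surj4 {n : ℕ} {a a' : Bool → ℕ} {c d : Fin n → Bool} {e : ∀ b, Fin (a b) ↪ Fin n}
    {f : ∀ b, Fin (a' b) ↪ Fin n} {k : Bool → Bool → ℕ} {g : ∀ b b', Fin (k b b') ↪ Fin (a b)}
    {h : ∀ b' b, Fin (k b b') ↪ Fin (a' b')}
    (he : ∀ b, Cov c b (e b)) (hf : ∀ b, Cov d b (f b)) (hg : ∀ b b', Cov (d ∘ e b) b' (g b b'))
    (hh : ∀ b' b, Cov (c ∘ f b') b (h b' b)) (hc : ∀ b b' i, e b (g b b' i) = f b' (h b' b i))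
    (u : ∀ b, GL (Fin (a b)) F) (v : ∀ b', GL (Fin (a' b')) F) (hu : ∀ b, u b ∈ P (d ∘ e b)) (hv : ∀ b', v b' ∈ P (c ∘ f b'))
    (huv : ∀ b b', res (g b b') (u b) = res (h b' b) (v b')) :
    ∃ x ∈ P c, x ∈ P d ∧ (∀ b, res (e b) x = u b) ∧ ∀ b', res (f b') x = v b' := by
  have hdf : ∀ b j, d (f b j) = b := fun b j => (hf b _).2 ⟨j, rfl⟩
  let Z : Matrix (Fin n) (Fin n) F := of fun i j => if d i = d j then ext (f (d i)) (v (d i)).1 i j else 0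
  have hZ1 : ∀ b i j, Z (f b i) (f b j) = (v b).1 i j := by
    intro b i j
    change (if d (f b i) = d (f b j) then ext (f (d (f b i))) (v (d (f b i))).1 (f b i) (f b j) else _) = _
    rw [if_pos (by rw [hdf, hdf]), hdf, ext_apply]
  have hZ2 : ∀ i j, d i ≠ d j → Z i j = 0 := fun i j h => if_neg h
  have hZ : Blk c Z := by
    intro i j hi hj
    by_cases hd : d i = d j
    · obtain ⟨i', hi'⟩ := (hf (d j) i).1 hd
      obtain ⟨j', hj'⟩ := (hf (d j) j).1 rfl
      have := hZ1 (d j) i' j'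
      rw [hi', hj'] at this
      rw [this]
      refine hv _ i' j' ?_ ?_
      · change c (f (d j) i') = true
        rw [hi', hi]
      · change c (f (d j) j') = false
        rw [hj', hj]
    · exact hZ2 i j hd
  obtain ⟨x, hx, h1, h2, h3⟩ := glue he u Z hZ
  have hxd : x ∈ P d := by
    intro i j hi hj
    by_cases hcc : c i = c j
    · obtain ⟨i', hi'⟩ := (he (c j) i).1 hcc
      obtain ⟨j', hj'⟩ := (he (c j) j).1 rfl
      have := h2 (c j) i' j'
      rw [hi', hj'] at this
      rw [this]
      refine hu _ i' j' ?_ ?_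
      · change d (e (c j) i') = true
        rw [hi', hi]
      · change d (e (c j) j') = false
        rw [hj', hj]
    · rw [h3 i j hcc]
      exact hZ2 i j (by rw [hi, hj]; decide)
  refine ⟨x, hx, hxd, h1, fun b' => ?_⟩
  apply Units.ext
  rw [res_val (hf b') hxd]
  ext i j
  change x.1 (f b' i) (f b' j) = _
  by_cases hcc : c (f b' i) = c (f b' j)
  · generalize hb : c (f b' j) = b at hcc
    obtain ⟨i', hi'⟩ := (hh b' b i).1 hcc
    obtain ⟨j', hj'⟩ := (hh b' b j).1 hb
    have e1 := congrArg (fun z : GL (Fin (k b b')) F => z.1 i' j') (huv b b')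
    beta_reduce at e1
    rw [res_val (hg b b') (hu b), res_val (hh b' b) (hv b')] at e1
    change (u b).1 (g b b' i') (g b b' j') = (v b').1 (h b' b i') (h b' b j') at e1
    rw [hi', hj', ← h2, hc, hc, hi', hj'] at e1
    exact e1
  · rw [h3 _ _ hcc, hZ1]
lemma dc {n : ℕ} (c d : Fin n → Bool) (T : GL (Fin n) F) : ∃ p, ∃ u ∈ P c, ∃ v ∈ P d, T = u * wU p * v := by
  have hT : ∀ x, T.1 *ᵥ x = 0 → x = 0 := by
    intro x hx
    have : (T⁻¹).1 *ᵥ (T.1 *ᵥ x) = 0 := by rw [hx, Matrix.mulVec_zero]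
    rwa [mulVec_mulVec, Units.inv_mul, one_mulVec] at this
  let L : (Fin n → F) →ₗ[F] (Fin n → F) := T.1.mulVecLin
  have hL : Function.Injective L := (injective_iff_map_eq_zero L).2 hT
  obtain ⟨y, p, hy1, hy2⟩ := adapted (Ax F (fun i => c i = false)) ((Ax F (fun i => d i = false)).map L) c d
    (by rw [Ax_finrank]; congr!) (by
      rw [← (Submodule.equivMapOfInjective L hL (Ax F (fun i => d i = false))).finrank_eq, Ax_finrank]; congr!)
  let U : GL (Fin n) F := ⟨(Pi.basisFun F (Fin n)).toMatrix y, y.toMatrix (Pi.basisFun F (Fin n)),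
    Module.Basis.toMatrix_mul_toMatrix_flip _ _, Module.Basis.toMatrix_mul_toMatrix_flip _ _⟩
  have hU : ∀ i j, U.1 i j = y j i := fun i j => by
    change (Pi.basisFun F (Fin n)).toMatrix y i j = _
    rw [Module.Basis.toMatrix_apply, Pi.basisFun_repr]
  have hUc : U ∈ P c := by
    apply Blk.of_col
    intro j hj i hi
    change U.1 i j = 0
    rw [hU]; exact hy1 j hj i hi
  have hV : T⁻¹ * U * wU p ∈ P d := by
    apply Blk.of_col
    intro j hj
    obtain ⟨x, hx, hxy⟩ := hy2 j hj
    have : (T⁻¹ * U * wU p).1.col j = x := by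
      funext i
      change ((T⁻¹).1 * U.1 * (w p : Matrix (Fin n) (Fin n) F)) i j = _
      rw [mul_w, Matrix.mul_apply]
      change ((T⁻¹).1 *ᵥ (fun k => U.1 k (p j))) i = x i
      have e1 : (fun k => U.1 k (p j)) = T.1 *ᵥ x := by
        funext k; rw [hU, ← hxy]; rfl
      rw [e1, mulVec_mulVec, Units.inv_mul, one_mulVec]
    rw [this]; exact hx
  refine ⟨p, U, hUc, (T⁻¹ * U * wU p)⁻¹, inv_mem hV, ?_⟩
  group
lemma dc_le {n : ℕ} (c d : Fin n → Bool) (p p' : Equiv.Perm (Fin n)) (u v : GL (Fin n) F) (hu : u ∈ P c) (hv : v ∈ P d)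
    (h : u * wU p * v = wU p') : (univ.filter (fun i => c (p' i) = false ∧ d i = false)).card ≤
      (univ.filter (fun i => c (p i) = false ∧ d i = false)).card := by
  have key : ∀ (p : Equiv.Perm (Fin n)) (x : Fin n → F), x ∈ Ax F (fun i => c (p i) = false ∧ d i = false) ↔
      x ∈ Ax F (fun i => d i = false) ∧ (w p : Matrix (Fin n) (Fin n) F) *ᵥ x ∈ Ax F (fun i => c i = false) := by
    intro p x
    constructor
    · intro hx
      refine ⟨fun i hi => hx i (fun h' => hi h'.2), fun i hi => ?_⟩
      obtain ⟨j, rfl⟩ := p.surjective i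
      rw [w_mulVec]
      exact hx j (fun h' => hi h'.1)
    · rintro ⟨h1, h2⟩ i hi
      by_cases hd : d i = false
      · have := h2 (p i) (fun h' => hi ⟨h', hd⟩)
        rwa [w_mulVec] at this
      · exact h1 i hd
  have hv0 : ∀ x, v.1 *ᵥ x = 0 → x = 0 := by
    intro x hx
    have : (v⁻¹).1 *ᵥ (v.1 *ᵥ x) = 0 := by rw [hx, Matrix.mulVec_zero]
    rwa [mulVec_mulVec, Units.inv_mul, one_mulVec] at this
  let L : (Fin n → F) →ₗ[F] (Fin n → F) := v.1.mulVecLin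
  have hL : Function.Injective L := (injective_iff_map_eq_zero L).2 hv0
  have hle : (Ax F (fun i => c (p' i) = false ∧ d i = false)).map L ≤ Ax F (fun i => c (p i) = false ∧ d i = false) := by
    rintro _ ⟨x, hx, rfl⟩
    obtain ⟨h1, h2⟩ := (key p' x).1 hx
    refine (key p _).2 ⟨Blk.mulVec hv h1, ?_⟩
    change (w p : Matrix (Fin n) (Fin n) F) *ᵥ (v.1 *ᵥ x) ∈ _
    have e1 : wU p * v = u⁻¹ * wU p' := by rw [← h]; group
    have e2 : (w p : Matrix (Fin n) (Fin n) F) * v.1 = (u⁻¹).1 * (w p' : Matrix (Fin n) (Fin n) F) := congrArg Units.val e1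
    rw [mulVec_mulVec, e2, ← mulVec_mulVec]
    exact Blk.mulVec (mem_P.1 (inv_mem hu)) h2
  have := Submodule.finrank_mono hle
  rw [← (Submodule.equivMapOfInjective L hL _).finrank_eq, Ax_finrank, Ax_finrank] at this
  convert this
lemma margins {n : ℕ} (s t : Fin n → Bool) (b b' : Bool) :
    (univ.filter (fun i => s i = b ∧ t i = b')).card + (univ.filter (fun i => s i = (!b) ∧ t i = b')).card
      = (univ.filter (fun i => t i = b')).card ∧
    (univ.filter (fun i => s i = b ∧ t i = b')).card + (univ.filter (fun i => s i = b ∧ t i = (!b'))).card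
      = (univ.filter (fun i => s i = b)).card := by
  simp only [Finset.card_filter, ← sum_add_distrib]
  constructor <;> (refine sum_congr rfl fun i _ => ?_) <;> cases s i <;> cases t i <;> cases b <;> cases b' <;> simp
lemma dc' {n : ℕ} (c d : Fin n → Bool) (p p' : Equiv.Perm (Fin n)) (u v : GL (Fin n) F) (hu : u ∈ P c) (hv : v ∈ P d)
    (h : u * wU p * v = wU p') (b b' : Bool) : (univ.filter (fun i => c (p i) = b ∧ d i = b')).card =
      (univ.filter (fun i => c (p' i) = b ∧ d i = b')).card := by
  have h1 := dc_le c d p p' u v hu hv h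
  have h2 := dc_le c d p' p u⁻¹ v⁻¹ (inv_mem hu) (inv_mem hv) (by rw [← h]; group)
  have m1 := margins (c ∘ p) d
  have m2 := margins (c ∘ p') d
  have e1 : ∀ p : Equiv.Perm (Fin n), (univ.filter (fun i => c (p i) = false)).card = (univ.filter (fun i => c i = false)).card := by
    intro p
    refine card_bij (fun i _ => p i) (fun i hi => by simpa using hi) (fun _ _ _ _ h => p.injective h) (fun i hi => ⟨p⁻¹ i, ?_, Wr.ai p i⟩)
    simpa [Wr.ai] using hi
  have e2 := (e1 p).trans (e1 p').symm
  have a1 := m1 false false; have a2 := m2 false false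
  have b1 := m1 false true; have b2 := m2 false true
  have c1 := m1 true false; have c2 := m2 true false
  simp only [Function.comp_apply, Bool.not_false, Bool.not_true] at a1 a2 b1 b2 c1 c2
  cases b <;> cases b' <;> omega
lemma mem3 {a n : ℕ} {c d : Fin n → Bool} {e : Fin a ↪ Fin n} (h : ∀ i, c i = true → d i = true)
    (he : Cov c false e) (x : GL (Fin n) F) (hx : x ∈ P c) (hr : res e x ∈ P (d ∘ e)) : x ∈ P d := by
  rw [mem_P, res_val he hx] at hr
  intro i j hi hj
  have hcj : c j = false := by
    cases hc : c j
    · rfl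
    · rw [h j hc] at hj; cases hj
  cases hc : c i
  · obtain ⟨i', rfl⟩ := (he i).1 hc
    obtain ⟨j', rfl⟩ := (he j).1 hcj
    exact hr i' j' hi hj
  · exact hx i j hc hcj
lemma mem3' {a n : ℕ} {c d : Fin n → Bool} {e : Fin a ↪ Fin n} (h : ∀ i, c i = true → d i = true)
    (he : Cov d true e) (x : GL (Fin n) F) (hx : x ∈ P d) (hr : res e x ∈ P (c ∘ e)) : x ∈ P c := by
  rw [mem_P, res_val he hx] at hr
  intro i j hi hj
  cases hd : d j
  · exact hx i j (h i hi) hd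
  · obtain ⟨i', rfl⟩ := (he i).1 (h i hi)
    obtain ⟨j', rfl⟩ := (he j).1 hd
    exact hr i' j' hi hj
lemma res_w {a n : ℕ} (e : Fin a ↪ Fin n) (p : Equiv.Perm (Fin n)) (x : GL (Fin n) F) :
    res (e.trans p.toEmbedding) (wU p * x * (wU p)⁻¹) = res e x := by
  have : (wU p * x * (wU p)⁻¹).1.submatrix (e.trans p.toEmbedding) (e.trans p.toEmbedding) = x.1.submatrix e e := by
    ext i j; exact conj_w p x _ _
  unfold res
  simp only [this]
end Gl
def glTower (F : Type) [Field F] [Fintype F] : Tower where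
  G n := GL (Fin n) F
  P := Gl.P
  res := Gl.res
  w := Gl.wU
  G0 := inferInstanceAs (Subsingleton (GL (Fin 0) F))
  P_const := by
    intro n c b h x i j hi hj
    rw [h] at hi hj; rw [hi] at hj; cases hj
  res_id := by
    intro n x
    unfold Gl.res
    rw [dif_pos (by exact x.isUnit)]
    apply Units.ext; rfl
  res_mul := by
    intro a n c b e he x hx y hy
    apply Units.ext
    rw [Gl.res_val he (mul_mem hx hy), Units.val_mul, Units.val_mul, Gl.res_val he hx, Gl.res_val he hy]
    exact Gl.sub_mul he hx hy
  res_mem := fun he => Gl.res_mem he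
  res_res := fun h1 h2 h3 h4 h5 => Gl.res_res h1 h2 h3 h4 h5
  surj2 := by
    intro n a c e he g
    obtain ⟨x, hx, h, _⟩ := Gl.glue he g 0 (fun _ _ _ _ => rfl)
    exact ⟨x, hx, h⟩
  surj4 := fun he hf hg hh hc u v => Gl.surj4 he hf hg hh hc u v
  mem3 := fun h he => Gl.mem3 h he
  mem3' := fun h he => Gl.mem3' h he
  w_mem := by
    intro n c p x
    constructor
    · intro h i j hi hj
      rw [← Gl.conj_w p]; exact h _ _ hi hj
    · intro h i j hi hj
      obtain ⟨i, rfl⟩ := p.surjective i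
      obtain ⟨j, rfl⟩ := p.surjective j
      rw [Gl.conj_w]; exact h _ _ hi hj
  res_w := Gl.res_w
  w_mul := fun p p' => Units.ext (Gl.w_mul p p')
  w_color := by
    intro n c p h i j hi hj
    change (if i = p j then (1 : F) else 0) = 0
    rw [if_neg]
    rintro rfl
    rw [h, hj] at hi; cases hi
  dc := Gl.dc
  dc' := fun c d p p' u v hu hv h => Gl.dc' c d p p' u v hu hv h
namespace Tower
variable {𝒯 : Tower}
lemma Dat.r_expand {n : ℕ} {a : Bool → ℕ} (D : Dat n a) (π : Irr (𝒯.G n)) (g : ∀ b, 𝒯.G (a b)) :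
    D.r π.1 g = ∑ σ : Irr (𝒯.G (a false)), ∑ τ : Irr (𝒯.G (a true)),
      (co ⟨a false, σ⟩ ⟨a true, τ⟩ ⟨n, π⟩ : ℂ) * (σ.1 (g false) * τ.1 (g true)) := by
  rw [expand_pi (D.r_class (Irr.isChar π.2).isClass) g]
  rw [← sum_product', Finset.univ_product_univ, ← Equiv.sum_comp (boolPi (fun b => Irr (𝒯.G (a b))))]
  refine sum_congr rfl fun χ _ => ?_
  have h1 := co_eq' D χ π
  rw [Dat.cf_eq_r, ip_comm] at h1
  rw [← h1]
  unfold tens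
  rw [prod_bool, mul_comm (((χ true).1) _)]
  rfl
lemma sum_ccop {R : Type} [CommSemiring R] {n : ℕ} (π : Irr (𝒯.G n)) (f : 𝒯.Om → 𝒯.Om → R) :
    ∑ p ∈ ccop ⟨n, π⟩, (co p.1 p.2 ⟨n, π⟩ : R) * f p.1 p.2 = ∑ N : Fin (n + 1),
      ∑ σ : Irr (𝒯.G N), ∑ τ : Irr (𝒯.G (n - N)), (co ⟨N, σ⟩ ⟨n - N, τ⟩ ⟨n, π⟩ : R) * f ⟨N, σ⟩ ⟨n - N, τ⟩ := by
  have h1 : ∀ N : Fin (n + 1), ∑ σ : Irr (𝒯.G N), ∑ τ : Irr (𝒯.G (n - N)), (co ⟨N, σ⟩ ⟨n - N, τ⟩ ⟨n, π⟩ : R) * f ⟨N, σ⟩ ⟨n - N, τ⟩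
      = ∑ x : Irr (𝒯.G N) × Irr (𝒯.G (n - N)), (co ⟨N, x.1⟩ ⟨n - N, x.2⟩ ⟨n, π⟩ : R) * f ⟨N, x.1⟩ ⟨n - N, x.2⟩ := by
    intro N
    rw [← sum_product', Finset.univ_product_univ]
  simp only [h1]
  rw [← Fintype.sum_sigma']
  let φ : (Σ N : Fin (n + 1), Irr (𝒯.G N) × Irr (𝒯.G (n - N))) → 𝒯.Om × 𝒯.Om := fun x => (⟨x.1, x.2.1⟩, ⟨n - x.1, x.2.2⟩)
  have hφ : Function.Injective φ := by
    rintro ⟨⟨N, hN⟩, σ, τ⟩ ⟨⟨N', hN'⟩, σ', τ'⟩ h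
    obtain ⟨h1, h2⟩ := Prod.mk.inj h
    obtain ⟨h3, h4⟩ := Sigma.mk.inj h1
    dsimp only at h3
    subst h3
    obtain ⟨_, h5⟩ := Sigma.mk.inj h2
    have h6 : σ = σ' := eq_of_heq h4
    have h7 : τ = τ' := eq_of_heq h5
    rw [h6, h7]
  have hsub : ccop ⟨n, π⟩ ⊆ univ.image φ := by
    rintro ⟨⟨N, σ⟩, ⟨k, τ⟩⟩ hp
    rw [mem_ccop, cc_apply] at hp
    have hd := co_deg hp
    change n = N + k at hd
    have hk : k = n - N := by omega
    subst hk
    exact mem_image.2 ⟨⟨⟨N, by omega⟩, σ, τ⟩, mem_univ _, rfl⟩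
  rw [sum_subset hsub, sum_image (fun x _ y _ h => hφ h)]
  intro p _ hp
  rw [mem_ccop, not_not, cc_apply] at hp
  rw [hp, Nat.cast_zero, zero_mul]
end Tower
def NN (Q : ℚ) (n : ℕ) : ℚ := ∏ i ∈ range n, (Q ^ (i + 1) - 1)
lemma NN_succ (Q : ℚ) (n : ℕ) : NN Q (n + 1) = NN Q n * (Q ^ (n + 1) - 1) := prod_range_succ _ _
lemma NN_pos {Q : ℚ} (hQ : 1 < Q) (n : ℕ) : 0 < NN Q n :=
  Finset.prod_pos fun i _ => by
    have : 1 < Q ^ (i + 1) := one_lt_pow₀ hQ (Nat.succ_ne_zero i)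
    linarith
namespace Gl
variable {F : Type} [Field F] [Fintype F]
lemma sumId_add (a b : ℕ) : ∑ i ∈ range (a + b), i = ∑ i ∈ range a, i + ∑ i ∈ range b, i + a * b := by
  rw [Finset.sum_range_add, sum_add_distrib]
  simp; ring
lemma card_GL (n : ℕ) : (Nat.card (GL (Fin n) F) : ℚ) = (card F : ℚ) ^ (∑ i ∈ range n, i) * NN (card F) n := by
  rw [Matrix.card_GL_field, Nat.cast_prod, prod_congr rfl (fun (i : Fin n) _ => ?_), prod_mul_distrib]
  rotate_left
  · exact fun i => (card F : ℚ) ^ i.1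
  · exact fun i => (card F : ℚ) ^ (n - i.1) - 1
  · rw [cast_sub (Nat.pow_le_pow_right Fintype.card_pos i.2.le), cast_pow, cast_pow, mul_sub, ← pow_add, mul_one,
      Nat.add_sub_cancel' i.2.le]
  · congr 1
    · rw [Finset.prod_pow_eq_pow_sum, Fin.sum_univ_eq_sum_range (fun i => i)]
    · rw [Fin.prod_univ_eq_prod_range (fun i => (card F : ℚ) ^ (n - i) - 1), ← Finset.prod_range_reflect]
      refine prod_congr rfl fun i hi => ?_
      rw [mem_range] at hi
      rw [show n - (n - 1 - i) = i + 1 by omega]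
lemma card_cov {n a : ℕ} {c : Fin n → Bool} {b : Bool} {e : Fin a ↪ Fin n} (he : Cov c b e) : card {i // c i = b} = a := by
  rw [← Fintype.card_congr (cEq he), card_fin]
lemma res_one_entry {n a : ℕ} {c : Fin n → Bool} {b : Bool} {e : Fin a ↪ Fin n} (he : Cov c b e) {x : GL (Fin n) F} (hx : x ∈ P c)
    (h : res e x = 1) {i j : Fin n} (hi : c i = b) (hj : c j = b) : x.1 i j = (1 : Matrix (Fin n) (Fin n) F) i j := by
  obtain ⟨i, rfl⟩ := (he i).1 hi
  obtain ⟨j, rfl⟩ := (he j).1 hj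
  have h1 := congrArg (fun z : GL (Fin a) F => z.1 i j) h
  beta_reduce at h1
  rw [res_val he hx, submatrix_apply] at h1
  rw [h1, Units.val_one]
  simp [Matrix.one_apply]
lemma card_kerP {n : ℕ} {a : Bool → ℕ} (D : Tower.Dat n a) :
    Nat.card (D.resH (𝒯 := glTower F)).ker = card F ^ (a false * a true) := by
  let φ : (D.resH (𝒯 := glTower F)).ker → ({i // D.c i = false} → {j // D.c j = true} → F) := fun x i j => x.1.1.1 i.1 j.1
  have hx : ∀ x : (D.resH (𝒯 := glTower F)).ker, ∀ b, res (D.e b) x.1.1 = 1 := fun x b => congrFun x.2 b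
  have hb : Function.Bijective φ := by
    constructor
    · intro x y h
      apply Subtype.ext; apply Subtype.ext; apply Units.ext
      ext i j
      cases hi : D.c i <;> cases hj : D.c j
      · rw [res_one_entry (D.cov false) x.1.2 (hx x false) hi hj, res_one_entry (D.cov false) y.1.2 (hx y false) hi hj]
      · exact congrFun (congrFun h ⟨i, hi⟩) ⟨j, hj⟩
      · have e1 : x.1.1.1 i j = 0 := x.1.2 i j hi hj
        have e2 : y.1.1.1 i j = 0 := y.1.2 i j hi hj
        rw [e1, e2]
      · rw [res_one_entry (D.cov true) x.1.2 (hx x true) hi hj, res_one_entry (D.cov true) y.1.2 (hx y true) hi hj]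
    · intro f
      obtain ⟨x, hx, h1, h2, h3⟩ := glue D.cov (fun _ => 1) (of fun i j => if h : D.c i = false ∧ D.c j = true then f ⟨i, h.1⟩ ⟨j, h.2⟩ else 0)
        (fun i j hi hj => dif_neg (fun h => by rw [h.1] at hi; cases hi))
      refine ⟨⟨⟨x, hx⟩, funext h1⟩, ?_⟩
      funext i j
      have := h3 i.1 j.1 (by rw [i.2, j.2]; decide)
      refine this.trans ?_
      rw [of_apply, dif_pos ⟨i.2, j.2⟩]
  rw [card_congr (Equiv.ofBijective φ hb), card_eq_fintype_card, card_fun, card_fun, card_cov (D.cov false),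
    card_cov (D.cov true), ← pow_mul, mul_comm]
lemma index {n : ℕ} {a : Bool → ℕ} (D : Tower.Dat n a) :
    (Nat.card ((glTower F).G n) : ℚ) / Nat.card ((glTower F).P D.c) =
      NN (card F) n / (NN (card F) (a false) * NN (card F) (a true)) := by
  have hq : (1 : ℚ) < card F := by exact_mod_cast one_lt_card
  rw [card_ker (D.resH (𝒯 := glTower F)) D.resH_surj, card_kerP, card_pi, prod_bool]
  change (Nat.card (GL (Fin n) F) : ℚ) / ((Nat.card (GL (Fin (a true)) F) * Nat.card (GL (Fin (a false)) F) * _ : ℕ) : ℚ) = _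
  push_cast
  rw [card_GL, card_GL, card_GL, D.card, sumId_add, pow_add, pow_add]
  have h1 := (NN_pos hq (a false)).ne'
  have h2 := (NN_pos hq (a true)).ne'
  have h3 : (card F : ℚ) ≠ 0 := by positivity
  field_simp
end Gl
namespace Wh
def av {X : Type} [Fintype X] (f : X → ℂ) : ℂ := (card X : ℂ)⁻¹ * ∑ x, f x
lemma av_equiv {X Y : Type} [Fintype X] [Fintype Y] (e : X ≃ Y) (f : Y → ℂ) : av (fun x => f (e x)) = av f := by
  unfold av
  rw [Fintype.card_congr e, Equiv.sum_comp e]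
lemma av_const {X : Type} [Fintype X] [Nonempty X] (a : ℂ) : av (fun _ : X => a) = a := by
  unfold av
  rw [sum_const, card_univ, nsmul_eq_mul, ← mul_assoc, inv_mul_cancel₀ (by simp [card_ne_zero]), one_mul]
lemma av_sum {X ι : Type} [Fintype X] (s : Finset ι) (f : ι → X → ℂ) : av (fun x => ∑ i ∈ s, f i x) = ∑ i ∈ s, av (f i) := by
  unfold av
  rw [sum_comm, mul_sum]
lemma av_mul {X : Type} [Fintype X] (a : ℂ) (f : X → ℂ) : av (fun x => a * f x) = a * av f := by
  unfold av
  rw [← mul_sum]; ring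
lemma av_comp {A B : Type} [AddGroup A] [AddGroup B] [Fintype A] [Fintype B] (φ : A →+ B) (hφ : Function.Surjective φ) (f : B → ℂ) :
    av (fun a => f (φ a)) = av f := by
  have hne : (card A : ℂ) ≠ 0 := by simp [card_ne_zero]
  have hne' : (card B : ℂ) ≠ 0 := by simp [card_ne_zero]
  have hfib : ∀ b, (univ.filter (fun a => φ a = b)).card = (univ.filter (fun a => φ a = 0)).card := by
    intro b
    obtain ⟨a0, rfl⟩ := hφ b
    refine Finset.card_bij' (fun a _ => a - a0) (fun a _ => a + a0) ?_ ?_ ?_ ?_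
    · intro a ha; simp only [mem_filter, mem_univ, true_and] at ha ⊢; rw [map_sub, ha, sub_self]
    · intro a ha; simp only [mem_filter, mem_univ, true_and] at ha ⊢; rw [map_add, ha, zero_add]
    · intro a _; simp
    · intro a _; simp
  have hs : ∀ g : B → ℂ, ∑ a, g (φ a) = ((univ.filter (fun a => φ a = 0)).card : ℂ) * ∑ b, g b := by
    intro g
    rw [← sum_fiberwise univ φ, mul_sum]
    refine sum_congr rfl fun b _ => ?_
    rw [← hfib b, ← nsmul_eq_mul, ← sum_const]
    refine sum_congr rfl fun a ha => ?_
    rw [(mem_filter.1 ha).2]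
  have h1 := hs (fun _ => 1)
  simp only [sum_const, card_univ, nsmul_eq_mul, mul_one] at h1
  unfold av
  rw [hs f, h1]
  rw [h1] at hne
  have := left_ne_zero_of_mul hne
  field_simp
set_option linter.unusedSectionVars false
variable {F : Type} [Field F] [Fintype F]
def mkM {n : ℕ} (N : ℕ) (z : Matrix (Fin n) (Fin n) F) : Matrix (Fin n) (Fin n) F :=
  of fun i j => if N ≤ j.1 ∧ i < j then z i j else if i = j then 1 else 0
lemma mkM_apply {n : ℕ} (N : ℕ) (z : Matrix (Fin n) (Fin n) F) (i j : Fin n) :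
    mkM N z i j = if N ≤ j.1 ∧ i < j then z i j else if i = j then 1 else 0 := rfl
lemma mkM_unit {n : ℕ} (N : ℕ) (z : Matrix (Fin n) (Fin n) F) : IsUnit (mkM N z) := by
  rw [isUnit_iff_isUnit_det, Matrix.det_of_isUpperTriangular]
  · simp [mkM_apply]
  · intro i j hij
    have hij' : j < i := hij
    rw [mkM_apply, if_neg (fun h => absurd h.2 hij'.asymm), if_neg hij'.ne']
def mkU {n : ℕ} (N : ℕ) (z : Matrix (Fin n) (Fin n) F) : GL (Fin n) F := (mkM_unit N z).unit
lemma mkU_val {n : ℕ} (N : ℕ) (z : Matrix (Fin n) (Fin n) F) : (mkU N z).1 = mkM N z := rfl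
def th {n : ℕ} (N : ℕ) (z : Matrix (Fin n) (Fin n) F) : F := ∑ i : Fin n, ∑ j : Fin n, if N ≤ i.1 ∧ i.1 + 1 = j.1 then z i j else 0
variable (ψ : AddChar F ℂ)
def aa {n : ℕ} (N : ℕ) (f : GL (Fin n) F → ℂ) : ℂ := av fun z : Matrix (Fin n) (Fin n) F => ψ (th N z) * f (mkU N z)
def EE {n : ℕ} (N : ℕ) (f : GL (Fin n) F → ℂ) : ℂ := av fun z : Matrix (Fin n) (Fin n) F => ψ (th N z) * f (mkU (N + 1) z)
abbrev II {n : ℕ} (N : Fin n) := {i : Fin n // i < N}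
def BB {n : ℕ} (N : Fin n) (l : II N → F) (f : GL (Fin n) F → ℂ) : ℂ :=
  av fun z : Matrix (Fin n) (Fin n) F => ψ (th N z + ∑ i : II N, l i * z i.1 N) * f (mkU N z)
lemma BB_zero {n : ℕ} (N : Fin n) (f : GL (Fin n) F → ℂ) : BB ψ N 0 f = aa ψ N f := by
  unfold BB aa
  congr 1; funext z
  simp
lemma EE_top {n : ℕ} (f : GL (Fin n) F → ℂ) (hn : 0 < n) : EE ψ (n - 1) f = f 1 := by
  unfold EE
  rw [← av_const (X := Matrix (Fin n) (Fin n) F) (f 1)]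
  congr 1; funext z
  have h1 : th (n - 1) z = 0 := by
    unfold th
    refine sum_eq_zero fun i _ => sum_eq_zero fun j _ => if_neg ?_
    have := j.2; omega
  have h2 : mkU (n - 1 + 1) z = 1 := by
    apply Units.ext
    ext i j
    rw [mkU_val, mkM_apply, if_neg (by have := j.2; omega)]
    rfl
  rw [h1, h2, AddChar.map_zero_eq_one, one_mul]
lemma aa_top {n : ℕ} (f : GL (Fin n) F → ℂ) : aa ψ n f = f 1 := by
  unfold aa
  rw [← av_const (X := Matrix (Fin n) (Fin n) F) (f 1)]
  congr 1; funext z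
  have h1 : th n z = 0 := by
    unfold th
    refine sum_eq_zero fun i _ => sum_eq_zero fun j _ => if_neg ?_
    have := i.2; omega
  have h2 : mkU n z = 1 := by
    apply Units.ext
    ext i j
    rw [mkU_val, mkM_apply, if_neg (by have := j.2; omega)]
    rfl
  rw [h1, h2, AddChar.map_zero_eq_one, one_mul]
lemma EE_zero {n : ℕ} (f : GL (Fin n) F → ℂ) : EE ψ 0 f = aa ψ 0 f := by
  unfold EE aa
  congr 1; funext z
  congr 2
  apply Units.ext
  ext i j
  rw [mkU_val, mkU_val, mkM_apply, mkM_apply]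
  congr 1
  apply propext
  constructor
  · rintro ⟨h1, h2⟩; exact ⟨by omega, h2⟩
  · rintro ⟨h1, h2⟩
    have : i.1 < j.1 := h2
    exact ⟨by omega, h2⟩
lemma sum_BB (hψ : ψ ≠ 1) {n : ℕ} (N : Fin n) (f : GL (Fin n) F → ℂ) : ∑ l, BB ψ N l f = EE ψ N f := by
  have h1 : ∀ y : II N → F, ∑ l : II N → F, ψ (∑ i, l i * y i) = if y = 0 then (card (II N → F) : ℂ) else 0 := by
    intro y
    let χ : AddChar (II N → F) ℂ :=
      { toFun := fun l => ψ (∑ i, l i * y i)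
        map_zero_eq_one' := by simp
        map_add_eq_mul' := fun l l' => by
          rw [← AddChar.map_add_eq_mul, ← sum_add_distrib]
          simp only [Pi.add_apply, add_mul] }
    have h2 := AddChar.sum_eq_ite χ
    have h3 : χ = 0 ↔ y = 0 := by
      constructor
      · intro h
        by_contra hy
        obtain ⟨i, hi⟩ := Function.ne_iff.1 hy
        obtain ⟨t, ht⟩ := AddChar.ne_one_iff.1 hψ
        apply ht
        have : χ (Pi.single i (t / y i)) = 1 := by rw [h]; rfl
        rw [← this]
        change _ = ψ (∑ j, (Pi.single i (t / y i) : II N → F) j * y j)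
        rw [sum_eq_single i]
        · rw [Pi.single_eq_same, div_mul_cancel₀ _ hi]
        · intro j _ hj; rw [Pi.single_eq_of_ne hj, zero_mul]
        · simp
      · rintro rfl
        ext l
        change ψ (∑ j, l j * 0) = 1
        simp
    refine Eq.trans h2 ?_
    simp only [h3]
  let col : Matrix (Fin n) (Fin n) F → (II N → F) := fun z i => z i.1 N
  let h : Matrix (Fin n) (Fin n) F → ℂ := fun z => ψ (th N z) * f (mkU (N + 1) z)
  have h2 : ∑ l, BB ψ N l f = av fun z : Matrix (Fin n) (Fin n) F => (card (II N → F) : ℂ) * if col z = 0 then h z else 0 := by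
    unfold BB
    rw [← av_sum]
    congr 1; funext z
    simp only [AddChar.map_add_eq_mul, mul_right_comm, ← mul_sum]
    rw [h1 (col z)]
    by_cases hz : col z = 0
    · rw [if_pos hz, if_pos hz, mul_comm]
      congr 3
      apply Units.ext
      ext i j
      rw [mkU_val, mkU_val, mkM_apply, mkM_apply]
      by_cases hj : j = N
      · subst hj
        by_cases hi : i < j
        · have : z i j = 0 := congrFun hz ⟨i, hi⟩
          rw [this, if_neg (c := j.1 + 1 ≤ j.1 ∧ i < j) (by omega), if_neg hi.ne]
          simp
        · simp only [hi, and_false]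
      · have : N.1 ≤ j.1 ↔ N.1 + 1 ≤ j.1 := by
          have : N.1 ≠ j.1 := fun h => hj (Fin.ext h.symm)
          omega
        simp only [this]
    · rw [if_neg hz, if_neg hz]; simp
  rw [h2, av_mul]
  have h3 : ∀ y : II N → F, av (fun z => if col z = 0 then h z else 0) = av (fun z => if col z = y then h z else 0) := by
    intro y
    let s : Matrix (Fin n) (Fin n) F := of fun i j => if hi : i < N ∧ j = N then y ⟨i, hi.1⟩ else 0
    have hs : ∀ i j, ¬ (i < N ∧ j = N) → s i j = 0 := fun i j hij => dif_neg hij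
    conv_rhs => rw [← av_equiv (Equiv.addRight s)]
    congr 1; funext z
    have e1 : col (z + s) = col z + y := by
      funext i
      change z i.1 N + s i.1 N = z i.1 N + y i
      congr 1
      exact dif_pos ⟨i.2, rfl⟩
    have e2 : h (z + s) = h z := by
      change ψ (th N (z + s)) * f (mkU (N + 1) (z + s)) = ψ (th N z) * f (mkU (N + 1) z)
      have a1 : th N (z + s) = th N z := by
        unfold th
        refine sum_congr rfl fun i _ => sum_congr rfl fun j _ => ?_
        split_ifs with hij
        · rw [Matrix.add_apply, hs i j (fun h' => by have : i.1 < N.1 := h'.1; omega), add_zero]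
        · rfl
      have a2 : mkU (N + 1) (z + s) = mkU (N + 1) z := by
        apply Units.ext
        ext i j
        rw [mkU_val, mkU_val, mkM_apply, mkM_apply]
        split_ifs with hij
        · rw [Matrix.add_apply, hs i j (fun h' => by rw [h'.2] at hij; omega), add_zero]
        · rfl
        · rfl
      rw [a1, a2]
    change _ = if col (z + s) = y then h (z + s) else 0
    rw [e1, e2]
    congr 1
    exact propext (by rw [add_eq_right])
  have h4 : ∑ y, av (fun z => if col z = y then h z else 0) = av h := by
    rw [← av_sum]
    congr 1; funext z
    rw [sum_ite_eq]; simp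
  rw [← sum_congr rfl (fun y _ => h3 y), sum_const, card_univ, nsmul_eq_mul] at h4
  exact h4
lemma BB_conj {n : ℕ} (N : Fin n) {f : GL (Fin n) F → ℂ} (hf : IsClass f) (l : II N → F) (k : II N) (hk : l k ≠ 0) :
    BB ψ N l f = BB ψ N (Pi.single k 1) f := by
  let v : Fin n → F := fun i => if h : i < N then l ⟨i, h⟩ else 0
  have hv : ∀ i, ¬ i < N → v i = 0 := fun i hi => dif_neg hi
  have hvk : v k.1 = l k := dif_pos k.2
  let g : Matrix (Fin n) (Fin n) F := (1 : Matrix (Fin n) (Fin n) F).updateRow k.1 v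
  have hdet : g.det = l k := by
    rw [← Matrix.cramer_transpose_apply, Matrix.transpose_one, Matrix.cramer_one]
    exact hvk
  have hg : IsUnit g := by rw [isUnit_iff_isUnit_det, hdet]; exact isUnit_iff_ne_zero.2 hk
  have hgm : ∀ (z : Matrix (Fin n) (Fin n) F) i j, (g * z) i j = if i = k.1 then ∑ a, v a * z a j else z i j := by
    intro z i j
    rw [Matrix.mul_apply]
    by_cases hi : i = k.1
    · subst hi
      simp [g]
    · simp [g, hi, Matrix.updateRow_ne, Matrix.one_apply]
  let G : GL (Fin n) F := hg.unit
  let e : Matrix (Fin n) (Fin n) F ≃ Matrix (Fin n) (Fin n) F :=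
    ⟨fun z => G.1 * z, fun z => (G⁻¹).1 * z, fun z => by simp [← Matrix.mul_assoc], fun z => by simp [← Matrix.mul_assoc]⟩
  unfold BB
  conv_rhs => rw [← av_equiv e]
  congr 1; funext z
  have he : e z = g * z := rfl
  rw [he]
  have b1 : th N z = th N (g * z) := by
    unfold th
    refine sum_congr rfl fun i _ => sum_congr rfl fun j _ => ?_
    split_ifs with hij
    · rw [hgm, if_neg]
      rintro rfl
      have : k.1.1 < N.1 := k.2
      omega
    · rfl
  have b2 : ∑ i : II N, (Pi.single k (1 : F) : II N → F) i * (g * z) i.1 N = ∑ i : II N, l i * z i.1 N := by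
    rw [sum_eq_single k]
    · rw [Pi.single_eq_same, one_mul, hgm, if_pos rfl]
      refine (sum_of_injOn Subtype.val Subtype.val_injective.injOn (by intro _ _; simp) ?_ ?_).symm
      · intro i _ hi
        rw [hv i, zero_mul]
        intro h
        exact hi ⟨⟨i, h⟩, by simp, rfl⟩
      · intro i _
        congr 1
        have hvi : v i.1 = l i := dif_pos i.2
        exact hvi.symm
    · intro j _ hj; rw [Pi.single_eq_of_ne hj, zero_mul]
    · simp
  have b3 : mkU N (g * z) = G * mkU N z * G⁻¹ := by
    rw [eq_mul_inv_iff_mul_eq]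
    apply Units.ext
    change mkM N (g * z) * g = g * mkM N z
    have hkN : k.1.1 < N.1 := k.2
    ext i j
    rw [hgm, Matrix.mul_apply]
    have hcol : ∀ i, mkM N (g * z) i k.1 = if i = k.1 then 1 else 0 := by
      intro i; rw [mkM_apply, if_neg (by omega)]
    have hgg : ∀ a b, g a b = if a = k.1 then v b else if a = b then 1 else 0 := by
      intro a b
      by_cases ha : a = k.1
      · subst ha; simp [g]
      · simp [g, ha, Matrix.updateRow_ne, Matrix.one_apply]
    have hL : ∑ a, mkM N (g * z) i a * g a j = (if i = k.1 then v j else 0) + if j = k.1 then 0 else mkM N (g * z) i j := by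
      rw [← add_sum_erase _ _ (mem_univ k.1), hcol, hgg, if_pos rfl]
      congr 1
      · split_ifs <;> simp
      · rw [sum_congr rfl (g := fun a => if a = j then mkM N (g * z) i a else 0)]
        · rw [sum_ite_eq']
          by_cases hj : j = k.1 <;> simp [hj]
        · intro a ha
          rw [hgg, if_neg (ne_of_mem_erase ha)]
          split_ifs <;> simp
    rw [hL]
    by_cases hi : i = k.1
    · subst hi
      rw [if_pos rfl, if_pos rfl]
      by_cases hj : N.1 ≤ j.1
      · have hjk : j ≠ k.1 := by rintro rfl; omega
        have hkj : k.1 < j := by change k.1.1 < j.1; omega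
        rw [hv j (by change ¬ j.1 < N.1; omega), zero_add, if_neg hjk, mkM_apply, if_pos ⟨hj, hkj⟩, hgm, if_pos rfl]
        refine sum_congr rfl fun a _ => ?_
        by_cases ha : a < N
        · rw [mkM_apply, if_pos ⟨hj, lt_of_lt_of_le ha hj⟩]
        · rw [hv a ha, zero_mul, zero_mul]
      · have : ∀ a, mkM N z a j = if a = j then 1 else 0 := by
          intro a; rw [mkM_apply, if_neg (fun h => hj h.1)]
        simp only [this]
        have h2 : (if j = k.1 then 0 else mkM N (g * z) k.1 j) = 0 := by
          split_ifs with h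
          · rfl
          · rw [mkM_apply, if_neg (fun h => hj h.1), if_neg (Ne.symm h)]
        rw [h2]
        simp
    · rw [if_neg hi, if_neg hi, zero_add]
      split_ifs with hj
      · subst hj
        rw [mkM_apply, if_neg (by omega), if_neg hi]
      · rw [mkM_apply, mkM_apply, hgm, if_neg hi]
  rw [b3, hf, ← b1, b2]
lemma BB_eq {n : ℕ} (N : Fin n) {f : GL (Fin n) F → ℂ} (hf : IsClass f) (l : II N → F) (hl : l ≠ 0) (k : II N) :
    BB ψ N l f = BB ψ N (Pi.single k 1) f := by
  obtain ⟨i, hi⟩ := Function.ne_iff.1 hl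
  rw [BB_conj ψ N hf l i hi]
  by_cases hik : i = k
  · rw [hik]
  · rw [← BB_conj ψ N hf (Pi.single i 1 + Pi.single k 1) i (by simp [hik]),
      ← BB_conj ψ N hf (Pi.single i 1 + Pi.single k 1) k (by simp [hik])]
lemma BB_last {n : ℕ} (N : Fin n) (f : GL (Fin n) F → ℂ) (k : II N) (hk : k.1.1 + 1 = N.1) :
    BB ψ N (Pi.single k 1) f = EE ψ k.1.1 f := by
  unfold BB EE
  congr 1; funext z
  rw [hk]
  congr 2
  rw [sum_eq_single k (fun j _ hj => by rw [Pi.single_eq_of_ne hj, zero_mul]) (by simp), Pi.single_eq_same, one_mul]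
  have : z k.1 N = ∑ i : Fin n, ∑ j : Fin n, if i = k.1 then (if j = N then z i j else 0) else 0 := by simp
  unfold th
  rw [this, ← sum_add_distrib]
  refine sum_congr rfl fun i _ => ?_
  rw [← sum_add_distrib]
  refine sum_congr rfl fun j _ => ?_
  by_cases hi : i = k.1
  · subst hi
    by_cases hj : j = N
    · subst hj
      have : ¬ (j ≤ k.1) := not_le.2 k.2
      simp [hk, this]
    · have : k.1.1 + 1 ≠ j.1 := fun h => hj (Fin.ext (by omega))
      simp [hj, this]
  · have : i.1 ≠ k.1.1 := fun h => hi (Fin.ext h)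
    simp only [hi, if_false, add_zero]
    congr 1
    exact propext (by omega)
lemma EE_rec (hψ : ψ ≠ 1) {n : ℕ} (N : ℕ) (hN : N + 1 < n) {f : GL (Fin n) F → ℂ} (hf : IsClass f) :
    EE ψ (N + 1) f = aa ψ (N + 1) f + ((card F : ℂ) ^ (N + 1) - 1) * EE ψ N f := by
  let k : II (⟨N + 1, hN⟩ : Fin n) := ⟨⟨N, by omega⟩, by simp⟩
  have h := sum_BB ψ hψ (⟨N + 1, hN⟩ : Fin n) f
  rw [← add_sum_erase _ _ (mem_univ 0), BB_zero,
    sum_congr rfl (fun l hl => (BB_eq ψ _ hf l (ne_of_mem_erase hl) k).trans (BB_last ψ _ f k rfl)),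
    sum_const, Finset.card_erase_of_mem (mem_univ _), card_univ, nsmul_eq_mul,
    cast_sub Fintype.card_pos, card_fun] at h
  have hc : card (II (⟨N + 1, hN⟩ : Fin n)) = N + 1 := by
    rw [card_subtype, Finset.filter_gt_eq_Iio, Fin.card_Iio]
  rw [hc] at h
  push_cast at h
  exact h.symm
lemma one_lt_q : (1 : ℚ) < (card F : ℚ) := by exact_mod_cast one_lt_card
lemma whit (hψ : ψ ≠ 1) {n : ℕ} {f : GL (Fin n) F → ℂ} (hf : IsClass f) :
    (card F : ℂ) ^ n * (f 1 / (NN (card F) n : ℚ)) =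
      ∑ N ∈ range (n + 1), aa ψ N f / (NN (card F) N : ℚ) := by
  have hNN : ∀ k, ((NN (card F) k : ℚ) : ℂ) ≠ 0 := fun k => by exact_mod_cast (NN_pos one_lt_q k).ne'
  have hN1 : ∀ k, ((NN (card F) (k + 1) : ℚ) : ℂ) = ((NN (card F) k : ℚ) : ℂ) * ((card F : ℂ) ^ (k + 1) - 1) := by
    intro k; rw [NN_succ]; push_cast; ring
  have key : ∀ N, N < n → EE ψ N f / (NN (card F) N : ℚ) = ∑ M ∈ range (N + 1), aa ψ M f / (NN (card F) M : ℚ) := by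
    intro N
    induction N with
    | zero => intro _; rw [EE_zero]; simp
    | succ N ih =>
      intro hN
      have h0 := hNN (N + 1)
      have h1 := hNN N
      rw [sum_range_succ, ← ih (by omega), EE_rec ψ hψ N hN hf]
      rw [hN1] at h0 ⊢
      have h2 := right_ne_zero_of_mul h0
      field_simp
      ring
  rw [sum_range_succ, aa_top]
  rcases n with _ | n
  · simp
  · have h := key n (by omega)
    have e := EE_top ψ f (Nat.succ_pos n)
    rw [Nat.add_sub_cancel] at e
    rw [← h, e]
    have h0 := hNN (n + 1)
    have h1 := hNN n
    rw [hN1] at h0 ⊢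
    have h2 := right_ne_zero_of_mul h0
    field_simp
    ring
set_option linter.unusedSectionVars false
lemma fav_shift {A B : Type} [Group A] [Group B] [Fintype A] [Fintype B] (φ : A →* B) (h : A → ℂ) (u : A) :
    fav φ h (φ u) = (Nat.card φ.ker : ℂ)⁻¹ * ∑ k : φ.ker, h (k.1 * u) := by
  unfold fav
  congr 1
  symm
  refine Finset.sum_bij (fun k _ => k.1 * u) ?_ ?_ ?_ ?_
  · intro k _
    have : φ k.1 = 1 := k.2
    simp [this]
  · intro k _ k' _ hk; exact Subtype.ext (mul_right_cancel hk)
  · intro b hb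
    rw [mem_filter] at hb
    exact ⟨⟨b * u⁻¹, by rw [MonoidHom.mem_ker, map_mul, map_inv, hb.2, mul_inv_cancel]⟩, mem_univ _, by simp⟩
  · intro k _; rfl
lemma r_shift {𝒯 : Tower} {n : ℕ} {a : Bool → ℕ} (D : Tower.Dat n a) (π : 𝒯.G n → ℂ) (u : 𝒯.P D.c) (t : ℂ) :
    t * D.r π (D.resH u) = (Nat.card (D.resH (𝒯 := 𝒯)).ker : ℂ)⁻¹ * ∑ k : (D.resH (𝒯 := 𝒯)).ker, t * π (k.1.1 * u.1) := by
  rw [← mul_sum, mul_left_comm]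
  refine congrArg (t * ·) ((fav_shift D.resH (fun u => π u.1) u).trans ?_)
  congr!
variable {F : Type} [Field F] [Fintype F]
def tau {n : ℕ} (N : ℕ) (k : GL (Fin n) F) (z : Matrix (Fin n) (Fin n) F) : Matrix (Fin n) (Fin n) F :=
  of fun i j => if i.1 < N ∧ N ≤ j.1 then (k.1 * mkM N z) i j else z i j
lemma tau_apply {n : ℕ} (N : ℕ) (k : GL (Fin n) F) (z : Matrix (Fin n) (Fin n) F) (i j : Fin n) :
    tau N k z i j = if i.1 < N ∧ N ≤ j.1 then (k.1 * mkM N z) i j else z i j := rfl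
def Ker {n : ℕ} (N : ℕ) (k : GL (Fin n) F) : Prop := ∀ i j : Fin n, ¬ (i.1 < N ∧ N ≤ j.1) → k.1 i j = if i = j then 1 else 0
lemma mkM_tau {n : ℕ} {N : ℕ} {k : GL (Fin n) F} (hk : Ker N k) (z : Matrix (Fin n) (Fin n) F) :
    mkM N (tau N k z) = k.1 * mkM N z := by
  ext i j
  rw [mkM_apply, tau_apply]
  by_cases hi : i.1 < N
  · by_cases hj : N ≤ j.1
    · rw [if_pos ⟨hj, by change i.1 < j.1; omega⟩, if_pos ⟨hi, hj⟩]
    · rw [if_neg (fun h => hj h.1), Matrix.mul_apply]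
      have h1 : ∀ l, mkM N z l j = if l = j then 1 else 0 := by
        intro l; rw [mkM_apply, if_neg (fun h => hj h.1)]
      simp only [h1, mul_ite, mul_one, mul_zero, sum_ite_eq', mem_univ, if_true]
      exact (hk i j (fun h => hj h.2)).symm
  · have h1 : ∀ l, k.1 i l = if i = l then 1 else 0 := fun l => hk i l (fun h => hi h.1)
    rw [if_neg (c := i.1 < N ∧ N ≤ j.1) (fun h => hi h.1), Matrix.mul_apply]
    simp only [h1, ite_mul, one_mul, zero_mul, sum_ite_eq, mem_univ, if_true]
    rfl
lemma tau_tau {n : ℕ} {N : ℕ} {k k' : GL (Fin n) F} (hk : Ker N k) (h : k' * k = 1) (z : Matrix (Fin n) (Fin n) F) :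
    tau N k' (tau N k z) = z := by
  ext i j
  rw [tau_apply]
  split_ifs with hij
  · rw [mkM_tau hk, ← Matrix.mul_assoc, ← Units.val_mul, h, Units.val_one, Matrix.one_mul, mkM_apply,
      if_pos ⟨hij.2, by change i.1 < j.1; omega⟩]
  · rw [tau_apply, if_neg hij]
variable (ψ : AddChar F ℂ)
lemma aa_shift {n : ℕ} {N : ℕ} {k : GL (Fin n) F} (hk : Ker N k) (hk' : Ker N k⁻¹) (f : GL (Fin n) F → ℂ) :
    av (fun z : Matrix (Fin n) (Fin n) F => ψ (th N z) * f (k * mkU N z)) = aa ψ N f := by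
  let e : Matrix (Fin n) (Fin n) F ≃ Matrix (Fin n) (Fin n) F :=
    ⟨tau N k, tau N k⁻¹, tau_tau hk (by simp), tau_tau hk' (by simp)⟩
  unfold aa
  rw [← av_equiv e (fun z => ψ (th N z) * f (mkU N z))]
  congr 1; funext z
  have h1 : th N (e z) = th N z := by
    unfold th
    refine sum_congr rfl fun i _ => sum_congr rfl fun j _ => ?_
    split_ifs with hij
    · change tau N k z i j = _
      rw [tau_apply, if_neg (by omega)]
    · rfl
  have h2 : mkU N (e z) = k * mkU N z := Units.ext (mkM_tau hk z)
  rw [h1, h2]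
def av0 (n N : ℕ) : Bool → ℕ := fun b => cond b (n - N) N
def dat (n N : ℕ) (hN : N ≤ n) : Tower.Dat n (av0 n N) where
  c i := decide (N ≤ i.1)
  e b := match b with
    | false => ⟨fun i => ⟨i.1, lt_of_lt_of_le i.2 hN⟩, fun i j h => Fin.ext (Fin.mk.inj h)⟩
    | true => ⟨fun i => ⟨N + i.1, by have : i.1 < n - N := i.2; omega⟩, fun i j h => Fin.ext (by have := Fin.mk.inj h; omega)⟩
  cov b i := by
    cases b
    · rw [decide_eq_false_iff_not]
      constructor
      · intro h; exact ⟨⟨i.1, by change i.1 < N; omega⟩, rfl⟩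
      · rintro ⟨j, rfl⟩
        have : j.1 < N := j.2
        change ¬ N ≤ j.1
        omega
    · rw [decide_eq_true_iff]
      constructor
      · intro h; exact ⟨⟨i.1 - N, by change i.1 - N < n - N; omega⟩, Fin.ext (by change N + (i.1 - N) = i.1; omega)⟩
      · rintro ⟨j, rfl⟩
        exact Nat.le_add_right _ _
lemma dat_c (n N : ℕ) (hN : N ≤ n) (i : Fin n) : (dat n N hN).c i = decide (N ≤ i.1) := rfl
lemma mkU_mem {n N : ℕ} (hN : N ≤ n) (z : Matrix (Fin n) (Fin n) F) : mkU N z ∈ (glTower F).P (dat n N hN).c := by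
  change mkU N z ∈ Gl.P (dat n N hN).c
  rw [Gl.mem_P]
  intro i j hi hj
  rw [dat_c, decide_eq_true_iff] at hi
  rw [dat_c, decide_eq_false_iff_not] at hj
  rw [mkU_val, mkM_apply, if_neg (fun h => hj h.1), if_neg]
  rintro rfl; exact hj hi
def subT {n N : ℕ} (hN : N ≤ n) : Matrix (Fin n) (Fin n) F →+ Matrix (Fin (n - N)) (Fin (n - N)) F where
  toFun z := z.submatrix ((dat n N hN).e true) ((dat n N hN).e true)
  map_zero' := rfl
  map_add' _ _ := rfl
lemma e_true {n N : ℕ} (hN : N ≤ n) (i : Fin (n - N)) : ((dat n N hN).e true i).1 = N + i.1 := rfl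
lemma subT_apply {n N : ℕ} (hN : N ≤ n) (z : Matrix (Fin n) (Fin n) F) (i j : Fin (n - N)) :
    subT hN z i j = z ((dat n N hN).e true i) ((dat n N hN).e true j) := rfl
lemma subT_surj {n N : ℕ} (hN : N ≤ n) : Function.Surjective (subT hN : Matrix (Fin n) (Fin n) F →+ _) := by
  intro y
  refine ⟨of fun i j => Gl.ext ((dat n N hN).e true) y i j, ?_⟩
  ext i j
  exact Gl.ext_apply _ y i j
lemma th_sub {n N : ℕ} (hN : N ≤ n) (z : Matrix (Fin n) (Fin n) F) : th 0 (subT hN z) = th N z := by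
  unfold th
  refine sum_of_injOn _ ((dat n N hN).e true).injective.injOn (fun _ _ => mem_coe.2 (mem_univ _)) ?_ ?_
  · intro i _ hi
    refine sum_eq_zero fun j _ => if_neg fun h => hi ?_
    obtain ⟨l, hl⟩ := ((dat n N hN).cov true i).1 (by rw [dat_c]; simp [h.1])
    exact ⟨l, mem_coe.2 (mem_univ _), hl⟩
  · intro i _
    refine sum_of_injOn _ ((dat n N hN).e true).injective.injOn (fun _ _ => mem_coe.2 (mem_univ _)) ?_ ?_
    · intro j _ hj
      refine if_neg fun h => hj ?_
      obtain ⟨l, hl⟩ := ((dat n N hN).cov true j).1 (by rw [dat_c, decide_eq_true_iff]; omega)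
      exact ⟨l, mem_coe.2 (mem_univ _), hl⟩
    · intro j _
      rw [e_true, e_true]
      exact if_congr (by omega) rfl rfl
lemma ker_Ker {n N : ℕ} (hN : N ≤ n) (k : ((dat n N hN).resH (𝒯 := glTower F)).ker) : Ker N (k.1.1 : GL (Fin n) F) := by
  have h1 : ∀ b, Gl.res ((dat n N hN).e b) (k.1.1 : GL (Fin n) F) = 1 := fun b => congrFun k.2 b
  have hm : (k.1.1 : GL (Fin n) F) ∈ Gl.P (dat n N hN).c := k.1.2
  have h2 : ∀ b i j, (k.1.1 : GL (Fin n) F).1 ((dat n N hN).e b i) ((dat n N hN).e b j) = if i = j then 1 else 0 := by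
    intro b i j
    have h3 := Gl.res_val ((dat n N hN).cov b) hm
    rw [h1] at h3
    exact (congrFun (congrFun h3 i) j).symm
  intro i j hij
  by_cases h : (dat n N hN).c i = (dat n N hN).c j
  · obtain ⟨a, rfl⟩ := ((dat n N hN).cov _ i).1 h
    obtain ⟨b, hb⟩ := ((dat n N hN).cov _ j).1 rfl
    generalize (dat n N hN).c j = β at a b h hb hij
    subst hb
    rw [h2]
    simp only [EmbeddingLike.apply_eq_iff_eq]
  · have hij' : ¬ i.1 < N ∧ j.1 < N := by
      rw [dat_c, dat_c] at h
      by_cases hi : N ≤ i.1 <;> by_cases hj : N ≤ j.1 <;> simp [hi, hj] at h ⊢ <;> omega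
    rw [hm i j (by rw [dat_c, decide_eq_true_iff]; omega) (by rw [dat_c, decide_eq_false_iff_not]; omega), if_neg]
    rintro rfl; omega
lemma res_mkU {n N : ℕ} (hN : N ≤ n) (z : Matrix (Fin n) (Fin n) F) :
    ((dat n N hN).resH (𝒯 := glTower F) ⟨mkU N z, mkU_mem hN z⟩ false : GL (Fin N) F) = 1 ∧
    ((dat n N hN).resH (𝒯 := glTower F) ⟨mkU N z, mkU_mem hN z⟩ true : GL (Fin (n - N)) F) = mkU 0 (subT hN z) := by
  constructor
  · apply Units.ext
    refine (Gl.res_val ((dat n N hN).cov false) (mkU_mem hN z)).trans ?_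
    refine Matrix.ext fun (i j : Fin N) => ?_
    change mkM N z ((dat n N hN).e false i) ((dat n N hN).e false j) = (1 : Matrix (Fin N) (Fin N) F) i j
    have : ((dat n N hN).e false j).1 < N := j.2
    rw [mkM_apply, if_neg (by omega), Matrix.one_apply]
    exact if_congr ((dat n N hN).e false).injective.eq_iff rfl rfl
  · apply Units.ext
    refine (Gl.res_val ((dat n N hN).cov true) (mkU_mem hN z)).trans ?_
    refine Matrix.ext fun (i j : Fin (n - N)) => ?_
    change mkM N z ((dat n N hN).e true i) ((dat n N hN).e true j) = mkM 0 (subT hN z) i j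
    rw [mkM_apply, mkM_apply, subT_apply]
    refine if_congr ?_ rfl (if_congr ((dat n N hN).e true).injective.eq_iff rfl rfl)
    change N ≤ N + j.1 ∧ N + i.1 < N + j.1 ↔ 0 ≤ j.1 ∧ i.1 < j.1
    omega
lemma aa_expand {n N : ℕ} (hN : N ≤ n) (π : Irr (GL (Fin n) F)) :
    aa ψ N π.1 = ∑ σ : Irr (GL (Fin N) F), ∑ τ : Irr (GL (Fin (n - N)) F),
      (Tower.co (𝒯 := glTower F) ⟨N, σ⟩ ⟨n - N, τ⟩ ⟨n, π⟩ : ℂ) * (σ.1 1 * aa ψ 0 τ.1) := by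
  have h1 : aa ψ N π.1 = av fun z : Matrix (Fin n) (Fin n) F => ψ (th N z) *
      (dat n N hN).r (𝒯 := glTower F) π.1 ((dat n N hN).resH (𝒯 := glTower F) ⟨mkU N z, mkU_mem hN z⟩) := by
    let kk : ((dat n N hN).resH (𝒯 := glTower F)).ker → GL (Fin n) F := fun k => k.1.1
    have h2 : ∀ z : Matrix (Fin n) (Fin n) F, ψ (th N z) *
      (dat n N hN).r (𝒯 := glTower F) π.1 ((dat n N hN).resH (𝒯 := glTower F) ⟨mkU N z, mkU_mem hN z⟩) =
        (Nat.card ((dat n N hN).resH (𝒯 := glTower F)).ker : ℂ)⁻¹ *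
          ∑ k : ((dat n N hN).resH (𝒯 := glTower F)).ker, ψ (th N z) * π.1 (kk k * mkU N z) := by
      intro z
      exact r_shift (𝒯 := glTower F) (dat n N hN) π.1 ⟨mkU N z, mkU_mem hN z⟩ (ψ (th N z))
    simp only [h2]
    rw [av_mul, av_sum]
    have h3 : ∀ k : ((dat n N hN).resH (𝒯 := glTower F)).ker,
        av (fun z : Matrix (Fin n) (Fin n) F => ψ (th N z) * π.1 (kk k * mkU N z)) = aa ψ N π.1 :=
      fun k => aa_shift ψ (ker_Ker hN k) (ker_Ker hN k⁻¹) π.1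
    rw [sum_congr rfl (fun k _ => h3 k), sum_const, card_univ, nsmul_eq_mul, ← card_eq_fintype_card,
      inv_mul_cancel_left₀ (ker_ne _)]
  rw [h1]
  have h2 : ∀ z : Matrix (Fin n) (Fin n) F, ψ (th N z) *
      (dat n N hN).r (𝒯 := glTower F) π.1 ((dat n N hN).resH (𝒯 := glTower F) ⟨mkU N z, mkU_mem hN z⟩) =
      ∑ σ : Irr (GL (Fin N) F), ∑ τ : Irr (GL (Fin (n - N)) F), ((Tower.co (𝒯 := glTower F) ⟨N, σ⟩ ⟨n - N, τ⟩ ⟨n, π⟩ : ℂ) * σ.1 1) *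
        (ψ (th 0 (subT hN z)) * τ.1 (mkU 0 (subT hN z))) := by
    intro z
    rw [(dat n N hN).r_expand (𝒯 := glTower F) π, mul_sum, th_sub]
    refine sum_congr rfl fun σ _ => ?_
    rw [mul_sum]
    refine sum_congr rfl fun τ _ => ?_
    have e1 := congrArg σ.1 (res_mkU hN z).1
    have e2 := congrArg τ.1 (res_mkU hN z).2
    refine (congrArg (fun x => ψ (th N z) * (_ * x)) (congrArg₂ (· * ·) e1 e2)).trans ?_
    have aux : ∀ a b c d : ℂ, a * (b * (c * d)) = (b * c) * (a * d) := by intros; ring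
    exact aux _ _ _ _
  simp only [h2]
  rw [av_sum]
  refine sum_congr rfl fun σ _ => ?_
  rw [av_sum]
  refine sum_congr rfl fun τ _ => ?_
  rw [av_mul, av_comp (subT hN) (subT_surj hN) (fun y => ψ (th 0 y) * τ.1 (mkU 0 y)), mul_assoc]
  rfl
set_option linter.unusedSectionVars false
variable {F : Type} [Field F] [Fintype F]
def Uni {n : ℕ} (M : Matrix (Fin n) (Fin n) F) : Prop := ∀ i j : Fin n, ¬ i < j → M i j = if i = j then 1 else 0
lemma Uni.one {n : ℕ} : Uni (1 : Matrix (Fin n) (Fin n) F) := fun _ _ _ => rfl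
lemma Uni.mul {n : ℕ} {M N : Matrix (Fin n) (Fin n) F} (hM : Uni M) (hN : Uni N) : Uni (M * N) := by
  intro i j hij
  rw [Matrix.mul_apply]
  by_cases h : i = j
  · subst h
    rw [if_pos rfl, sum_eq_single i]
    · rw [hM i i hij, hN i i hij, if_pos rfl, one_mul]
    · intro k _ hk
      rcases lt_or_gt_of_ne hk with h | h
      · rw [hM i k h.asymm, if_neg hk.symm, zero_mul]
      · rw [hN k i h.asymm, if_neg hk, mul_zero]
    · simp
  · rw [if_neg h]
    have hji : j < i := lt_of_le_of_ne (not_lt.1 hij) (Ne.symm h)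
    refine sum_eq_zero fun k _ => ?_
    by_cases hk : k < i
    · rw [hM i k hk.asymm, if_neg hk.ne', zero_mul]
    · have : j < k := lt_of_lt_of_le hji (not_lt.1 hk)
      rw [hN k j this.asymm, if_neg this.ne', mul_zero]
lemma Uni.th {n : ℕ} {M N : Matrix (Fin n) (Fin n) F} (hM : Uni M) (hN : Uni N) : th 0 (M * N) = th 0 M + th 0 N := by
  unfold Wh.th
  rw [← sum_add_distrib]
  refine sum_congr rfl fun i _ => ?_
  rw [← sum_add_distrib]
  refine sum_congr rfl fun j _ => ?_
  split_ifs with h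
  · have hij : i < j := by change i.1 < j.1; omega
    rw [Matrix.mul_apply, ← add_sum_erase _ _ (mem_univ i), ← add_sum_erase _ _ (mem_erase.2 ⟨hij.ne', mem_univ j⟩),
      sum_eq_zero, hM i i (lt_irrefl _), hN j j (lt_irrefl _), if_pos rfl, if_pos rfl]
    · ring
    · intro k hk
      rw [mem_erase, mem_erase] at hk
      have k1 : k.1 ≠ i.1 := fun h => hk.2.1 (Fin.ext h)
      have k2 : k.1 ≠ j.1 := fun h => hk.1 (Fin.ext h)
      by_cases hki : k.1 < i.1
      · rw [hM i k (by change ¬ i.1 < k.1; omega), if_neg (Ne.symm hk.2.1), zero_mul]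
      · rw [hN k j (by change ¬ k.1 < j.1; omega), if_neg hk.1, mul_zero]
  · simp
def UU (F : Type) [Field F] [Fintype F] (n : ℕ) : Subgroup (GL (Fin n) F) where
  carrier := {x | Uni x.1}
  one_mem' := Uni.one
  mul_mem' := fun hx hy => Uni.mul hx hy
  inv_mem' := fun {x} hx => by
    have h : ∀ k : ℕ, Uni (x ^ k).1 := by
      intro k
      induction k with
      | zero => exact Uni.one
      | succ k ih => rw [pow_succ]; exact Uni.mul ih hx
    have : x⁻¹ = x ^ (orderOf x - 1) := by
      rw [inv_eq_iff_mul_eq_one, ← pow_succ', Nat.sub_add_cancel (orderOf_pos x), pow_orderOf_eq_one]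
    change Uni (x⁻¹).1
    rw [this]; exact h _
abbrev St (n : ℕ) := {p : Fin n × Fin n // p.1 < p.2}
def rsS (F : Type) [Field F] (n : ℕ) : Matrix (Fin n) (Fin n) F →+ (St n → F) where
  toFun z p := z p.1.1 p.1.2
  map_zero' := rfl
  map_add' _ _ := rfl
def ms {n : ℕ} (s : St n → F) : Matrix (Fin n) (Fin n) F := of fun i j => if h : i < j then s ⟨(i, j), h⟩ else 0
lemma ms_apply {n : ℕ} (s : St n → F) {i j : Fin n} (h : i < j) : ms s i j = s ⟨(i, j), h⟩ := dif_pos h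
lemma mkU_ms {n : ℕ} (z : Matrix (Fin n) (Fin n) F) : mkU 0 (ms (rsS F n z)) = mkU 0 z := by
  apply Units.ext
  ext i j
  rw [mkU_val, mkU_val, mkM_apply, mkM_apply]
  split_ifs with h
  · rw [ms_apply _ h.2]; rfl
  · rfl
  · rfl
lemma rsS_ms {n : ℕ} (s : St n → F) : rsS F n (ms s) = s := by
  funext p
  exact ms_apply s p.2
def SU {n : ℕ} : (St n → F) ≃ UU F n where
  toFun s := ⟨mkU 0 (ms s), fun i j h => by rw [mkU_val, mkM_apply, if_neg (fun h' => h h'.2)]⟩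
  invFun u := rsS F n u.1.1
  left_inv s := by
    funext p
    change mkM 0 (ms s) p.1.1 p.1.2 = _
    rw [mkM_apply, if_pos ⟨Nat.zero_le _, p.2⟩]
    exact ms_apply s p.2
  right_inv u := by
    apply Subtype.ext; apply Units.ext
    ext i j
    change mkM 0 (ms (rsS F n u.1.1)) i j = u.1.1 i j
    rw [mkM_apply]
    by_cases h : i < j
    · rw [if_pos ⟨Nat.zero_le _, h⟩, ms_apply _ h]; rfl
    · rw [if_neg (fun h' => h h'.2), u.2 i j h]
variable (ψ : AddChar F ℂ)
def lamU (n : ℕ) : UU F n →* ℂ where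
  toFun u := ψ (- th 0 u.1.1)
  map_one' := by
    have : th 0 (1 : Matrix (Fin n) (Fin n) F) = 0 := by
      have := Uni.th (Uni.one (F := F) (n := n)) Uni.one
      rw [Matrix.one_mul] at this
      exact left_eq_add.1 this
    change ψ (- th 0 (1 : Matrix (Fin n) (Fin n) F)) = 1
    rw [this, neg_zero, AddChar.map_zero_eq_one]
  map_mul' u v := by
    change ψ (- th 0 (u.1.1 * v.1.1)) = _
    rw [Uni.th u.2 v.2, neg_add, AddChar.map_add_eq_mul]
lemma aa_nat {n : ℕ} {f : GL (Fin n) F → ℂ} (hf : IsChar f) : ∃ k : ℕ, aa ψ 0 f = k := by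
  obtain ⟨k, hk⟩ := IsChar.ip_nat (hf.comp (UU F n).subtype) (isChar_lin (lamU ψ n))
  refine ⟨k, ?_⟩
  rw [← hk]
  have h1 : aa ψ 0 f = av fun u : UU F n => ψ (th 0 u.1.1) * f u.1 := by
    rw [← av_equiv (SU (F := F) (n := n)), ← av_comp (rsS F n) (fun s => ⟨ms s, rsS_ms s⟩)]
    unfold aa
    congr 1; funext z
    change _ = ψ (th 0 (mkM 0 (ms (rsS F n z)))) * f (mkU 0 (ms (rsS F n z)))
    rw [mkU_ms]
    congr 2
    rw [← mkU_val, mkU_ms]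
    unfold th
    refine sum_congr rfl fun i _ => sum_congr rfl fun j _ => ?_
    split_ifs with h
    · rw [mkU_val, mkM_apply, if_pos ⟨Nat.zero_le _, by change i.1 < j.1; omega⟩]
    · rfl
  rw [h1]
  unfold av ip
  rw [card_eq_fintype_card]
  congr 1
  refine sum_congr rfl fun u _ => ?_
  change ψ (th 0 u.1.1) * f u.1 = f u.1 * ψ (- th 0 (u⁻¹).1.1)
  refine (mul_comm _ _).trans (congrArg (fun x => f u.1 * ψ x) ?_)
  have h2 : th 0 u.1.1 + th 0 (u⁻¹).1.1 = 0 := by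
    rw [← Uni.th u.2 (u⁻¹).2]
    change th 0 (u.1 * (u.1)⁻¹).1 = 0
    rw [mul_inv_cancel]
    have := Uni.th (Uni.one (F := F) (n := n)) Uni.one
    rw [Matrix.one_mul] at this
    exact left_eq_add.1 this
  exact eq_neg_of_add_eq_zero_left h2
lemma exists_psi (F : Type) [Field F] [Fintype F] : ∃ ψ : AddChar F ℂ, ψ ≠ 1 := by
  obtain ⟨ψ, h⟩ := AddChar.exists_apply_ne_zero (α := F) (a := 1) |>.2 one_ne_zero
  exact ⟨ψ, AddChar.ne_one_iff.2 ⟨1, h⟩⟩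
end Wh
def dm {𝒯 : Tower} (ω : 𝒯.Om) : ℕ := (Irr_one_pos ω.2.2).choose
lemma dm_pos {𝒯 : Tower} (ω : 𝒯.Om) : 0 < dm ω := (Irr_one_pos ω.2.2).choose_spec.1
lemma dm_spec {𝒯 : Tower} (ω : 𝒯.Om) : ω.2.1 1 = dm ω := (Irr_one_pos ω.2.2).choose_spec.2
def gD {F : Type} [Field F] [Fintype F] (ω : (glTower F).Om) : ℚ := dm ω / NN (card F) ω.1
lemma exists_whit (F : Type) [Field F] [Fintype F] : ∃ w : (glTower F).Om → ℕ, ∀ ω : (glTower F).Om,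
    (card F : ℚ) ^ ω.1 * gD ω = ∑ p ∈ (glTower F).psh.cop ω, ((glTower F).psh.c p.1 p.2 ω : ℚ) * (gD p.1 * w p.2) := by
  obtain ⟨ψ, hψ⟩ := Wh.exists_psi F
  choose w hw using fun ω : (glTower F).Om => Wh.aa_nat ψ (Irr.isChar ω.2.2)
  refine ⟨w, ?_⟩
  rintro ⟨n, π⟩
  change (card F : ℚ) ^ n * gD ⟨n, π⟩ = ∑ p ∈ Tower.ccop (𝒯 := glTower F) ⟨n, π⟩, (Tower.cc p.1 p.2 ⟨n, π⟩ : ℚ) * (gD p.1 * w p.2)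
  simp only [Tower.cc_apply]
  rw [Tower.sum_ccop π (fun σ τ => gD σ * (w τ : ℚ))]
  apply Rat.cast_injective (α := ℂ)
  have h := Wh.whit ψ hψ (Irr.isChar π.2).isClass
  have hd : π.1 1 = dm (𝒯 := glTower F) ⟨n, π⟩ := dm_spec (𝒯 := glTower F) ⟨n, π⟩
  rw [Finset.sum_range] at h
  unfold gD
  push_cast
  refine (congrArg (fun x => (card F : ℂ) ^ n * (x / (NN (card F) n : ℚ))) hd).symm.trans (h.trans ?_)
  refine sum_congr rfl fun N _ => ?_
  refine (congrArg (fun x : ℂ => x / ((NN (card F) N.1 : ℚ) : ℂ)) (Wh.aa_expand ψ (Nat.lt_succ_iff.1 N.2) π)).trans ?_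
  beta_reduce
  rw [sum_div]
  refine sum_congr rfl fun σ _ => ?_
  rw [sum_div]
  refine sum_congr rfl fun τ _ => ?_
  have e1 : σ.1 1 = dm (𝒯 := glTower F) ⟨N, σ⟩ := dm_spec (𝒯 := glTower F) ⟨N, σ⟩
  have e2 : Wh.aa ψ 0 τ.1 = w ⟨n - N, τ⟩ := hw ⟨n - N, τ⟩
  have aux : ∀ a b b' c c' d : ℂ, b = b' → c = c' → a * (b * c) / d = a * (b' / d * c') := by intros; subst_vars; ring
  exact aux _ _ _ _ _ _ e1 e2
lemma gD_mul {F : Type} [Field F] [Fintype F] (σ τ : (glTower F).Om) :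
    ((glTower F).psh.c σ τ).sum (fun π k => (k : ℚ) * gD π) = gD σ * gD τ :=
  Tower.co_dim (NN (card F)) (fun n => (NN_pos Wh.one_lt_q n).ne') (fun D => Gl.index D) dm dm_spec σ τ
namespace PSH
variable {Ω : Type} {S : PSH Ω}
lemma emul (σ τ : Ω) : S.e σ * S.e τ = S.cE σ τ := by
  change S.mulL (S.e σ) (S.e τ) = _
  simp [mulL]
lemma lift_emul (f : Ω → ℚ) (σ τ : Ω) : S.lift f (S.e σ * S.e τ) = (S.c σ τ).sum (fun π k => (k : ℚ) * f π) := by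
  rw [emul, lift_cE]; simp
def ev (f : Ω → ℚ) (hm : ∀ σ τ, (S.c σ τ).sum (fun π k => (k : ℚ) * f π) = f σ * f τ) (h1 : f S.one = 1) : S.R →+* ℚ where
  toFun := S.lift f
  map_one' := by rw [one_def, lift_e, h1]
  map_zero' := map_zero _
  map_add' := map_add _
  map_mul' a b := by
    have : (LinearMap.mul ℤ S.R).compr₂ (S.lift f) = (LinearMap.mul ℤ ℚ).compl₁₂ (S.lift f) (S.lift f) := by
      apply S.hom_ext; intro σ; apply S.hom_ext; intro τ
      simp only [compr₂_apply, LinearMap.mul_apply', LinearMap.compl₁₂_apply, lift_emul, lift_e, hm]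
    exact DFunLike.congr_fun (DFunLike.congr_fun this a) b
variable (S) in
def TT (n : ℕ) : Finset Ω := (range (n + 1)).biUnion fun k => (S.fin k).toFinset
lemma mem_TT {n : ℕ} {ω : Ω} : ω ∈ S.TT n ↔ S.deg ω ≤ n := by
  simp [TT]
lemma sum_c {n : ℕ} {σ τ : Ω} (h : S.deg σ + S.deg τ ≤ n) (f : Ω → ℚ) :
    (S.c σ τ).sum (fun π k => (k : ℚ) * f π) = ∑ π ∈ S.TT n, (S.c σ τ π : ℚ) * f π := by
  refine Finsupp.sum_of_support_subset _ (fun π hπ => ?_) _ (by simp)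
  rw [mem_TT, S.c_deg (Finsupp.mem_support_iff.1 hπ)]; exact h
lemma sum_cop {n : ℕ} {π : Ω} (h : S.deg π ≤ n) (f : Ω → Ω → ℚ) :
    ∑ p ∈ S.cop π, (S.c p.1 p.2 π : ℚ) * f p.1 p.2 = ∑ γ ∈ S.TT n, ∑ δ ∈ S.TT n, (S.c γ δ π : ℚ) * f γ δ := by
  rw [← sum_product']
  refine sum_subset (fun p hp => ?_) (fun p _ hp => ?_)
  · have := S.c_deg ((S.mem_cop _ _).1 hp)
    rw [mem_product, mem_TT, mem_TT]; omega
  · rw [S.mem_cop, not_not] at hp; rw [hp]; simp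
lemma hopf_sum (σ τ : Ω) (f g : Ω → ℚ) :
    (S.c σ τ).sum (fun π k => (k : ℚ) * ∑ p ∈ S.cop π, (S.c p.1 p.2 π : ℚ) * (f p.1 * g p.2)) =
    ∑ p ∈ S.cop σ, ∑ p' ∈ S.cop τ, (S.c p.1 p.2 σ : ℚ) * S.c p'.1 p'.2 τ *
      (S.lift f (S.e p.1 * S.e p'.1) * S.lift g (S.e p.2 * S.e p'.2)) := by
  set n := S.deg σ + S.deg τ
  have h1 : ∀ γ δ, ∑ π ∈ S.TT n, (S.c σ τ π : ℚ) * S.c γ δ π =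
      ∑ p ∈ S.cop σ, ∑ p' ∈ S.cop τ, (S.c p.1 p.2 σ : ℚ) * S.c p'.1 p'.2 τ * S.c p.1 p'.1 γ * S.c p.2 p'.2 δ := by
    intro γ δ
    rw [← sum_c (le_refl n)]
    have := S.hopf σ τ γ δ
    have h2 := congrArg (Nat.cast : ℕ → ℚ) this
    push_cast [Finsupp.sum] at h2
    exact h2
  calc _ = ∑ π ∈ S.TT n, ∑ γ ∈ S.TT n, ∑ δ ∈ S.TT n, (f γ * g δ) * ((S.c σ τ π : ℚ) * S.c γ δ π) := by
        rw [sum_c (le_refl n)]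
        refine sum_congr rfl fun π hπ => ?_
        rw [sum_cop (mem_TT.1 hπ) (fun a b => f a * g b), mul_sum]
        refine sum_congr rfl fun γ _ => ?_
        rw [mul_sum]
        exact sum_congr rfl fun δ _ => by ring
    _ = ∑ γ ∈ S.TT n, ∑ δ ∈ S.TT n, (f γ * g δ) * ∑ π ∈ S.TT n, ((S.c σ τ π : ℚ) * S.c γ δ π) := by
        rw [sum_comm]
        refine sum_congr rfl fun γ _ => ?_
        rw [sum_comm]
        exact sum_congr rfl fun δ _ => by rw [mul_sum]
    _ = ∑ γ ∈ S.TT n, ∑ δ ∈ S.TT n, ∑ p ∈ S.cop σ, ∑ p' ∈ S.cop τ, (S.c p.1 p.2 σ : ℚ) * S.c p'.1 p'.2 τ * ((S.c p.1 p'.1 γ * f γ) * (S.c p.2 p'.2 δ * g δ)) := by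
        simp only [h1, mul_sum]
        refine sum_congr rfl fun γ _ => sum_congr rfl fun δ _ => sum_congr rfl fun p _ => sum_congr rfl fun p' _ => by ring
    _ = ∑ p ∈ S.cop σ, ∑ p' ∈ S.cop τ, ∑ γ ∈ S.TT n, ∑ δ ∈ S.TT n, (S.c p.1 p.2 σ : ℚ) * S.c p'.1 p'.2 τ * ((S.c p.1 p'.1 γ * f γ) * (S.c p.2 p'.2 δ * g δ)) := by
        exact ((sum_congr rfl fun a _ => sum_comm).trans sum_comm).trans (sum_congr rfl fun c _ =>
          (sum_congr rfl fun a _ => sum_comm).trans sum_comm)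
    _ = _ := by
        refine sum_congr rfl fun p hp => sum_congr rfl fun p' hp' => ?_
        have e1 := S.c_deg ((S.mem_cop _ _).1 hp)
        have e2 := S.c_deg ((S.mem_cop _ _).1 hp')
        rw [lift_emul, lift_emul, sum_c (n := n) (by omega), sum_c (n := n) (by omega), sum_mul_sum, mul_sum]
        exact sum_congr rfl fun γ _ => by rw [mul_sum]
/-- A multiplicative degree function together with its Whittaker function -/
structure Whit (S : PSH Ω) where
  D : Ω → ℚ
  w : Ω → ℕ
  q : ℚ
  q_gt : 1 < q
  D_one : D S.one = 1
  D_mul : ∀ σ τ, (S.c σ τ).sum (fun π k => (k : ℚ) * D π) = D σ * D τ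
  W1 : ∀ ω, q ^ S.deg ω * D ω = ∑ p ∈ S.cop ω, (S.c p.1 p.2 ω : ℚ) * (D p.1 * w p.2)
namespace Whit
variable (V : S.Whit)
lemma one_cop (ω : Ω) : (S.one, ω) ∈ S.cop ω := by
  rw [S.mem_cop, S.c_one_left]; simp
lemma c_one (p : Ω × Ω) {σ : Ω} (hp : p ∈ S.cop σ) (h1 : p.1 = S.one) : p = (S.one, σ) := by
  obtain ⟨a, b⟩ := p
  subst h1
  rw [S.mem_cop, S.c_one_left, Finsupp.single_apply] at hp
  have : σ = b ∨ b = σ := by by_contra h; push Not at h; simp [h.1, h.2] at hp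
  rcases this with h | h <;> rw [h]
lemma w_one : V.w S.one = 1 := by
  have h := V.W1 S.one
  have hc : S.cop S.one = {(S.one, S.one)} := by
    refine Finset.eq_singleton_iff_unique_mem.2 ⟨one_cop _, fun p hp => ?_⟩
    refine c_one p hp (S.eq_one _ ?_)
    have := S.c_deg ((S.mem_cop _ _).1 hp)
    rw [S.deg_one] at this; omega
  rw [hc, sum_singleton, S.c_one_left, S.deg_one, V.D_one] at h
  simp at h
  exact_mod_cast h.symm
lemma w_mul (σ τ : Ω) : (S.c σ τ).sum (fun π k => (k : ℚ) * V.w π) = V.w σ * V.w τ := by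
  induction hn : S.deg σ + S.deg τ using Nat.strong_induction_on generalizing σ τ with
  | _ n ih =>
  have h1 := hopf_sum (S := S) σ τ V.D (fun x => V.w x)
  have h2 : (S.c σ τ).sum (fun π k => (k : ℚ) * ∑ p ∈ S.cop π, (S.c p.1 p.2 π : ℚ) * (V.D p.1 * V.w p.2)) =
      (V.q ^ S.deg σ * V.D σ) * (V.q ^ S.deg τ * V.D τ) := by
    have : ∀ a b c d : ℚ, (a * b) * (c * d) = (a * c) * (b * d) := by intros; ring
    rw [this, ← V.D_mul, ← pow_add, Finsupp.sum, Finsupp.sum, mul_sum]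
    refine sum_congr rfl fun π hπ => ?_
    rw [← V.W1, S.c_deg (Finsupp.mem_support_iff.1 hπ)]; ring
  rw [h2, V.W1, V.W1, sum_mul_sum] at h1
  simp only [lift_emul, V.D_mul] at h1
  rw [← sum_product', ← sum_product', ← sub_eq_zero, ← Finset.sum_sub_distrib,
    sum_eq_single ((S.one, σ), (S.one, τ))] at h1
  · simp [S.c_one_left, V.D_one] at h1
    exact (sub_eq_zero.1 h1).symm
  · rintro ⟨p, p'⟩ hp hne
    rw [mem_product] at hp
    have e1 := S.c_deg ((S.mem_cop _ _).1 hp.1)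
    have e2 := S.c_deg ((S.mem_cop _ _).1 hp.2)
    rw [ih (S.deg p.2 + S.deg p'.2) ?_ _ _ rfl]
    · ring
    · by_contra hlt
      have a1 := c_one p hp.1 (S.eq_one _ (by simp only at e1 e2; omega))
      have a2 := c_one p' hp.2 (S.eq_one _ (by simp only at e1 e2; omega))
      exact hne (by rw [a1, a2])
  · intro h
    exact absurd (mem_product.2 ⟨one_cop _, one_cop _⟩) h
def eD : S.R →+* ℚ := ev V.D V.D_mul V.D_one
def ew : S.R →+* ℚ := ev (fun x => V.w x) V.w_mul (by rw [V.w_one]; simp)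
lemma eD_e (ω : Ω) : V.eD (S.e ω) = V.D ω := lift_e _ _ _
lemma ew_e (ω : Ω) : V.ew (S.e ω) = V.w ω := lift_e _ _ _
lemma W2 (ω : Ω) : (V.q ^ S.deg ω - 1) * V.D ω =
    ∑ p ∈ (S.cop ω).filter (fun p => p.2 ≠ S.one), (S.c p.1 p.2 ω : ℚ) * (V.D p.1 * V.w p.2) := by
  have h1 := V.W1 ω
  rw [← Finset.sum_filter_add_sum_filter_not _ (fun p => p.2 ≠ S.one)] at h1
  have h2 : (S.cop ω).filter (fun p => ¬ p.2 ≠ S.one) = {(ω, S.one)} := by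
    refine Finset.eq_singleton_iff_unique_mem.2 ⟨?_, fun p hp => ?_⟩
    · rw [mem_filter, S.mem_cop, S.c_one_right]; simp
    · rw [mem_filter, not_not] at hp
      obtain ⟨a, b⟩ := p
      obtain ⟨hp, h3⟩ := hp
      simp only at h3
      subst h3
      rw [S.mem_cop, S.c_one_right, Finsupp.single_apply] at hp
      have : a = ω := by by_contra h; simp [h] at hp
      rw [this]
  rw [h2, sum_singleton, S.c_one_right, V.w_one] at h1
  simp at h1
  rw [sub_mul, one_mul, h1]; simp
end Whit
variable {Ω : Type} {S : PSH Ω}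
lemma cop_X {x : ℕ → Ω} (hx : ∀ σ τ n, S.c σ τ (x n) = if ∃ i ≤ n, σ = x i ∧ τ = x (n - i) then 1 else 0)
    {n : ℕ} {p : Ω × Ω} (hp : p ∈ S.cop (x n)) : ∃ i ≤ n, p = (x i, x (n - i)) := by
  rw [S.mem_cop, hx] at hp
  have : ∃ i ≤ n, p.1 = x i ∧ p.2 = x (n - i) := by by_contra h; simp [h] at hp
  obtain ⟨i, hi, h1, h2⟩ := this
  exact ⟨i, hi, Prod.ext h1 h2⟩
lemma deg_X' {ρ : Ω} {x : ℕ → Ω} (h0 : x 0 = S.one) (h1 : ∀ n, S.c ρ (x n) (x (n + 1)) = 1) (n : ℕ) :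
    S.deg (x n) = n * S.deg ρ := by
  induction n with
  | zero => rw [h0, S.deg_one, zero_mul]
  | succ n ih => rw [S.c_deg (by rw [h1 n]; simp), ih]; ring
structure IsX (S : PSH Ω) (ρ : Ω) (x : ℕ → Ω) : Prop where
  h0 : x 0 = S.one
  h1 : x 1 = ρ
  deg : ∀ n, S.deg (x n) = n * S.deg ρ
  c : ∀ σ τ n, S.c σ τ (x n) = if ∃ i ≤ n, σ = x i ∧ τ = x (n - i) then 1 else 0
lemma Prim.exists_X {ρ : Ω} (hρ : S.Prim ρ) : ∃ x, S.IsX ρ x := by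
  obtain ⟨u, y, huy, hsq⟩ := hρ.sq
  obtain ⟨x, h0, h1, h2, -, -, h3⟩ := hρ.exists_h huy hsq
  exact ⟨x, h0, h1, deg_X' h0 h2, h3⟩
namespace Whit
variable (V : S.Whit)
lemma w_zero_of {σ τ π : Ω} (h : V.w σ = 0) (hc : S.c σ τ π ≠ 0) : V.w π = 0 := by
  have h1 := V.w_mul σ τ
  rw [h, Nat.cast_zero, zero_mul, Finsupp.sum, Finset.sum_eq_zero_iff_of_nonneg (fun _ _ => by positivity)] at h1
  have := h1 π (Finsupp.mem_support_iff.2 hc)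
  rw [mul_eq_zero] at this
  exact_mod_cast this.resolve_left (by exact_mod_cast hc)
lemma W3 (ω : Ω) : ∃ T : Finset (Ω × Ω), (∀ p, p ∈ T ↔ p ∈ S.cop ω ∧ p.2 ≠ S.one) ∧
    (V.q ^ S.deg ω - 1) * V.D ω = ∑ p ∈ T, (S.c p.1 p.2 ω : ℚ) * (V.D p.1 * V.w p.2) :=
  ⟨_, fun _ => mem_filter, V.W2 ω⟩
lemma D_prim {ρ : Ω} (h : S.Prim ρ) : (V.q ^ S.deg ρ - 1) * V.D ρ = V.w ρ := by
  have h1 : (S.cop ρ).filter (fun p => p.2 ≠ S.one) = {(S.one, ρ)} := by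
    refine Finset.eq_singleton_iff_unique_mem.2 ⟨?_, fun p hp => ?_⟩
    · exact mem_filter.2 ⟨one_cop _, h.ne_one⟩
    · rw [mem_filter] at hp
      exact c_one p hp.1 ((h.2 _ _ ((S.mem_cop _ _).1 hp.1)).resolve_right hp.2)
  rw [V.W2, h1, sum_singleton, S.c_one_left, V.D_one]; simp
lemma exists_X {ρ : Ω} (hρ : S.Prim ρ) (hw : V.w ρ = 1) : ∃ x, S.IsX ρ x ∧
    ∀ n, V.D (x n) * NN (V.q ^ S.deg ρ) n = 1 := by
  obtain ⟨u, y, huy, hsq, hu⟩ : ∃ u y, u ≠ y ∧ S.e ρ * S.e ρ = S.e u + S.e y ∧ V.w u = 0 := by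
    obtain ⟨u, y, huy, hsq⟩ := hρ.sq
    have h1 := congrArg V.ew hsq
    rw [map_mul, map_add, ew_e, ew_e, ew_e, hw] at h1
    have h2 : V.w u + V.w y = 1 := by
      rw [cast_one, one_mul] at h1; exact_mod_cast h1.symm
    rcases Nat.eq_zero_or_pos (V.w u) with h | h
    · exact ⟨u, y, huy, hsq, h⟩
    · exact ⟨y, u, huy.symm, by rw [hsq, add_comm], by omega⟩
  obtain ⟨x, h0, h1, h2, -, hx2, h3⟩ := hρ.exists_h huy hsq
  have hX : S.IsX ρ x := ⟨h0, h1, deg_X' h0 h2, h3⟩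
  refine ⟨x, hX, fun n => ?_⟩
  have hw0 : ∀ n, V.w (x (n + 2)) = 0 := fun n => by
    refine V.w_zero_of hu (τ := x n) ?_
    rw [h3, if_pos ⟨2, by omega, hx2.symm, by rw [Nat.add_sub_cancel]⟩]; simp
  induction n with
  | zero => rw [h0, V.D_one, NN]; simp
  | succ n ih =>
    have h4 := V.W2 (x (n + 1))
    have hne : V.q ^ S.deg ρ > 1 := one_lt_pow₀ V.q_gt hρ.1.ne'
    rw [sum_eq_single (x n, ρ), h3, if_pos ⟨n, by omega, rfl, by rw [Nat.add_sub_cancel_left, h1]⟩, hw, hX.deg,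
      mul_comm (n + 1), pow_mul] at h4
    · rw [NN_succ, mul_comm (NN _ n), ← mul_assoc, mul_comm (V.D _), h4]
      simpa using ih
    · intro p hp hpn
      rw [mem_filter] at hp
      obtain ⟨i, hi, rfl⟩ := cop_X h3 hp.1
      have a1 : i ≠ n + 1 := by rintro rfl; exact hp.2 (by simp [h0])
      have a2 : i ≠ n := by rintro rfl; exact hpn (by simp [h1])
      have : n + 1 - i = (n - 1 - i) + 2 := by omega
      simp only [this, hw0]; simp
    · intro hn
      exfalso; apply hn
      rw [mem_filter, S.mem_cop, S.c_comm, ]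
      exact ⟨by rw [h2 n]; simp, hρ.ne_one⟩
end Whit
end PSH
lemma exists_V (F : Type) [Field F] [Fintype F] : ∃ V : (glTower F).psh.Whit, V.D = gD ∧ V.q = card F := by
  obtain ⟨w, hw⟩ := exists_whit F
  refine ⟨⟨gD, w, card F, Wh.one_lt_q, ?_, gD_mul, hw⟩, rfl, rfl⟩
  have h : (Tower.one1 (𝒯 := glTower F)).2.1 1 = dm (Tower.one1 (𝒯 := glTower F)) := dm_spec _
  have h1 : (Tower.one1 (𝒯 := glTower F)).2.1 1 = 1 := rfl
  have h2 : dm (Tower.one1 (𝒯 := glTower F)) = 1 := by rw [h1] at h; exact_mod_cast h.symm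
  change (dm (Tower.one1 (𝒯 := glTower F)) : ℚ) / NN _ 0 = 1
  rw [h2, NN]; simp
/-- every irreducible constituent of a power of a cuspidal of degree at least 3 has degree divisible by 3 -/
lemma three_dvd {F : Type} [Field F] [Fintype F] (h3 : 3 ∣ card F + 1) {ρ ω : (glTower F).Om} (hρ : (glTower F).psh.Prim ρ)
    (hr : 3 ≤ ρ.1) {k : ℕ} (hk : ((glTower F).psh.e ρ ^ k) ω ≠ 0) (h0 : 0 < ω.1) : 3 ∣ dm ω := by
  obtain ⟨V, hV, hq⟩ := exists_V F
  have hdiv : ∀ a b, a + 3 ≤ b → ∃ z : ℤ, NN (card F) (b - 1) / NN (card F) a = 3 * z := by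
    intro a b hab
    have key : ∀ d, ∃ z : ℤ, NN (card F) (a + 2 + d) = NN (card F) a * (3 * z) := by
      intro d
      induction d with
      | zero =>
        rw [add_zero, NN_succ, NN_succ, mul_assoc]
        have : (3 : ℤ) ∣ ((card F : ℤ) ^ (a + 1) - 1) * ((card F : ℤ) ^ (a + 1 + 1) - 1) := by
          have h3' : (card F : ℤ) ≡ -1 [ZMOD 3] := (Int.modEq_iff_dvd.2 (by
            have : (3 : ℤ) ∣ card F + 1 := by exact_mod_cast h3
            obtain ⟨c, hc⟩ := this
            exact ⟨-c, by linarith⟩))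
          rcases Nat.even_or_odd (a + 1) with h | h
          · refine Dvd.dvd.mul_right (Int.modEq_iff_dvd.1 ?_) _
            have := (h3'.pow (a + 1)).symm
            rwa [h.neg_one_pow] at this
          · refine Dvd.dvd.mul_left (Int.modEq_iff_dvd.1 ?_) _
            have := (h3'.pow (a + 1 + 1)).symm
            rwa [h.add_one.neg_one_pow] at this
        obtain ⟨z, hz⟩ := this
        refine ⟨z, ?_⟩
        have := congrArg (Int.cast : ℤ → ℚ) hz
        push_cast at this
        rw [this]
      | succ d ih =>
        obtain ⟨z, hz⟩ := ih
        refine ⟨z * ((card F : ℤ) ^ (a + 2 + d + 1) - 1), ?_⟩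
        rw [← add_assoc, NN_succ, hz]; push_cast; ring
    obtain ⟨z, hz⟩ := key (b - 1 - (a + 2))
    refine ⟨z, ?_⟩
    rw [show a + 2 + (b - 1 - (a + 2)) = b - 1 by omega] at hz
    rw [hz, mul_div_cancel_left₀ _ (NN_pos Wh.one_lt_q a).ne']
  obtain ⟨T, hT, hW⟩ := V.W3 ω
  rw [hV, hq] at hW
  have e0 : (dm ω : ℚ) = NN (card F) (ω.1 - 1) * (((card F : ℚ) ^ ω.1 - 1) * gD ω) := by
    have := NN_succ (card F) (ω.1 - 1)
    rw [Nat.sub_add_cancel h0] at this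
    rw [← mul_assoc, ← this, gD, mul_div_cancel₀ _ (NN_pos Wh.one_lt_q _).ne']
  have e1 : ∀ p ∈ T,
      ∃ z : ℤ, NN (card F) (ω.1 - 1) * (((glTower F).psh.c p.1 p.2 ω : ℚ) * (gD p.1 * V.w p.2)) = 3 * z := by
    intro p hp
    replace hp := (hT p).1 hp
    rw [PSH.mem_cop] at hp
    have hd : ω.1 = p.1.1 + p.2.1 := (glTower F).psh.c_deg hp.1
    have hB : (glTower F).psh.B ((glTower F).psh.e p.1 * (glTower F).psh.e p.2) ((glTower F).psh.e ρ ^ k) ≠ 0 := by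
      refine (PSH.Pos.B_pos (PSH.Pos.mul (PSH.pos_e _ _) (PSH.pos_e _ _)) ((PSH.pos_e _ _).pow _) (ω := ω) ?_ hk).ne'
      rw [PSH.e_mul_e]; exact_mod_cast hp.1
    obtain ⟨i, j, -, -, hj⟩ := hρ.split k _ _ hB
    have hj2 : p.2.1 = ∑ _i ∈ range j, ρ.1 := by
      have := PSH.hom_prod (range j) _ _ (fun _ _ => PSH.hom_e (S := (glTower F).psh) ρ) p.2 (by rwa [prod_const, card_range])
      exact this
    have hj0 : j ≠ 0 := by
      rintro rfl
      exact hp.2 ((glTower F).psh.eq_one _ (by change p.2.1 = 0; simpa using hj2))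
    have hj3 : 3 ≤ p.2.1 := by
      rw [hj2, sum_const, card_range, smul_eq_mul]; nlinarith [Nat.pos_of_ne_zero hj0]
    obtain ⟨z, hz⟩ := hdiv p.1.1 ω.1 (by omega)
    refine ⟨(glTower F).psh.c p.1 p.2 ω * dm p.1 * V.w p.2 * z, ?_⟩
    rw [gD]
    have aux : ∀ a b c d e : ℚ, a * (b * (c / d * e)) = (a / d) * (b * c * e) := by intros; ring
    rw [aux, hz]; push_cast; ring
  choose! z hz using e1
  have e2 : (dm ω : ℚ) = ((3 * ∑ p ∈ T, z p : ℤ) : ℚ) := by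
    rw [e0]
    refine (congrArg (fun x => NN (card F) (ω.1 - 1) * x) hW).trans ?_
    rw [mul_sum, sum_congr rfl hz]
    push_cast
    rw [mul_sum]
  have e3 : (dm ω : ℤ) = 3 * ∑ p ∈ T, z p := by exact_mod_cast e2
  exact_mod_cast (Dvd.intro _ e3.symm : (3 : ℤ) ∣ dm ω)
namespace Chr
variable {G : Type} [Group G] [Fintype G]
lemma card_Irr : card (Irr G) = Nat.card (ConjClasses G) := by
  have hc : ∀ χ : Irr G, ∀ a b : G, IsConj a b → χ.1 a = χ.1 b := fun χ a b h => by
    obtain ⟨c, rfl⟩ := isConj_iff.1 h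
    exact ((Irr.isChar χ.2).isClass a c).symm
  let v : Irr G → (ConjClasses G → ℂ) := fun χ => Quotient.lift χ.1 (hc χ)
  let T : (ConjClasses G → ℂ) →ₗ[ℂ] (G → ℂ) := LinearMap.funLeft ℂ ℂ ConjClasses.mk
  have hli : LinearIndependent ℂ v := LinearIndependent.of_comp T (Irr_linearIndependent (G := G))
  have hsp : ⊤ ≤ Submodule.span ℂ (Set.range v) := by
    intro f _
    have h1 := class_expand (G := G) (f := T f) (fun g x => congrArg f (ConjClasses.mk_eq_mk_iff_isConj.2 (isConj_iff.2 ⟨x, rfl⟩).symm))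
    have h2 : f = ∑ χ : Irr G, ip (T f) χ • v χ := by
      funext x
      obtain ⟨g, rfl⟩ := ConjClasses.mk_surjective x
      rw [Finset.sum_apply]; exact h1 g
    rw [h2]
    exact Submodule.sum_mem _ fun χ _ => Submodule.smul_mem _ _ (Submodule.subset_span ⟨χ, rfl⟩)
  have := Module.finrank_eq_card_basis (Module.Basis.mk hli hsp)
  rw [← this, Module.finrank_pi, card_eq_fintype_card]
lemma sum_sq : ∑ χ : Irr G, χ.1 1 * χ.1 1 = Nat.card G := by
  have h := class_expand (G := G) (f := fun g => if g = 1 then 1 else 0) (fun g x => by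
    have : x * g * x⁻¹ = 1 ↔ g = 1 := conj_eq_one_iff
    simp only [this]) 1
  have hG : (Nat.card G : ℂ) ≠ 0 := NeZero.ne _
  have h2 : ∀ χ : Irr G, ip (fun g => if g = 1 then 1 else 0) χ.1 = (Nat.card G : ℂ)⁻¹ * χ.1 1 := by
    intro χ
    unfold ip
    rw [sum_eq_single 1] <;> simp +contextual
  simp only [h2, if_true] at h
  rw [← mul_inv_cancel_left₀ hG (∑ χ : Irr G, χ.1 1 * χ.1 1), mul_sum]
  simp only [← mul_assoc]
  rw [← h, mul_one]
lemma card_Irr_comm (hc : ∀ a b : G, a * b = b * a) : card (Irr G) = Nat.card G := by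
  rw [card_Irr]
  refine (card_congr (Equiv.ofBijective ConjClasses.mk ⟨fun a b h => ?_, ConjClasses.mk_surjective⟩)).symm
  obtain ⟨c, h⟩ := isConj_iff.1 (ConjClasses.mk_eq_mk_iff_isConj.1 h)
  rw [← h, hc c a, mul_inv_cancel_right]
lemma one_comm (hc : ∀ a b : G, a * b = b * a) (χ : Irr G) : χ.1 1 = 1 := by
  choose d hd hd1 using fun χ : Irr G => Irr_one_pos χ.2
  have h := sum_sq (G := G)
  simp only [hd1] at h
  have h1 : ∑ χ : Irr G, d χ * d χ = ∑ χ : Irr G, 1 := by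
    rw [sum_const, card_univ, card_Irr_comm hc, smul_eq_mul, mul_one]
    exact_mod_cast h
  have h2 := (Finset.sum_eq_sum_iff_of_le (fun χ _ => Nat.mul_pos (hd χ) (hd χ))).1 h1.symm χ (mem_univ _)
  rw [hd1, Nat.eq_one_of_mul_eq_one_left h2.symm, cast_one]
lemma irr_comp {H : Type} [Group H] [Fintype H] (φ : H ≃* G) {f : G → ℂ} (hf : f ∈ Irr G) : (fun h => f (φ h)) ∈ Irr H := by
  rw [mem_Irr_iff] at hf ⊢
  refine ⟨hf.1.comp φ.toMonoidHom, ?_⟩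
  rw [← hf.2]
  unfold ip
  rw [card_congr φ.toEquiv]
  congr 1
  refine Fintype.sum_equiv φ.toEquiv _ _ fun h => ?_
  simp
/-- irreducible characters of a group with an abelian subgroup of index at most two -/
lemma irr_two (ε : G →* ℂ) (hε : ∀ g, ε g = 1 ∨ ε g = -1) (hc : ∀ g h, ε g = 1 → ε h = 1 → g * h = h * g)
    {χ : G → ℂ} (hχ : χ ∈ Irr G) : ∃ k : ℕ, k ≤ 2 ∧ χ 1 = k := by
  have hG : (Nat.card G : ℂ) ≠ 0 := NeZero.ne _
  have hA : (Nat.card ε.ker : ℂ) ≠ 0 := NeZero.ne _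
  have hsum : ∀ F : G → ℂ, ∑ g, F g * (1 + ε g) = 2 * ∑ a : ε.ker, F a.1 := by
    intro F
    rw [← Finset.sum_subtype (univ.filter fun g => ε g = 1) (fun g => by rw [mem_filter, MonoidHom.mem_ker]; simp) F,
      sum_filter, mul_sum]
    refine sum_congr rfl fun g _ => ?_
    rcases hε g with h | h
    · rw [if_pos h, h]; ring
    · rw [if_neg (by rw [h]; norm_num), h]; ring
  have hεχ : (fun g => χ g * ε g) ∈ Irr G := by
    rw [mem_Irr_iff] at hχ ⊢
    refine ⟨hχ.1.mul (isChar_lin ε), ?_⟩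
    rw [← hχ.2]
    unfold ip
    congr 1
    refine sum_congr rfl fun g _ => ?_
    have : ε g * ε g⁻¹ = 1 := by rw [← map_mul, mul_inv_cancel, map_one]
    linear_combination (χ g * χ g⁻¹) * this
  obtain ⟨k, hk, hk1⟩ : ∃ k : ℕ, k ≤ 1 ∧ ip (fun g => χ g * ε g) χ = k := by
    rw [ip_Irr hεχ hχ]; split_ifs
    · exact ⟨1, le_refl _, by simp⟩
    · exact ⟨0, by simp, by simp⟩
  obtain ⟨k', hk'⟩ := IsChar.ip_nat (isChar_lin ε) (isChar_lin (1 : G →* ℂ))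
  have e1 := hsum (fun g => χ g * χ g⁻¹)
  have e2 := hsum (fun _ => 1)
  have e3 : ∑ g, χ g * χ g⁻¹ * (1 + ε g) = Nat.card G * (1 + k) := by
    have hip := (mem_Irr_iff.1 hχ).2
    unfold ip at hip hk1
    rw [inv_mul_eq_iff_eq_mul₀ hG] at hip hk1
    rw [mul_add, ← hip, ← hk1, ← sum_add_distrib]
    exact sum_congr rfl fun g _ => by ring
  have e4 : ∑ g, (1 : ℂ) * (1 + ε g) = Nat.card G * (1 + k') := by
    rw [← hk']
    unfold ip
    rw [mul_add, mul_inv_cancel_left₀ hG]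
    simp [mul_add, sum_add_distrib]
  rw [e3] at e1
  rw [e4] at e2
  set f : ε.ker → ℂ := fun a => χ a.1 with hf
  have hfc : IsChar f := (Irr.isChar hχ).comp ε.ker.subtype
  have e5 : ip f f * (1 + k') = 1 + k := by
    have a1 : ∑ a : ε.ker, χ a.1 * χ (a.1)⁻¹ = Nat.card ε.ker * ip f f := by
      unfold ip; rw [mul_inv_cancel_left₀ hA]; rfl
    have a2 : ∑ a : ε.ker, (1 : ℂ) = Nat.card ε.ker := by simp
    rw [a1] at e1
    rw [a2] at e2
    apply mul_left_cancel₀ (mul_ne_zero hG hA)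
    linear_combination (- (Nat.card ε.ker : ℂ)) * e1 + Nat.card ε.ker * ip f f * e2
  choose mm hm using fun l : Irr ε.ker => IsChar.ip_nat hfc (Irr.isChar l.2)
  have hcA : ∀ a b : ε.ker, a * b = b * a := fun a b => Subtype.ext (hc _ _ a.2 b.2)
  have e6 : ip f f = ((∑ l, mm l * mm l : ℕ) : ℂ) := by
    rw [ip_expand hfc.isClass]
    push_cast
    refine sum_congr rfl fun l _ => ?_
    rw [ip_comm l.1, hm]
  have e7 : χ 1 = ((∑ l, mm l : ℕ) : ℂ) := by
    have : χ 1 = f 1 := rfl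
    rw [this, class_expand hfc.isClass 1]
    push_cast
    refine sum_congr rfl fun l _ => ?_
    rw [hm, one_comm hcA, mul_one]
  refine ⟨_, ?_, e7⟩
  rw [e6] at e5
  have e8 : (∑ l, mm l * mm l) * (1 + k') = 1 + k := by exact_mod_cast e5
  have e9 : ∑ l, mm l ≤ ∑ l, mm l * mm l := sum_le_sum fun l _ => Nat.le_mul_self _
  nlinarith
end Chr
namespace PSH
variable {Ω : Type} {S : PSH Ω}
lemma prim_deg1 {ρ : Ω} (h : S.deg ρ = 1) : S.Prim ρ := by
  refine ⟨by omega, fun σ τ hc => ?_⟩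
  have := S.c_deg hc
  by_cases h0 : S.deg σ = 0
  · exact Or.inl (S.eq_one _ h0)
  · exact Or.inr (S.eq_one _ (by omega))
lemma B_two {σ τ σ' τ' : Ω} (hσ : S.deg σ = 1) (hσ' : S.deg σ' = 1) (hτ' : S.deg τ' = 1) :
    S.B (S.e σ' * S.e τ') (S.e σ * S.e τ) = (if σ = σ' ∧ τ = τ' then 1 else 0) + (if σ = τ' ∧ τ = σ' then 1 else 0) := by
  have key : ∀ α, S.deg α = 1 → S.perp σ (S.e α) = if σ = α then 1 else 0 := by
    intro α hα
    split_ifs with h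
    · rw [h, perp_self_e]
    · exact (prim_deg1 hα).perp_e (prim_deg1 hσ).ne_one h
  rw [← perp_adj, (prim_deg1 hσ).perp_mul, key _ hσ', key _ hτ', map_add, LinearMap.add_apply, B_e_right, B_e_right]
  have aux : ∀ (p : Prop) (x : S.R), ((if p then 1 else 0) * x) τ = if p then x τ else 0 := by
    intro p x; split_ifs <;> simp
  rw [aux, mul_comm (S.e σ'), aux, e_apply, e_apply, eq_comm (a := τ'), eq_comm (a := σ') (b := τ)]
  simp only [ite_and]
namespace Whit
variable (V : S.Whit)
lemma count2 (q : ℕ) (hq : V.q = q) (L M : Finset Ω) (hL : ∀ ω, ω ∈ L ↔ S.deg ω = 1) (hM : ∀ ω, ω ∈ M ↔ S.deg ω = 2)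
    (hLc : (L.card : ℚ) = q - 1) (hw : ∀ σ ∈ L, V.w σ = 1) (hD : ∀ π ∈ M, 0 < V.D π)
    (hsum : ∑ π ∈ M, (V.D π * ((q - 1) * (q ^ 2 - 1))) ^ 2 = ((q : ℚ) ^ 2 - 1) * (q ^ 2 - q)) (hcard : (q : ℚ) ^ 2 - 1 ≤ M.card) :
    (∀ π ∈ M, S.Prim π → V.w π = 1) ∧ 2 * ((M.filter S.Prim).card : ℚ) = q * (q - 1) := by
  have hq1 : (1 : ℚ) < q := hq ▸ V.q_gt
  have hq0 : (q : ℚ) - 1 ≠ 0 := by linarith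
  have hqq : (q : ℚ) ^ 2 - 1 ≠ 0 := by nlinarith
  set d : Ω → ℚ := fun π => V.D π * ((q - 1) * (q ^ 2 - 1)) with hd
  set t : Ω → ℚ := fun π => ∑ σ ∈ L, ∑ τ ∈ L, (S.c σ τ π : ℚ) with ht
  have hDL : ∀ σ ∈ L, V.D σ * (q - 1) = 1 := by
    intro σ hσ
    have := V.D_prim (prim_deg1 ((hL σ).1 hσ))
    rw [hq, (hL σ).1 hσ, hw σ hσ, pow_one] at this
    push_cast at this; linarith
  have hc : ∀ σ τ π, (S.c σ τ π : ℚ) = ((S.e σ * S.e τ) π : ℤ) := fun σ τ π => by rw [e_mul_e]; simp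
  have hcM : ∀ σ ∈ L, ∀ τ ∈ L, ∀ π, S.c σ τ π ≠ 0 → π ∈ M := fun σ hσ τ hτ π h => by
    rw [hM, S.c_deg h, (hL σ).1 hσ, (hL τ).1 hτ]
  -- the nonprimitive elements
  have F2 : ∀ g : Ω → ℚ, ∑ π ∈ M.filter (fun π => ¬ S.Prim π), g π = ∑ σ ∈ L, ∑ τ ∈ L, ∑ π ∈ M, (S.c σ τ π : ℚ) * (g π / t π) := by
    intro g
    have e1 : ∀ π ∈ M, (if ¬ S.Prim π then g π else 0) = ∑ σ ∈ L, ∑ τ ∈ L, (S.c σ τ π : ℚ) * (g π / t π) := by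
      intro π hπ
      simp only [← sum_mul]
      change _ = t π * (g π / t π)
      split_ifs with h
      · have : t π = 0 := sum_eq_zero fun σ hσ => sum_eq_zero fun τ hτ => by
          by_contra h1
          rcases h.2 σ τ (by exact_mod_cast h1) with rfl | rfl
          · have := (hL _).1 hσ; rw [S.deg_one] at this; omega
          · have := (hL _).1 hτ; rw [S.deg_one] at this; omega
        rw [this, zero_mul]
      · rw [mul_div_cancel₀]
        unfold Prim at h
        push Not at h
        obtain ⟨σ, τ, h1, h2, h3⟩ := h (by rw [(hM π).1 hπ]; norm_num)
        have e2 := S.c_deg h1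
        rw [(hM π).1 hπ] at e2
        have e3 : S.deg σ ≠ 0 := fun h => h2 (S.eq_one _ h)
        have e4 : S.deg τ ≠ 0 := fun h => h3 (S.eq_one _ h)
        refine (lt_of_lt_of_le ?_ ((single_le_sum (f := fun τ => (S.c σ τ π : ℚ)) (fun _ _ => by positivity) ((hL τ).2 (by omega))).trans
          (single_le_sum (f := fun σ => ∑ τ ∈ L, (S.c σ τ π : ℚ)) (fun _ _ => by positivity) ((hL σ).2 (by omega))))).ne'
        change (0 : ℚ) < S.c σ τ π
        positivity
    rw [sum_filter, sum_congr rfl e1, sum_comm]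
    exact sum_congr rfl fun σ _ => sum_comm
  have F3 : ∀ σ ∈ L, ∀ τ ∈ L, σ ≠ τ → ∀ h : ℚ → ℚ, ∑ π ∈ M, (S.c σ τ π : ℚ) * (h (d π) / t π) = h (q + 1) / 2 := by
    intro σ hσ τ hτ hne h
    have h1 := B_two (τ := τ) ((hL _).1 hσ) ((hL _).1 hσ) ((hL _).1 hτ)
    rw [if_pos ⟨rfl, rfl⟩, if_neg (fun h => hne h.1), add_zero] at h1
    obtain ⟨π, hπ⟩ : ∃ π, S.e σ * S.e τ = S.e π := by
      obtain ⟨π, hπ | hπ⟩ := norm_one h1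
      · exact ⟨π, hπ⟩
      · have := (S.pos_e σ).mul (S.pos_e τ) π
        rw [hπ] at this; change 0 ≤ - (S.e π π) at this; simp [e_apply] at this
    have h2 : t π = 2 := by
      change ∑ σ' ∈ L, ∑ τ' ∈ L, (S.c σ' τ' π : ℚ) = 2
      have : ∀ σ' ∈ L, ∀ τ' ∈ L, (S.c σ' τ' π : ℚ) = (if σ = σ' ∧ τ = τ' then 1 else 0) + (if σ = τ' ∧ τ = σ' then 1 else 0) := by
        intro σ' hσ' τ' hτ'
        rw [hc, ← B_e_right, ← hπ, B_two ((hL _).1 hσ) ((hL _).1 hσ') ((hL _).1 hτ')]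
        push_cast; rfl
      rw [sum_congr rfl fun σ' hσ' => sum_congr rfl (this σ' hσ')]
      simp only [sum_add_distrib, ite_and, sum_ite_eq, hτ, hσ, if_true, Finset.sum_ite_irrel, Finset.sum_const_zero]
      norm_num
    have h3 : d π = q + 1 := by
      have := congrArg V.eD hπ
      rw [map_mul, eD_e, eD_e, eD_e] at this
      change V.D π * _ = _
      rw [← this]
      linear_combination (V.D τ * (q - 1) * (q + 1)) * hDL σ hσ + (q + 1) * hDL τ hτ
    have hπM : π ∈ M := hcM σ hσ τ hτ π (by
      have := hc σ τ π; rw [hπ, e_apply, if_pos rfl] at this; intro h0; rw [h0] at this; norm_num at this)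
    rw [sum_eq_single_of_mem π hπM, hc, hπ, h2, h3, e_apply, if_pos rfl]
    · push_cast; ring
    · intro π' _ hne
      rw [hc, hπ, e_apply, if_neg hne.symm]; simp
  have F4 : ∀ σ ∈ L, ∀ h : ℚ → ℚ, ∑ π ∈ M, (S.c σ σ π : ℚ) * (h (d π) / t π) = h 1 + h q := by
    intro σ hσ h
    have hρ := prim_deg1 ((hL _).1 hσ)
    obtain ⟨u, v, huv, hsq, hu⟩ : ∃ u v, u ≠ v ∧ S.e σ * S.e σ = S.e u + S.e v ∧ d u = 1 := by
      obtain ⟨u, v, huv, hsq⟩ := hρ.sq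
      obtain ⟨x, hx, hx2⟩ := V.exists_X hρ (hw σ hσ)
      have h2 : d (x 2) = 1 := by
        rw [← hx2 2, NN, hq, (hL _).1 hσ]
        simp only [prod_range_succ, Finset.prod_range_zero, hd]; ring
      have h1 : (S.e u + S.e v) (x 2) = 1 := by
        rw [← hsq, e_mul_e, hx.c, if_pos ⟨1, by norm_num, hx.h1.symm, hx.h1.symm⟩]; rfl
      rw [add_apply, e_apply, e_apply] at h1
      by_cases hu : u = x 2
      · exact ⟨u, v, huv, hsq, by rw [hu, h2]⟩
      · by_cases hv : v = x 2
        · exact ⟨v, u, huv.symm, by rw [hsq, add_comm], by rw [hv, h2]⟩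
        · simp [hu, hv] at h1
    have hv : d v = q := by
      have := congrArg V.eD hsq
      rw [map_mul, map_add, eD_e, eD_e, eD_e] at this
      have h2 : d u + d v = q + 1 := by
        change V.D u * _ + V.D v * _ = _
        rw [← add_mul, ← this]
        linear_combination (V.D σ * (q - 1) * (q + 1) + (q + 1)) * hDL σ hσ
      linarith
    have hcs : ∀ π, (S.c σ σ π : ℚ) = (if u = π then 1 else 0) + (if v = π then 1 else 0) := by
      intro π; rw [hc, hsq, add_apply, e_apply, e_apply]; push_cast; rfl
    have h2 : t u = 1 ∧ t v = 1 := by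
      have h3 : ∀ σ' ∈ L, ∀ τ' ∈ L, ¬ (σ' = σ ∧ τ' = σ) → S.c σ' τ' u = 0 ∧ S.c σ' τ' v = 0 := by
        intro σ' hσ' τ' hτ' hne
        have := B_two (τ := σ) ((hL _).1 hσ) ((hL _).1 hσ') ((hL _).1 hτ')
        rw [hsq, if_neg (fun h => hne ⟨h.1.symm, h.2.symm⟩), if_neg (fun h => hne ⟨h.2.symm, h.1.symm⟩), map_add, B_e_right, B_e_right,
          e_mul_e, e_mul_e] at this
        omega
      constructor <;> change ∑ σ' ∈ L, ∑ τ' ∈ L, (S.c σ' τ' _ : ℚ) = 1 <;>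
      · rw [sum_eq_single_of_mem σ hσ, sum_eq_single_of_mem σ hσ, hcs]
        · simp [huv, huv.symm]
        · intro τ hτ hne; rw [Nat.cast_eq_zero]; first | exact (h3 σ hσ τ hτ (fun h => hne h.2)).1 | exact (h3 σ hσ τ hτ (fun h => hne h.2)).2
        · intro τ hτ hne
          refine sum_eq_zero fun τ' hτ' => ?_
          rw [Nat.cast_eq_zero]; first | exact (h3 _ hτ τ' hτ' (fun h => hne h.1)).1 | exact (h3 _ hτ τ' hτ' (fun h => hne h.1)).2
    have hm : u ∈ M ∧ v ∈ M := by
      constructor <;> refine hcM σ hσ σ hσ _ (fun h0 => ?_) <;>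
      · have h1 := hcs u
        have h2 := hcs v
        rw [if_pos rfl, if_neg huv.symm] at h1
        rw [if_pos rfl, if_neg huv] at h2
        first | (rw [h0] at h1; norm_num at h1; done) | (rw [h0] at h2; norm_num at h2; done)
    simp only [hcs, add_mul, sum_add_distrib, ite_mul, one_mul, zero_mul, sum_ite_eq, hm.1, hm.2, if_true, h2.1, h2.2, hu, hv, div_one]
  have F5 : ∀ h : ℚ → ℚ, ∑ π ∈ M.filter (fun π => ¬ S.Prim π), h (d π) =
      (q - 1) * (q - 2) * (h (q + 1) / 2) + (q - 1) * (h 1 + h q) := by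
    intro h
    rw [F2]
    have : ∀ σ ∈ L, ∑ τ ∈ L, ∑ π ∈ M, (S.c σ τ π : ℚ) * (h (d π) / t π) = (q - 2) * (h (q + 1) / 2) + (h 1 + h q) := by
      intro σ hσ
      rw [← add_sum_erase _ _ hσ, F4 σ hσ, sum_congr rfl (fun τ hτ => F3 σ hσ τ (Finset.mem_of_mem_erase hτ) (ne_of_mem_erase hτ).symm h),
        sum_const, nsmul_eq_mul, Finset.cast_card_erase_of_mem hσ, hLc]
      ring
    rw [sum_congr rfl this, sum_const, nsmul_eq_mul, hLc]; ring
  have hP : ∀ π ∈ M.filter S.Prim, d π = (q - 1) * V.w π ∧ 1 ≤ V.w π := by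
    intro π hπ
    rw [mem_filter] at hπ
    have h1 := V.D_prim hπ.2
    rw [hq, (hM π).1 hπ.1] at h1
    refine ⟨by rw [← h1, hd]; ring, ?_⟩
    have : (0 : ℚ) < V.w π := by
      rw [← h1]; exact mul_pos (by nlinarith) (hD π hπ.1)
    exact_mod_cast this
  have G1 := F5 (fun _ => 1)
  have G2 := F5 (fun x => x ^ 2)
  change ∑ π ∈ M, d π ^ 2 = _ at hsum
  rw [← Finset.sum_filter_add_sum_filter_not M S.Prim, G2, sum_congr rfl (fun π hπ => by rw [(hP π hπ).1, mul_pow]), ← mul_sum] at hsum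
  have G3 : ((M.filter S.Prim).card : ℚ) + (M.filter (fun π => ¬ S.Prim π)).card = M.card := by
    exact_mod_cast card_filter_add_card_filter_not S.Prim
  rw [sum_const, nsmul_eq_mul, mul_one] at G1
  have G4 : 2 * ∑ π ∈ M.filter S.Prim, (V.w π : ℚ) ^ 2 = q * (q - 1) := by
    apply mul_left_cancel₀ (mul_ne_zero hq0 hq0)
    linear_combination 2 * hsum
  have G5 : ((M.filter S.Prim).card : ℚ) = ∑ π ∈ M.filter S.Prim, 1 := by simp
  have G6 : ∀ π ∈ M.filter S.Prim, (1 : ℚ) ≤ (V.w π : ℚ) ^ 2 := fun π hπ => by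
    exact_mod_cast one_le_pow _ _ (hP π hπ).2
  have G7 := sum_le_sum G6
  have G8 : ((M.filter S.Prim).card : ℚ) = ∑ π ∈ M.filter S.Prim, (V.w π : ℚ) ^ 2 := by
    rw [← G5] at G7
    nlinarith
  refine ⟨fun π hπ hπ' => ?_, by rw [G8, G4]⟩
  have := (Finset.sum_eq_sum_iff_of_le G6).1 (G5.symm.trans G8) π (mem_filter.2 ⟨hπ, hπ'⟩)
  have : V.w π ^ 2 = 1 := by exact_mod_cast this.symm
  simpa using this
end Whit
end PSH
section
variable {F : Type} [Field F] [Fintype F]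
lemma gl2_conj : card F ^ 2 - 1 ≤ Nat.card (ConjClasses (GL (Fin 2) F)) := by
  let A : F × Fˣ → GL (Fin 2) F := fun p => Matrix.GeneralLinearGroup.mkOfDetNeZero !![0, -p.2.1; 1, p.1] (by simp [Matrix.det_fin_two])
  let Z : Fˣ → GL (Fin 2) F := Units.map (Matrix.scalar (Fin 2)).toMonoidHom
  have hA : ∀ p, (A p).1 = !![0, -p.2.1; 1, p.1] := fun p => rfl
  have hZ : ∀ a, (Z a).1 = Matrix.scalar (Fin 2) a.1 := fun a => rfl
  have hc : ∀ a g, g * Z a * g⁻¹ = Z a := by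
    intro a g
    have : g * Z a = Z a * g := by
      ext1
      exact ((Matrix.scalar_commute a.1 (fun r => Commute.all _ r) g.1).eq).symm
    rw [this, mul_inv_cancel_right]
  have hne : ∀ p a, A p ≠ Z a := by
    intro p a h
    have := congrArg (fun M : GL (Fin 2) F => M.1 1 0) h
    simp only [hA, hZ] at this; simp at this
  let f : (F × Fˣ) ⊕ Fˣ → ConjClasses (GL (Fin 2) F) := fun x => ConjClasses.mk (Sum.elim A Z x)
  have hf : Function.Injective f := by
    intro x y h
    obtain ⟨g, hg⟩ := isConj_iff.1 (ConjClasses.mk_eq_mk_iff_isConj.1 h)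
    rcases x with p | a <;> rcases y with p' | a' <;> simp only [Sum.elim_inl, Sum.elim_inr] at hg
    · have h1 := congrArg Units.val hg
      rw [Units.val_mul, Units.val_mul] at h1
      have h2 := congrArg Matrix.trace h1
      have h3 := congrArg Matrix.det h1
      rw [Matrix.trace_units_conj, hA, hA] at h2
      rw [Matrix.det_units_conj, hA, hA] at h3
      simp [Matrix.det_fin_two, Matrix.trace_fin_two] at h2 h3
      rw [Prod.ext h2 (Units.ext h3)]
    · refine absurd ?_ (hne p a')
      have := hc a' g⁻¹
      rw [← hg] at this ⊢
      rw [← this]; group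
    · exact absurd (by rw [← hg, hc]) (hne p' a)
    · rw [hc] at hg
      have := congrArg (fun M : GL (Fin 2) F => M.1 1 1) hg
      simp only [hZ] at this
      simp at this
      rw [Units.ext this]
  have := Nat.card_le_card_of_injective f hf
  rw [card_eq_fintype_card, Fintype.card_sum, Fintype.card_prod, card_units] at this
  refine le_trans (le_of_eq ?_) this
  obtain ⟨k, hk⟩ := Nat.exists_eq_add_of_le (Fintype.card_pos (α := F))
  rw [hk, Nat.add_sub_cancel_left]
  have : (0 + 1 + k) ^ 2 = (0 + 1 + k) * k + k + 1 := by ring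
  exact Nat.sub_eq_of_eq_add this
lemma dm_gD {ω : (glTower F).Om} : (dm ω : ℚ) = gD ω * NN (card F) ω.1 := by
  rw [gD, div_mul_cancel₀ _ (NN_pos Wh.one_lt_q _).ne']
lemma gl_prims (F : Type) [Field F] [Fintype F] : ∃ V : (glTower F).psh.Whit, V.D = gD ∧ V.q = card F ∧
    (∀ ρ, (glTower F).psh.Prim ρ → ρ.1 ≤ 2 → V.w ρ = 1) ∧ Nat.card {ω : (glTower F).Om // ω.1 = 1} = card F - 1 ∧
    2 * Nat.card {ω : (glTower F).Om // (glTower F).psh.Prim ω ∧ ω.1 = 2} = card F * (card F - 1) := by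
  obtain ⟨V, hD, hq⟩ := exists_V F
  have q1 : 1 < card F := one_lt_card
  let em : ∀ n, Irr ((glTower F).G n) ↪ (glTower F).Om := fun n => ⟨fun χ => ⟨n, χ⟩, fun a b h => eq_of_heq (Sigma.mk.inj h).2⟩
  let L : ℕ → Finset (glTower F).Om := fun n => univ.map (em n)
  have hL : ∀ n ω, ω ∈ L n ↔ ω.1 = n := by
    intro n ω
    refine ⟨fun h => ?_, fun h => ?_⟩
    · obtain ⟨χ, -, rfl⟩ := mem_map.1 h; rfl
    · subst h; exact mem_map.2 ⟨ω.2, mem_univ _, rfl⟩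
  have hcomm : ∀ a b : GL (Fin 1) F, a * b = b * a := by
    intro a b
    ext i j
    rw [Units.val_mul, Units.val_mul, Matrix.mul_apply, Matrix.mul_apply, Fin.sum_univ_one, Fin.sum_univ_one, Subsingleton.elim i 0,
      Subsingleton.elim j 0, mul_comm]
  have c1 : ((L 1).card : ℚ) = card F - 1 := by
    rw [card_map, card_univ]
    refine (congrArg Nat.cast (card_Irr_comm hcomm)).trans ((Gl.card_GL 1).trans ?_)
    simp [NN]
  have dm1 : ∀ ω ∈ L 1, dm ω = 1 := by
    intro ω h
    obtain ⟨χ, -, rfl⟩ := mem_map.1 h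
    have := (dm_spec (em 1 χ)).symm.trans (one_comm hcomm χ)
    exact_mod_cast this
  have w1 : ∀ ω ∈ L 1, V.w ω = 1 := by
    intro ω h
    have h1 := (hL _ _).1 h
    have h2 := V.D_prim (PSH.prim_deg1 (S := (glTower F).psh) h1)
    have h3 := dm_gD (ω := ω)
    rw [dm1 ω h, h1] at h3
    rw [hD, hq, show (glTower F).psh.deg ω = 1 from h1] at h2
    have : (V.w ω : ℚ) = 1 := by
      simp only [NN, Finset.prod_range_one, cast_one, zero_add] at h3
      rw [← h2, mul_comm]; exact h3.symm
    exact_mod_cast this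
  have hs : ∑ π ∈ L 2, (V.D π * ((card F - 1) * ((card F : ℚ) ^ 2 - 1))) ^ 2 =
      ((card F : ℚ) ^ 2 - 1) * ((card F : ℚ) ^ 2 - card F) := by
    have h1 : ∀ χ, (V.D (em 2 χ) * ((card F - 1) * ((card F : ℚ) ^ 2 - 1))) ^ 2 = ((dm (em 2 χ) * dm (em 2 χ) : ℕ) : ℚ) := by
      intro χ
      push_cast
      rw [dm_gD, hD]
      change _ = gD (em 2 χ) * NN _ 2 * (gD (em 2 χ) * NN _ 2)
      simp [NN, prod_range_succ]; ring
    rw [sum_map, sum_congr rfl fun χ _ => h1 χ, ← Nat.cast_sum]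
    have h2 : ∑ χ, dm (em 2 χ) * dm (em 2 χ) = Nat.card (GL (Fin 2) F) := by
      have := sum_sq (G := (glTower F).G 2)
      have h3 := (sum_congr rfl fun χ _ => congrArg₂ (· * ·) (dm_spec (em 2 χ)).symm (dm_spec (em 2 χ)).symm).trans this
      beta_reduce at h3
      exact_mod_cast h3
    rw [h2, Gl.card_GL]
    simp [NN, prod_range_succ]; ring
  have hc2 : (card F : ℚ) ^ 2 - 1 ≤ (L 2).card := by
    have h1 : card F ^ 2 - 1 ≤ (L 2).card := by
      rw [card_map, card_univ]
      exact gl2_conj.trans (card_Irr (G := GL (Fin 2) F)).symm.le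
    have : card F ^ 2 ≤ (L 2).card + 1 := by omega
    have : ((card F ^ 2 : ℕ) : ℚ) ≤ ((L 2).card + 1 : ℕ) := by exact_mod_cast this
    push_cast at this; linarith
  obtain ⟨k1, k2⟩ := V.count2 (card F) hq (L 1) (L 2) (hL 1) (hL 2) c1 w1
    (fun π _ => by rw [hD, gD]; exact div_pos (by exact_mod_cast dm_pos π) (NN_pos Wh.one_lt_q _)) hs hc2
  refine ⟨V, hD, hq, fun ρ hρ h => ?_, ?_, ?_⟩
  · have : 0 < ρ.1 := hρ.1
    rcases (by omega : ρ.1 = 1 ∨ ρ.1 = 2) with h | h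
    · exact w1 ρ ((hL _ _).2 h)
    · exact k1 ρ ((hL _ _).2 h) hρ
  · have e1 : Nat.card {ω : (glTower F).Om // ω.1 = 1} = (L 1).card := by
      rw [Nat.subtype_card (L 1) (hL 1)]
    rw [e1]
    have := c1.trans (Nat.cast_pred (R := ℚ) (by omega : 0 < card F)).symm
    exact_mod_cast this
  · have e1 : Nat.card {ω : (glTower F).Om // (glTower F).psh.Prim ω ∧ ω.1 = 2} = ((L 2).filter (glTower F).psh.Prim).card := by
      rw [Nat.subtype_card _ fun ω => ?_]
      rw [mem_filter, hL, and_comm]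
    rw [e1]
    rw [← Nat.cast_pred (by omega : 0 < card F)] at k2
    exact_mod_cast k2
end
namespace Wr
variable {K : Type} [Group K] [Fintype K]
open Tower
lemma res_dim {a b : ℕ} (π : Irr ((wrTower K).G (a + b))) : (dm (𝒯 := wrTower K) ⟨a + b, π⟩ : ℂ) =
    ∑ σ : Irr ((wrTower K).G a), ∑ τ : Irr ((wrTower K).G b),
      ((wrTower K).psh.c ⟨a, σ⟩ ⟨b, τ⟩ ⟨a + b, π⟩ : ℂ) * (dm (𝒯 := wrTower K) ⟨a, σ⟩ * dm (𝒯 := wrTower K) ⟨b, τ⟩) := by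
  obtain ⟨D⟩ := Dat.exists_dat (n := a + b) (a := bb a b) rfl
  have h := D.r_expand (𝒯 := wrTower K) π 1
  have h1 : D.r (𝒯 := wrTower K) π.1 1 = π.1 1 := by
    unfold Dat.r fav
    have hb := wr_bij K D
    have e1 : (D.resH (𝒯 := wrTower K)).ker = ⊥ := (MonoidHom.ker_eq_bot_iff _).2 hb.1
    rw [e1, sum_eq_single_of_mem 1 (by simp)]
    · simp
    · intro u hu hne
      have hu : D.resH (𝒯 := wrTower K) u = 1 := by simpa using hu
      exact absurd (hb.1 (hu.trans (map_one _).symm)) hne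
  refine (dm_spec (𝒯 := wrTower K) ⟨a + b, π⟩).symm.trans (h1.symm.trans (h.trans ?_))
  refine sum_congr rfl fun σ _ => sum_congr rfl fun τ _ => ?_
  exact congrArg₂ (· * ·) rfl (congrArg₂ (· * ·) (dm_spec (𝒯 := wrTower K) ⟨a, σ⟩) (dm_spec (𝒯 := wrTower K) ⟨b, τ⟩))
lemma prim_deg {ρ : (wrTower K).Om} (h : (wrTower K).psh.Prim ρ) : ρ.1 = 1 := by
  by_contra hne
  have h0 : 0 < ρ.1 := h.1
  obtain ⟨n, π⟩ := ρ
  obtain ⟨k, rfl⟩ : ∃ k, n = 1 + (k + 1) := ⟨n - 2, by change 0 < n at h0; change n ≠ 1 at hne; omega⟩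
  have h1 := res_dim π
  rw [sum_eq_zero] at h1
  · have := dm_pos (𝒯 := wrTower K) ⟨1 + (k + 1), π⟩
    rw [Nat.cast_eq_zero] at h1; omega
  · refine fun σ _ => sum_eq_zero fun τ _ => ?_
    have : (wrTower K).psh.c ⟨1, σ⟩ ⟨k + 1, τ⟩ ⟨1 + (k + 1), π⟩ = 0 := by
      by_contra hc
      rcases h.2 _ _ hc with h2 | h2
      · exact absurd (congrArg Sigma.fst h2) (by change ¬ (1 = 0); omega)
      · exact absurd (congrArg Sigma.fst h2) (by change ¬ (k + 1 = 0); omega)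
    rw [this]; simp
def hD (ω : (wrTower K).Om) : ℚ := dm ω / ω.1.factorial
lemma hD_mul (σ τ : (wrTower K).Om) : ((wrTower K).psh.c σ τ).sum (fun π k => (k : ℚ) * hD π) = hD σ * hD τ :=
  Tower.co_dim (fun n => (n.factorial : ℚ)) (fun n => cast_ne_zero.2 n.factorial_ne_zero) (fun D => wr_index K D) dm dm_spec σ τ
lemma dm_one : dm ((wrTower K).psh.one) = 1 := by
  have := dm_spec ((wrTower K).psh.one)
  exact_mod_cast this.symm.trans (one1_val (𝒯 := wrTower K) 1)
def hev (K : Type) [Group K] [Fintype K] : (wrTower K).psh.R →+* ℚ := PSH.ev hD hD_mul (by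
  rw [hD, dm_one]; change ((1 : ℕ) : ℚ) / (Nat.factorial 0 : ℕ) = 1; simp)
lemma hev_e (ω : (wrTower K).Om) : hev K ((wrTower K).psh.e ω) = hD ω := PSH.lift_e _ _ _
lemma dm_X {ρ : (wrTower K).Om} (h : ρ.1 = 1) {x : ℕ → (wrTower K).Om} (hx : (wrTower K).psh.IsX ρ x) (n : ℕ) : dm (x n) = dm ρ ^ n := by
  induction n with
  | zero => rw [hx.h0, dm_one, pow_zero]
  | succ n ih =>
    have hd : ∀ n, ∃ χ : Irr ((wrTower K).G n), (⟨n, χ⟩ : (wrTower K).Om) = x n := by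
      intro n
      have : (x n).1 = n := by
        have := hx.deg n
        rw [show (wrTower K).psh.deg ρ = 1 from h, mul_one] at this; exact this
      generalize x n = y at this
      obtain ⟨k, χ⟩ := y
      subst this
      exact ⟨χ, rfl⟩
    rw [add_comm]
    obtain ⟨σ, hσ⟩ := hd 1
    obtain ⟨τ, hτ⟩ := hd n
    obtain ⟨π, hπ⟩ := hd (1 + n)
    have h1 := res_dim π
    rw [sum_eq_single_of_mem σ (mem_univ _), sum_eq_single_of_mem τ (mem_univ _), hσ, hτ, hπ, hx.c,
      if_pos ⟨1, by omega, rfl, by rw [Nat.add_sub_cancel_left]⟩, hx.h1, ih] at h1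
    · rw [pow_add, pow_one]
      have : (dm (x (1 + n)) : ℂ) = ((dm ρ * dm ρ ^ n : ℕ) : ℂ) := by rw [h1]; push_cast; ring
      exact_mod_cast this
    · intro τ' _ hne
      rw [hπ, hx.c, if_neg]
      · simp
      · rintro ⟨i, hi, h1, h2⟩
        obtain ⟨χ, hχ⟩ := hd i
        have : 1 = i := congrArg Sigma.fst (h1.trans hχ.symm)
        subst this
        rw [Nat.add_sub_cancel_left, ← hτ] at h2
        exact hne (eq_of_heq (Sigma.mk.inj h2).2)
    · intro σ' _ hne
      refine sum_eq_zero fun τ' _ => ?_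
      rw [hπ, hx.c, if_neg]
      · simp
      · rintro ⟨i, hi, h1, h2⟩
        obtain ⟨χ, hχ⟩ := hd i
        have : 1 = i := congrArg Sigma.fst (h1.trans hχ.symm)
        subst this
        rw [← hσ] at h1
        exact hne (eq_of_heq (Sigma.mk.inj h1).2)
def iso1 (K : Type) [Group K] : K ≃* WreathProductSymm K 1 where
  toFun k := ⟨fun _ => k, 1⟩
  invFun x := x.left 0
  left_inv _ := rfl
  right_inv x := SemidirectProduct.ext (funext fun i => by rw [Subsingleton.elim i 0]) (Subsingleton.elim _ _)
  map_mul' x y := SemidirectProduct.ext (by rw [SemidirectProduct.mul_left]; rfl) (Subsingleton.elim _ _)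
lemma card1 : Nat.card {ω : (wrTower K).Om // ω.1 = 1} = Nat.card (ConjClasses K) := by
  have e1 : Nat.card {ω : (wrTower K).Om // ω.1 = 1} = Nat.card (Irr ((wrTower K).G 1)) :=
    card_congr ⟨fun ω => ω.2 ▸ ω.1.2, fun χ => ⟨⟨1, χ⟩, rfl⟩, by rintro ⟨⟨n, χ⟩, h⟩; change n = 1 at h; subst h; rfl, fun χ => rfl⟩
  rw [e1, card_eq_fintype_card, card_Irr]
  have key : ∀ {A B : Type} [Group A] [Group B] [Finite A] (φ : A ≃* B), Nat.card (ConjClasses B) ≤ Nat.card (ConjClasses A) := by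
    intro A B _ _ _ φ
    have : Finite (ConjClasses A) := Quotient.finite _
    exact Nat.card_le_card_of_surjective (ConjClasses.map φ.toMonoidHom) (ConjClasses.map_surjective φ.surjective)
  exact le_antisymm (key (A := K) (B := WreathProductSymm K 1) (iso1 K)) (key (iso1 K).symm)
end Wr
namespace CC
variable {E : Type} [Field E] [Fintype E] {q : ℕ} {hq : 0 < q} {hE : card E = q ^ 2}
local notation "φ" => qPowAut E q hq hE
local notation "ZZ" => Subgroup.zpowers (qPowAut E q hq hE)
lemma two : φ * φ = 1 := MulEquiv.ext fun x => (φ).left_inv x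
lemma cases (s : ZZ) : s = 1 ∨ s.1 = φ := by
  obtain ⟨k, hk⟩ := Subgroup.mem_zpowers_iff.1 s.2
  rcases Int.even_or_odd' k with ⟨c, rfl | rfl⟩
  · left; ext1; rw [← hk, _root_.zpow_mul, zpow_two, two, _root_.one_zpow]; rfl
  · right; rw [← hk, _root_.zpow_add, _root_.zpow_mul, zpow_two, two, _root_.one_zpow, one_mul, zpow_one]
lemma fix_card (hq : 0 < q) (hE : card E = q ^ 2) : Nat.card {x : Eˣ // x ^ q = x} = q - 1 := by
  have h1 := IsCyclic.card_powMonoidHom_ker (G := Eˣ) (q - 1)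
  rw [card_eq_fintype_card (α := Eˣ), card_units, hE, Nat.gcd_eq_right] at h1
  · rw [← h1]
    refine card_congr (Equiv.subtypeEquivRight fun x => ?_)
    rw [MonoidHom.mem_ker, powMonoidHom_apply]
    conv_lhs => rw [← Nat.sub_add_cancel hq, pow_succ]
    exact mul_eq_right
  · exact ⟨q + 1, by rw [mul_comm]; simpa using Nat.sq_sub_sq q 1⟩
lemma one_lt (hE : card E = q ^ 2) (hq : 0 < q) : 1 < q := by
  have h0 := one_lt_card (α := E)
  rw [hE] at h0
  by_contra h
  have : q = 1 := by omega
  subst this; simp at h0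
lemma ne_one : φ ≠ 1 := by
  intro h
  have h1 := fix_card hq hE
  have h2 : Nat.card {x : Eˣ // x ^ q = x} = Nat.card Eˣ :=
    card_congr (Equiv.subtypeUnivEquiv fun x => congrArg (fun f : MulAut Eˣ => f x) h)
  rw [h2, card_eq_fintype_card, card_units, hE] at h1
  have := one_lt hE hq
  have : q * 1 < q * q := Nat.mul_lt_mul_of_pos_left this hq
  rw [← sq] at this; omega
def gen : ZZ := ⟨φ, Subgroup.mem_zpowers _⟩
lemma gen_ne : gen (hq := hq) (hE := hE) ≠ 1 := fun h => ne_one (hq := hq) (hE := hE) (congrArg Subtype.val h)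
lemma univ_eq : (univ : Finset ZZ) = {1, gen} :=
  Finset.eq_univ_iff_forall.2 (fun s => by
    rcases cases s with h | h
    · simp [h]
    · have : s = gen := Subtype.ext h
      simp [this]) |>.symm
lemma card_conj : 2 * Nat.card (ConjClasses (CyclicExt E q hq hE)) = (q - 1) * (q + 4) := by
  have h := card_comm_eq_card_conjClasses_mul_card (CyclicExt E q hq hE)
  have hN : Nat.card Eˣ = (q - 1) * (q + 1) := by
    rw [card_eq_fintype_card, card_units, hE, mul_comm]; simpa using Nat.sq_sub_sq q 1
  have hC : Nat.card (CyclicExt E q hq hE) = Nat.card Eˣ * 2 := by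
    rw [SemidirectProduct.card]
    congr 1
    rw [card_eq_fintype_card, ← card_univ, univ_eq, Finset.card_pair gen_ne.symm]
  let e : {p : CyclicExt E q hq hE × CyclicExt E q hq hE // Commute p.1 p.2} ≃
      (Σ st : ZZ × ZZ, {p : Eˣ × Eˣ // p.1 * st.1.1 p.2 = p.2 * st.2.1 p.1}) :=
    { toFun := fun p => ⟨(p.1.1.right, p.1.2.right), (p.1.1.left, p.1.2.left), congrArg SemidirectProduct.left p.2⟩
      invFun := fun x => ⟨(⟨x.2.1.1, x.1.1⟩, ⟨x.2.1.2, x.1.2⟩), SemidirectProduct.ext x.2.2 (mul_comm' _ _)⟩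
      left_inv := fun _ => rfl
      right_inv := fun _ => rfl }
  have hsub : ∀ P : Eˣ × Eˣ → Prop, (∃ f : Eˣ × Eˣ ≃ Eˣ × Eˣ, ∀ p, P p ↔ (f p).2 ^ q = (f p).2) → Nat.card {p // P p} = Nat.card Eˣ * (q - 1) := by
    rintro P ⟨f, hf⟩
    rw [← fix_card hq hE, ← Nat.card_prod]
    exact card_congr ((f.subtypeEquiv (q := fun p => p.2 ^ q = p.2) hf).trans
      ⟨fun p => (p.1.1, ⟨p.1.2, p.2⟩), fun p => ⟨(p.1, p.2.1), p.2.2⟩, fun _ => rfl, fun _ => rfl⟩)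
  have n1 : Nat.card {p : Eˣ × Eˣ // p.1 * (1 : ZZ).1 p.2 = p.2 * (1 : ZZ).1 p.1} = Nat.card Eˣ * Nat.card Eˣ :=
    (card_congr (Equiv.subtypeUnivEquiv fun p : Eˣ × Eˣ => mul_comm p.1 p.2)).trans (Nat.card_prod _ _)
  have n2 : Nat.card {p : Eˣ × Eˣ // p.1 * (1 : ZZ).1 p.2 = p.2 * (gen (hq := hq) (hE := hE)).1 p.1} = Nat.card Eˣ * (q - 1) :=
    hsub _ ⟨Equiv.prodComm _ _, fun p => by
      change p.1 * p.2 = p.2 * p.1 ^ q ↔ p.1 ^ q = p.1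
      rw [mul_comm, mul_left_cancel_iff, eq_comm]⟩
  have n3 : Nat.card {p : Eˣ × Eˣ // p.1 * (gen (hq := hq) (hE := hE)).1 p.2 = p.2 * (1 : ZZ).1 p.1} = Nat.card Eˣ * (q - 1) :=
    hsub _ ⟨Equiv.refl _, fun p => by
      change p.1 * p.2 ^ q = p.2 * p.1 ↔ p.2 ^ q = p.2
      rw [mul_comm p.2, mul_left_cancel_iff]⟩
  have n4 : Nat.card {p : Eˣ × Eˣ // p.1 * (gen (hq := hq) (hE := hE)).1 p.2 = p.2 * (gen (hq := hq) (hE := hE)).1 p.1} = Nat.card Eˣ * (q - 1) :=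
    hsub _ ⟨⟨fun p => (p.2, p.1 * p.2⁻¹), fun p => (p.2 * p.1, p.1), fun p => by simp, fun p => by simp⟩, fun p => by
      change p.1 * p.2 ^ q = p.2 * p.1 ^ q ↔ (p.1 * p.2⁻¹) ^ q = p.1 * p.2⁻¹
      rw [← div_eq_mul_inv, div_pow, div_eq_div_iff_mul_eq_mul, mul_comm p.2, eq_comm]⟩
  rw [card_congr e, Nat.card_sigma, sum_prod_type, univ_eq, sum_pair gen_ne.symm, sum_pair gen_ne.symm,
    sum_pair gen_ne.symm, n1, n2, n3, n4, hC] at h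
  have h0 : 0 < Nat.card Eˣ := Nat.card_pos
  apply Nat.eq_of_mul_eq_mul_left h0
  have : Nat.card Eˣ * (Nat.card Eˣ + 3 * (q - 1)) = Nat.card Eˣ * (2 * Nat.card (ConjClasses (CyclicExt E q hq hE))) := by
    rw [mul_comm _ (Nat.card Eˣ * 2)] at h
    linarith
  rw [← this]
  nth_rw 2 [hN]
  ring
def sgn (hq : 0 < q) (hE : card E = q ^ 2) : CyclicExt E q hq hE →* ℂ :=
  MonoidHom.comp { toFun := fun s : Subgroup.zpowers (qPowAut E q hq hE) => if s = 1 then 1 else -1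
                   map_one' := if_pos rfl
                   map_mul' := fun s t => by
                    rcases cases s with h | h <;> rcases cases t with h' | h'
                    · simp [h, h']
                    · simp [h]
                    · simp [h']
                    · have h1 : s = gen := Subtype.ext h
                      have h2 : t = gen := Subtype.ext h'
                      have h3 : gen (hq := hq) (hE := hE) * gen = 1 := Subtype.ext (two (hq := hq) (hE := hE))
                      rw [h1, h2, h3]; simp [gen_ne] } SemidirectProduct.rightHom
instance : Fintype (CyclicExt E q hq hE) := ofEquiv _ SemidirectProduct.equivProd.symm
lemma dm_lt {ω : (wrTower (CyclicExt E q hq hE)).Om} (h : ω.1 = 1) : dm ω ≤ 2 := by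
  obtain ⟨n, χ⟩ := ω
  change n = 1 at h
  subst h
  have key : ∀ g : CyclicExt E q hq hE, sgn hq hE g = 1 → g.right = 1 := by
    intro g hg
    by_contra hne
    have : sgn hq hE g = -1 := if_neg hne
    rw [this] at hg; norm_num at hg
  have hc : ∀ g h, sgn hq hE g = 1 → sgn hq hE h = 1 → g * h = h * g := fun g h h1 h2 => by
    refine SemidirectProduct.ext ?_ (by rw [SemidirectProduct.mul_right, SemidirectProduct.mul_right, key g h1, key h h2])
    rw [SemidirectProduct.mul_left, SemidirectProduct.mul_left, key g h1, key h h2, mul_comm]; rfl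
  obtain ⟨k, hk, hk1⟩ := irr_two (sgn hq hE) (fun g => by
    change ite _ _ _ = _ ∨ ite _ _ _ = _
    split_ifs <;> simp) hc (irr_comp (G := (wrTower (CyclicExt E q hq hE)).G 1) (Wr.iso1 (CyclicExt E q hq hE)) χ.2)
  have := dm_spec (𝒯 := wrTower (CyclicExt E q hq hE)) ⟨1, χ⟩
  replace hk1 := (congrArg χ.1 (map_one (Wr.iso1 (CyclicExt E q hq hE)))).symm.trans hk1
  have : (dm (𝒯 := wrTower (CyclicExt E q hq hE)) ⟨1, χ⟩ : ℂ) = k := this.symm.trans hk1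
  have : dm (𝒯 := wrTower (CyclicExt E q hq hE)) ⟨1, χ⟩ = k := by exact_mod_cast this
  omega
end CC
namespace Cb
local notation "v" => padicValRat 3
lemma v_prod {ι : Type} (s : Finset ι) (f : ι → ℚ) (h : ∀ i ∈ s, f i ≠ 0) : v (∏ i ∈ s, f i) = ∑ i ∈ s, v (f i) := by
  induction s using Finset.induction_on with
  | empty => simp
  | insert a s ha ih =>
    have h' : ∀ i ∈ s, f i ≠ 0 := fun i hi => h i (mem_insert_of_mem hi)
    rw [prod_insert ha, sum_insert ha, padicValRat.mul (h a (mem_insert_self a s)) (prod_ne_zero_iff.2 h'), ih h']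
def hk (ν : ℕ → ℕ) (X : Finset ℕ) : ℕ := ∑ x ∈ X, ∑ k ∈ range x \ X, ν (x - k)
def bd (y : ℕ → ℚ) {K : ℕ} (X : Finset ℕ) (h : X.card = K) : ℚ :=
  det (of fun i j : Fin K => if j ≤ X.orderEmbOfFin h i then y (X.orderEmbOfFin h i - j) else 0)
lemma bd_v {y t s : ℕ → ℚ} (hy0 : y 0 = 1) (hy : ∀ x j, j < x → y (x - (j + 1)) = s j * y (x - j) * (t x - t j))
    (hs : ∀ j, s j ≠ 0 ∧ v (s j) = 0) {ν : ℕ → ℕ} (ht : ∀ k x, k < x → t x - t k ≠ 0 ∧ v (t x - t k) = ν (x - k))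
    {K : ℕ} (X : Finset ℕ) (h : X.card = K) : bd y X h ≠ 0 ∧ v (bd y X h) = - hk ν X := by
  have hM : ∀ x j : ℕ, (if j ≤ x then y (x - j) else 0) = (∏ k ∈ range j, s k) * (y x * ∏ k ∈ range j, (t x - t k)) := by
    intro x j
    induction j with
    | zero => simp
    | succ j ih =>
      rw [prod_range_succ, prod_range_succ]
      rcases lt_trichotomy j x with hj | rfl | hj
      · rw [if_pos (by omega), hy x j hj]
        rw [if_pos hj.le] at ih
        rw [ih]; ring
      · rw [if_neg (by omega)]; simp
      · rw [if_neg (by omega)] at ih ⊢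
        linear_combination s j * (t x - t j) * ih
  have hS : ∀ j, (∏ k ∈ range j, s k) ≠ 0 ∧ v (∏ k ∈ range j, s k) = 0 := fun j =>
    ⟨prod_ne_zero_iff.2 fun k _ => (hs k).1, by rw [v_prod _ _ fun k _ => (hs k).1]; exact sum_eq_zero fun k _ => (hs k).2⟩
  have hT : ∀ (x : ℕ) (A : Finset ℕ), A ⊆ range x → (∏ k ∈ A, (t x - t k)) ≠ 0 ∧ v (∏ k ∈ A, (t x - t k)) = ∑ k ∈ A, (ν (x - k) : ℤ) := by
    intro x A hA
    have : ∀ k ∈ A, t x - t k ≠ 0 ∧ v (t x - t k) = ν (x - k) := fun k hk => ht k x (mem_range.1 (hA hk))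
    exact ⟨prod_ne_zero_iff.2 fun k hk => (this k hk).1, by rw [v_prod _ _ fun k hk => (this k hk).1]; exact sum_congr rfl fun k hk => (this k hk).2⟩
  have hyx : ∀ x, y x ≠ 0 ∧ v (y x) = - ∑ k ∈ range x, (ν (x - k) : ℤ) := by
    intro x
    have h1 := hM x x
    rw [if_pos le_rfl, Nat.sub_self, hy0] at h1
    have h0 : y x ≠ 0 := fun h => by rw [h] at h1; simp at h1
    have h2 := congrArg v h1
    obtain ⟨a, b⟩ := hT x _ subset_rfl
    rw [padicValRat.one, padicValRat.mul (hS x).1 (mul_ne_zero h0 a), (hS x).2, padicValRat.mul h0 a, b] at h2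
    exact ⟨h0, by linarith⟩
  let z := X.orderEmbOfFin h
  have hz : ∀ {M : Type} [CommMonoid M] (f : ℕ → M), ∏ i, f (z i) = ∏ x ∈ X, f x := fun f => by
    rw [← map_orderEmbOfFin_univ X h, prod_map]; rfl
  have hd : bd y X h = (∏ j : Fin K, ∏ k ∈ range j, s k) * ((∏ x ∈ X, y x) * ∏ x ∈ X, ∏ k ∈ range x ∩ X, (t x - t k)) := by
    have hp := det_eval_matrixOfPolynomials_eq_det_vandermonde (fun i => t (z i)) (fun j : Fin K => ∏ k ∈ range j, (Polynomial.X - Polynomial.C (t k)))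
      (fun j => by rw [Polynomial.natDegree_prod_of_monic _ _ fun k _ => Polynomial.monic_X_sub_C _]; simp)
      (fun j => Polynomial.monic_prod_of_monic _ _ fun k _ => Polynomial.monic_X_sub_C _)
    have hv : ∏ x ∈ X, ∏ k ∈ range x ∩ X, (t x - t k) = det (vandermonde fun i => t (z i)) := by
      rw [det_vandermonde, ← hz fun x => ∏ k ∈ range x ∩ X, (t x - t k), Finset.prod_comm' (t' := univ) (s' := fun j => Finset.Iio j) (by simp)]
      refine prod_congr rfl fun j _ => ?_
      have : range (z j) ∩ X = (Finset.Iio j).map z.toEmbedding := by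
        ext x
        rw [Finset.mem_inter, ← map_orderEmbOfFin_univ X h]
        simp only [mem_map, mem_range, mem_univ, true_and, Finset.mem_Iio]
        constructor
        · rintro ⟨h1, i, rfl⟩; exact ⟨i, z.lt_iff_lt.1 h1, rfl⟩
        · rintro ⟨i, h1, rfl⟩; exact ⟨z.lt_iff_lt.2 h1, i, rfl⟩
      rw [this, prod_map]; rfl
    rw [hv, hp, ← hz y, ← det_mul_column, ← det_mul_row]
    unfold bd
    congr 1
    ext i j
    simp only [of_apply, Polynomial.eval_prod, Polynomial.eval_sub, Polynomial.eval_X, Polynomial.eval_C]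
    exact hM _ _
  have n1 := prod_ne_zero_iff.2 fun (j : Fin K) (_ : j ∈ univ) => (hS j).1
  have n2 := prod_ne_zero_iff.2 fun x (_ : x ∈ X) => (hyx x).1
  have n3 := prod_ne_zero_iff.2 fun x (_ : x ∈ X) => (hT x (range x ∩ X) inter_subset_left).1
  rw [hd]
  refine ⟨mul_ne_zero n1 (mul_ne_zero n2 n3), ?_⟩
  rw [padicValRat.mul n1 (mul_ne_zero n2 n3), padicValRat.mul n2 n3, v_prod _ _ fun (j : Fin K) _ => (hS j).1, v_prod _ _ fun x _ => (hyx x).1,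
    v_prod _ _ fun x _ => (hT x _ inter_subset_left).1, sum_eq_zero fun (j : Fin K) _ => (hS j).2, zero_add, ← sum_add_distrib]
  unfold hk
  push_cast
  rw [← Finset.sum_neg_distrib]
  refine sum_congr rfl fun x _ => ?_
  rw [(hyx x).2, (hT x _ inter_subset_left).2, ← Finset.sum_inter_add_sum_sdiff (range x) X]
  ring
lemma v_nat (n : ℕ) : v (n : ℚ) = padicValNat 3 n := padicValRat.of_nat
lemma sum_eq (X : Finset ℕ) : ∑ x ∈ X, x = hk 1 X + ∑ a ∈ range X.card, a := by
  induction X using Finset.induction_on_max with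
  | empty => simp [hk]
  | insert a s hs ih =>
    have ha : a ∉ s := fun h => (hs a h).false
    have h1 : s ⊆ range a := fun x hx => mem_range.2 (hs x hx)
    have h2 : hk 1 (insert a s) = a - s.card + hk 1 s := by
      unfold hk
      rw [sum_insert ha]
      congr 1
      · rw [Finset.sdiff_insert_of_notMem (by simp)]
        simp [Finset.card_sdiff_of_subset h1]
      · refine sum_congr rfl fun x hx => ?_
        rw [Finset.sdiff_insert_of_notMem (by simpa using (hs x hx).le)]
    have h3 := Finset.card_le_card h1
    rw [card_range] at h3
    rw [sum_insert ha, Finset.card_insert_of_notMem ha, sum_range_succ, h2, ih]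
    omega
lemma hk_add (a : ℕ) (ν : ℕ → ℕ) (X : Finset ℕ) : hk (fun n => a + ν n) X = a * hk 1 X + hk ν X := by
  simp [hk, sum_add_distrib, mul_sum, mul_comm]
lemma bdH {d : ℚ} (hd : d ≠ 0) (hv : v d = 0) {K : ℕ} (X : Finset ℕ) (h : X.card = K) :
    bd (fun n => d ^ n / (n.factorial : ℚ)) X h ≠ 0 ∧ v (bd (fun n => d ^ n / (n.factorial : ℚ)) X h) = - hk (padicValNat 3) X := 
  bd_v (t := fun n => (n : ℚ)) (s := fun _ => d⁻¹) (by simp)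
    (fun x j hj => by
      obtain ⟨n, rfl⟩ : ∃ n, x = j + n + 1 := ⟨x - j - 1, by omega⟩
      have h1 : j + n + 1 - (j + 1) = n := by omega
      have h2 : j + n + 1 - j = n + 1 := by omega
      have := n.factorial_ne_zero
      simp only [h1, h2, Nat.factorial_succ]
      push_cast
      field_simp
      ring) (fun j => by simp [hd, hv]) (fun k x hx => by
      rw [← cast_sub hx.le, v_nat]
      exact ⟨cast_ne_zero.2 (by omega), rfl⟩) X h
lemma hk_le (X : Finset ℕ) : hk (padicValNat 3) X ≤ padicValNat 3 (hk 1 X).factorial := by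
  obtain ⟨h0, hv⟩ := bdH (d := 1) one_ne_zero (by simp) X rfl
  simp only [one_pow] at h0 hv
  have hint : ∃ n : ℤ, ((hk 1 X).factorial : ℚ) * bd (fun n => 1 / (n.factorial : ℚ)) X rfl = n := by
    unfold bd
    rw [det_apply, mul_sum]
    suffices ∀ σ : Equiv.Perm (Fin X.card), ∃ n : ℤ, ((hk 1 X).factorial : ℚ) * (Equiv.Perm.sign σ • ∏ i : Fin X.card, if (i : ℕ) ≤ X.orderEmbOfFin rfl (σ i) then 1 / ((X.orderEmbOfFin rfl (σ i) - i : ℕ).factorial : ℚ) else 0) = n by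
      choose n hn using this
      exact ⟨∑ σ, n σ, by push_cast; exact sum_congr rfl fun σ _ => hn σ⟩
    intro σ
    by_cases hle : ∀ i : Fin X.card, (i : ℕ) ≤ X.orderEmbOfFin rfl (σ i)
    · obtain ⟨c, hc⟩ := Nat.prod_factorial_dvd_factorial_sum univ fun i : Fin X.card => X.orderEmbOfFin rfl (σ i) - i
      have hs : ∑ i : Fin X.card, (X.orderEmbOfFin rfl (σ i) - i) = hk 1 X := by
        have h1 := sum_eq X
        have h2 : ∑ x ∈ X, x = ∑ i, X.orderEmbOfFin rfl (σ i) := by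
          rw [Equiv.sum_comp σ (fun i => X.orderEmbOfFin rfl i)]
          conv_lhs => rw [← map_orderEmbOfFin_univ X rfl, sum_map]
          rfl
        have h3 : ∑ i : Fin X.card, (X.orderEmbOfFin rfl (σ i) - i) + ∑ i : Fin X.card, (i : ℕ) = ∑ i, X.orderEmbOfFin rfl (σ i) := by
          rw [← sum_add_distrib]; exact sum_congr rfl fun i _ => Nat.sub_add_cancel (hle i)
        rw [Fin.sum_univ_eq_sum_range (fun i => i)] at h3
        omega
      rw [hs] at hc
      refine ⟨Equiv.Perm.sign σ * c, ?_⟩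
      have hn : (∏ i : Fin X.card, ((X.orderEmbOfFin rfl (σ i) - i : ℕ).factorial : ℚ)) ≠ 0 :=
        prod_ne_zero_iff.2 fun i _ => cast_ne_zero.2 (factorial_ne_zero _)
      rw [prod_congr rfl (g := fun i => 1 / ((X.orderEmbOfFin rfl (σ i) - i : ℕ).factorial : ℚ)) fun i _ => if_pos (hle i), Finset.prod_div_distrib, prod_const_one, hc, Units.smul_def, zsmul_eq_mul]
      push_cast
      field_simp
    · push Not at hle
      obtain ⟨i, hi⟩ := hle
      exact ⟨0, by rw [prod_eq_zero (mem_univ i) (if_neg (by omega))]; simp⟩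
  obtain ⟨n, hn⟩ := hint
  have h1 := congrArg v hn
  rw [padicValRat.mul (cast_ne_zero.2 (factorial_ne_zero _)) h0, hv, v_nat, padicValRat.of_int] at h1
  omega
lemma sum_two (f : ℕ → ℕ) (y : ℕ) : ∑ k ∈ range (2 * y), f k = ∑ l ∈ range y, (f (2 * l) + f (2 * l + 1)) := by
  induction y with
  | zero => simp
  | succ y ih => rw [show 2 * (y + 1) = 2 * y + 1 + 1 by ring, sum_range_succ, sum_range_succ, ih, sum_range_succ]; ring
def itl (A B : Finset ℕ) : Finset ℕ := A.image (2 * ·) ∪ B.image (2 * · + 1)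
lemma mem_itl (A B : Finset ℕ) (y : ℕ) : (2 * y ∈ itl A B ↔ y ∈ A) ∧ (2 * y + 1 ∈ itl A B ↔ y ∈ B) := by
  simp only [itl, mem_union, mem_image]
  refine ⟨⟨?_, fun h => Or.inl ⟨y, h, rfl⟩⟩, ⟨?_, fun h => Or.inr ⟨y, h, rfl⟩⟩⟩ <;> rintro (⟨z, hz, h⟩ | ⟨z, hz, h⟩)
  · rwa [show y = z by omega]
  · omega
  · omega
  · rwa [show y = z by omega]
lemma itl_sum (A B : Finset ℕ) (f : ℕ → ℕ) : ∑ x ∈ itl A B, f x = ∑ y ∈ A, f (2 * y) + ∑ y ∈ B, f (2 * y + 1) := by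
  rw [itl, Finset.sum_union, sum_image (by intro a _ b _ h; simpa using h), sum_image (by intro a _ b _ h; simpa using h)]
  rw [Finset.disjoint_left]
  simp only [mem_image, not_exists, not_and]
  rintro _ ⟨a, _, rfl⟩ b _ h
  omega
lemma exists_itl (X : Finset ℕ) : ∃ A B, X = itl A B := by
  have key : ∀ (c x : ℕ), c ≤ 1 → 2 * x + c ∈ X → x ∈ X.image (· / 2) := fun c x hc h => mem_image.2 ⟨_, h, by omega⟩
  refine ⟨(X.image (· / 2)).filter (2 * · ∈ X), (X.image (· / 2)).filter (2 * · + 1 ∈ X), ?_⟩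
  ext x
  obtain ⟨y, rfl | rfl⟩ := Nat.even_or_odd' x
  · rw [(mem_itl _ _ y).1, mem_filter]
    exact ⟨fun h => ⟨key 0 y (by omega) h, h⟩, fun h => h.2⟩
  · rw [(mem_itl _ _ y).2, mem_filter]
    exact ⟨fun h => ⟨key 1 y le_rfl h, h⟩, fun h => h.2⟩
lemma itl_hk (A B : Finset ℕ) (μ : ℕ → ℕ) : hk (fun n => if 2 ∣ n then μ (n / 2) else 0) (itl A B) = hk μ A + hk μ B := by
  have key : ∀ (ν : ℕ → ℕ) (X : Finset ℕ) (x : ℕ), ∑ k ∈ range x \ X, ν (x - k) = ∑ k ∈ range x, if k ∈ X then 0 else ν (x - k) := by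
    intro ν X x
    rw [Finset.sdiff_eq_filter, sum_filter]
    exact sum_congr rfl fun k _ => by split_ifs <;> simp_all
  unfold hk
  rw [sum_congr rfl fun x _ => key (fun n => if 2 ∣ n then μ (n / 2) else 0) (itl A B) x, itl_sum, sum_congr rfl fun x _ => key μ A x,
    sum_congr rfl fun x _ => key μ B x]
  congr 1 <;> refine sum_congr rfl fun y _ => ?_
  · rw [sum_two]
    refine sum_congr rfl fun l hl => ?_
    have := mem_range.1 hl
    rw [if_neg (by omega : ¬ 2 ∣ 2 * y - (2 * l + 1)), if_pos (by omega : 2 ∣ 2 * y - 2 * l), show (2 * y - 2 * l) / 2 = y - l by omega]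
    simp [(mem_itl A B l).1]
  · rw [sum_range_succ, sum_two, if_neg (by omega : ¬ 2 ∣ 2 * y + 1 - 2 * y), ite_self, add_zero]
    refine sum_congr rfl fun l hl => ?_
    have := mem_range.1 hl
    rw [if_neg (by omega : ¬ 2 ∣ 2 * y + 1 - 2 * l), if_pos (by omega : 2 ∣ 2 * y + 1 - (2 * l + 1)), show (2 * y + 1 - (2 * l + 1)) / 2 = y - l by omega]
    simp [(mem_itl A B l).2]
lemma itl_size {A B : Finset ℕ} {m : ℕ} (h : (itl A B).card = 2 * m) : 2 * (hk 1 A + hk 1 B) ≤ hk 1 (itl A B) ∧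
    (2 * (hk 1 A + hk 1 B) = hk 1 (itl A B) ↔ A.card = m ∧ B.card = m) := by
  have h0 := itl_sum A B fun x => x
  have h1 := itl_sum A B fun x => 1
  rw [sum_eq, h] at h0
  have hA := sum_eq A
  have hB := sum_eq B
  have g : ∀ n : ℕ, (2 * ∑ a ∈ range n, a : ℤ) = n * (n - 1) := fun n => by
    induction n with
    | zero => simp
    | succ n ih => rw [sum_range_succ, Nat.cast_add, mul_add, ih]; push_cast; ring
  have gA := g A.card
  have gB := g B.card
  have gm := g (2 * m)
  simp only [sum_const, smul_eq_mul, mul_one, h, sum_add_distrib] at h0 h1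
  rw [← mul_sum, ← mul_sum, hA, hB] at h0
  zify at h0 h1 ⊢
  push_cast at gm gA gB
  obtain ⟨e, he⟩ : ∃ e : ℤ, (A.card : ℤ) = m + e := ⟨A.card - m, by ring⟩
  have he' : (B.card : ℤ) = m - e := by linarith
  rw [he] at gA
  rw [he'] at gB h0
  have key : (hk 1 (itl A B) : ℤ) = 2 * (hk 1 A + hk 1 B) + e * (2 * e - 1) := by nlinarith
  have hpos : e ≠ 0 → 0 < e * (2 * e - 1) := fun h => by
    rcases lt_or_gt_of_ne h with h | h <;> nlinarith
  rw [key, he, he']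
  by_cases h : e = 0
  · subst h; simp
  · have := hpos h
    exact ⟨by linarith, ⟨fun h => by linarith, fun h2 => absurd (by linarith [h2.1] : e = 0) h⟩⟩
local notation "u" => padicValNat 3
def nu (a n : ℕ) : ℕ := if 2 ∣ n then a + u (n / 2) else 0
lemma v_pow {q : ℕ} (h3 : 3 ∣ q + 1) (hq : 1 < q) {n : ℕ} (hn : 0 < n) : v ((q : ℚ) ^ n - 1) = nu (u (q ^ 2 - 1)) n := by
  have h2 : (q : ℤ) ≡ -1 [ZMOD 3] := (Int.modEq_iff_dvd.2 (by omega))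
  rw [show ((q : ℚ) ^ n - 1) = ((q ^ n - 1 : ℕ) : ℚ) by rw [cast_sub (one_le_pow _ _ (by omega))]; push_cast; rfl, v_nat, nu]
  congr 1
  have hc : ∀ k, ((q ^ k - 1 : ℕ) : ℤ) = (q : ℤ) ^ k - 1 := fun k => by rw [cast_sub (one_le_pow _ _ (by omega))]; push_cast; rfl
  obtain ⟨l, rfl | rfl⟩ := Nat.even_or_odd' n
  · have e2 := Int.modEq_iff_dvd.1 (h2.pow 2).symm
    rw [if_pos (by omega), show 2 * l / 2 = l by omega, pow_mul]
    have := padicValNat.pow_sub_pow (p := 3) (x := q ^ 2) (y := 1) (by decide) (Nat.one_lt_pow two_ne_zero hq) (Int.natCast_dvd_natCast.1 (by rw [hc]; simpa using e2)) (fun h => by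
      have h' : 3 ∣ q := Nat.prime_three.dvd_of_dvd_pow h
      omega) (n := l) (by omega)
    rwa [one_pow] at this
  · have e2 := Int.modEq_iff_dvd.1 (h2.pow (2 * l + 1)).symm
    rw [if_neg (by omega)]
    refine padicValNat.eq_zero_of_not_dvd fun h => ?_
    zify at h
    rw [hc] at h
    rw [Odd.neg_one_pow ⟨l, rfl⟩] at e2
    omega
lemma v_NN {q : ℕ} (h3 : 3 ∣ q + 1) (hq : 1 < q) (n : ℕ) : v (NN q n) = u (q ^ 2 - 1) * (n / 2 : ℕ) + u (n / 2).factorial := by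
  have hq' : (1 : ℚ) < q := by exact_mod_cast hq
  induction n with
  | zero => simp [NN]
  | succ n ih =>
    have h1 : (q : ℚ) ^ (n + 1) - 1 ≠ 0 := (sub_pos.2 (one_lt_pow₀ hq' (Nat.succ_ne_zero n))).ne'
    rw [NN_succ, padicValRat.mul (NN_pos hq' n).ne' h1, ih, v_pow h3 hq (Nat.succ_pos n), nu]
    split_ifs with h
    · have : (n + 1) / 2 = n / 2 + 1 := by omega
      rw [this, Nat.factorial_succ, padicValNat.mul (Nat.succ_ne_zero _) (factorial_ne_zero _)]
      push_cast; ring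
    · rw [show (n + 1) / 2 = n / 2 by omega]; simp
lemma bdG {q r : ℕ} (h3 : 3 ∣ q + 1) (hq : 1 < q) (hr : 0 < r) {y : ℕ → ℚ} (hy : ∀ n, y n * NN ((q : ℚ) ^ r) n = 1) {K : ℕ} (X : Finset ℕ) (h : X.card = K) :
    bd y X h ≠ 0 ∧ v (bd y X h) = - hk (fun n => nu (u (q ^ 2 - 1)) (r * n)) X := by
  have hq' : (1 : ℚ) < q := by exact_mod_cast hq
  have hQ : (1 : ℚ) < (q : ℚ) ^ r := one_lt_pow₀ hq' hr.ne'
  have hv : ∀ k, v (((q : ℚ) ^ r) ^ k) = 0 := fun k => by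
    rw [← pow_mul, ← cast_pow, v_nat, padicValNat.eq_zero_of_not_dvd fun h => ?_]; · rfl
    have := Nat.prime_three.dvd_of_dvd_pow h
    omega
  have h0 : ∀ k, ((q : ℚ) ^ r) ^ k ≠ 0 := fun k => by positivity
  refine bd_v (t := fun x => ((q : ℚ) ^ r) ^ x) (s := fun j => (((q : ℚ) ^ r) ^ j)⁻¹) (by simpa [NN] using hy 0) (fun x j hj => ?_)
    (fun j => ⟨inv_ne_zero (h0 j), by rw [padicValRat.inv, hv, neg_zero]⟩) (fun k x hx => ?_) X h
  · obtain ⟨n, rfl⟩ : ∃ n, x = j + n + 1 := ⟨x - j - 1, by omega⟩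
    rw [show j + n + 1 - (j + 1) = n by omega, show j + n + 1 - j = n + 1 by omega]
    have e1 := hy n
    have e2 := hy (n + 1)
    have n0 := (NN_pos hQ n).ne'
    rw [NN_succ] at e2
    have e3 : y (n + 1) * (((q : ℚ) ^ r) ^ (n + 1) - 1) = y n := mul_right_cancel₀ n0 (by rw [e1]; linear_combination e2)
    rw [← e3, show j + n + 1 = j + (n + 1) by ring, pow_add _ j]
    have := h0 j
    field_simp
  · obtain ⟨n, rfl⟩ : ∃ n, x = k + n + 1 := ⟨x - k - 1, by omega⟩
    have e : ((q : ℚ) ^ r) ^ (k + n + 1) - ((q : ℚ) ^ r) ^ k = ((q : ℚ) ^ r) ^ k * ((q : ℚ) ^ (r * (n + 1)) - 1) := by rw [pow_mul]; ring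
    have e0 : (q : ℚ) ^ (r * (n + 1)) - 1 ≠ 0 := (sub_pos.2 (one_lt_pow₀ hq' (by positivity))).ne'
    rw [e, padicValRat.mul (h0 k) e0, hv, zero_add, v_pow h3 hq (by positivity), show k + n + 1 - k = n + 1 by omega]
    exact ⟨mul_ne_zero (h0 k) e0, rfl⟩
abbrev Fs (K : ℕ) := {s : Finset ℕ // s.card = K}
def Row {T : Type} (N : T → ℕ) (V : T → ℤ) (a m c : ℕ) : Prop := ∃ ψ : (Fin c → Fs m) → T, Function.Injective ψ ∧
  (∀ Y, N (ψ Y) = 2 * ∑ k, hk 1 (Y k) ∧ V (ψ Y) = a * ∑ k, hk 1 (Y k) + ∑ k, hk u (Y k)) ∧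
  ∀ X, (∀ Y, ψ Y ≠ X) → ∃ h : ℕ, 2 * h ≤ N X ∧ V X ≤ a * h + u h.factorial ∧ (2 * h < N X ∨ V X < a * h + u h.factorial)
lemma row1 (a m : ℕ) : Row (T := Fs (2 * m)) (fun X => hk 1 X) (fun X => hk (nu a) X) a m 2 := by
  have hnu : ∀ A B, hk (nu a) (itl A B) = a * (hk 1 A + hk 1 B) + (hk u A + hk u B) := fun A B => by
    have := itl_hk A B (fun n => a + u n)
    rw [hk_add, hk_add] at this
    exact Eq.trans rfl (this.trans (by ring))
  have hcard : ∀ A B : Finset ℕ, (itl A B).card = A.card + B.card := fun A B => by simpa using itl_sum A B fun _ => 1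
  refine ⟨fun Y => ⟨itl (Y 0) (Y 1), by rw [hcard, (Y 0).2, (Y 1).2]; ring⟩, fun Y Y' h => ?_, fun Y => ?_, fun X hX => ?_⟩
  · have h' : itl (Y 0) (Y 1) = itl (Y' 0) (Y' 1) := congrArg Subtype.val h
    funext k
    fin_cases k <;> refine Subtype.ext (Finset.ext fun y => ?_)
    · exact (mem_itl (Y 0) (Y 1) y).1.symm.trans ((by rw [h'] : _ ↔ _).trans (mem_itl (Y' 0) (Y' 1) y).1)
    · exact (mem_itl (Y 0) (Y 1) y).2.symm.trans ((by rw [h'] : _ ↔ _).trans (mem_itl (Y' 0) (Y' 1) y).2)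
  · simp only [Fin.sum_univ_two]
    refine ⟨((itl_size (m := m) (by rw [hcard, (Y 0).2, (Y 1).2]; ring)).2.2 ⟨(Y 0).2, (Y 1).2⟩).symm, ?_⟩
    rw [hnu]; push_cast; ring
  · obtain ⟨X, hc⟩ := X
    obtain ⟨A, B, rfl⟩ := exists_itl X
    obtain ⟨h1, h2⟩ := itl_size hc
    refine ⟨hk 1 A + hk 1 B, h1, ?_, Or.inl (lt_of_le_of_ne h1 fun h => ?_)⟩
    · have hd := Nat.factorial_mul_factorial_dvd_factorial_add (hk 1 A) (hk 1 B)
      have := (padicValNat_dvd_iff_le (p := 3) (factorial_ne_zero _)).1 (pow_padicValNat_dvd.trans hd)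
      rw [padicValNat.mul (factorial_ne_zero _) (factorial_ne_zero _)] at this
      have hA := hk_le A
      have hB := hk_le B
      beta_reduce
      rw [hnu]; push_cast; linarith
    · obtain ⟨hA, hB⟩ := h2.1 h
      exact hX ![⟨A, hA⟩, ⟨B, hB⟩] rfl
lemma row2 (a m : ℕ) : Row (T := Fs m) (fun X => 2 * hk 1 X) (fun X => hk (fun n => nu a (2 * n)) X) a m 1 := by
  refine ⟨fun Y => Y 0, fun Y Y' h => funext fun k => by rw [Subsingleton.elim k 0]; exact h, fun Y => ?_, fun X hX => absurd rfl (hX fun _ => X)⟩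
  have : (fun n => nu a (2 * n)) = fun n => a + u n := by funext n; simp [nu]
  beta_reduce
  rw [this, hk_add]
  simp
lemma row3 (a m K r : ℕ) (V : Fs K → ℤ) (hr : 0 < r) (h0 : V ⟨range K, card_range K⟩ = 0)
    (h1 : ∀ X : Fs K, 0 < r * hk 1 X → V X < a * (r * hk 1 X / 2 : ℕ) + u (r * hk 1 X / 2).factorial) : Row (fun X : Fs K => r * hk 1 X) V a m 0 := by
  have hk0 : hk 1 (range K) = 0 := by
    have := sum_eq (range K)
    rw [card_range] at this; omega
  refine ⟨fun _ => ⟨range K, card_range K⟩, fun _ _ _ => Subsingleton.elim _ _, fun Y => by simp [hk0, h0], fun X hX => ?_⟩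
  by_cases hp : 0 < r * hk 1 X
  · exact ⟨r * hk 1 X / 2, Nat.mul_div_le _ 2, (h1 X hp).le, Or.inr (h1 X hp)⟩
  · have hz : hk 1 X = 0 := by
      by_contra h
      exact hp (Nat.mul_pos hr (Nat.pos_of_ne_zero h))
    refine absurd (Subtype.ext ?_) (hX fun i => i.elim0)
    have hs : ∀ x ∈ X.1, ∀ k, k < x → k ∈ X.1 := fun x hx k hk => by
      by_contra hn
      have := Finset.sum_eq_zero_iff.1 (Finset.sum_eq_zero_iff.1 hz x hx) k (by simp [hk, hn])
      simp at this
    refine (Finset.eq_of_subset_of_card_le (fun x hx => ?_) (by rw [X.2, card_range])).symm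
    rw [mem_range, ← X.2]
    by_contra h
    have := Finset.card_le_card (fun k hk => (by
      rcases (Nat.le_of_lt_succ (mem_range.1 hk)).lt_or_eq with h' | rfl
      · exact hs x hx k h'
      · exact hx : k ∈ X.1) : range (x + 1) ⊆ X.1)
    rw [card_range] at this
    omega
theorem cb {P : Type} [Fintype P] {T : P → Type} (N : ∀ ρ, T ρ → ℕ) (V : ∀ ρ, T ρ → ℤ) {a m : ℕ} (ha : 0 < a) (c : P → ℕ)
    (hrow : ∀ ρ, Row (N ρ) (V ρ) a m (c ρ)) :
    Nonempty ({W : (Σ ρ, Fin (c ρ)) → Fs m // ∑ x, hk 1 (W x) = m ∧ (∑ x, hk u (W x) : ℤ) = u m.factorial} ≃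
      {Z : ∀ ρ, T ρ // ∑ ρ, N ρ (Z ρ) = 2 * m ∧ ∑ ρ, V ρ (Z ρ) = a * m + u m.factorial}) := by
  choose ψ hinj hgood hbad using hrow
  let Ψ : ((Σ ρ, Fin (c ρ)) → Fs m) → ∀ ρ, T ρ := fun W ρ => ψ ρ fun k => W ⟨ρ, k⟩
  have hN : ∀ W, ∑ ρ, N ρ (Ψ W ρ) = 2 * ∑ x, hk 1 (W x) := fun W => by
    rw [sum_sigma, mul_sum]; exact sum_congr rfl fun ρ _ => (hgood ρ _).1
  have hV : ∀ W, ∑ ρ, V ρ (Ψ W ρ) = a * (∑ x, hk 1 (W x) : ℕ) + ∑ x, (hk u (W x) : ℤ) := fun W => by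
    rw [sum_sigma, sum_sigma, Nat.cast_sum, mul_sum, ← sum_add_distrib]
    exact sum_congr rfl fun ρ _ => by rw [(hgood ρ _).2]; push_cast; rfl
  have hdv : ∀ {ι : Type} (s : Finset ι) (f : ι → ℕ), ∑ i ∈ s, u (f i).factorial ≤ u (∑ i ∈ s, f i).factorial := fun s f => by
    have := (padicValNat_dvd_iff_le (p := 3) (factorial_ne_zero _)).1 (pow_padicValNat_dvd.trans (Nat.prod_factorial_dvd_factorial_sum s f))
    refine le_trans (le_of_eq ?_) this
    have h1 := v_prod s (fun i => ((f i).factorial : ℚ)) fun i _ => cast_ne_zero.2 (factorial_ne_zero _)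
    rw [← Nat.cast_prod, v_nat, sum_congr rfl fun i _ => v_nat _] at h1
    exact_mod_cast h1.symm
  refine ⟨Equiv.ofBijective (fun W => ⟨Ψ W.1, by rw [hN, W.2.1], by rw [hV, W.2.1, W.2.2]⟩) ⟨fun W W' h => ?_, fun Z => ?_⟩⟩
  · refine Subtype.ext (funext fun x => ?_)
    exact congrFun (hinj x.1 (congrFun (congrArg Subtype.val h) x.1)) x.2
  · obtain ⟨Z, h1, h2⟩ := Z
    have hall : ∀ ρ, ∃ h : ℕ, 2 * h ≤ N ρ (Z ρ) ∧ V ρ (Z ρ) ≤ a * h + u h.factorial ∧ ((∀ Y, ψ ρ Y ≠ Z ρ) → 2 * h < N ρ (Z ρ) ∨ V ρ (Z ρ) < a * h + u h.factorial) := by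
      intro ρ
      by_cases h : ∃ Y, ψ ρ Y = Z ρ
      · obtain ⟨Y, hY⟩ := h
        obtain ⟨g1, g2⟩ := hgood ρ Y
        rw [← hY]
        refine ⟨_, g1.ge, g2.le.trans ?_, fun h => absurd rfl (h Y)⟩
        have := (sum_le_sum fun k _ => hk_le (Y k)).trans (hdv univ fun k => hk 1 (Y k))
        zify at this ⊢
        linarith
      · push Not at h
        obtain ⟨k, k1, k2, k3⟩ := hbad ρ (Z ρ) h
        exact ⟨k, k1, k2, fun _ => k3⟩
    choose h g1 g2 g3 using hall
    have s1 : 2 * ∑ ρ, h ρ ≤ 2 * m := by rw [← h1, mul_sum]; exact sum_le_sum fun ρ _ => g1 ρ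
    have s2 : ∑ ρ, ((a : ℤ) * h ρ + u (h ρ).factorial) ≤ a * (∑ ρ, h ρ : ℕ) + u (∑ ρ, h ρ).factorial := by
      have := hdv univ h
      zify at this
      rw [sum_add_distrib, ← mul_sum]; push_cast; linarith
    have s3 : u (∑ ρ, h ρ).factorial ≤ u m.factorial :=
      (padicValNat_dvd_iff_le (p := 3) (factorial_ne_zero _)).1 (pow_padicValNat_dvd.trans (Nat.factorial_dvd_factorial (by omega)))
    have s4 := sum_le_sum fun ρ (_ : ρ ∈ univ) => g2 ρ
    have hm : ∑ ρ, h ρ = m := by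
      by_contra hne
      have : a * (∑ ρ, h ρ + 1) ≤ a * m := Nat.mul_le_mul_left a (by omega)
      have t1 : (a : ℤ) * ((∑ ρ, h ρ : ℕ) + 1) ≤ a * m := by exact_mod_cast this
      have := Int.ofNat_le.2 s3
      have := Int.ofNat_lt.2 ha
      linarith
    rw [hm] at s2
    have key : ∀ ρ, ∃ Y, ψ ρ Y = Z ρ := by
      intro ρ
      by_contra hn
      push Not at hn
      rcases g3 ρ hn with hlt | hlt
      · have := sum_lt_sum (fun ρ _ => g1 ρ) ⟨ρ, mem_univ ρ, hlt⟩
        rw [h1, ← mul_sum, hm] at this; exact this.false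
      · have := sum_lt_sum (fun ρ _ => g2 ρ) ⟨ρ, mem_univ ρ, hlt⟩
        linarith
    choose Y hY using key
    have hZ : Ψ (fun x => Y x.1 x.2) = Z := funext hY
    subst hZ
    have e1 := hN fun x => Y x.1 x.2
    rw [h1] at e1
    have e2 : ∑ x : (Σ ρ, Fin (c ρ)), hk 1 (Y x.1 x.2) = m := by omega
    have e3 := hV fun x => Y x.1 x.2
    beta_reduce at e3
    rw [e2, h2] at e3
    exact ⟨⟨fun x => Y x.1 x.2, e2, by linarith⟩, rfl⟩
def ofX {Ω : Type} {S : PSH Ω} {p : Ω → Prop} (hp : ∀ ρ : {ω // p ω}, S.Prim ρ.1) (x : {ω // p ω} → ℕ → Ω)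
    (hx : ∀ ρ : {ω // p ω}, S.IsX ρ.1 (x ρ)) (K : {ω // p ω} → ℕ) : S.Sys {ω // p ω} where
  X := x
  r ρ := S.deg ρ.1
  K := K
  r_pos ρ := (hp ρ).1
  X0 ρ := (hx ρ).h0
  deg_X ρ := (hx ρ).deg
  prim ρ := by rw [(hx ρ).h1]; exact hp ρ
  inj ρ ρ' h := by rw [(hx ρ).h1, (hx ρ').h1] at h; exact Subtype.ext h
  c_X ρ := (hx ρ).c
section
variable {Ω : Type} {S : PSH Ω} {P : Type} [Fintype P] (Y : S.Sys P) (ε : S.R →+* ℚ)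
def bl (ρ : P) (X : Fs (Y.K ρ)) : ℚ := ε (Y.sB ρ (X.1.orderEmbOfFin X.2))
lemma bl_bd {ρ : P} (X : Fs (Y.K ρ)) : bl Y ε ρ X = bd (fun n => ε (S.e (Y.X ρ n))) X.1 X.2 := by
  rw [bl, PSH.Sys.sB, RingHom.map_det, bd]
  congr 1
  ext1 i j
  simp only [RingHom.mapMatrix_apply, map_apply, of_apply, PSH.Sys.hs]
  split_ifs <;> simp
lemma bl_range {ρ : P} : bl Y ε ρ ⟨_, card_range _⟩ = 1 := by
  have h := Finset.orderEmbOfFin_unique (card_range (Y.K ρ)) (f := fun i => i.1) (fun i => mem_range.2 i.2) (fun i j h => h)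
  rw [bl_bd, bd, ← h, det_of_isLowerTriangular]
  · simp only [of_apply, le_refl, if_true, Nat.sub_self, Y.X0, ← PSH.one_def, map_one, prod_const_one]
  · intro i j hij
    exact if_neg (not_le.2 (OrderDual.toDual_lt_toDual.1 hij))
lemma bl_deg {ρ : P} {X : Fs (Y.K ρ)} {ω : Ω} (h : Y.sB ρ (X.1.orderEmbOfFin X.2) ω ≠ 0) : S.deg ω = Y.r ρ * hk 1 X.1 := by
  have h1 := Y.sB_deg ρ h
  have h2 : ∑ i, X.1.orderEmbOfFin X.2 i = ∑ x ∈ X.1, x := by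
    conv_rhs => rw [← map_orderEmbOfFin_univ X.1 X.2]
    rw [sum_map]; rfl
  rw [h2, sum_eq X.1, X.2, mul_add] at h1
  omega
end
/-- irreducible characters of degree prime to `3` in terms of beta-sets -/
theorem param {𝒯 : Tower} {P : Type} [Fintype P] (Y : 𝒯.psh.Sys P) (ε : 𝒯.psh.R →+* ℚ) {n : ℕ} {z : ℤ}
    (hP : ∀ σ, 𝒯.psh.Prim σ → σ.1 ≤ n → ∃ ρ, Y.X ρ 1 = σ) (hK : ∀ ρ, n ≤ Y.K ρ * Y.r ρ)
    (hne : ∀ ω, ε (𝒯.psh.e ω) ≠ 0) (hz : ∀ ω : 𝒯.Om, ω.1 = n → v (dm ω) = z + v (ε (𝒯.psh.e ω))) :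
    Nonempty (IrrCoprime 3 (𝒯.G n) ≃ {Z : ∀ ρ, Fs (Y.K ρ) // ∑ ρ, Y.r ρ * hk 1 (Z ρ).1 = n ∧ ∑ ρ, -v (bl Y ε ρ (Z ρ)) = z}) := by
  obtain ⟨f, hf⟩ := Y.classify hP hK
  have hv : ∀ Z, v (dm (f Z).1) = z - ∑ ρ, -v (bl Y ε ρ (Z.1 ρ)) := by
    intro Z
    have h1 : ε (Y.s (Y.srt Z.1)) = ∏ ρ, bl Y ε ρ (Z.1 ρ) := by rw [Y.s_blocks, map_prod]; rfl
    have h2 : v (ε (𝒯.psh.e (f Z).1)) = v (∏ ρ, bl Y ε ρ (Z.1 ρ)) ∧ ∏ ρ, bl Y ε ρ (Z.1 ρ) ≠ 0 := by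
      have := hne (f Z).1
      rcases hf Z with h | h <;> rw [h] at this ⊢
      · exact ⟨by rw [h1], h1 ▸ this⟩
      · rw [map_neg, padicValRat.neg, h1] at *
        exact ⟨rfl, neg_ne_zero.1 this⟩
    rw [hz _ (f Z).2, h2.1, v_prod _ _ fun ρ h => prod_ne_zero_iff.1 h2.2 ρ h, Finset.sum_neg_distrib, sub_neg_eq_add]
  have hL : ∀ Z : ∀ ρ, Fs (Y.K ρ), ∑ ρ, Y.r ρ * ∑ a ∈ (Z ρ).1, a = n + ∑ ρ, Y.r ρ * ∑ a ∈ range (Y.K ρ), a ↔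
      ∑ ρ, Y.r ρ * hk 1 (Z ρ).1 = n := fun Z => by
    have : ∑ ρ, Y.r ρ * ∑ a ∈ (Z ρ).1, a = ∑ ρ, Y.r ρ * hk 1 (Z ρ).1 + ∑ ρ, Y.r ρ * ∑ a ∈ range (Y.K ρ), a := by
      rw [← sum_add_distrib]
      exact sum_congr rfl fun ρ _ => by rw [sum_eq, (Z ρ).2, mul_add]
    omega
  have hI : ∀ χ, χ ∈ IrrCoprime 3 (𝒯.G n) ↔ ∃ h : χ ∈ Irr (𝒯.G n), ¬ 3 ∣ dm (𝒯 := 𝒯) ⟨n, χ, h⟩ := by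
    intro χ
    have key : ∀ (V : FDRep ℂ (𝒯.G n)) (h : V.character ∈ Irr (𝒯.G n)), (Module.finrank ℂ V).Coprime 3 ↔ ¬ 3 ∣ dm (𝒯 := 𝒯) ⟨n, _, h⟩ := fun V h => by
      have e := (FDRep.char_one V).symm.trans (dm_spec (𝒯 := 𝒯) ⟨n, _, h⟩)
      rw [Nat.cast_injective e, Nat.coprime_comm, Nat.prime_three.coprime_iff_not_dvd]
    constructor
    · rintro ⟨V, hV, rfl, h⟩
      exact ⟨⟨V, hV, rfl⟩, (key V _).1 h⟩
    · rintro ⟨⟨V, hV, rfl⟩, h⟩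
      exact ⟨V, hV, rfl, (key V _).2 h⟩
  have h3 : ∀ Z, ¬ 3 ∣ dm (f Z).1 ↔ ∑ ρ, -v (bl Y ε ρ (Z.1 ρ)) = z := fun Z => by
    have := hv Z
    rw [v_nat] at this
    have h0 : u (dm (f Z).1) = 0 ↔ ¬ 3 ∣ dm (f Z).1 := by simp [padicValNat.eq_zero_iff, (dm_pos (f Z).1).ne']
    rw [← h0]; omega
  refine ⟨Equiv.trans (β := {ω : {ω : 𝒯.Om // 𝒯.psh.deg ω = n} // ¬ 3 ∣ dm ω.1}) ?_ (Equiv.trans (f.subtypeEquiv fun Z => (h3 Z).symm).symm ?_)⟩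
  · refine Equiv.ofBijective (fun χ => ⟨⟨⟨n, χ.1, ((hI _).1 χ.2).1⟩, rfl⟩, ((hI _).1 χ.2).2⟩) ⟨fun a b h => ?_, ?_⟩
    · have := congrArg (fun t => t.1.1) h
      exact Subtype.ext (Subtype.mk.inj (eq_of_heq (Sigma.mk.inj this).2))
    · rintro ⟨⟨⟨k, χ⟩, hk⟩, h⟩
      obtain rfl : k = n := hk
      exact ⟨⟨χ.1, (hI _).2 ⟨χ.2, h⟩⟩, rfl⟩
  · exact (Equiv.subtypeSubtypeEquivSubtypeInter _ (fun Z : ∀ ρ, Fs (Y.K ρ) => ∑ ρ, -v (bl Y ε ρ (Z ρ)) = z)).trans (Equiv.subtypeEquivRight fun Z => and_congr_left' (hL Z))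
lemma Hside {E : Type} [Field E] [Fintype E] {q : ℕ} (hq : 0 < q) (hE : card E = q ^ 2) (m : ℕ) (I : Type) [Fintype I]
    (hI : 2 * card I = (q - 1) * (q + 4)) : Nonempty (IrrCoprime 3 (WreathProductSymm (CyclicExt E q hq hE) m) ≃
      {W : I → Fs m // ∑ x, hk 1 (W x) = m ∧ (∑ x, hk u (W x) : ℤ) = u m.factorial}) := by
  let 𝒯 := wrTower (CyclicExt E q hq hE)
  let _ : Fintype {ω : 𝒯.Om // ω.1 = 1} := (𝒯.psh.fin 1).fintype
  obtain ⟨e⟩ := Fintype.card_eq.1 (show card I = card {ω : 𝒯.Om // ω.1 = 1} by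
    have := CC.card_conj (hq := hq) (hE := hE)
    rw [← card_eq_fintype_card (α := {ω : 𝒯.Om // ω.1 = 1}), Wr.card1]; omega)
  choose x hx using fun ρ : {ω : 𝒯.Om // ω.1 = 1} => (PSH.prim_deg1 (S := 𝒯.psh) ρ.2).exists_X
  let Y := ofX (fun ρ => PSH.prim_deg1 ρ.2) x hx fun _ => m
  have hr : ∀ ρ, Y.r ρ = 1 := fun ρ => ρ.2
  have hbl : ∀ ρ X, -v (bl Y (Wr.hev _) ρ X) = hk u X.1 := fun ρ X => by
    have hd : dm ρ.1 = 1 ∨ dm ρ.1 = 2 := by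
      have := CC.dm_lt ρ.2
      have := dm_pos ρ.1
      omega
    rw [bl_bd, show (fun n => Wr.hev _ (𝒯.psh.e (Y.X ρ n))) = fun n => (dm ρ.1 : ℚ) ^ n / (n.factorial : ℚ) from funext fun n => by
      have h1 : (x ρ n).1 = n := ((hx ρ).deg n).trans ((congrArg _ ρ.2).trans (mul_one n))
      refine (Wr.hev_e _).trans ?_
      change (dm (x ρ n) : ℚ) / (x ρ n).1.factorial = _
      rw [h1, Wr.dm_X ρ.2 (hx ρ)]; push_cast; rfl,
      (bdH (cast_ne_zero.2 (dm_pos _).ne') (by rw [v_nat]; rcases hd with h | h <;> rw [h] <;> simp [padicValNat.eq_zero_of_not_dvd]) _ _).2, neg_neg]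
  obtain ⟨F⟩ := param Y (Wr.hev _) (n := m) (z := u m.factorial) (fun σ h _ => ⟨⟨σ, Wr.prim_deg h⟩, (hx _).h1⟩)
    (fun ρ => by rw [hr, mul_one]; exact le_rfl) (fun ω => by
      rw [Wr.hev_e]
      exact div_ne_zero (cast_ne_zero.2 (dm_pos _).ne') (cast_ne_zero.2 (factorial_ne_zero _)))
    (fun ω h => by
      have h0 : (m.factorial : ℚ) ≠ 0 := cast_ne_zero.2 (factorial_ne_zero _)
      rw [Wr.hev_e, ← v_nat, Wr.hD, h, ← padicValRat.mul h0 (div_ne_zero (cast_ne_zero.2 (dm_pos _).ne') h0), mul_div_cancel₀ _ h0])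
  refine ⟨F.trans ((e.arrowCongr (Equiv.refl (Fs m))).subtypeEquiv fun W => ?_).symm⟩
  refine and_congr (Eq.congr_left ?_) (Eq.congr_left ?_)
  · exact Eq.symm ((e.sum_comp _).symm.trans (Fintype.sum_congr _ _ fun i => by rw [hr, one_mul]; simp))
  · exact Eq.symm ((Fintype.sum_congr _ _ fun ρ => hbl ρ _).trans ((e.sum_comp _).symm.trans (by simp)))
lemma Gside {F : Type} [Field F] [Fintype F] (h3 : 3 ∣ card F + 1) {m : ℕ} (hm : 1 ≤ m) :
    ∃ (I : Type) (_ : Fintype I), 2 * card I = (card F - 1) * (card F + 4) ∧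
      Nonempty ({W : I → Fs m // ∑ x, hk 1 (W x) = m ∧ (∑ x, hk u (W x) : ℤ) = u m.factorial} ≃ IrrCoprime 3 (GL (Fin (2 * m)) F)) := by
  obtain ⟨V, hD, hVq, hw, c1, c2⟩ := gl_prims F
  have q1 : 1 < card F := one_lt_card
  have q1' : (1 : ℚ) < card F := by exact_mod_cast q1
  have NN0 : ∀ n, NN (card F) n ≠ 0 := fun n => (NN_pos q1' n).ne'
  have hne : ∀ ω, V.eD ((glTower F).psh.e ω) ≠ 0 := fun ω => by
    rw [V.eD_e, hD]; exact div_ne_zero (cast_ne_zero.2 (dm_pos _).ne') (NN0 _)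
  let p : (glTower F).Om → Prop := fun ω => (glTower F).psh.Prim ω ∧ ω.1 ≤ 2 * m
  let _ : Fintype {ω // p ω} := (((glTower F).psh.TT (2 * m)).finite_toSet.subset fun ω h => PSH.mem_TT.2 h.2).fintype
  have hx : ∀ ρ : {ω // p ω}, ∃ x, (glTower F).psh.IsX ρ.1 x ∧ (ρ.1.1 ≤ 2 → ∀ n, V.D (x n) * NN ((card F : ℚ) ^ ρ.1.1) n = 1) := fun ρ => by
    by_cases h : ρ.1.1 ≤ 2
    · obtain ⟨x, h1, h2⟩ := V.exists_X ρ.2.1 (hw _ ρ.2.1 h)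
      rw [hVq] at h2
      exact ⟨x, h1, fun _ => h2⟩
    · obtain ⟨x, h1⟩ := ρ.2.1.exists_X
      exact ⟨x, h1, fun h2 => absurd h2 h⟩
  choose x hx hxD using hx
  let Y := ofX (fun ρ => ρ.2.1) x hx fun ρ => if ρ.1.1 = 1 then 2 * m else m
  let c : {ω // p ω} → ℕ := fun ρ => if ρ.1.1 = 1 then 2 else if ρ.1.1 = 2 then 1 else 0
  let a := u (card F ^ 2 - 1)
  have ha : 0 < a := one_le_padicValNat_of_dvd (by have := Nat.one_lt_pow two_ne_zero q1; omega) (by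
    have := Nat.sq_sub_sq (card F) 1
    rw [one_pow] at this
    rw [this]; exact h3.mul_right _)
  have hb : ∀ ρ X, ρ.1.1 ≤ 2 → - v (bl Y V.eD ρ X) = hk (fun n => nu a (ρ.1.1 * n)) X.1 := fun ρ X h => by
    rw [bl_bd, (bdG h3 q1 (Y.r_pos ρ) (fun n => by rw [V.eD_e]; exact hxD ρ h n) _ _).2, neg_neg]; rfl
  have row : ∀ ρ, Row (fun X : Fs (Y.K ρ) => Y.r ρ * hk 1 X.1) (fun X => -v (bl Y V.eD ρ X)) a m (c ρ) := by
    intro ρ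
    have r0 : 0 < ρ.1.1 := Y.r_pos ρ
    have hr : Y.r ρ = ρ.1.1 := rfl
    have hK : Y.K ρ = if ρ.1.1 = 1 then 2 * m else m := rfl
    by_cases h1 : ρ.1.1 = 1
    · rw [show c ρ = 2 from if_pos h1, funext fun X => hb ρ X (by omega), hr, h1]
      rw [if_pos h1] at hK
      simp only [one_mul]
      exact hK ▸ row1 a m
    by_cases h2 : ρ.1.1 = 2
    · rw [show c ρ = 1 from (if_neg h1).trans (if_pos h2), funext fun X => hb ρ X (by omega), hr, h2]
      rw [if_neg h1] at hK
      exact hK ▸ row2 a m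
    rw [show c ρ = 0 from (if_neg h1).trans (if_neg h2)]
    refine row3 _ _ _ _ _ r0 (by rw [bl_range]; simp) fun X h0 => ?_
    set N := Y.r ρ * hk 1 X.1 with hN
    have hN3 : 3 ≤ N := by
      have : 0 < hk 1 X.1 := Nat.pos_of_mul_pos_left h0
      have : 3 ≤ Y.r ρ := by omega
      nlinarith
    by_cases hz : bl Y V.eD ρ X = 0
    · have : 0 < a * (N / 2) := Nat.mul_pos ha (by omega)
      rw [hz, padicValRat.zero]
      have h4 : (0 : ℤ) < a * (N / 2 : ℕ) := by exact_mod_cast this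
      omega
    have key : bl Y V.eD ρ X * NN (card F) N = ((3 * (Y.sB ρ (X.1.orderEmbOfFin X.2)).sum fun ω k => k * (dm ω / 3 : ℕ) : ℤ) : ℚ) := by
      refine (congrArg (· * _) (PSH.lift_apply _ V.D _)).trans ?_
      unfold Finsupp.sum
      rw [sum_mul, mul_sum]
      push_cast
      refine sum_congr rfl fun ω hω => ?_
      have h4 := Finsupp.mem_support_iff.1 hω
      have h5 : ω.1 = N := bl_deg Y h4
      obtain ⟨k, hk⟩ := Y.sB_Sp ρ _ ω h4
      obtain ⟨d, hd⟩ := three_dvd h3 (Y.prim ρ) (by rw [show Y.X ρ 1 = ρ.1 from (hx ρ).h1]; omega) hk (by omega)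
      have h6 := dm_gD (ω := ω)
      rw [h5, hd] at h6
      rw [hD, hd, Nat.cast_mul, Nat.cast_ofNat, Int.mul_ediv_cancel_left _ (by norm_num), zsmul_eq_mul, mul_assoc, ← h6]
      push_cast; ring
    have h4 := congrArg v key
    have hz' := mul_ne_zero hz (NN0 N)
    rw [key] at hz'
    rw [padicValRat.mul hz (NN0 N), v_NN h3 q1, padicValRat.of_int] at h4
    have h5 := one_le_padicValNat_of_dvd (p := 3) (Int.natAbs_ne_zero.2 (Int.cast_ne_zero.1 hz')) (Int.natAbs_dvd_natAbs.2 (Dvd.intro _ rfl))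
    rw [← padicValInt] at h5
    have h6 := Int.ofNat_le.2 h5
    rw [← h4, cast_one, show ((u (card F ^ 2 - 1) : ℕ) : ℤ) = a from rfl] at h6
    linarith
  obtain ⟨f⟩ := cb (fun ρ (X : Fs (Y.K ρ)) => Y.r ρ * hk 1 X.1) (fun ρ X => -v (bl Y V.eD ρ X)) ha c row
  obtain ⟨g⟩ := param Y V.eD (n := 2 * m) (z := a * m + u m.factorial) (fun σ h1 h2 => ⟨⟨σ, h1, h2⟩, (hx _).h1⟩)
    (fun ρ => by
      have r0 : 0 < ρ.1.1 := Y.r_pos ρ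
      change 2 * m ≤ (if ρ.1.1 = 1 then 2 * m else m) * ρ.1.1
      split_ifs with h
      · rw [h, mul_one]
      · have : 2 ≤ ρ.1.1 := by omega
        nlinarith) hne (fun ω h => by
      have h4 := hne ω
      have h5 := v_NN h3 q1 (2 * m)
      rw [Nat.mul_div_cancel_left _ (by norm_num)] at h5
      rw [V.eD_e, hD] at h4 ⊢
      rw [dm_gD, h, padicValRat.mul h4 (NN0 _), h5, add_comm])
  refine ⟨Σ ρ, Fin (c ρ), inferInstance, ?_, ⟨f.trans g.symm⟩⟩
  have k : ∀ j ≤ 2, Nat.card {ω // (glTower F).psh.Prim ω ∧ ω.1 = j} = ∑ ρ : {ω // p ω}, if ρ.1.1 = j then 1 else 0 := fun j hj => by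
    rw [Finset.sum_boole, Nat.cast_id, ← card_subtype, ← card_eq_fintype_card]
    exact card_congr (((Equiv.subtypeSubtypeEquivSubtypeInter p (fun ω => ω.1 = j)).trans
      (Equiv.subtypeEquivRight fun ω => ⟨fun h => ⟨h.1.1, h.2⟩, fun h => ⟨⟨h.1, by omega⟩, h.2⟩⟩)).symm)
  have k1 := c1.symm.trans ((card_congr (Equiv.subtypeEquivRight fun ω => ⟨fun h => ⟨PSH.prim_deg1 (S := (glTower F).psh) h, h⟩, fun h => h.2⟩)).trans (k 1 (by omega)))
  rw [k 2 (by omega)] at c2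
  have k3 : ∑ ρ, c ρ = 2 * (∑ ρ : {ω // p ω}, if ρ.1.1 = 1 then 1 else 0) + ∑ ρ : {ω // p ω}, if ρ.1.1 = 2 then 1 else 0 := by
    rw [mul_sum, ← sum_add_distrib]
    exact sum_congr rfl fun ρ _ => by simp only [c]; split_ifs <;> omega
  rw [card_sigma]
  simp only [card_fin]
  rw [k3, ← k1, mul_add, c2]; ring
end Cb
/-- Let `m ≥ 1`, `q` a prime power with `3 ∣ q + 1`, `F` the field with `q` elements and `E`
the field with `q²` elements.  Let `C = Eˣ ⋊ C₂`, where the nontrivial element of `C₂` acts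
on `Eˣ` by `x ↦ x^q`, and let `H = C ≀ S_m`.  Then there is a bijection between
`Irr_{3'}(H)` and `Irr_{3'}(GL_{2m}(F))`. -/
theorem global_bijection_GL_q_plus_one (m q : ℕ) (hm : 1 ≤ m) (hq : 0 < q)
    (hqpp : IsPrimePow q) (h3 : 3 ∣ q + 1)
    (F E : Type) [Field F] [Fintype F] [Field E] [Fintype E]
    (hF : Fintype.card F = q) (hE : Fintype.card E = q ^ 2) :
    Nonempty ((IrrCoprime 3 (WreathProductSymm (CyclicExt E q hq hE) m)) ≃
      (IrrCoprime 3 (GL (Fin (2 * m)) F))) := by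
  obtain ⟨I, _, h1, ⟨f⟩⟩ := Cb.Gside (F := F) (hF ▸ h3) hm
  rw [hF] at h1
  obtain ⟨g⟩ := Cb.Hside hq hE m I h1
  exact ⟨g.trans f⟩
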